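/- There exists a real number A > 1 such that for every natural number n ≥ 1, the floor of A^(3^n) is a prime number. -/

import Mathlib

section
open Finset

theorem card_not_injective_le (ι : Type) [Fintype ι] [DecidableEq ι] (k : ℕ) :
    (#{a : Fin k → ι | ¬ Function.Injective a}) ≤ k ^ 2 * Fintype.card ι ^ (k - 1) := by
  classical
  have hsub : ({a : Fin k → ι | ¬ Function.Injective a} : Finset (Fin k → ι)) ⊆
      ((univ : Finset (Fin k × Fin k)).filter (fun q => q.1 ≠ q.2)).biUnion
        (fun q => {a : Fin k → ι | a q.1 = a q.2}) := by
    intro a ha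
    have h := (mem_filter.1 ha).2
    simp only [Function.Injective, not_forall] at h
    obtain ⟨i, j, hij, hne⟩ := h
    simp only [mem_biUnion, mem_filter, mem_univ, true_and]
    exact ⟨(i, j), hne, hij⟩
  refine (card_le_card hsub).trans ((card_biUnion_le_card_mul _ _ (Fintype.card ι ^ (k - 1)) ?_).trans ?_)
  · rintro ⟨i, j⟩ hq
    simp only [mem_filter, mem_univ, true_and] at hq
    have : #({a : Fin k → ι | a i = a j} : Finset (Fin k → ι)) ≤
        #(univ : Finset ({x : Fin k // x ≠ i} → ι)) := by
      refine card_le_card_of_injOn (fun a x => a x.1) (fun _ _ => mem_univ _) ?_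
      intro a ha b hb hab
      simp only [coe_filter, mem_univ, true_and, Set.mem_ofPred_eq] at ha hb
      have h1 : ∀ x, x ≠ i → a x = b x := fun x hx => congrFun hab ⟨x, hx⟩
      funext x
      by_cases hx : x = i
      · subst hx
        rw [ha, hb, h1 j (Ne.symm hq)]
      · exact h1 x hx
    refine this.trans ?_
    simp [card_univ, Fintype.card_subtype_compl]
  · gcongr
    refine (card_le_univ _).trans ?_
    simp [sq]

/-- Pointwise splitting of a high power of a sum into its injective part and a diagonal part. -/
theorem norm_sum_pow_le_inj_add_diag {ι : Type} [Fintype ι] [DecidableEq ι] (c : ι → ℂ) (k l : ℕ)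
    (hk : k ≠ 0) :
    ‖∑ a, c a‖ ^ (2 * ((l + 1) * k)) ≤
      4 * (‖∑ a : Fin k → ι with Function.Injective a, ∏ i, c (a i)‖ ^ 2 *
        ‖∑ a, c a‖ ^ (2 * (l * k))) +
      (2 * (k ^ 2 * Fintype.card ι ^ (k - 1) : ℕ) : ℝ) ^ (2 * (l + 1)) *
        ∑ a, ‖c a‖ ^ (2 * ((l + 1) * k)) := by
  classical
  rcases isEmpty_or_nonempty ι with hι | hι
  · simp only [univ_eq_empty, sum_empty, norm_zero]
    rw [zero_pow (by positivity)]
    positivity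
  obtain ⟨b, hb⟩ := Finite.exists_max (fun a => ‖c a‖)
  set E := ∑ a : Fin k → ι with Function.Injective a, ∏ i, c (a i) with hE
  set F := ∑ a : Fin k → ι with ¬ Function.Injective a, ∏ i, c (a i) with hF
  set K : ℝ := ((k ^ 2 * Fintype.card ι ^ (k - 1) : ℕ) : ℝ) with hK
  have hsum : (∑ a, c a) ^ k = E + F := by
    rw [hE, hF, sum_filter_add_sum_filter_not]
    rw [← Fintype.piFinset_univ, ← Finset.prod_univ_sum]
    simp
  have hFle : ‖F‖ ≤ K * ‖c b‖ ^ k := by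
    refine (norm_sum_le _ _).trans ?_
    have : ∀ a ∈ (univ.filter (fun a : Fin k → ι => ¬ Function.Injective a)),
        ‖∏ i, c (a i)‖ ≤ ‖c b‖ ^ k := by
      intro a _
      rw [norm_prod]
      calc ∏ i, ‖c (a i)‖ ≤ ∏ _i : Fin k, ‖c b‖ := by
            gcongr with i; exact hb (a i)
        _ = _ := by simp
    refine (sum_le_card_nsmul _ _ _ this).trans ?_
    rw [nsmul_eq_mul]
    gcongr
    rw [hK]; exact Nat.cast_le.2 (card_not_injective_le ι k)
  have hmain : ‖∑ a, c a‖ ^ k ≤ ‖E‖ + K * ‖c b‖ ^ k := by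
    rw [← norm_pow, hsum]
    exact (norm_add_le _ _).trans (by gcongr)
  have hK0 : 0 ≤ K := Nat.cast_nonneg _
  have hdiag : ‖c b‖ ^ (2 * ((l + 1) * k)) ≤ ∑ a, ‖c a‖ ^ (2 * ((l + 1) * k)) :=
    single_le_sum (f := fun a => ‖c a‖ ^ (2 * ((l + 1) * k))) (fun _ _ => by positivity) (mem_univ b)
  rcases le_total (‖E‖) (K * ‖c b‖ ^ k) with h | h
  · have h2 : ‖∑ a, c a‖ ^ k ≤ 2 * K * ‖c b‖ ^ k := by linarith
    have h3 : ‖∑ a, c a‖ ^ (2 * ((l + 1) * k)) ≤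
        (2 * K) ^ (2 * (l + 1)) * ‖c b‖ ^ (2 * ((l + 1) * k)) := by
      calc ‖∑ a, c a‖ ^ (2 * ((l + 1) * k)) = (‖∑ a, c a‖ ^ k) ^ (2 * (l + 1)) := by
            rw [← pow_mul]; congr 1; ring
        _ ≤ (2 * K * ‖c b‖ ^ k) ^ (2 * (l + 1)) := by gcongr
        _ = _ := by rw [mul_pow, ← pow_mul]; congr 2; ring
    refine h3.trans ?_
    have : 0 ≤ 4 * (‖E‖ ^ 2 * ‖∑ a, c a‖ ^ (2 * (l * k))) := by positivity
    have h4 : (2 * K) ^ (2 * (l + 1)) * ‖c b‖ ^ (2 * ((l + 1) * k)) ≤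
      (2 * K) ^ (2 * (l + 1)) * ∑ a, ‖c a‖ ^ (2 * ((l + 1) * k)) := by gcongr
    linarith
  · have h2 : ‖∑ a, c a‖ ^ k ≤ 2 * ‖E‖ := by linarith
    have h3 : ‖∑ a, c a‖ ^ (2 * ((l + 1) * k)) ≤ 4 * (‖E‖ ^ 2 * ‖∑ a, c a‖ ^ (2 * (l * k))) := by
      calc ‖∑ a, c a‖ ^ (2 * ((l + 1) * k)) = (‖∑ a, c a‖ ^ k) ^ 2 * ‖∑ a, c a‖ ^ (2 * (l * k)) := by
            rw [← pow_mul, ← pow_add]; congr 1; ring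
        _ ≤ (2 * ‖E‖) ^ 2 * ‖∑ a, c a‖ ^ (2 * (l * k)) := by gcongr
        _ = _ := by ring
    refine h3.trans (le_add_of_nonneg_right (by positivity))

theorem sum_addChar_norm_sq {G ι : Type} [AddCommGroup G] [Finite G] [Fintype (AddChar G ℂ)]
    [DecidableEq G] (U : Finset ι) (w : ι → G) :
    ∑ ψ : AddChar G ℂ, ‖∑ u ∈ U, ψ (w u)‖ ^ 2 =
      Nat.card G * (#{z ∈ U ×ˢ U | w z.1 = w z.2} : ℝ) := by
  classical
  have := Fintype.ofFinite G
  have h : ∀ ψ : AddChar G ℂ, ((‖∑ u ∈ U, ψ (w u)‖ ^ 2 : ℝ) : ℂ) =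
      ∑ z ∈ U ×ˢ U, ψ (w z.1 - w z.2) := by
    intro ψ
    rw [← Complex.normSq_eq_norm_sq, Complex.normSq_eq_conj_mul_self, map_sum, mul_comm,
      sum_mul_sum, ← sum_product']
    refine sum_congr rfl fun z _ => ?_
    rw [sub_eq_add_neg, AddChar.map_add_eq_mul, AddChar.map_neg_eq_conj]
  have h2 : ((∑ ψ : AddChar G ℂ, ‖∑ u ∈ U, ψ (w u)‖ ^ 2 : ℝ) : ℂ) =
      ((Nat.card G * (#{z ∈ U ×ˢ U | w z.1 = w z.2} : ℝ) : ℝ) : ℂ) := by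
    push_cast
    have : ∀ ψ : AddChar G ℂ, ((‖∑ u ∈ U, ψ (w u)‖ : ℂ) ^ 2) =
      ∑ z ∈ U ×ˢ U, ψ (w z.1 - w z.2) := fun ψ => by rw [← h ψ]; push_cast; rfl
    rw [sum_congr rfl fun ψ _ => this ψ, sum_comm]
    have h3 : ∀ g : G, ∑ ψ : AddChar G ℂ, ψ g = if g = 0 then (Nat.card G : ℂ) else 0 := by
      intro g
      have := AddChar.sum_apply_eq_ite (α := G) g
      rw [Nat.card_eq_fintype_card]
      convert this
    simp_rw [h3, sub_eq_zero]
    rw [← sum_filter, sum_const, nsmul_eq_mul, mul_comm]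
  exact_mod_cast h2

/-- The number of pairs of elements of `U` with the same image under `w`. -/
def collisions {ι H : Type} [DecidableEq H] (U : Finset ι) (w : ι → H) : ℕ :=
  #{z ∈ U ×ˢ U | w z.1 = w z.2}

theorem collisions_comp {ι H G : Type} [DecidableEq H] [DecidableEq G] (U : Finset ι) (w : ι → H)
    (π : H → G) (h : Set.InjOn π (w '' U)) : collisions U (fun u => π (w u)) = collisions U w := by
  unfold collisions
  congr 1
  refine filter_congr fun z hz => ?_
  rw [mem_product] at hz
  exact h.eq_iff ⟨z.1, hz.1, rfl⟩ ⟨z.2, hz.2, rfl⟩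

theorem sum_pow_le_card_pow_mul {ι : Type} (s : Finset ι) (hs : s.Nonempty) (f : ι → ℝ)
    (hf : ∀ i ∈ s, 0 ≤ f i) (n : ℕ) :
    (∑ i ∈ s, f i) ^ n ≤ (#s : ℝ) ^ (n - 1) * ∑ i ∈ s, f i ^ n := by
  have hc : (0 : ℝ) < #s := by exact_mod_cast hs.card_pos
  rcases n with _ | n
  · simp only [pow_zero, sum_const, nsmul_eq_mul, mul_one, Nat.zero_sub, one_mul]
    exact_mod_cast hs.card_pos
  · have := pow_sum_div_card_le_sum_pow hf n
    rw [div_le_iff₀ (by positivity)] at this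
    simpa [mul_comm] using this

theorem addChar_map_sum {ι G : Type} [AddCommGroup G] (ψ : AddChar G ℂ) (s : Finset ι)
    (f : ι → G) : ψ (∑ i ∈ s, f i) = ∏ i ∈ s, ψ (f i) := by
  classical
  induction s using Finset.induction_on with
  | empty => simp
  | insert a s ha ih => rw [sum_insert ha, prod_insert ha, AddChar.map_add_eq_mul, ih]

theorem sum_addChar_pow {α G : Type} [AddCommGroup G] (ψ : AddChar G ℂ) (A : Finset α)
    (φ : α → G) (n : ℕ) :
    (∑ x ∈ A, ψ (φ x)) ^ n =
      ∑ x ∈ Fintype.piFinset (fun _ : Fin n => A), ψ (∑ i, φ (x i)) := by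
  have h := Finset.prod_univ_sum (fun _ : Fin n => A) (fun _ x => ψ (φ x))
  rw [prod_const, card_univ, Fintype.card_fin] at h
  rw [h]
  refine sum_congr rfl fun x _ => ?_
  rw [addChar_map_sum]

theorem collisions_recursion_of_finite {α G ι : Type} [AddCommGroup G] [Finite G] [DecidableEq G]
    [Fintype ι] [DecidableEq ι] [Nonempty ι] (A : Finset α) (φ : α → G) (ρ : α → ι) (k l : ℕ)
    (hk : k ≠ 0) :
    (collisions (Fintype.piFinset fun _ : Fin ((l + 1) * k) => A) (fun x => ∑ i, φ (x i)) : ℝ) ≤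
      4 * ((Fintype.card ι : ℝ) ^ (2 * (l * k) - 1) * ∑ a, (collisions
        ((Fintype.piFinset fun _ : Fin k => A).filter (fun u => Function.Injective (ρ ∘ u)) ×ˢ
          (Fintype.piFinset fun _ : Fin (l * k) => A.filter (ρ · = a)))
        (fun z => ∑ i, φ (z.1 i) + ∑ i, φ (z.2 i)) : ℝ)) +
      (2 * (k ^ 2 * Fintype.card ι ^ (k - 1) : ℕ) : ℝ) ^ (2 * (l + 1)) *
        ∑ a, (collisions (Fintype.piFinset fun _ : Fin ((l + 1) * k) => A.filter (ρ · = a))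
          (fun x => ∑ i, φ (x i)) : ℝ) := by
  classical
  have := Fintype.ofFinite G
  have hG : (0 : ℝ) < Nat.card G := by exact_mod_cast Nat.card_pos
  set U := (Fintype.piFinset fun _ : Fin k => A).filter (fun u => Function.Injective (ρ ∘ u)) with hU
  set p : ℝ := (Fintype.card ι : ℝ) with hp
  set K : ℝ := (2 * (k ^ 2 * Fintype.card ι ^ (k - 1) : ℕ) : ℝ) with hK
  have hc : ∀ {β : Type} (V : Finset β) (w : β → G), (collisions V w : ℝ) =
      (Nat.card G : ℝ)⁻¹ * ∑ ψ : AddChar G ℂ, ‖∑ u ∈ V, ψ (w u)‖ ^ 2 := by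
    intro β V w
    rw [sum_addChar_norm_sq, collisions]
    field_simp
  have key : ∀ ψ : AddChar G ℂ,
      ‖∑ x ∈ Fintype.piFinset (fun _ : Fin ((l + 1) * k) => A), ψ (∑ i, φ (x i))‖ ^ 2 ≤
      4 * (p ^ (2 * (l * k) - 1) * ∑ a,
        ‖∑ z ∈ U ×ˢ (Fintype.piFinset fun _ : Fin (l * k) => A.filter (ρ · = a)),
          ψ (∑ i, φ (z.1 i) + ∑ i, φ (z.2 i))‖ ^ 2) + K ^ (2 * (l + 1)) * ∑ a,
        ‖∑ x ∈ Fintype.piFinset (fun _ : Fin ((l + 1) * k) => A.filter (ρ · = a)),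
          ψ (∑ i, φ (x i))‖ ^ 2 := by
    intro ψ
    set c : ι → ℂ := fun a => ∑ x ∈ A.filter (ρ · = a), ψ (φ x) with hcdef
    have hf : ∑ x ∈ A, ψ (φ x) = ∑ a, c a := by
      rw [hcdef, sum_fiberwise]
    have hE : ∑ a : Fin k → ι with Function.Injective a, ∏ i, c (a i) =
        ∑ u ∈ U, ψ (∑ i, φ (u i)) := by
      have hmaps : ∀ u ∈ U, (ρ ∘ u) ∈ (univ.filter fun a : Fin k → ι => Function.Injective a) := by
        intro u hu
        rw [mem_filter]
        exact ⟨mem_univ _, (mem_filter.1 hu).2⟩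
      rw [← sum_fiberwise_of_maps_to hmaps]
      refine sum_congr rfl fun a ha => ?_
      rw [hcdef, Finset.prod_univ_sum]
      refine sum_congr ?_ fun u _ => (addChar_map_sum _ _ _).symm
      ext u
      have ha2 := (mem_filter.1 ha).2
      simp only [Fintype.mem_piFinset, mem_filter, hU]
      constructor
      · intro h
        have : ρ ∘ u = a := funext fun i => (h i).2
        exact ⟨⟨fun i => (h i).1, this ▸ ha2⟩, this⟩
      · rintro ⟨⟨h1, _⟩, h3⟩ i
        exact ⟨h1 i, congrFun h3 i⟩
    have h1 := norm_sum_pow_le_inj_add_diag c k l hk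
    rw [← sum_addChar_pow, hf]
    have e1 : ‖(∑ a, c a) ^ ((l + 1) * k)‖ ^ 2 = ‖∑ a, c a‖ ^ (2 * ((l + 1) * k)) := by
      rw [norm_pow, ← pow_mul, mul_comm]
    have e2 : ∀ a, ‖∑ x ∈ Fintype.piFinset (fun _ : Fin ((l + 1) * k) => A.filter (ρ · = a)),
          ψ (∑ i, φ (x i))‖ ^ 2 = ‖c a‖ ^ (2 * ((l + 1) * k)) := by
      intro a
      rw [← sum_addChar_pow, norm_pow, ← pow_mul, mul_comm 2]
    have e3 : ∀ a, ‖∑ z ∈ U ×ˢ (Fintype.piFinset fun _ : Fin (l * k) => A.filter (ρ · = a)),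
          ψ (∑ i, φ (z.1 i) + ∑ i, φ (z.2 i))‖ ^ 2 =
        ‖∑ u ∈ U, ψ (∑ i, φ (u i))‖ ^ 2 * ‖c a‖ ^ (2 * (l * k)) := by
      intro a
      simp_rw [AddChar.map_add_eq_mul]
      have hprod : ∀ (V : Finset (Fin (l * k) → α)) (f : (Fin k → α) → ℂ)
          (g : (Fin (l * k) → α) → ℂ), ∑ z ∈ U ×ˢ V, f z.1 * g z.2 =
          (∑ u ∈ U, f u) * ∑ v ∈ V, g v := by
        intro V f g
        rw [sum_mul_sum, sum_product]
      rw [hprod _ (fun u => ψ (∑ i, φ (u i))) (fun v => ψ (∑ i, φ (v i))), ← sum_addChar_pow,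
        norm_mul, mul_pow, norm_pow, ← pow_mul,
        mul_comm 2]
    rw [e1]
    simp_rw [e2, e3]
    rw [hE] at h1
    have h2 : ‖∑ a, c a‖ ≤ ∑ a, ‖c a‖ := norm_sum_le _ _
    have h3 := sum_pow_le_card_pow_mul univ univ_nonempty (fun a => ‖c a‖)
      (fun _ _ => norm_nonneg _) (2 * (l * k))
    rw [card_univ] at h3
    have h4 := (pow_le_pow_left₀ (norm_nonneg _) h2 (2 * (l * k))).trans h3
    refine h1.trans ?_
    rw [← mul_sum, mul_left_comm (p ^ _)]
    gcongr
  have hsum := sum_le_sum fun (ψ : AddChar G ℂ) (_ : ψ ∈ univ) => key ψ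
  simp_rw [hc]
  rw [← mul_sum, ← mul_sum, sum_comm (s := (univ : Finset ι)), sum_comm (s := (univ : Finset ι))]
  rw [sum_add_distrib, ← mul_sum, ← mul_sum, ← mul_sum] at hsum
  calc _ ≤ _ := mul_le_mul_of_nonneg_left hsum (by positivity)
    _ = _ := by ring

/-- The vector of the first `k` powers of an integer. -/
def powerVec (k : ℕ) (x : ℤ) : Fin k → ℤ := fun j => x ^ (j.1 + 1)

/-- The number of solutions of the Vinogradov system of degree `k` in `2 s` variables in `A`. -/
def vinogradovCount (k s : ℕ) (A : Finset ℤ) : ℕ :=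
  collisions (Fintype.piFinset fun _ : Fin s => A) (fun x => ∑ i, powerVec k (x i))

theorem exists_modulus_injOn {k : ℕ} (S : Set (Fin k → ℤ)) (hS : S.Finite) :
    ∃ M : ℕ, M ≠ 0 ∧ Set.InjOn (fun (v : Fin k → ℤ) (j : Fin k) => (v j : ZMod M)) S := by
  lift S to Finset (Fin k → ℤ) using hS
  set B : ℕ := ∑ v ∈ S, ∑ j, (v j).natAbs with hB
  refine ⟨2 * B + 1, by omega, ?_⟩
  intro v hv w hw hvw
  funext j
  have hb : ∀ v ∈ S, (v j).natAbs ≤ B := fun v hv =>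
    (single_le_sum (f := fun j => (v j).natAbs) (fun _ _ => Nat.zero_le _) (mem_univ j)).trans
      (single_le_sum (f := fun v : Fin k → ℤ => ∑ j, (v j).natAbs) (fun _ _ => Nat.zero_le _) hv)
  have h1 := hb v hv
  have h2 := hb w hw
  have h3 := congrFun hvw j
  simp only at h3
  rw [ZMod.intCast_eq_intCast_iff_dvd_sub] at h3
  have h4 : w j - v j = 0 := Int.eq_zero_of_abs_lt_dvd h3 (by push_cast; rw [abs_lt]; omega)
  omega

theorem vinogradovCount_recursion {ι : Type} [Fintype ι] [DecidableEq ι] [Nonempty ι]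
    (A : Finset ℤ) (ρ : ℤ → ι) (k l : ℕ) (hk : k ≠ 0) :
    (vinogradovCount k ((l + 1) * k) A : ℝ) ≤
      4 * ((Fintype.card ι : ℝ) ^ (2 * (l * k) - 1) * ∑ a, (collisions
        ((Fintype.piFinset fun _ : Fin k => A).filter (fun u => Function.Injective (ρ ∘ u)) ×ˢ
          (Fintype.piFinset fun _ : Fin (l * k) => A.filter (ρ · = a)))
        (fun z => ∑ i, powerVec k (z.1 i) + ∑ i, powerVec k (z.2 i)) : ℝ)) +
      (2 * (k ^ 2 * Fintype.card ι ^ (k - 1) : ℕ) : ℝ) ^ (2 * (l + 1)) *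
        ∑ a, (vinogradovCount k ((l + 1) * k) (A.filter (ρ · = a)) : ℝ) := by
  set w1 : (Fin ((l + 1) * k) → ℤ) → (Fin k → ℤ) := fun x => ∑ i, powerVec k (x i) with hw1
  set w2 : (Fin k → ℤ) × (Fin (l * k) → ℤ) → (Fin k → ℤ) :=
    fun z => ∑ i, powerVec k (z.1 i) + ∑ i, powerVec k (z.2 i) with hw2
  set P1 : Finset (Fin ((l + 1) * k) → ℤ) := Fintype.piFinset fun _ => A
  set P2 : Finset ((Fin k → ℤ) × (Fin (l * k) → ℤ)) :=
    (Fintype.piFinset fun _ => A) ×ˢ (Fintype.piFinset fun _ => A)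
  obtain ⟨M, hM, hinj⟩ := exists_modulus_injOn (w1 '' P1 ∪ w2 '' P2)
    ((P1.finite_toSet.image _).union (P2.finite_toSet.image _))
  have : NeZero M := ⟨hM⟩
  have h := collisions_recursion_of_finite A
    (fun x (j : Fin k) => ((powerVec k x j : ℤ) : ZMod M)) ρ k l hk
  set π : (Fin k → ℤ) → (Fin k → ZMod M) := fun v j => (v j : ZMod M) with hπ
  have hπs : ∀ {n : ℕ} (x : Fin n → ℤ),
      ∑ i, (fun (j : Fin k) => ((powerVec k (x i) j : ℤ) : ZMod M)) =
        π (∑ i, powerVec k (x i)) := by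
    intro n x
    funext j
    simp [hπ, Finset.sum_apply]
  have hπa : ∀ v w, π v + π w = π (v + w) := by
    intro v w
    funext j
    simp [hπ]
  simp_rw [hπs, hπa] at h
  rw [collisions_comp _ w1 π (hinj.mono Set.subset_union_left)] at h
  have h1 : ∀ a, collisions (Fintype.piFinset fun _ : Fin ((l + 1) * k) => A.filter (ρ · = a))
      (fun x => π (∑ i, powerVec k (x i))) =
      collisions (Fintype.piFinset fun _ : Fin ((l + 1) * k) => A.filter (ρ · = a)) w1 := by
    intro a
    refine collisions_comp _ w1 π (hinj.mono (Set.subset_union_of_subset_left (Set.image_mono ?_) _))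
    exact coe_subset.2 (Fintype.piFinset_subset _ _ fun _ => filter_subset _ _)
  have h2 : ∀ a, collisions
        ((Fintype.piFinset fun _ : Fin k => A).filter (fun u => Function.Injective (ρ ∘ u)) ×ˢ
          (Fintype.piFinset fun _ : Fin (l * k) => A.filter (ρ · = a)))
      (fun z => π (∑ i, powerVec k (z.1 i) + ∑ i, powerVec k (z.2 i))) =
      collisions
        ((Fintype.piFinset fun _ : Fin k => A).filter (fun u => Function.Injective (ρ ∘ u)) ×ˢ
          (Fintype.piFinset fun _ : Fin (l * k) => A.filter (ρ · = a))) w2 := by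
    intro a
    refine collisions_comp _ w2 π
      (hinj.mono (Set.subset_union_of_subset_right (Set.image_mono ?_) _))
    exact coe_subset.2 (product_subset_product (filter_subset _ _)
      (Fintype.piFinset_subset _ _ fun _ => filter_subset _ _))
  simp_rw [h1, h2] at h
  exact h

theorem aeval_esymm_eq_of_psum_eq {R : Type} [CommRing R] {k : ℕ} (x y : Fin k → R)
    (hu : ∀ m : ℕ, m ≠ 0 → m ≤ k → IsUnit (m : R))
    (h : ∀ j : ℕ, j ≠ 0 → j ≤ k → ∑ i, x i ^ j = ∑ i, y i ^ j) (m : ℕ) (hm : m ≤ k) :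
    MvPolynomial.aeval x (MvPolynomial.esymm (Fin k) ℤ m) =
      MvPolynomial.aeval y (MvPolynomial.esymm (Fin k) ℤ m) := by
  induction m using Nat.strong_induction_on with
  | _ m ih =>
    rcases eq_or_ne m 0 with rfl | h0
    · simp
    have key : ∀ z : Fin k → R, (m : R) * MvPolynomial.aeval z (MvPolynomial.esymm (Fin k) ℤ m) =
        (-1) ^ (m + 1) * ∑ a ∈ antidiagonal m with a.1 < m,
          (-1) ^ a.1 * MvPolynomial.aeval z (MvPolynomial.esymm (Fin k) ℤ a.1) *
            ∑ i, z i ^ a.2 := by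
      intro z
      have := congrArg (MvPolynomial.aeval z) (MvPolynomial.mul_esymm_eq_sum (Fin k) ℤ m)
      simpa [map_mul, map_sum, MvPolynomial.psum] using this
    apply (hu m h0 hm).mul_left_cancel
    rw [key, key]
    congr 1
    refine sum_congr rfl fun a ha => ?_
    rw [mem_filter, HasAntidiagonal.mem_antidiagonal] at ha
    rw [ih a.1 ha.2 (by omega), h a.2 (by omega) (by omega)]

theorem prod_sub_eq_zero_of_psum_eq {R : Type} [CommRing R] {k : ℕ} (x y : Fin k → R)
    (hu : ∀ m : ℕ, m ≠ 0 → m ≤ k → IsUnit (m : R))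
    (h : ∀ j : ℕ, j ≠ 0 → j ≤ k → ∑ i, x i ^ j = ∑ i, y i ^ j) (i : Fin k) :
    ∏ j, (y i - x j) = 0 := by
  have key : ∀ z : Fin k → R, ∏ j, (y i - z j) = ∑ m ∈ range (k + 1),
      (-1) ^ m * (MvPolynomial.aeval z (MvPolynomial.esymm (Fin k) ℤ m) * y i ^ (k - m)) := by
    intro z
    have := congrArg (Polynomial.eval (y i))
      (Multiset.prod_X_sub_X_eq_sum_esymm (Multiset.map z univ.val))
    rw [Polynomial.eval_multiset_prod] at this
    simp only [Multiset.map_map, Multiset.card_map, Function.comp_def] at this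
    simp only [Polynomial.eval_sub, Polynomial.eval_X, Polynomial.eval_C] at this
    simp_rw [MvPolynomial.aeval_esymm_eq_multiset_esymm]
    rw [Polynomial.eval_finsetSum] at this
    rw [Finset.prod_eq_multiset_prod]
    simpa [-Fin.univ_val_map] using this
  have h1 : ∏ j, (y i - x j) = ∏ j, (y i - y j) := by
    rw [key, key]
    refine sum_congr rfl fun m hm => ?_
    rw [aeval_esymm_eq_of_psum_eq x y hu h m (by simpa [Nat.lt_succ_iff] using hm)]
  rw [h1]
  exact prod_eq_zero (mem_univ i) (sub_self _)

theorem pow_dvd_sub_of_psum_modEq {p k : ℕ} (hp : p.Prime) (hpk : k < p) (x y : Fin k → ℤ)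
    (hx : Function.Injective fun i => ((x i : ℤ) : ZMod p))
    (h : ∀ j : ℕ, j ≠ 0 → j ≤ k → (p : ℤ) ^ k ∣ ∑ i, x i ^ j - ∑ i, y i ^ j) (i : Fin k) :
    ∃ j, (p : ℤ) ^ k ∣ y i - x j := by
  have hk : k ≠ 0 := fun h => by subst h; exact i.elim0
  have hprod : (p : ℤ) ^ k ∣ ∏ j, (y i - x j) := by
    have := prod_sub_eq_zero_of_psum_eq (R := ZMod (p ^ k)) (fun i => (x i : ZMod (p ^ k)))
      (fun i => (y i : ZMod (p ^ k))) ?_ ?_ i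
    · have h2 : ((∏ j, (y i - x j) : ℤ) : ZMod (p ^ k)) = 0 := by push_cast; exact this
      rw [ZMod.intCast_zmod_eq_zero_iff_dvd] at h2
      exact_mod_cast h2
    · intro m hm0 hm
      rw [ZMod.isUnit_iff_coprime]
      exact (Nat.Coprime.pow_right k ((Nat.coprime_comm.1 ((Nat.Prime.coprime_iff_not_dvd hp).2
        fun hd => by have := Nat.le_of_dvd (Nat.pos_of_ne_zero hm0) hd; omega))))
    · intro j hj0 hj
      have h2 := h j hj0 hj
      have h3 : ((∑ i, x i ^ j - ∑ i, y i ^ j : ℤ) : ZMod (p ^ k)) = 0 := by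
        rw [ZMod.intCast_zmod_eq_zero_iff_dvd]; exact_mod_cast h2
      push_cast at h3
      exact sub_eq_zero.1 h3
  have hpI : Prime (p : ℤ) := Nat.prime_iff_prime_int.1 hp
  have hd : (p : ℤ) ∣ ∏ j, (y i - x j) := (dvd_pow_self _ hk).trans hprod
  obtain ⟨j, _, hj⟩ := (Prime.dvd_finsetProd_iff hpI _).1 hd
  refine ⟨j, ?_⟩
  rw [← mul_prod_erase univ _ (mem_univ j)] at hprod
  refine IsCoprime.dvd_of_dvd_mul_right (IsCoprime.pow_left ?_) hprod
  refine IsCoprime.prod_right fun l hl => ?_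
  rw [hpI.coprime_iff_not_dvd]
  intro hl2
  have h1 : (p : ℤ) ∣ x j - x l := by
    have := dvd_sub hl2 hj
    have e : y i - x l - (y i - x j) = x j - x l := by ring
    rwa [e] at this
  have h2 : ((x l : ℤ) : ZMod p) = x j := by
    rw [ZMod.intCast_eq_intCast_iff_dvd_sub]; exact h1
  exact (mem_erase.1 hl).1 (hx h2)

theorem collisions_shift_le {ι H : Type} [AddCommGroup H] [DecidableEq H] (U : Finset ι)
    (w : ι → H) (h : H) : #{z ∈ U ×ˢ U | w z.1 = w z.2 + h} ≤ collisions U w := by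
  classical
  set r : H → ℕ := fun g => #{y ∈ U | w y = g} with hr
  have hrV : ∀ g, g ∉ U.image w → r g = 0 := by
    intro g hg
    rw [hr, card_eq_zero, filter_eq_empty_iff]
    rintro y hy rfl
    exact hg (mem_image_of_mem w hy)
  have key : ∀ h, #{z ∈ U ×ˢ U | w z.1 = w z.2 + h} = ∑ g ∈ U.image w, r g * r (g - h) := by
    intro h
    have h1 : #{z ∈ U ×ˢ U | w z.1 = w z.2 + h} = ∑ x ∈ U, r (w x - h) := by
      rw [card_filter, sum_product]
      refine sum_congr rfl fun x _ => ?_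
      simp only [hr, card_filter]
      refine sum_congr rfl fun y _ => ?_
      simp only [eq_sub_iff_add_eq, eq_comm]
    rw [h1, ← sum_fiberwise_of_maps_to (t := U.image w) (g := w)
      fun x hx => mem_image_of_mem w hx]
    refine sum_congr rfl fun g _ => ?_
    rw [sum_congr rfl fun x hx => by rw [(mem_filter.1 hx).2], sum_const, smul_eq_mul]
  have h0 := key 0
  simp only [add_zero, sub_zero] at h0
  rw [collisions, h0, key]
  have h2 : ∑ g ∈ U.image w, r (g - h) * r (g - h) ≤ ∑ g ∈ U.image w, r g * r g := by
    rw [← sum_image (s := U.image w) (g := fun g => g - h) (f := fun g => r g * r g)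
      (fun a _ b _ hab => sub_left_injective hab)]
    rw [← sum_filter_add_sum_filter_not _ (fun g => g ∈ U.image w)]
    rw [sum_eq_zero (s := filter (fun g => g ∉ U.image w) _)
      (fun g hg => by rw [hrV g (mem_filter.1 hg).2, mul_zero]), add_zero]
    exact sum_le_sum_of_subset fun g hg => (mem_filter.1 hg).2
  have h3 : ∀ g, 2 * (r g * r (g - h)) ≤ r g * r g + r (g - h) * r (g - h) := by
    intro g
    have := two_mul_le_add_sq (r g) (r (g - h))
    nlinarith
  have h4 := sum_le_sum fun g (_ : g ∈ U.image w) => h3 g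
  rw [← mul_sum, sum_add_distrib] at h4
  omega

theorem sum_powerVec_eq_iff {τ σ : Type} [Fintype τ] [Fintype σ] {k : ℕ} (x : τ → ℤ) (y : σ → ℤ) :
    ∑ i, powerVec k (x i) = ∑ i, powerVec k (y i) ↔
      ∀ j : ℕ, j ≠ 0 → j ≤ k → ∑ i, x i ^ j = ∑ i, y i ^ j := by
  constructor
  · intro h j hj0 hj
    have := congrFun h ⟨j - 1, by omega⟩
    simp only [Finset.sum_apply, powerVec] at this
    rwa [Nat.sub_add_cancel (by omega)] at this
  · intro h
    funext j
    simp only [Finset.sum_apply, powerVec]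
    exact h _ (by omega) j.2

theorem sum_pow_add_eq {τ : Type} [Fintype τ] {k : ℕ} (x y : τ → ℤ) (c : ℤ)
    (h : ∀ j : ℕ, j ≠ 0 → j ≤ k → ∑ i, x i ^ j = ∑ i, y i ^ j) (j : ℕ) (hj : j ≤ k) :
    ∑ i, (x i + c) ^ j = ∑ i, (y i + c) ^ j := by
  simp_rw [add_pow]
  rw [sum_comm, sum_comm (s := (univ : Finset τ))]
  refine sum_congr rfl fun m hm => ?_
  simp_rw [mul_assoc]
  rw [← sum_mul, ← sum_mul]
  congr 1
  rcases eq_or_ne m 0 with rfl | h0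
  · simp
  · exact h m h0 (by have := mem_range.1 hm; omega)

theorem vinogradovCount_le_of_affine (k s : ℕ) (A B : Finset ℤ) (c q : ℤ) (hq : q ≠ 0)
    (hAB : ∀ x ∈ A, ∃ b ∈ B, x = c + q * b) : vinogradovCount k s A ≤ vinogradovCount k s B := by
  set g : ℤ → ℤ := fun x => (x - c) / q with hg
  have hgx : ∀ x ∈ A, x = c + q * g x ∧ g x ∈ B := by
    intro x hx
    obtain ⟨b, hb, rfl⟩ := hAB x hx
    have : g (c + q * b) = b := by rw [hg]; simp [hq]
    rw [this]; exact ⟨rfl, hb⟩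
  refine card_le_card_of_injOn (fun z => (fun i => g (z.1 i), fun i => g (z.2 i))) ?_ ?_
  · rintro ⟨x, y⟩ hz
    simp only [coe_filter, mem_product, Fintype.mem_piFinset, Set.mem_ofPred_eq] at hz ⊢
    obtain ⟨⟨hx, hy⟩, hz⟩ := hz
    refine ⟨⟨fun i => (hgx _ (hx i)).2, fun i => (hgx _ (hy i)).2⟩, ?_⟩
    rw [sum_powerVec_eq_iff] at hz ⊢
    intro j hj0 hj
    have h1 := sum_pow_add_eq x y (-c) hz j hj
    have hx' : ∀ i, x i + -c = q * g (x i) := fun i => by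
      have := (hgx _ (hx i)).1; linarith
    have hy' : ∀ i, y i + -c = q * g (y i) := fun i => by
      have := (hgx _ (hy i)).1; linarith
    simp_rw [hx', hy', mul_pow, ← mul_sum] at h1
    exact mul_left_cancel₀ (pow_ne_zero _ hq) h1
  · rintro ⟨x, y⟩ hz ⟨x', y'⟩ hz' heq
    simp only [coe_filter, mem_product, Fintype.mem_piFinset, Set.mem_ofPred_eq] at hz hz'
    simp only [Prod.mk.injEq] at heq ⊢
    constructor
    · funext i
      rw [(hgx _ (hz.1.1 i)).1, (hgx _ (hz'.1.1 i)).1, congrFun heq.1 i]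
    · funext i
      rw [(hgx _ (hz.1.2 i)).1, (hgx _ (hz'.1.2 i)).1, congrFun heq.2 i]

open Classical in
theorem card_congruent_le {p k : ℕ} (hp : p.Prime) (hpk : k < p) (X : ℕ) (hX : X ≤ p ^ k) (c : ℤ)
    (u' : Fin k → ℤ) :
    #{u ∈ Fintype.piFinset fun _ : Fin k => Icc (1 : ℤ) X |
      (Function.Injective fun i => ((u i : ℤ) : ZMod p)) ∧ ∀ j : ℕ, j ≠ 0 → j ≤ k →
        (p : ℤ) ^ j ∣ ∑ i, (u i - c) ^ j - ∑ i, (u' i - c) ^ j} ≤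
      k ^ k * p ^ (k * (k - 1) / 2) := by
  have hp0 : (0 : ℤ) < p := by exact_mod_cast hp.pos
  set S := {u ∈ Fintype.piFinset fun _ : Fin k => Icc (1 : ℤ) X |
      (Function.Injective fun i => ((u i : ℤ) : ZMod p)) ∧ ∀ j : ℕ, j ≠ 0 → j ≤ k →
        (p : ℤ) ^ j ∣ ∑ i, (u i - c) ^ j - ∑ i, (u' i - c) ^ j} with hS
  set f : (Fin k → ℤ) → Fin k → ℤ := fun u j =>
    (∑ i, (u i - c) ^ (j.1 + 1) - ∑ i, (u' i - c) ^ (j.1 + 1)) / (p : ℤ) ^ (j.1 + 1) %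
      (p : ℤ) ^ (k - 1 - j.1) with hf
  set t : Finset (Fin k → ℤ) := Fintype.piFinset fun j : Fin k => Ico (0 : ℤ) (p ^ (k - 1 - j.1))
    with ht
  have hmaps : ∀ u ∈ S, f u ∈ t := by
    intro u _
    rw [ht, Fintype.mem_piFinset]
    intro j
    rw [mem_Ico]
    exact ⟨Int.emod_nonneg _ (by positivity), Int.emod_lt_of_pos _ (by positivity)⟩
  have hcard : #t = p ^ (k * (k - 1) / 2) := by
    rw [ht, Fintype.card_piFinset]
    have : ∀ j : Fin k, #(Ico (0 : ℤ) ((p : ℤ) ^ (k - 1 - j.1))) = p ^ (k - 1 - j.1) := by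
      intro j
      rw [Int.card_Ico, sub_zero]
      have : ((p : ℤ) ^ (k - 1 - j.1)) = ((p ^ (k - 1 - j.1) : ℕ) : ℤ) := by push_cast; rfl
      rw [this, Int.toNat_natCast]
    rw [prod_congr rfl fun j _ => this j, prod_pow_eq_pow_sum,
      Fin.sum_univ_eq_sum_range (fun j => k - 1 - j) k, sum_range_reflect (fun j => j) k,
      sum_range_id]
  rw [← hcard]
  refine card_le_mul_card_image_of_maps_to hmaps _ ?_
  intro b _
  rcases (S.filter (fun u => f u = b)).eq_empty_or_nonempty with he | ⟨u0, hu0⟩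
  · rw [he]; simp
  rw [mem_filter] at hu0
  obtain ⟨hu0S, hu0b⟩ := hu0
  have hsub : S.filter (fun u => f u = b) ⊆ Fintype.piFinset fun _ : Fin k => univ.image u0 := by
    intro u hu
    rw [mem_filter] at hu
    obtain ⟨huS, hub⟩ := hu
    rw [hS, mem_filter, Fintype.mem_piFinset] at hu0S huS
    rw [Fintype.mem_piFinset]
    intro i
    obtain ⟨j, hj⟩ := pow_dvd_sub_of_psum_modEq hp hpk (fun i => u0 i - c) (fun i => u i - c)
      (by
        intro a b hab
        apply hu0S.2.1
        simp only [Int.cast_sub] at hab ⊢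
        exact sub_left_injective hab)
      (by
        intro j hj0 hj
        have h1 := hu0S.2.2 j hj0 hj
        have h2 := huS.2.2 j hj0 hj
        have h3 : f u0 ⟨j - 1, by omega⟩ = f u ⟨j - 1, by omega⟩ := by rw [hu0b, hub]
        simp only [hf] at h3
        rw [Nat.sub_add_cancel (by omega)] at h3
        obtain ⟨d1, hd1⟩ := h1
        obtain ⟨d2, hd2⟩ := h2
        rw [hd1, hd2, Int.mul_ediv_cancel_left _ (by positivity),
          Int.mul_ediv_cancel_left _ (by positivity)] at h3
        have h4 : (p : ℤ) ^ (k - 1 - (j - 1)) ∣ d1 - d2 := Int.ModEq.dvd (Eq.symm h3)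
        have h5 : ∑ i, (u0 i - c) ^ j - ∑ i, (u i - c) ^ j = (p : ℤ) ^ j * (d1 - d2) := by
          rw [mul_sub, ← hd1, ← hd2]; ring
        rw [h5, show k = j + (k - 1 - (j - 1)) by omega, pow_add]
        have h6 : j + (k - 1 - (j - 1)) - 1 - (j - 1) = k - 1 - (j - 1) := by omega
        exact mul_dvd_mul_left _ h4) i
    rw [mem_image]
    refine ⟨j, mem_univ _, ?_⟩
    have h1 := mem_Icc.1 (hu0S.1 j)
    have h2 := mem_Icc.1 (huS.1 i)
    have hXp : (X : ℤ) ≤ (p : ℤ) ^ k := by exact_mod_cast hX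
    have h3 : u i - c - (u0 j - c) = 0 :=
      Int.eq_zero_of_abs_lt_dvd hj (by rw [abs_lt]; constructor <;> linarith)
    linarith
  refine (card_le_card hsub).trans ?_
  rw [Fintype.card_piFinset, prod_const, card_univ, Fintype.card_fin]
  gcongr
  exact card_image_le.trans (by simp)

open Classical in
theorem collisions_conditioned_le {p k : ℕ} (hp : p.Prime) (hpk : k < p) (X X' n : ℕ)
    (hX : X ≤ p ^ k) (c : ℤ) (Aa : Finset ℤ)
    (hAa : ∀ x ∈ Aa, ∃ b ∈ Icc (1 : ℤ) X', x = c + p * b) :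
    collisions ((Fintype.piFinset fun _ : Fin k => Icc (1 : ℤ) X).filter
        (fun u => Function.Injective ((fun x : ℤ => (x : ZMod p)) ∘ u)) ×ˢ
          (Fintype.piFinset fun _ : Fin n => Aa))
        (fun z => ∑ i, powerVec k (z.1 i) + ∑ i, powerVec k (z.2 i)) ≤
      vinogradovCount k n (Icc 1 X') * (X ^ k * (k ^ k * p ^ (k * (k - 1) / 2))) := by
  have hp0 : (p : ℤ) ≠ 0 := by exact_mod_cast hp.ne_zero
  set g : ℤ → ℤ := fun x => (x - c) / p with hg
  have hgx : ∀ x ∈ Aa, x - c = p * g x ∧ g x ∈ Icc (1 : ℤ) X' := by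
    intro x hx
    obtain ⟨b, hb, rfl⟩ := hAa x hx
    have : g (c + p * b) = b := by
      simp only [hg, add_sub_cancel_left]
      exact Int.mul_ediv_cancel_left _ hp0
    rw [this]; exact ⟨by ring, hb⟩
  set U := (Fintype.piFinset fun _ : Fin k => Icc (1 : ℤ) X).filter
        (fun u => Function.Injective ((fun x : ℤ => (x : ZMod p)) ∘ u)) with hU
  set pairs := {z ∈ U ×ˢ U | ∀ j : ℕ, j ≠ 0 → j ≤ k →
        (p : ℤ) ^ j ∣ ∑ i, (z.1 i - c) ^ j - ∑ i, (z.2 i - c) ^ j} with hpairs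
  have hpc : #pairs ≤ X ^ k * (k ^ k * p ^ (k * (k - 1) / 2)) := by
    have hUc : #U ≤ X ^ k := by
      refine (card_filter_le _ _).trans ?_
      simp [Fintype.card_piFinset]
    have h1 : #pairs ≤ (k ^ k * p ^ (k * (k - 1) / 2)) * #U := by
      refine card_le_mul_card_image_of_maps_to (f := fun z => z.2)
        (fun z hz => (mem_product.1 (mem_filter.1 hz).1).2) _ ?_
      intro u' _
      refine le_trans ?_ (card_congruent_le hp hpk X hX c u')
      refine card_le_card_of_injOn (fun z => z.1) ?_ ?_
      · rintro ⟨u, v⟩ hz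
        simp only [hU, coe_filter, mem_filter, mem_product, Set.mem_ofPred_eq] at hz ⊢
        obtain ⟨⟨⟨h1, _⟩, h2⟩, rfl⟩ := hz
        exact ⟨h1.1, h1.2, h2⟩
      · rintro ⟨u, v⟩ hz ⟨u2, v2⟩ hz2 heq
        simp only [coe_filter, Set.mem_ofPred_eq] at hz hz2
        exact Prod.ext heq (hz.2.trans hz2.2.symm)
    calc #pairs ≤ _ := h1
      _ ≤ (k ^ k * p ^ (k * (k - 1) / 2)) * X ^ k := by gcongr
      _ = _ := by ring
  have hfact : ∀ z ∈ (U ×ˢ (Fintype.piFinset fun _ : Fin n => Aa)) ×ˢ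
      (U ×ˢ (Fintype.piFinset fun _ : Fin n => Aa)),
      (∑ i, powerVec k (z.1.1 i) + ∑ i, powerVec k (z.1.2 i) =
        ∑ i, powerVec k (z.2.1 i) + ∑ i, powerVec k (z.2.2 i)) →
      ∀ j : ℕ, j ≠ 0 → j ≤ k → ∑ i, (z.1.1 i - c) ^ j - ∑ i, (z.2.1 i - c) ^ j =
        (p : ℤ) ^ j * (∑ i, g (z.2.2 i) ^ j - ∑ i, g (z.1.2 i) ^ j) := by
    rintro ⟨⟨u, x⟩, ⟨u', x'⟩⟩ hz heq j hj0 hj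
    simp only [mem_product, Fintype.mem_piFinset] at hz heq ⊢
    have h1 : ∑ i, powerVec k (Sum.elim u x i) = ∑ i, powerVec k (Sum.elim u' x' i) := by
      simpa [Fintype.sum_sum_type] using heq
    rw [sum_powerVec_eq_iff] at h1
    have h2 := sum_pow_add_eq _ _ (-c) h1 j hj
    simp only [Fintype.sum_sum_type, Sum.elim_inl, Sum.elim_inr, ← sub_eq_add_neg] at h2
    have e1 : ∑ i, (x i - c) ^ j = (p : ℤ) ^ j * ∑ i, g (x i) ^ j := by
      rw [mul_sum]
      exact sum_congr rfl fun i _ => by rw [(hgx _ (hz.1.2 i)).1, mul_pow]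
    have e2 : ∑ i, (x' i - c) ^ j = (p : ℤ) ^ j * ∑ i, g (x' i) ^ j := by
      rw [mul_sum]
      exact sum_congr rfl fun i _ => by rw [(hgx _ (hz.2.2 i)).1, mul_pow]
    rw [e1, e2] at h2
    linarith
  unfold collisions
  refine le_trans (card_le_mul_card_image_of_maps_to (f := fun z => (z.1.1, z.2.1)) (t := pairs)
    ?_ (vinogradovCount k n (Icc 1 X')) ?_) (Nat.mul_le_mul_left _ hpc)
  · intro z hz
    rw [mem_filter] at hz
    have hm := hz.1
    simp only [mem_product] at hm
    rw [hpairs, mem_filter, mem_product]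
    exact ⟨⟨hm.1.1, hm.2.1⟩, fun j hj0 hj => ⟨_, hfact z hz.1 hz.2 j hj0 hj⟩⟩
  · rintro ⟨u, u'⟩ _
    set h : Fin k → ℤ := fun j => (∑ i, (u' i - c) ^ (j.1 + 1) - ∑ i, (u i - c) ^ (j.1 + 1)) /
      (p : ℤ) ^ (j.1 + 1) with hh
    refine le_trans ?_ (collisions_shift_le (Fintype.piFinset fun _ : Fin n => Icc (1 : ℤ) X')
      (fun x => ∑ i, powerVec k (x i)) h)
    refine card_le_card_of_injOn (fun z => (fun i => g (z.1.2 i), fun i => g (z.2.2 i))) ?_ ?_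
    · rintro ⟨⟨v, x⟩, ⟨v', x'⟩⟩ hz
      simp only [coe_filter, mem_filter, Set.mem_ofPred_eq, Prod.mk.injEq] at hz
      obtain ⟨⟨hz1, hz2⟩, rfl, rfl⟩ := hz
      have h2 := hfact _ hz1 hz2
      simp only [mem_product, Fintype.mem_piFinset] at hz1 h2
      simp only [coe_filter, mem_product, Fintype.mem_piFinset, Set.mem_ofPred_eq]
      refine ⟨⟨fun i => (hgx _ (hz1.1.2 i)).2, fun i => (hgx _ (hz1.2.2 i)).2⟩, ?_⟩
      funext j
      have h3 := h2 (j.1 + 1) (by omega) j.2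
      have h4 : h j = ∑ i, g (x i) ^ (j.1 + 1) - ∑ i, g (x' i) ^ (j.1 + 1) := by
        rw [hh]
        apply Int.ediv_eq_of_eq_mul_right (pow_ne_zero _ hp0)
        linarith
      simp only [Pi.add_apply, Finset.sum_apply, powerVec, h4]
      ring
    · rintro ⟨⟨v, x⟩, ⟨v', x'⟩⟩ hz ⟨⟨v2, x2⟩, ⟨v2', x2'⟩⟩ hz2 heq
      simp only [coe_filter, mem_filter, Set.mem_ofPred_eq, Prod.mk.injEq, mem_product,
        Fintype.mem_piFinset] at hz hz2 heq ⊢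
      have inj : ∀ y ∈ Aa, ∀ y' ∈ Aa, g y = g y' → y = y' := by
        intro y hy y' hy' h
        have h1 := (hgx y hy).1
        have h2 := (hgx y' hy').1
        rw [h] at h1
        linarith
      refine ⟨⟨hz.2.1.trans hz2.2.1.symm, ?_⟩, hz.2.2.trans hz2.2.2.symm, ?_⟩
      · funext i
        exact inj _ (hz.1.1.1.2 i) _ (hz2.1.1.1.2 i) (congrFun heq.1 i)
      · funext i
        exact inj _ (hz.1.1.2.2 i) _ (hz2.1.1.2.2 i) (congrFun heq.2 i)

theorem vinogradovCount_add_le (k s m : ℕ) (A : Finset ℤ) :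
    vinogradovCount k (s + m) A ≤ vinogradovCount k s A * #A ^ (2 * m) := by
  classical
  set t : Finset ((Fin m → ℤ) × (Fin m → ℤ)) :=
    (Fintype.piFinset fun _ => A) ×ˢ (Fintype.piFinset fun _ => A) with ht
  have htc : #t = #A ^ (2 * m) := by
    rw [ht, card_product, Fintype.card_piFinset, prod_const, card_univ, Fintype.card_fin]; ring
  rw [← htc]
  refine card_le_mul_card_image_of_maps_to
    (f := fun z => (fun i => z.1 (Fin.natAdd s i), fun i => z.2 (Fin.natAdd s i))) ?_ _ ?_
  · rintro ⟨x, y⟩ hz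
    simp only [mem_filter, mem_product, Fintype.mem_piFinset, ht] at hz ⊢
    exact ⟨fun i => hz.1.1 _, fun i => hz.1.2 _⟩
  · rintro ⟨b, b'⟩ _
    refine le_trans ?_ (collisions_shift_le (Fintype.piFinset fun _ : Fin s => A)
      (fun x => ∑ i, powerVec k (x i)) (∑ i, powerVec k (b' i) - ∑ i, powerVec k (b i)))
    refine card_le_card_of_injOn
      (fun z => (fun i => z.1 (Fin.castAdd m i), fun i => z.2 (Fin.castAdd m i))) ?_ ?_
    · rintro ⟨x, y⟩ hz
      simp only [coe_filter, mem_filter, mem_product, Fintype.mem_piFinset, Set.mem_ofPred_eq,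
        Prod.mk.injEq] at hz ⊢
      obtain ⟨⟨⟨hx, hy⟩, heq⟩, rfl, rfl⟩ := hz
      refine ⟨⟨fun i => hx _, fun i => hy _⟩, ?_⟩
      rw [Fin.sum_univ_add, Fin.sum_univ_add] at heq
      rw [← add_sub_assoc, ← heq]; abel
    · rintro ⟨x, y⟩ hz ⟨x', y'⟩ hz' heq
      simp only [coe_filter, mem_filter, Set.mem_ofPred_eq, Prod.mk.injEq] at hz hz' heq ⊢
      have e1 := hz.2.1.trans hz'.2.1.symm
      have e2 := hz.2.2.trans hz'.2.2.symm
      constructor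
      · funext i
        exact Fin.addCases (fun i => congrFun heq.1 i) (fun i => congrFun e1 i) i
      · funext i
        exact Fin.addCases (fun i => congrFun heq.2 i) (fun i => congrFun e2 i) i

theorem vinogradovCount_le_trivial (k s : ℕ) (A : Finset ℤ) :
    vinogradovCount k s A ≤ #A ^ (2 * s) := by
  have := vinogradovCount_add_le k 0 s A
  have h0 : vinogradovCount k 0 A ≤ 1 := by
    unfold vinogradovCount collisions
    refine (card_filter_le _ _).trans ?_
    simp
  rw [zero_add] at this
  exact this.trans (by nlinarith [Nat.zero_le (#A ^ (2 * s))])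

theorem vinogradovCount_Icc_recursion {p k l X : ℕ} (hp : p.Prime) (hk : k ≠ 0) (hl : l ≠ 0)
    (hpk : k < p) (hX : X ≤ p ^ k) :
    (vinogradovCount k ((l + 1) * k) (Icc 1 X) : ℝ) ≤
      (4 * (p : ℝ) ^ (2 * (l * k)) * (X ^ k * (k ^ k * p ^ (k * (k - 1) / 2))) +
        (2 * (k ^ 2 * (p : ℝ) ^ (k - 1))) ^ (2 * (l + 1)) * p * ((X / p + 1 : ℕ) : ℝ) ^ (2 * k)) *
        vinogradovCount k (l * k) (Icc 1 ((X / p + 1 : ℕ) : ℤ)) := by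
  have : NeZero p := ⟨hp.ne_zero⟩
  set X' := X / p + 1 with hX'
  have h := vinogradovCount_recursion (ι := ZMod p) (Icc 1 (X : ℤ)) (fun x => (x : ZMod p)) k l hk
  have haff : ∀ a : ZMod p, ∀ x ∈ (Icc 1 (X : ℤ)).filter (fun x : ℤ => (x : ZMod p) = a),
      ∃ b ∈ Icc (1 : ℤ) X', x = ((a.val : ℤ) - p) + p * b := by
    intro a x hx
    rw [mem_filter, mem_Icc] at hx
    obtain ⟨⟨hx1, hx2⟩, hxa⟩ := hx
    have hval : ((a.val : ℤ) : ZMod p) = x := by rw [hxa]; simp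
    rw [ZMod.intCast_eq_intCast_iff_dvd_sub] at hval
    obtain ⟨d, hd⟩ := hval
    have hlt : (a.val : ℤ) < p := by exact_mod_cast ZMod.val_lt a
    have h0 : (0 : ℤ) ≤ a.val := by positivity
    have hp0 : (0 : ℤ) < p := by exact_mod_cast hp.pos
    refine ⟨d + 1, ?_, by linarith⟩
    rw [mem_Icc]
    constructor
    · by_contra hc
      have : d ≤ -1 := by omega
      nlinarith
    · have : d ≤ (X : ℤ) / p := by
        rw [Int.le_ediv_iff_mul_le hp0]; nlinarith
      rw [hX']; push_cast; omega
  have h1 : ∀ a : ZMod p, (collisions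
        ((Fintype.piFinset fun _ : Fin k => Icc 1 (X : ℤ)).filter
          (fun u => Function.Injective ((fun x : ℤ => (x : ZMod p)) ∘ u)) ×ˢ
          (Fintype.piFinset fun _ : Fin (l * k) =>
            (Icc 1 (X : ℤ)).filter (fun x : ℤ => (x : ZMod p) = a)))
        (fun z => ∑ i, powerVec k (z.1 i) + ∑ i, powerVec k (z.2 i)) : ℝ) ≤
      vinogradovCount k (l * k) (Icc 1 X') * (X ^ k * (k ^ k * p ^ (k * (k - 1) / 2))) := by
    intro a
    exact_mod_cast collisions_conditioned_le hp hpk X X' (l * k) hX _ _ (haff a)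
  have h2 : ∀ a : ZMod p, (vinogradovCount k ((l + 1) * k)
      ((Icc 1 (X : ℤ)).filter (fun x : ℤ => (x : ZMod p) = a)) : ℝ) ≤
      vinogradovCount k (l * k) (Icc 1 X') * (X' : ℝ) ^ (2 * k) := by
    intro a
    have e1 := vinogradovCount_le_of_affine k ((l + 1) * k) _ _ _ p
      (by exact_mod_cast hp.ne_zero) (haff a)
    have e2 := vinogradovCount_add_le k (l * k) k (Icc 1 (X' : ℤ))
    rw [← Nat.succ_mul] at e2
    have e3 : #(Icc 1 (X' : ℤ)) = X' := by simp
    rw [e3] at e2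
    exact_mod_cast e1.trans e2
  rw [ZMod.card] at h
  refine h.trans ?_
  have hpow : (p : ℝ) ^ (2 * (l * k)) = (p : ℝ) ^ (2 * (l * k) - 1) * p := by
    rw [← pow_succ, Nat.sub_add_cancel]
    have := Nat.pos_of_ne_zero (mul_ne_zero hl hk)
    omega
  have s1 := sum_le_sum fun a (_ : a ∈ (univ : Finset (ZMod p))) => h1 a
  have s2 := sum_le_sum fun a (_ : a ∈ (univ : Finset (ZMod p))) => h2 a
  rw [sum_const, card_univ, ZMod.card, nsmul_eq_mul] at s1 s2
  set J : ℝ := ((vinogradovCount k (l * k) (Icc 1 (X' : ℤ)) : ℕ) : ℝ)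
  rw [hpow]
  calc _ ≤ 4 * ((p : ℝ) ^ (2 * (l * k) - 1) *
          (p * (J * (X ^ k * (k ^ k * p ^ (k * (k - 1) / 2)))))) +
        (2 * (k ^ 2 * p ^ (k - 1) : ℕ) : ℝ) ^ (2 * (l + 1)) * (p * (J * (X' : ℝ) ^ (2 * k))) := by
        gcongr
    _ = _ := by push_cast; ring

theorem two_mul_pow_add_pow_le {k l : ℕ} (hk : 2 ≤ k) (hl : l + 1 ≤ 2 * k ^ 2) :
    (4 * (k : ℝ) ^ k + (2 * (k : ℝ) ^ 2) ^ (2 * (l + 1)) * 4 ^ k) ≤ (2 * k : ℝ) ^ (10 * k ^ 2) := by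
  have hk' : (2 : ℝ) ≤ k := by exact_mod_cast hk
  have h1 : (1 : ℝ) ≤ 2 * k := by linarith
  have a1 : 4 * (k : ℝ) ^ k ≤ (2 * k : ℝ) ^ (k + 1) := by
    rw [pow_succ]
    have : (k : ℝ) ^ k ≤ (2 * k : ℝ) ^ k := by gcongr; linarith
    have h0 : (0 : ℝ) ≤ (2 * k : ℝ) ^ k := by positivity
    nlinarith
  have a2 : (2 * (k : ℝ) ^ 2) ^ (2 * (l + 1)) ≤ (2 * k : ℝ) ^ (8 * k ^ 2) := by
    calc (2 * (k : ℝ) ^ 2) ^ (2 * (l + 1)) ≤ ((2 * k : ℝ) ^ 2) ^ (2 * (l + 1)) := by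
          gcongr; nlinarith
      _ = (2 * k : ℝ) ^ (4 * (l + 1)) := by rw [← pow_mul]; congr 1; ring
      _ ≤ _ := pow_le_pow_right₀ h1 (by omega)
  have a3 : (4 : ℝ) ^ k ≤ (2 * k : ℝ) ^ k := by gcongr; linarith
  have a4 : (2 * k : ℝ) ^ (k + 1) ≤ (2 * k : ℝ) ^ (9 * k ^ 2) := pow_le_pow_right₀ h1 (by nlinarith)
  have a5 : (2 * k : ℝ) ^ (8 * k ^ 2) * (2 * k : ℝ) ^ k ≤ (2 * k : ℝ) ^ (9 * k ^ 2) := by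
    rw [← pow_add]; exact pow_le_pow_right₀ h1 (by nlinarith)
  have a6 : (2 * k : ℝ) ^ (9 * k ^ 2) * (2 * k) ≤ (2 * k : ℝ) ^ (10 * k ^ 2) := by
    rw [← pow_succ]; exact pow_le_pow_right₀ h1 (by nlinarith)
  have h0 : (0 : ℝ) ≤ (2 * k : ℝ) ^ (9 * k ^ 2) := by positivity
  have a7 : (2 * (k : ℝ) ^ 2) ^ (2 * (l + 1)) * 4 ^ k ≤
      (2 * k : ℝ) ^ (8 * k ^ 2) * (2 * k : ℝ) ^ k := by gcongr
  nlinarith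

set_option maxHeartbeats 1000000 in
/-- Vinogradov's mean value theorem, in Linnik's form. -/
theorem vinogradovCount_le_induction {k : ℕ} (hk : 2 ≤ k) (m : ℕ) (hm : m ≤ k ^ 2) (X : ℕ)
    (hX : 1 ≤ X) : (vinogradovCount k ((k ^ 2 + m) * k) (Icc 1 X) : ℝ) ≤
      ((2 * k : ℝ) ^ (14 * k ^ 3)) ^ m * (X : ℝ) ^ (2 * ((k ^ 2 + m) * k) - k * (k + 1) / 2 +
        k * (k + 1) / 2 * (1 - 1 / k) ^ m : ℝ) := by
  have hk' : (2 : ℝ) ≤ k := by exact_mod_cast hk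
  have hk0 : (0 : ℝ) < k := by linarith
  induction m generalizing X with
  | zero =>
    have h := vinogradovCount_le_trivial k ((k ^ 2 + 0) * k) (Icc 1 (X : ℤ))
    have hc : #(Icc 1 (X : ℤ)) = X := by simp
    rw [hc] at h
    have h' : (vinogradovCount k ((k ^ 2 + 0) * k) (Icc 1 (X : ℤ)) : ℝ) ≤
        (X : ℝ) ^ (2 * ((k ^ 2 + 0) * k)) := by exact_mod_cast h
    refine h'.trans (le_of_eq ?_)
    rw [pow_zero, one_mul, ← Real.rpow_natCast]
    congr 1
    push_cast; ring
  | succ m ih =>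
    have hx1 : (1 : ℝ) ≤ X := by exact_mod_cast hX
    have hx0 : (0 : ℝ) < X := by linarith
    have hq0 : (0 : ℝ) ≤ 1 - 1 / k := by
      rw [sub_nonneg, div_le_one hk0]; linarith
    have hq1 : (1 - 1 / k : ℝ) ≤ 1 := by
      have : (0 : ℝ) ≤ 1 / k := by positivity
      linarith
    have hqm : ∀ m : ℕ, (1 - 1 / k : ℝ) ^ m ≤ 1 := fun m => pow_le_one₀ hq0 hq1
    have hqm0 : ∀ m : ℕ, 0 ≤ (1 - 1 / k : ℝ) ^ m := fun m => pow_nonneg hq0 m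
    set B : ℝ := (2 * k : ℝ) ^ (14 * k ^ 3) with hB
    have h2k : (1 : ℝ) ≤ 2 * k := by linarith
    have hB1 : 1 ≤ B := one_le_pow₀ h2k
    rcases lt_or_ge X (k ^ k) with hlt | hge
    · have h := vinogradovCount_le_trivial k ((k ^ 2 + (m + 1)) * k) (Icc 1 (X : ℤ))
      have hc : #(Icc 1 (X : ℤ)) = X := by simp
      rw [hc] at h
      have h' : (vinogradovCount k ((k ^ 2 + (m + 1)) * k) (Icc 1 (X : ℤ)) : ℝ) ≤
          (X : ℝ) ^ (2 * ((k ^ 2 + (m + 1)) * k)) := by exact_mod_cast h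
      refine h'.trans ?_
      have e1 : (X : ℝ) ^ (2 * ((k ^ 2 + (m + 1)) * k)) ≤ (X : ℝ) ^ (k ^ 2) *
          (X : ℝ) ^ (2 * ((k ^ 2 + (m + 1 : ℕ)) * k) - k * (k + 1) / 2 +
        k * (k + 1) / 2 * (1 - 1 / k) ^ (m + 1) : ℝ) := by
        rw [← Real.rpow_natCast, ← Real.rpow_natCast, ← Real.rpow_add hx0]
        apply Real.rpow_le_rpow_of_exponent_le hx1
        have := mul_nonneg (by positivity : (0 : ℝ) ≤ k * (k + 1) / 2) (hqm0 (m + 1))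
        push_cast
        nlinarith
      refine e1.trans ?_
      gcongr
      calc (X : ℝ) ^ (k ^ 2) ≤ ((k : ℝ) ^ k) ^ (k ^ 2) := by
            gcongr; exact_mod_cast hlt.le
        _ ≤ ((2 * k : ℝ) ^ k) ^ (k ^ 2) := by gcongr; linarith
        _ = (2 * k : ℝ) ^ (k ^ 3) := by rw [← pow_mul]; congr 1; ring
        _ ≤ B := pow_le_pow_right₀ h2k (by nlinarith)
        _ ≤ B ^ (m + 1) := le_self_pow₀ hB1 (by omega)
    · set x : ℝ := (X : ℝ) ^ (1 / k : ℝ) with hx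
      have hxk : x ^ k = X := by
        rw [hx, ← Real.rpow_natCast, ← Real.rpow_mul hx0.le, one_div_mul_cancel hk0.ne',
          Real.rpow_one]
      have hxpos : 0 < x := Real.rpow_pos_of_pos hx0 _
      have hkx : (k : ℝ) ≤ x := by
        have : (k : ℝ) ^ k ≤ x ^ k := by rw [hxk]; exact_mod_cast hge
        exact le_of_pow_le_pow_left₀ (by omega) hxpos.le this
      have hn : k ≤ ⌊x⌋₊ := Nat.le_floor hkx
      obtain ⟨p, hp, hnp, hp2⟩ := Nat.exists_prime_lt_and_le_two_mul ⌊x⌋₊ (by omega)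
      have hpk : k < p := by omega
      have hxp : x < p := (Nat.lt_floor_add_one x).trans_le (by exact_mod_cast hnp)
      have hpx : (p : ℝ) ≤ 2 * x := by
        have h1 : (⌊x⌋₊ : ℝ) ≤ x := Nat.floor_le hxpos.le
        have h2 : (p : ℝ) ≤ 2 * ⌊x⌋₊ := by exact_mod_cast hp2
        linarith
      have hp0 : (0 : ℝ) < p := by linarith
      have hp1 : (1 : ℝ) ≤ p := by exact_mod_cast hp.one_le
      have hXp : X ≤ p ^ k := by
        have : (X : ℝ) ≤ (p : ℝ) ^ k := by rw [← hxk]; gcongr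
        exact_mod_cast this
      have hpX : (p : ℝ) ≤ X := by
        have : x ^ 2 ≤ x ^ k := pow_le_pow_right₀ (by linarith) hk
        rw [hxk] at this
        nlinarith
      set l := k ^ 2 + m with hl
      have hrec := vinogradovCount_Icc_recursion (l := l) hp (by omega) (by positivity) hpk hXp
      set X' := X / p + 1 with hX'
      have hX'p : (X' : ℝ) * p ≤ 2 * X := by
        have h1 : ((X / p : ℕ) : ℝ) ≤ X / p := Nat.cast_div_le
        rw [le_div_iff₀ hp0] at h1
        rw [hX']; push_cast; nlinarith
      have hX'1 : 1 ≤ X' := by rw [hX']; exact Nat.le_add_left 1 _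
      set T := k * (k - 1) / 2 with hT
      have hT2 : 2 * T = k * (k - 1) :=
        Nat.mul_div_cancel' (Nat.even_mul_pred_self k).two_dvd
      have hT3 : (2 * T : ℝ) = k * (k - 1) := by
        have : ((2 * T : ℕ) : ℝ) = ((k * (k - 1) : ℕ) : ℝ) := by rw [hT2]
        push_cast [Nat.cast_sub (by omega : 1 ≤ k)] at this
        exact this
      set N := 2 * (l * k) + T with hN
      have hb2 : (p : ℝ) ^ (2 * (k - 1) * (l + 1) + 1) * (X' : ℝ) ^ (2 * k) ≤
          4 ^ k * X ^ k * p ^ N := by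
        have h1 : ((X' : ℝ) * p) ^ (2 * k) ≤ 4 ^ k * X ^ k * p ^ (k * k) := by
          calc ((X' : ℝ) * p) ^ (2 * k) ≤ (2 * X) ^ (2 * k) := by gcongr
            _ = 4 ^ k * X ^ k * X ^ k := by
              rw [pow_mul, mul_pow, mul_pow, ← pow_mul (X : ℝ), two_mul, pow_add]; norm_num; ring
            _ ≤ 4 ^ k * X ^ k * (p ^ k) ^ k := by gcongr; exact_mod_cast hXp
            _ = _ := by rw [← pow_mul]
        have h2 : (p : ℝ) ^ (2 * (k - 1) * (l + 1) + 1 + k * k) ≤ (p : ℝ) ^ (N + 2 * k) := by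
          apply pow_le_pow_right₀ hp1
          obtain ⟨d, rfl⟩ : ∃ d, k = d + 2 := ⟨k - 2, by omega⟩
          have : (d + 2 - 1) = d + 1 := by omega
          rw [this] at hT2 ⊢
          rw [hN, hl]
          nlinarith
        have h3 : (0 : ℝ) < (p : ℝ) ^ (2 * k) := by positivity
        refine le_of_mul_le_mul_right ?_ h3
        calc (p : ℝ) ^ (2 * (k - 1) * (l + 1) + 1) * (X' : ℝ) ^ (2 * k) * p ^ (2 * k)
            = (p : ℝ) ^ (2 * (k - 1) * (l + 1) + 1) * ((X' : ℝ) * p) ^ (2 * k) := by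
              rw [mul_pow]; ring
          _ ≤ (p : ℝ) ^ (2 * (k - 1) * (l + 1) + 1) * (4 ^ k * X ^ k * p ^ (k * k)) := by gcongr
          _ = 4 ^ k * X ^ k * (p : ℝ) ^ (2 * (k - 1) * (l + 1) + 1 + k * k) := by
              rw [pow_add _ _ (k * k)]; ring
          _ ≤ 4 ^ k * X ^ k * (p : ℝ) ^ (N + 2 * k) := by gcongr
          _ = _ := by rw [pow_add]; ring
      clear_value N T X' l x
      have hcoef : 4 * (p : ℝ) ^ (2 * (l * k)) * (X ^ k * (k ^ k * p ^ T)) +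
          (2 * (k ^ 2 * (p : ℝ) ^ (k - 1))) ^ (2 * (l + 1)) * p * (X' : ℝ) ^ (2 * k) ≤
          (2 * k : ℝ) ^ (10 * k ^ 2) * (X ^ k * p ^ N) := by
        have h1 := two_mul_pow_add_pow_le (l := l) hk (by omega)
        calc _ = 4 * (k : ℝ) ^ k * (X ^ k * p ^ N) + (2 * (k : ℝ) ^ 2) ^ (2 * (l + 1)) *
              ((p : ℝ) ^ (2 * (k - 1) * (l + 1) + 1) * (X' : ℝ) ^ (2 * k)) := by
              rw [← mul_assoc 2 ((k : ℝ) ^ 2), mul_pow _ ((p : ℝ) ^ (k - 1)), ← pow_mul (p : ℝ), hN, pow_add, pow_succ,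
                show (k - 1) * (2 * (l + 1)) = 2 * (k - 1) * (l + 1) by ring]
              ring
          _ ≤ 4 * (k : ℝ) ^ k * (X ^ k * p ^ N) + (2 * (k : ℝ) ^ 2) ^ (2 * (l + 1)) *
              (4 ^ k * X ^ k * p ^ N) := by gcongr
          _ = (4 * (k : ℝ) ^ k + (2 * (k : ℝ) ^ 2) ^ (2 * (l + 1)) * 4 ^ k) * (X ^ k * p ^ N) := by
              ring
          _ ≤ _ := by gcongr
      have hih := ih (by omega) X' hX'1
      set e : ℝ := 2 * ((k ^ 2 + m) * k) - k * (k + 1) / 2 + k * (k + 1) / 2 * (1 - 1 / k) ^ m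
        with he
      clear_value e B
      have he0 : 0 ≤ e := by
        have h1 := mul_nonneg (by positivity : (0 : ℝ) ≤ k * (k + 1) / 2) (hqm0 m)
        have h2 : (0 : ℝ) ≤ m * k := by positivity
        rw [he]; nlinarith
      have he1 : e ≤ 2 * (l * k) := by
        have h1 := mul_le_mul_of_nonneg_left (hqm m) (by positivity : (0 : ℝ) ≤ k * (k + 1) / 2)
        rw [he, hl]; push_cast; linarith
      have hX'x : (X' : ℝ) ≤ 2 * (X : ℝ) ^ (1 - 1 / k : ℝ) := by
        rw [Real.rpow_sub hx0, Real.rpow_one, ← mul_div_assoc, le_div_iff₀ (by rw [← hx]; exact hxpos)]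
        rw [← hx]
        refine le_trans ?_ hX'p
        gcongr
      have hX'e : (X' : ℝ) ^ e ≤ 2 ^ (2 * (l * k)) * (X : ℝ) ^ ((1 - 1 / k) * e : ℝ) := by
        calc (X' : ℝ) ^ e ≤ (2 * (X : ℝ) ^ (1 - 1 / k : ℝ)) ^ e :=
              Real.rpow_le_rpow (by positivity) hX'x he0
          _ = 2 ^ e * (X : ℝ) ^ ((1 - 1 / k) * e : ℝ) := by
              rw [Real.mul_rpow (by norm_num) (by positivity), ← Real.rpow_mul hx0.le]
          _ ≤ _ := by
              gcongr
              rw [← Real.rpow_natCast]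
              apply Real.rpow_le_rpow_of_exponent_le (by norm_num)
              push_cast; linarith
      have hpN : (p : ℝ) ^ N ≤ 2 ^ N * (X : ℝ) ^ (1 / k * N : ℝ) := by
        calc (p : ℝ) ^ N ≤ (2 * x) ^ N := by gcongr
          _ = 2 ^ N * (X : ℝ) ^ (1 / k * N : ℝ) := by
              rw [mul_pow, hx, ← Real.rpow_natCast _ N, ← Real.rpow_natCast _ N,
                ← Real.rpow_mul hx0.le]
      have hconst : (2 * k : ℝ) ^ (10 * k ^ 2) * 2 ^ N * 2 ^ (2 * (l * k)) ≤ B := by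
        have h1 : (2 : ℝ) ^ N ≤ (2 * k : ℝ) ^ N := by gcongr; linarith
        have h2 : (2 : ℝ) ^ (2 * (l * k)) ≤ (2 * k : ℝ) ^ (2 * (l * k)) := by gcongr; linarith
        calc (2 * k : ℝ) ^ (10 * k ^ 2) * 2 ^ N * 2 ^ (2 * (l * k)) ≤
            (2 * k : ℝ) ^ (10 * k ^ 2) * (2 * k : ℝ) ^ N * (2 * k : ℝ) ^ (2 * (l * k)) := by gcongr
          _ = (2 * k : ℝ) ^ (10 * k ^ 2 + N + 2 * (l * k)) := by rw [pow_add, pow_add]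
          _ ≤ B := by
              rw [hB]
              apply pow_le_pow_right₀ h2k
              have h3 : l * k ≤ 2 * k ^ 3 := by
                have : l ≤ 2 * k ^ 2 := by omega
                calc l * k ≤ 2 * k ^ 2 * k := by gcongr
                  _ = _ := by ring
              have h4 : T ≤ k ^ 2 := by
                have : k * (k - 1) ≤ k * k := by gcongr; omega
                nlinarith
              have h5 : 11 * k ^ 2 ≤ 6 * k ^ 3 := by nlinarith
              omega
      rw [show k ^ 2 + (m + 1) = l + 1 by rw [hl]; ring]
      refine hrec.trans ?_
      calc _ ≤ ((2 * k : ℝ) ^ (10 * k ^ 2) * (X ^ k * p ^ N)) * (B ^ m * (X' : ℝ) ^ e) := by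
            gcongr
        _ ≤ ((2 * k : ℝ) ^ (10 * k ^ 2) * (X ^ k * (2 ^ N * (X : ℝ) ^ (1 / k * N : ℝ)))) *
            (B ^ m * (2 ^ (2 * (l * k)) * (X : ℝ) ^ ((1 - 1 / k) * e : ℝ))) := by gcongr
        _ = ((2 * k : ℝ) ^ (10 * k ^ 2) * 2 ^ N * 2 ^ (2 * (l * k))) * B ^ m *
            ((X : ℝ) ^ (k : ℝ) * (X : ℝ) ^ (1 / k * N : ℝ) * (X : ℝ) ^ ((1 - 1 / k) * e : ℝ)) := by
            rw [Real.rpow_natCast]; ring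
        _ ≤ B * B ^ m * (X : ℝ) ^ (k + 1 / k * N + (1 - 1 / k) * e : ℝ) := by
            rw [← Real.rpow_add hx0, ← Real.rpow_add hx0]
            gcongr
        _ = _ := by
            rw [← pow_succ']
            congr 2
            rw [he, hN, hl]
            push_cast
            have : (T : ℝ) = k * (k - 1) / 2 := by linarith
            rw [this, pow_succ (1 - 1 / (k : ℝ)) m]
            generalize (1 - 1 / (k : ℝ)) ^ m = q
            field_simp
            ring

theorem vinogradovCount_le {k : ℕ} (hk : 12 ≤ k) (X : ℕ) (hX : 1 ≤ X) :
    (vinogradovCount k (2 * k ^ 3) (Icc 1 X) : ℝ) ≤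
      (2 * k : ℝ) ^ (14 * k ^ 5) * (X : ℝ) ^ (4 * k ^ 3 - k * (k + 1) / 2 + 1 / 100 : ℝ) := by
  have hk' : (12 : ℝ) ≤ k := by exact_mod_cast hk
  have hk0 : (0 : ℝ) < k := by linarith
  have h := vinogradovCount_le_induction (by omega : 2 ≤ k) (k ^ 2) le_rfl X hX
  rw [show (k ^ 2 + k ^ 2) * k = 2 * k ^ 3 by ring, ← pow_mul,
    show 14 * k ^ 3 * k ^ 2 = 14 * k ^ 5 by ring] at h
  refine h.trans ?_
  gcongr ?_ * ?_
  apply Real.rpow_le_rpow_of_exponent_le (by exact_mod_cast hX)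
  have h1 : (1 - 1 / k : ℝ) ^ (k ^ 2) ≤ Real.exp (-k) := by
    have h2 : (1 - 1 / k : ℝ) ≤ Real.exp (-(1 / k)) := by
      have := Real.add_one_le_exp (-(1 / k : ℝ)); linarith
    have h0 : (0 : ℝ) ≤ 1 - 1 / k := by
      rw [sub_nonneg, div_le_one hk0]; linarith
    calc (1 - 1 / k : ℝ) ^ (k ^ 2) ≤ (Real.exp (-(1 / k))) ^ (k ^ 2) := by gcongr
      _ = Real.exp (-k) := by
        rw [← Real.exp_nat_mul]; congr 1; push_cast; field_simp
  have h3 : (k * (k + 1) / 2 : ℝ) ≤ 1 / 100 * Real.exp k := by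
    have e1 := Real.pow_div_factorial_le_exp (k : ℝ) hk0.le 8
    have e2 : (12 : ℝ) ^ 6 ≤ (k : ℝ) ^ 6 := by gcongr
    have e3 : (k : ℝ) ^ 2 * 12 ^ 6 ≤ (k : ℝ) ^ 8 := by
      calc (k : ℝ) ^ 2 * 12 ^ 6 ≤ (k : ℝ) ^ 2 * (k : ℝ) ^ 6 := by gcongr
        _ = _ := by ring
    norm_num [Nat.factorial] at e1 e3
    nlinarith
  have h5 : (0 : ℝ) ≤ (1 - 1 / k : ℝ) ^ (k ^ 2) := by
    apply pow_nonneg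
    rw [sub_nonneg, div_le_one hk0]; linarith
  have h4 : (k * (k + 1) / 2 : ℝ) * (1 - 1 / k : ℝ) ^ (k ^ 2) ≤ 1 / 100 := by
    calc (k * (k + 1) / 2 : ℝ) * (1 - 1 / k : ℝ) ^ (k ^ 2) ≤
        1 / 100 * Real.exp k * Real.exp (-k) := by gcongr
      _ = 1 / 100 := by rw [mul_assoc, ← Real.exp_add]; simp
  push_cast
  linarith

/-- The character `v ↦ exp (i ∑ βⱼ vⱼ)` of `ℤᵏ`. -/
noncomputable def phaseChar {k : ℕ} (β : Fin k → ℝ) : AddChar (Fin k → ℤ) ℂ where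
  toFun v := Complex.exp (((∑ j, β j * v j : ℝ) : ℂ) * Complex.I)
  map_zero_eq_one' := by simp
  map_add_eq_mul' a b := by
    rw [← Complex.exp_add, ← add_mul]
    congr 2
    simp only [Pi.add_apply, Int.cast_add, mul_add, sum_add_distrib]
    push_cast
    ring

theorem phaseChar_apply {k : ℕ} (β : Fin k → ℝ) (v : Fin k → ℤ) :
    phaseChar β v = Complex.exp (((∑ j, β j * v j : ℝ) : ℂ) * Complex.I) := rfl

theorem conj_phaseChar {k : ℕ} (β : Fin k → ℝ) (v : Fin k → ℤ) :
    (starRingEnd ℂ) (phaseChar β v) = phaseChar β (-v) := by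
  rw [phaseChar_apply, phaseChar_apply, ← Complex.exp_conj]
  congr 1
  simp [sum_neg_distrib]

theorem norm_sum_phaseChar_pow {α : Type} {k : ℕ} (β : Fin k → ℝ) (A : Finset α)
    (φ : α → Fin k → ℤ) (s : ℕ) :
    ((‖∑ x ∈ A, phaseChar β (φ x)‖ ^ (2 * s) : ℝ) : ℂ) =
      ∑ z ∈ (Fintype.piFinset fun _ : Fin s => A) ×ˢ (Fintype.piFinset fun _ : Fin s => A),
        phaseChar β (∑ i, φ (z.1 i) - ∑ i, φ (z.2 i)) := by
  rw [pow_mul', ← norm_pow, sum_addChar_pow]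
  push_cast
  rw [← Complex.mul_conj', map_sum, sum_mul_sum, sum_product]
  refine sum_congr rfl fun x _ => sum_congr rfl fun y _ => ?_
  rw [conj_phaseChar, sub_eq_add_neg, AddChar.map_add_eq_mul]

theorem sum_le_collisions_mul_sum {ι H : Type} [AddCommGroup H] [DecidableEq H] (U : Finset ι)
    (w : ι → H) (B : Finset H) (hB : ∀ z ∈ U ×ˢ U, w z.1 - w z.2 ∈ B) (g : H → ℝ)
    (hg : ∀ h, 0 ≤ g h) :
    ∑ z ∈ U ×ˢ U, g (w z.1 - w z.2) ≤ collisions U w * ∑ h ∈ B, g h := by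
  rw [← sum_fiberwise_of_maps_to hB, mul_sum]
  refine sum_le_sum fun h _ => ?_
  rw [sum_congr rfl (g := fun _ => g h) (fun z hz => by rw [(mem_filter.1 hz).2]), sum_const,
    nsmul_eq_mul]
  refine mul_le_mul_of_nonneg_right ?_ (hg h)
  have := collisions_shift_le U w h
  refine le_trans (le_of_eq ?_) (Nat.cast_le.2 this)
  congr 2
  refine filter_congr fun z _ => ?_
  rw [sub_eq_iff_eq_add, add_comm]

/-- The box containing the differences of sums of `s` vectors of powers. -/
noncomputable def powerBox (k s P : ℕ) : Finset (Fin k → ℤ) :=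
  Fintype.piFinset fun j : Fin k => Icc (-(s * P ^ (j.1 + 1) : ℤ)) (s * P ^ (j.1 + 1))

theorem sum_powerVec_sub_mem_powerBox {k s P : ℕ} {x y : Fin s → ℤ}
    (hx : x ∈ Fintype.piFinset fun _ : Fin s => Icc (1 : ℤ) P)
    (hy : y ∈ Fintype.piFinset fun _ : Fin s => Icc (1 : ℤ) P) :
    ∑ i, powerVec k (x i) - ∑ i, powerVec k (y i) ∈ powerBox k s P := by
  have key : ∀ x ∈ Fintype.piFinset fun _ : Fin s => Icc (1 : ℤ) P, ∀ j : Fin k,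
      0 ≤ (∑ i, powerVec k (x i)) j ∧ (∑ i, powerVec k (x i)) j ≤ s * (P : ℤ) ^ (j.1 + 1) := by
    intro x hx j
    rw [Fintype.mem_piFinset] at hx
    simp only [mem_Icc] at hx
    rw [Finset.sum_apply]
    refine ⟨sum_nonneg fun i _ => pow_nonneg (by linarith [(hx i).1]) _, ?_⟩
    calc ∑ i, powerVec k (x i) j ≤ ∑ _i : Fin s, (P : ℤ) ^ (j.1 + 1) :=
          sum_le_sum fun i _ => pow_le_pow_left₀ (by linarith [(hx i).1]) (hx i).2 _
      _ = _ := by simp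
  rw [powerBox, Fintype.mem_piFinset]
  intro j
  have h1 := key x hx j
  have h2 := key y hy j
  rw [mem_Icc, Pi.sub_apply]
  constructor <;> linarith

theorem norm_bilinear_sum_pow_le (k s P : ℕ) (hs : 1 ≤ s) (hP : 1 ≤ P) (β : Fin k → ℝ) :
    ‖∑ x ∈ Icc (1 : ℤ) P, ∑ y ∈ Icc (1 : ℤ) P,
      phaseChar (fun j => β j * powerVec k x j) (powerVec k y)‖ ^ (2 * s * (2 * s)) ≤
      (P : ℝ) ^ (8 * s ^ 2 - 4 * s) * (vinogradovCount k s (Icc 1 P) : ℝ) ^ 2 *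
        ∏ j : Fin k, ∑ μ ∈ Icc (-(s * P ^ (j.1 + 1) : ℤ)) (s * P ^ (j.1 + 1)),
          ‖∑ l ∈ Icc (-(s * P ^ (j.1 + 1) : ℤ)) (s * P ^ (j.1 + 1)),
            Complex.exp (((β j * l * μ : ℝ) : ℂ) * Complex.I)‖ := by
  set A := Icc (1 : ℤ) P with hA
  have hAc : #A = P := by simp [hA]
  have hAne : A.Nonempty := by rw [← card_pos, hAc]; exact hP
  set U := Fintype.piFinset fun _ : Fin s => A with hU
  have hUc : #U = P ^ s := by rw [hU, Fintype.card_piFinset]; simp [hAc]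
  set w : (Fin s → ℤ) → Fin k → ℤ := fun x => ∑ i, powerVec k (x i) with hw
  set J : ℝ := ((vinogradovCount k s A : ℕ) : ℝ) with hJ
  have hJ0 : 0 ≤ J := Nat.cast_nonneg _
  have hbox : ∀ z ∈ U ×ˢ U, w z.1 - w z.2 ∈ powerBox k s P := fun z hz =>
    sum_powerVec_sub_mem_powerBox (mem_product.1 hz).1 (mem_product.1 hz).2
  have hsum : ∀ g : (Fin k → ℤ) → ℝ, (∀ h, 0 ≤ g h) →
      ∑ z ∈ U ×ˢ U, g (w z.1 - w z.2) ≤ J * ∑ h ∈ powerBox k s P, g h := fun g hg =>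
    sum_le_collisions_mul_sum U w _ hbox g hg
  set f : (Fin k → ℤ) → ℂ := fun l => ∑ x ∈ A, phaseChar (fun j => β j * l j) (powerVec k x)
    with hf
  -- swapping the roles of the two vectors
  have hswap : ∀ a b : Fin k → ℤ, phaseChar (fun j => β j * a j) b =
      phaseChar (fun j => β j * b j) a := by
    intro a b
    simp only [phaseChar_apply]
    congr 3
    exact sum_congr rfl fun j _ => by ring
  have hS : ∀ B : Finset (Fin k → ℤ), ∑ v ∈ B, ‖f v‖ ^ (2 * s) ≤
      ∑ z ∈ U ×ˢ U, ‖∑ v ∈ B, phaseChar (fun j => β j * v j) (w z.1 - w z.2)‖ := by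
    intro B
    have : ((∑ v ∈ B, ‖f v‖ ^ (2 * s) : ℝ) : ℂ) =
        ∑ z ∈ U ×ˢ U, ∑ v ∈ B, phaseChar (fun j => β j * v j) (w z.1 - w z.2) := by
      rw [sum_comm, Complex.ofReal_sum]
      exact sum_congr rfl fun v _ => norm_sum_phaseChar_pow _ _ _ _
    have h2 : (∑ v ∈ B, ‖f v‖ ^ (2 * s) : ℝ) = ‖((∑ v ∈ B, ‖f v‖ ^ (2 * s) : ℝ) : ℂ)‖ := by
      rw [Complex.norm_of_nonneg (sum_nonneg fun _ _ => by positivity)]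
    rw [h2, this]
    exact norm_sum_le _ _
  have hS' : ∑ x ∈ A, ‖∑ y ∈ A, phaseChar (fun j => β j * powerVec k x j) (powerVec k y)‖ ^ (2 * s)
      ≤ ∑ z ∈ U ×ˢ U, ‖f (w z.1 - w z.2)‖ := by
    have : ((∑ x ∈ A, ‖∑ y ∈ A, phaseChar (fun j => β j * powerVec k x j)
        (powerVec k y)‖ ^ (2 * s) : ℝ) : ℂ) = ∑ z ∈ U ×ˢ U, f (w z.1 - w z.2) := by
      rw [hf, sum_comm, Complex.ofReal_sum]
      refine sum_congr rfl fun x _ => ?_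
      rw [norm_sum_phaseChar_pow]
      exact sum_congr rfl fun z _ => hswap _ _
    have h2 : (∑ x ∈ A, ‖∑ y ∈ A, phaseChar (fun j => β j * powerVec k x j)
        (powerVec k y)‖ ^ (2 * s) : ℝ) = ‖((∑ x ∈ A, ‖∑ y ∈ A,
        phaseChar (fun j => β j * powerVec k x j) (powerVec k y)‖ ^ (2 * s) : ℝ) : ℂ)‖ := by
      rw [Complex.norm_of_nonneg (sum_nonneg fun _ _ => by positivity)]
    rw [h2, this]
    exact norm_sum_le _ _
  have hprod : ∑ μ ∈ powerBox k s P, ‖∑ v ∈ powerBox k s P, phaseChar (fun j => β j * v j) μ‖ =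
      ∏ j : Fin k, ∑ μ ∈ Icc (-(s * P ^ (j.1 + 1) : ℤ)) (s * P ^ (j.1 + 1)),
          ‖∑ l ∈ Icc (-(s * P ^ (j.1 + 1) : ℤ)) (s * P ^ (j.1 + 1)),
            Complex.exp (((β j * l * μ : ℝ) : ℂ) * Complex.I)‖ := by
    rw [Finset.prod_univ_sum]
    refine sum_congr rfl fun μ _ => ?_
    rw [← norm_prod, Finset.prod_univ_sum]
    congr 1
    refine sum_congr rfl fun v _ => ?_
    rw [phaseChar_apply, ← Complex.exp_sum, Complex.ofReal_sum, sum_mul]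
  have hUn : (U ×ˢ U).Nonempty := by
    rw [← card_pos, card_product, hUc]; positivity
  have hUU : (#(U ×ˢ U) : ℝ) = (P : ℝ) ^ (2 * s) := by
    rw [card_product, hUc]; push_cast; ring
  set W := ∑ x ∈ A, ∑ y ∈ A, phaseChar (fun j => β j * powerVec k x j) (powerVec k y) with hW
  set Q := ∏ j : Fin k, ∑ μ ∈ Icc (-(s * P ^ (j.1 + 1) : ℤ)) (s * P ^ (j.1 + 1)),
          ‖∑ l ∈ Icc (-(s * P ^ (j.1 + 1) : ℤ)) (s * P ^ (j.1 + 1)),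
            Complex.exp (((β j * l * μ : ℝ) : ℂ) * Complex.I)‖ with hQ
  have h1 : ‖W‖ ^ (2 * s) ≤ (P : ℝ) ^ (2 * s - 1) * ∑ z ∈ U ×ˢ U, ‖f (w z.1 - w z.2)‖ := by
    calc ‖W‖ ^ (2 * s) ≤ (∑ x ∈ A, ‖∑ y ∈ A, phaseChar (fun j => β j * powerVec k x j)
          (powerVec k y)‖) ^ (2 * s) := by gcongr; exact norm_sum_le _ _
      _ ≤ (#A : ℝ) ^ (2 * s - 1) * ∑ x ∈ A, ‖∑ y ∈ A, phaseChar (fun j => β j * powerVec k x j)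
          (powerVec k y)‖ ^ (2 * s) :=
          sum_pow_le_card_pow_mul _ hAne _ (fun _ _ => norm_nonneg _) _
      _ ≤ _ := by rw [hAc]; gcongr
  have h2 : (∑ z ∈ U ×ˢ U, ‖f (w z.1 - w z.2)‖) ^ (2 * s) ≤
      ((P : ℝ) ^ (2 * s)) ^ (2 * s - 1) * (J * (J * Q)) := by
    calc _ ≤ (#(U ×ˢ U) : ℝ) ^ (2 * s - 1) * ∑ z ∈ U ×ˢ U, ‖f (w z.1 - w z.2)‖ ^ (2 * s) :=
          sum_pow_le_card_pow_mul _ hUn _ (fun _ _ => norm_nonneg _) _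
      _ ≤ _ := by
        rw [hUU]
        gcongr
        refine (hsum (fun h => ‖f h‖ ^ (2 * s)) fun _ => by positivity).trans ?_
        gcongr
        refine (hS _).trans ?_
        rw [← hprod]
        exact hsum (fun h => ‖∑ v ∈ powerBox k s P, phaseChar (fun j => β j * v j) h‖)
          fun _ => norm_nonneg _
  calc ‖W‖ ^ (2 * s * (2 * s)) = (‖W‖ ^ (2 * s)) ^ (2 * s) := pow_mul _ _ _
    _ ≤ ((P : ℝ) ^ (2 * s - 1) * ∑ z ∈ U ×ˢ U, ‖f (w z.1 - w z.2)‖) ^ (2 * s) := by gcongr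
    _ = ((P : ℝ) ^ (2 * s - 1)) ^ (2 * s) * (∑ z ∈ U ×ˢ U, ‖f (w z.1 - w z.2)‖) ^ (2 * s) :=
        mul_pow _ _ _
    _ ≤ ((P : ℝ) ^ (2 * s - 1)) ^ (2 * s) * (((P : ℝ) ^ (2 * s)) ^ (2 * s - 1) * (J * (J * Q))) := by
        gcongr
    _ = (P : ℝ) ^ ((2 * s - 1) * (2 * s) + 2 * s * (2 * s - 1)) * J ^ 2 * Q := by
        rw [pow_add, pow_mul, pow_mul]; ring
    _ = _ := by
        congr 3
        obtain ⟨r, rfl⟩ : ∃ r, s = r + 1 := ⟨s - 1, by omega⟩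
        have e1 : 2 * (r + 1) - 1 = 2 * r + 1 := by omega
        have e2 : 8 * (r + 1) ^ 2 - 4 * (r + 1) = 8 * r ^ 2 + 12 * r + 4 := by
          have : 8 * (r + 1) ^ 2 = 8 * r ^ 2 + 12 * r + 4 + 4 * (r + 1) := by ring
          omega
        rw [e1, e2]; ring

theorem Icc_neg_succ (M : ℕ) : Icc (-((M + 1 : ℕ) : ℤ)) ((M + 1 : ℕ) : ℤ) =
    insert ((M + 1 : ℕ) : ℤ) (insert (-((M + 1 : ℕ) : ℤ)) (Icc (-(M : ℤ)) M)) := by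
  ext x
  simp only [mem_Icc, mem_insert]
  omega

theorem sum_Icc_neg {E : Type*} [AddCommGroup E] (g : ℤ → E) (M : ℕ) :
    ∑ m ∈ Icc (-(M : ℤ)) M, g m = g 0 + ∑ m ∈ range M, (g (m + 1 : ℕ) + g (-(m + 1 : ℕ))) := by
  induction M with
  | zero => simp
  | succ M ih =>
    rw [Icc_neg_succ, sum_insert, sum_insert, ih, sum_range_succ]
    · abel
    · simp only [mem_Icc]; omega
    · simp only [mem_Icc, mem_insert]; omega

theorem norm_exp_sub_one_ge {θ : ℝ} (h : |θ| ≤ Real.pi) :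
    2 / Real.pi * |θ| ≤ ‖Complex.exp (θ * Complex.I) - 1‖ := by
  rw [mul_comm (θ : ℂ), Complex.norm_exp_I_mul_ofReal_sub_one, norm_mul, Real.norm_eq_abs,
    Real.norm_eq_abs, abs_two]
  have := Real.mul_abs_le_abs_sin (x := θ / 2) (by rw [abs_div, abs_two]; linarith)
  rw [abs_div, abs_two] at this
  linarith

theorem norm_sum_exp_le {θ : ℝ} (h : |θ| ≤ Real.pi) (h0 : θ ≠ 0) (M : ℕ) :
    ‖∑ l ∈ Icc (-(M : ℤ)) M, Complex.exp (((θ * l : ℝ) : ℂ) * Complex.I)‖ ≤ Real.pi / |θ| := by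
  have hsum : (∑ l ∈ Icc (-(M : ℤ)) M, Complex.exp (((θ * l : ℝ) : ℂ) * Complex.I)) *
      (Complex.exp (θ * Complex.I) - 1) = Complex.exp (((θ * (M + 1) : ℝ) : ℂ) * Complex.I) -
        Complex.exp (((θ * (-M) : ℝ) : ℂ) * Complex.I) := by
    induction M with
    | zero => simp
    | succ M ih =>
      rw [Icc_neg_succ, sum_insert, sum_insert, add_mul, add_mul, ih]
      · simp only [mul_sub, ← Complex.exp_add]
        push_cast
        ring_nf
      · simp only [mem_Icc]; omega
      · simp only [mem_Icc, mem_insert]; omega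
  have h1 := norm_exp_sub_one_ge h
  have hθ : 0 < |θ| := abs_pos.2 h0
  have h2 : ‖∑ l ∈ Icc (-(M : ℤ)) M, Complex.exp (((θ * l : ℝ) : ℂ) * Complex.I)‖ *
      ‖Complex.exp (θ * Complex.I) - 1‖ ≤ 2 := by
    rw [← norm_mul, hsum]
    refine (norm_sub_le _ _).trans ?_
    rw [Complex.norm_exp_ofReal_mul_I, Complex.norm_exp_ofReal_mul_I]
    norm_num
  rw [le_div_iff₀ hθ]
  have h3 := (mul_le_mul_of_nonneg_left h1 (norm_nonneg _)).trans h2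
  have hpi := Real.pi_pos
  clear h2 hsum
  generalize ‖∑ l ∈ Icc (-(M : ℤ)) M, Complex.exp (((θ * l : ℝ) : ℂ) * Complex.I)‖ = S at h3 ⊢
  calc S * |θ| = (S * (2 / Real.pi * |θ|)) * (Real.pi / 2) := by field_simp
    _ ≤ 2 * (Real.pi / 2) := by gcongr
    _ = _ := by ring

theorem norm_sum_exp_le_trivial (θ : ℝ) (M : ℕ) :
    ‖∑ l ∈ Icc (-(M : ℤ)) M, Complex.exp (((θ * l : ℝ) : ℂ) * Complex.I)‖ ≤ 2 * M + 1 := by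
  refine (norm_sum_le _ _).trans ?_
  simp only [Complex.norm_exp_ofReal_mul_I, sum_const, Int.card_Icc, nsmul_eq_mul, mul_one]
  have : ((M : ℤ) + 1 - -(M : ℤ)).toNat = 2 * M + 1 := by omega
  rw [this]; push_cast; rfl

theorem sum_norm_sum_exp_le_trivial (β : ℝ) (M : ℕ) :
    ∑ μ ∈ Icc (-(M : ℤ)) M, ‖∑ l ∈ Icc (-(M : ℤ)) M,
      Complex.exp (((β * l * μ : ℝ) : ℂ) * Complex.I)‖ ≤ (2 * M + 1) ^ 2 := by
  have h : ∀ μ ∈ Icc (-(M : ℤ)) M, ‖∑ l ∈ Icc (-(M : ℤ)) M,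
      Complex.exp (((β * l * μ : ℝ) : ℂ) * Complex.I)‖ ≤ 2 * M + 1 := fun μ _ => by
    have := norm_sum_exp_le_trivial (β * μ) M
    simpa only [mul_right_comm β] using this
  refine (sum_le_card_nsmul _ _ _ h).trans ?_
  have : ((M : ℤ) + 1 - -(M : ℤ)).toNat = 2 * M + 1 := by omega
  rw [Int.card_Icc, this, nsmul_eq_mul]; push_cast; exact le_of_eq (by ring)

theorem sum_norm_sum_exp_le {β : ℝ} (h0 : β ≠ 0) {M : ℕ} (hM : |β| * M ≤ Real.pi) :
    ∑ μ ∈ Icc (-(M : ℤ)) M, ‖∑ l ∈ Icc (-(M : ℤ)) M,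
      Complex.exp (((β * l * μ : ℝ) : ℂ) * Complex.I)‖ ≤
      2 * M + 1 + 2 * Real.pi / |β| * (1 + Real.log M) := by
  have hβ : 0 < |β| := abs_pos.2 h0
  have key : ∀ m ∈ range M, ∀ μ : ℤ, (|(μ : ℝ)| = m + 1) → ‖∑ l ∈ Icc (-(M : ℤ)) M,
      Complex.exp (((β * l * μ : ℝ) : ℂ) * Complex.I)‖ ≤ Real.pi / |β| * ((m : ℝ) + 1)⁻¹ := by
    intro m hm μ hμ
    have hm' : (m : ℝ) + 1 ≤ M := by exact_mod_cast mem_range.1 hm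
    have := norm_sum_exp_le (θ := β * μ) (by
      rw [abs_mul, hμ]; exact (mul_le_mul_of_nonneg_left hm' hβ.le).trans hM) (by
      refine mul_ne_zero h0 ?_
      rw [← abs_pos, hμ]; positivity) M
    rw [abs_mul, hμ, ← div_div, div_eq_mul_inv _ ((m : ℝ) + 1)] at this
    simpa only [mul_right_comm β] using this
  rw [sum_Icc_neg]
  have h1 : ‖∑ l ∈ Icc (-(M : ℤ)) M, Complex.exp (((β * l * (0 : ℤ) : ℝ) : ℂ) * Complex.I)‖ ≤
      2 * M + 1 := by
    have := norm_sum_exp_le_trivial (β * (0 : ℤ)) M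
    simpa only [mul_right_comm β] using this
  refine add_le_add h1 ?_
  have h2 : (∑ m ∈ range M, ((m : ℝ) + 1)⁻¹) ≤ 1 + Real.log M := by
    have := harmonic_le_one_add_log M
    simpa [harmonic] using this
  calc _ ≤ ∑ m ∈ range M, (2 * Real.pi / |β|) * ((m : ℝ) + 1)⁻¹ := by
        refine sum_le_sum fun m hm => ?_
        have e1 := key m hm ((m + 1 : ℕ) : ℤ) (by
          push_cast; exact abs_of_nonneg (by positivity))
        have e2 := key m hm (-((m + 1 : ℕ) : ℤ)) (by
          push_cast; rw [abs_neg]; exact abs_of_nonneg (by positivity))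
        calc _ ≤ _ := add_le_add e1 e2
          _ = _ := by ring
    _ ≤ _ := by
        rw [← mul_sum]
        gcongr

theorem prod_sum_norm_sum_exp_le {k s P : ℕ} (hs : 1 ≤ s) (hP : 1 ≤ P) (β : Fin k → ℝ)
    (i : Fin k) (h0 : β i ≠ 0) (hi : |β i| * (s * P ^ (i.1 + 1)) ≤ Real.pi) :
    ∏ j : Fin k, ∑ μ ∈ Icc (-(s * P ^ (j.1 + 1) : ℤ)) (s * P ^ (j.1 + 1)),
      ‖∑ l ∈ Icc (-(s * P ^ (j.1 + 1) : ℤ)) (s * P ^ (j.1 + 1)),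
        Complex.exp (((β j * l * μ : ℝ) : ℂ) * Complex.I)‖ ≤
      (3 * s : ℝ) ^ (2 * k) * (P : ℝ) ^ (k * (k + 1)) *
        ((3 * s * P ^ (i.1 + 1) + 2 * Real.pi / |β i| * (1 + Real.log (s * P ^ (i.1 + 1)))) /
          (P : ℝ) ^ (2 * (i.1 + 1))) := by
  have hs' : (1 : ℝ) ≤ s := by exact_mod_cast hs
  have hP' : (1 : ℝ) ≤ P := by exact_mod_cast hP
  have hP0 : (0 : ℝ) < P := by linarith
  set R := 3 * s * P ^ (i.1 + 1) + 2 * Real.pi / |β i| * (1 + Real.log (s * P ^ (i.1 + 1)))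
    with hR
  have hM : ∀ j : Fin k, (1 : ℝ) ≤ s * P ^ (j.1 + 1) := fun j =>
    one_le_mul_of_one_le_of_one_le hs' (one_le_pow₀ hP')
  have hR0 : 0 ≤ R := by
    have := Real.log_nonneg (hM i)
    positivity
  have hcast : ∀ j : Fin k, ((s * P ^ (j.1 + 1) : ℕ) : ℤ) = (s * P ^ (j.1 + 1) : ℤ) := by
    intro j; push_cast; rfl
  have hb : ∀ j : Fin k, ∑ μ ∈ Icc (-(s * P ^ (j.1 + 1) : ℤ)) (s * P ^ (j.1 + 1)),
      ‖∑ l ∈ Icc (-(s * P ^ (j.1 + 1) : ℤ)) (s * P ^ (j.1 + 1)),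
        Complex.exp (((β j * l * μ : ℝ) : ℂ) * Complex.I)‖ ≤
      (3 * s * P ^ (j.1 + 1)) ^ 2 * (if j = i then R / P ^ (2 * (i.1 + 1)) else 1) := by
    intro j
    rw [← hcast j]
    split_ifs with hj
    · subst hj
      have := sum_norm_sum_exp_le h0 (M := s * P ^ (j.1 + 1)) (by push_cast; exact hi)
      refine this.trans ?_
      push_cast
      calc _ ≤ R := by rw [hR]; have := hM j; gcongr; linarith
        _ ≤ (3 * s) ^ 2 * R := le_mul_of_one_le_left hR0 (by nlinarith)
        _ = _ := by field_simp; ring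
    · have := sum_norm_sum_exp_le_trivial (β j) (s * P ^ (j.1 + 1))
      refine this.trans ?_
      push_cast
      have := hM j
      rw [mul_one]
      gcongr
      linarith
  calc _ ≤ ∏ j : Fin k, ((3 * s * (P : ℝ) ^ (j.1 + 1)) ^ 2 *
        (if j = i then R / P ^ (2 * (i.1 + 1)) else 1)) :=
        prod_le_prod (fun j _ => sum_nonneg fun _ _ => norm_nonneg _) fun j _ => hb j
    _ = _ := by
        rw [prod_mul_distrib, Fintype.prod_ite_eq']
        congr 1
        rw [prod_pow, prod_mul_distrib, prod_const, card_univ, Fintype.card_fin, prod_pow_eq_pow_sum,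
          mul_pow, ← pow_mul, ← pow_mul, mul_comm k 2]
        congr 2
        rw [Fin.sum_univ_eq_sum_range (fun j => j + 1)]
        clear * -
        induction k with
        | zero => simp
        | succ k ih => rw [sum_range_succ, add_mul, ih]; ring

theorem norm_bilinear_sum_pow_le_of_small {k P : ℕ} (hk : 12 ≤ k) (hP : 1 ≤ P) (β : Fin k → ℝ)
    (i : Fin k) (h0 : β i ≠ 0) (hi : |β i| * (2 * k ^ 3 * P ^ (i.1 + 1)) ≤ Real.pi) :
    ‖∑ x ∈ Icc (1 : ℤ) P, ∑ y ∈ Icc (1 : ℤ) P,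
      phaseChar (fun j => β j * powerVec k x j) (powerVec k y)‖ ^ (16 * k ^ 6) ≤
      (2 * k : ℝ) ^ (36 * k ^ 5) * (P : ℝ) ^ (32 * k ^ 6) * (P : ℝ) ^ (1 / 50 : ℝ) *
        ((6 * k ^ 3 * P ^ (i.1 + 1) + 2 * Real.pi / |β i| *
          (1 + Real.log (2 * k ^ 3 * P ^ (i.1 + 1)))) / (P : ℝ) ^ (2 * (i.1 + 1))) := by
  have hk' : (12 : ℝ) ≤ k := by exact_mod_cast hk
  have hP' : (1 : ℝ) ≤ P := by exact_mod_cast hP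
  have hP0 : (0 : ℝ) < P := by linarith
  have hs : 1 ≤ 2 * k ^ 3 := by
    have : 0 < k ^ 3 := by positivity
    omega
  have h1 := norm_bilinear_sum_pow_le k (2 * k ^ 3) P hs hP β
  have h2 := prod_sum_norm_sum_exp_le hs hP β i h0 (by push_cast; exact hi)
  have h3 := vinogradovCount_le hk P hP
  rw [show ((2 * k ^ 3 : ℕ) : ℝ) = 2 * (k : ℝ) ^ 3 by push_cast; rfl] at h2
  set R := (6 * k ^ 3 * (P : ℝ) ^ (i.1 + 1) + 2 * Real.pi / |β i| *
          (1 + Real.log (2 * k ^ 3 * P ^ (i.1 + 1)))) / (P : ℝ) ^ (2 * (i.1 + 1)) with hR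
  have hR0 : 0 ≤ R := by
    have := Real.log_nonneg (x := 2 * k ^ 3 * P ^ (i.1 + 1))
      (one_le_mul_of_one_le_of_one_le (by exact_mod_cast hs) (one_le_pow₀ hP'))
    positivity
  have e1 : (3 * (2 * (k : ℝ) ^ 3) * (P : ℝ) ^ (i.1 + 1) + 2 * Real.pi / |β i| *
          (1 + Real.log (2 * k ^ 3 * P ^ (i.1 + 1)))) / (P : ℝ) ^ (2 * (i.1 + 1)) = R := by
    rw [hR]; ring
  rw [e1] at h2
  rw [show 2 * (2 * k ^ 3) * (2 * (2 * k ^ 3)) = 16 * k ^ 6 by ring,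
    show 8 * (2 * k ^ 3) ^ 2 = 32 * k ^ 6 by ring, show 4 * (2 * k ^ 3) = 8 * k ^ 3 by ring] at h1
  refine h1.trans ?_
  have hpow : (P : ℝ) ^ (32 * k ^ 6 - 8 * k ^ 3) * ((P : ℝ) ^ (4 * k ^ 3 - k * (k + 1) / 2 + 1 / 100 : ℝ)) ^ 2 *
      (P : ℝ) ^ (k * (k + 1)) = (P : ℝ) ^ (32 * k ^ 6) * (P : ℝ) ^ (1 / 50 : ℝ) := by
    have hle : 8 * k ^ 3 ≤ 32 * k ^ 6 := by
      have : k ^ 3 ≤ k ^ 6 := Nat.pow_le_pow_right (by omega) (by norm_num)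
      omega
    rw [← Real.rpow_natCast (P : ℝ) (32 * k ^ 6 - 8 * k ^ 3), ← Real.rpow_natCast _ 2,
      ← Real.rpow_natCast (P : ℝ) (k * (k + 1)), ← Real.rpow_natCast (P : ℝ) (32 * k ^ 6),
      ← Real.rpow_mul hP0.le, ← Real.rpow_add hP0, ← Real.rpow_add hP0, ← Real.rpow_add hP0]
    congr 1
    push_cast [Nat.cast_sub hle]
    ring
  have hC : ((2 * k : ℝ) ^ (14 * k ^ 5)) ^ 2 * (3 * (2 * (k : ℝ) ^ 3)) ^ (2 * k) ≤
      (2 * k : ℝ) ^ (36 * k ^ 5) := by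
    have e2 : 3 * (2 * (k : ℝ) ^ 3) ≤ (2 * k) ^ 3 := by
      have : (0 : ℝ) ≤ (k : ℝ) ^ 3 := by positivity
      nlinarith
    calc _ ≤ ((2 * k : ℝ) ^ (14 * k ^ 5)) ^ 2 * ((2 * k) ^ 3) ^ (2 * k) := by gcongr
      _ = (2 * k : ℝ) ^ (28 * k ^ 5 + 6 * k) := by
          rw [pow_add, ← pow_mul, ← pow_mul]; ring_nf
      _ ≤ _ := by
          apply pow_le_pow_right₀ (by linarith)
          have : k ≤ k ^ 5 := Nat.le_self_pow (by norm_num) k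
          omega
  calc _ ≤ (P : ℝ) ^ (32 * k ^ 6 - 8 * k ^ 3) * ((2 * k : ℝ) ^ (14 * k ^ 5) *
        (P : ℝ) ^ (4 * k ^ 3 - k * (k + 1) / 2 + 1 / 100 : ℝ)) ^ 2 *
        ((3 * (2 * (k : ℝ) ^ 3)) ^ (2 * k) * (P : ℝ) ^ (k * (k + 1)) * R) := by
        gcongr
    _ = (((2 * k : ℝ) ^ (14 * k ^ 5)) ^ 2 * (3 * (2 * (k : ℝ) ^ 3)) ^ (2 * k)) *
        ((P : ℝ) ^ (32 * k ^ 6 - 8 * k ^ 3) *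
          ((P : ℝ) ^ (4 * k ^ 3 - k * (k + 1) / 2 + 1 / 100 : ℝ)) ^ 2 * (P : ℝ) ^ (k * (k + 1))) *
        R := by ring
    _ ≤ (2 * k : ℝ) ^ (36 * k ^ 5) * ((P : ℝ) ^ (32 * k ^ 6) * (P : ℝ) ^ (1 / 50 : ℝ)) * R := by
        rw [hpow]
        gcongr
    _ = _ := by ring

theorem norm_sum_Ioc_sub_shift_le (f : ℕ → ℂ) (hf : ∀ n, ‖f n‖ ≤ 1) {a b : ℕ} (hab : a ≤ b)
    (h : ℕ) : ‖∑ n ∈ Ioc a b, f n - ∑ n ∈ Ioc a b, f (n + h)‖ ≤ 2 * h := by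
  have hstep : ∀ h, ∑ n ∈ Ioc a b, f (n + h) - ∑ n ∈ Ioc a b, f (n + (h + 1)) =
      f (a + h + 1) - f (b + h + 1) := by
    intro h
    induction b, hab using Nat.le_induction with
    | base => simp
    | succ b hb ih =>
      rw [sum_Ioc_succ_top hb, sum_Ioc_succ_top hb, add_sub_add_comm, ih]
      rw [show b + 1 + h = b + h + 1 by ring, show b + 1 + (h + 1) = b + 1 + h + 1 by ring,
        show b + 1 + h + 1 = b + h + 1 + 1 by ring]
      ring
  induction h with
  | zero => simp
  | succ h ih =>
    have h1 : ‖f (a + h + 1) - f (b + h + 1)‖ ≤ 2 :=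
      (norm_sub_le _ _).trans (by linarith [hf (a + h + 1), hf (b + h + 1)])
    rw [← hstep] at h1
    calc _ = ‖(∑ n ∈ Ioc a b, f n - ∑ n ∈ Ioc a b, f (n + h)) +
          (∑ n ∈ Ioc a b, f (n + h) - ∑ n ∈ Ioc a b, f (n + (h + 1)))‖ := by congr 1; ring
      _ ≤ 2 * h + 2 := (norm_add_le _ _).trans (add_le_add ih h1)
      _ = _ := by push_cast; ring

theorem norm_exp_mul_I_sub_le (a b : ℝ) :
    ‖Complex.exp ((a : ℂ) * Complex.I) - Complex.exp ((b : ℂ) * Complex.I)‖ ≤ |a - b| := by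
  have h : Complex.exp ((a : ℂ) * Complex.I) - Complex.exp ((b : ℂ) * Complex.I) =
      Complex.exp ((b : ℂ) * Complex.I) * (Complex.exp (Complex.I * ((a - b : ℝ) : ℂ)) - 1) := by
    rw [mul_sub, ← Complex.exp_add, mul_one]
    congr 2
    push_cast; ring
  rw [h, norm_mul, Complex.norm_exp_ofReal_mul_I, one_mul]
  exact Real.norm_exp_I_mul_ofReal_sub_one_le

theorem abs_log_one_add_sub_le {z : ℝ} (h0 : 0 ≤ z) (h1 : z ≤ 1 / 2) (k : ℕ) :
    |Real.log (1 + z) - ∑ j ∈ range k, (-1) ^ j * z ^ (j + 1) / (j + 1)| ≤ 2 * z ^ (k + 1) := by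
  have h := Real.abs_log_sub_add_sum_range_le (x := -z) (by rw [abs_neg, abs_of_nonneg h0]; linarith) k
  rw [abs_neg, abs_of_nonneg h0, sub_neg_eq_add] at h
  have e : ∑ j ∈ range k, (-z) ^ (j + 1) / ((j : ℝ) + 1) =
      - ∑ j ∈ range k, (-1) ^ j * z ^ (j + 1) / (j + 1) := by
    rw [← sum_neg_distrib]
    refine sum_congr rfl fun j _ => ?_
    rw [neg_pow, pow_succ]; ring
  rw [e, neg_add_eq_sub] at h
  refine h.trans ?_
  rw [div_le_iff₀ (by linarith)]
  have : 0 ≤ z ^ (k + 1) := by positivity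
  nlinarith

/-- The coefficients of the Taylor polynomial of `x ↦ -t log (1 + x / n)`. -/
noncomputable def taylorCoeff (k : ℕ) (t n : ℝ) : Fin k → ℝ :=
  fun j => -t * ((-1) ^ j.1 / ((j.1 + 1) * n ^ (j.1 + 1)))

theorem norm_sum_exp_log_add_mul_le (k P n : ℕ) (t : ℝ) (hn : 2 * P ^ 2 ≤ n) (hP : 1 ≤ P) :
    ‖∑ x ∈ Icc 1 P, ∑ y ∈ Icc 1 P,
      Complex.exp (((-t * Real.log ((n + x * y : ℕ) : ℝ) : ℝ) : ℂ) * Complex.I)‖ ≤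
    ‖∑ x ∈ Icc (1 : ℤ) P, ∑ y ∈ Icc (1 : ℤ) P,
      phaseChar (fun j => taylorCoeff k t n j * powerVec k x j) (powerVec k y)‖ +
      (P : ℝ) ^ 2 * (2 * |t| * ((P : ℝ) ^ 2 / n) ^ (k + 1)) := by
  have hn0 : (0 : ℝ) < n := by
    have : 0 < P ^ 2 := by positivity
    exact_mod_cast (by omega : 0 < n)
  have hn' : 2 * (P : ℝ) ^ 2 ≤ n := by exact_mod_cast hn
  have hI : ∀ g : ℤ → ℂ, ∑ x ∈ Icc (1 : ℤ) P, g x = ∑ x ∈ Icc 1 P, g ((x : ℕ) : ℤ) := by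
    intro g
    refine (sum_nbij (fun x : ℕ => (x : ℤ)) ?_ ?_ ?_ fun _ _ => rfl).symm
    · intro x hx; simp only [mem_Icc] at hx ⊢; omega
    · intro x _ y _ h; simpa using h
    · intro x hx
      simp only [coe_Icc, Set.mem_Icc, Set.mem_image] at hx ⊢
      exact ⟨x.toNat, by omega, by omega⟩
  simp only [hI]
  set c := Complex.exp (((-t * Real.log n : ℝ) : ℂ) * Complex.I) with hc
  have hcn : ‖c‖ = 1 := Complex.norm_exp_ofReal_mul_I _
  set V := ∑ x ∈ Icc 1 P, ∑ y ∈ Icc 1 P, phaseChar (fun j => taylorCoeff k t n j *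
    powerVec k ((x : ℕ) : ℤ) j) (powerVec k ((y : ℕ) : ℤ)) with hV
  have key : ∀ x ∈ Icc 1 P, ∀ y ∈ Icc 1 P,
      ‖Complex.exp (((-t * Real.log ((n + x * y : ℕ) : ℝ) : ℝ) : ℂ) * Complex.I) -
        c * phaseChar (fun j => taylorCoeff k t n j *
          powerVec k ((x : ℕ) : ℤ) j) (powerVec k ((y : ℕ) : ℤ))‖ ≤
      2 * |t| * ((P : ℝ) ^ 2 / n) ^ (k + 1) := by
    intro x hx y hy
    rw [mem_Icc] at hx hy
    have hxy : (x * y : ℝ) ≤ P ^ 2 := by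
      rw [sq]; exact_mod_cast Nat.mul_le_mul hx.2 hy.2
    set z : ℝ := x * y / n with hz
    have hz0 : 0 ≤ z := by positivity
    have hzP : z ≤ (P : ℝ) ^ 2 / n := by rw [hz]; gcongr
    have hz1 : z ≤ 1 / 2 := hzP.trans (by rw [div_le_iff₀ hn0]; linarith)
    have hlog : Real.log ((n + x * y : ℕ) : ℝ) = Real.log n + Real.log (1 + z) := by
      rw [← Real.log_mul hn0.ne' (by positivity)]
      congr 1
      rw [hz]; push_cast; field_simp
    rw [phaseChar_apply, hc, ← Complex.exp_add, ← add_mul, ← Complex.ofReal_add]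
    refine (norm_exp_mul_I_sub_le _ _).trans ?_
    have e : ∑ j : Fin k, taylorCoeff k t n j * (powerVec k ((x : ℕ) : ℤ) j : ℝ) *
        (powerVec k ((y : ℕ) : ℤ) j : ℝ) =
        -t * ∑ j ∈ range k, (-1) ^ j * z ^ (j + 1) / (j + 1) := by
      rw [← Fin.sum_univ_eq_sum_range (fun j => (-1 : ℝ) ^ j * z ^ (j + 1) / (j + 1)), mul_sum]
      refine sum_congr rfl fun j _ => ?_
      rw [taylorCoeff, powerVec, powerVec, hz, div_pow, mul_pow]
      push_cast
      field_simp
    rw [e, hlog]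
    have h1 := abs_log_one_add_sub_le hz0 hz1 k
    calc _ = |t| * |Real.log (1 + z) - ∑ j ∈ range k, (-1) ^ j * z ^ (j + 1) / (j + 1)| := by
          rw [← abs_neg t, ← abs_mul]; congr 1; ring
      _ ≤ |t| * (2 * z ^ (k + 1)) := by gcongr
      _ ≤ |t| * (2 * ((P : ℝ) ^ 2 / n) ^ (k + 1)) := by gcongr
      _ = _ := by ring
  have hdiff : ‖(∑ x ∈ Icc 1 P, ∑ y ∈ Icc 1 P,
      Complex.exp (((-t * Real.log ((n + x * y : ℕ) : ℝ) : ℝ) : ℂ) * Complex.I)) - c * V‖ ≤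
      (P : ℝ) ^ 2 * (2 * |t| * ((P : ℝ) ^ 2 / n) ^ (k + 1)) := by
    rw [hV, mul_sum, ← sum_sub_distrib]
    calc _ ≤ ∑ x ∈ Icc 1 P, ∑ y ∈ Icc 1 P, 2 * |t| * ((P : ℝ) ^ 2 / n) ^ (k + 1) := by
          refine (norm_sum_le _ _).trans (sum_le_sum fun x hx => ?_)
          rw [mul_sum, ← sum_sub_distrib]
          exact (norm_sum_le _ _).trans (sum_le_sum fun y hy => key x hx y hy)
      _ = _ := by simp; ring
  have h3 := norm_le_norm_add_norm_sub' (∑ x ∈ Icc 1 P, ∑ y ∈ Icc 1 P,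
      Complex.exp (((-t * Real.log ((n + x * y : ℕ) : ℝ) : ℝ) : ℂ) * Complex.I)) (c * V)
  rw [norm_mul, hcn, one_mul] at h3
  linarith

theorem combine_bound_le {i k : ℕ} (hk : k = 3 * i + 12) :
    6 * (k : ℝ) ^ 3 * 2 ^ i + 8 * (i * 2 ^ i * ((4 * i + 2) * 5) * 4 ^ i) ≤
      (2 * k : ℝ) ^ (k ^ 5) := by
  have hk12 : 12 ≤ k := by omega
  have hk' : (12 : ℝ) ≤ k := by exact_mod_cast hk12
  have hik : (i : ℝ) ≤ k := by exact_mod_cast (by omega : i ≤ k)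
  have e8 : (8 : ℝ) ^ i ≤ (2 * k : ℝ) ^ k := by
    calc (8 : ℝ) ^ i = 2 ^ (3 * i) := by rw [pow_mul]; norm_num
      _ ≤ 2 ^ k := pow_le_pow_right₀ (by norm_num) (by omega)
      _ ≤ _ := by gcongr; linarith
  have e2 : (2 : ℝ) ^ i ≤ 8 ^ i := by gcongr; norm_num
  calc _ = 6 * (k : ℝ) ^ 3 * 2 ^ i + 40 * i * (4 * i + 2) * (2 * 4) ^ i := by
        rw [mul_pow]; ring
    _ = 6 * (k : ℝ) ^ 3 * 2 ^ i + 40 * i * (4 * i + 2) * 8 ^ i := by norm_num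
    _ ≤ 6 * (k : ℝ) ^ 3 * 8 ^ i + 40 * k * (4 * k + 2) * 8 ^ i := by gcongr
    _ = (6 * (k : ℝ) ^ 3 + 160 * k ^ 2 + 80 * k) * 8 ^ i := by ring
    _ ≤ (2 * k) ^ 4 * (2 * k) ^ k := by
        gcongr
        have h3 : (0 : ℝ) ≤ k ^ 2 := by positivity
        have h4 : 12 * (k : ℝ) ^ 2 ≤ k ^ 3 := by nlinarith
        have h5 : 12 * (k : ℝ) ^ 3 ≤ k ^ 4 := by
          calc 12 * (k : ℝ) ^ 3 ≤ k * k ^ 3 := by gcongr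
            _ = _ := by ring
        nlinarith
    _ = (2 * k : ℝ) ^ (4 + k) := by rw [pow_add]
    _ ≤ _ := by
        apply pow_le_pow_right₀ (by linarith)
        have : k ^ 2 ≤ k ^ 5 := Nat.pow_le_pow_right (by omega) (by norm_num)
        nlinarith


theorem two_mul_pow_le_eight_pow {k : ℕ} (hk : 3 ≤ k) :
    (2 * k : ℝ) ^ (37 * k ^ 5) ≤ 8 ^ (16 * k ^ 6) := by
  have e1 : (2 * k : ℝ) ≤ 2 ^ k := by
    have : ∀ m : ℕ, 2 * (m + 3) ≤ 2 ^ (m + 3) := by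
      intro m
      induction m with
      | zero => norm_num
      | succ m ih => rw [show m + 1 + 3 = m + 3 + 1 by ring, pow_succ]; omega
    have := this (k - 3)
    rw [Nat.sub_add_cancel (by omega)] at this
    exact_mod_cast this
  calc (2 * k : ℝ) ^ (37 * k ^ 5) ≤ (2 ^ k) ^ (37 * k ^ 5) := by gcongr
    _ = 2 ^ (37 * k ^ 6) := by rw [← pow_mul]; ring_nf
    _ ≤ 2 ^ (3 * (16 * k ^ 6)) := pow_le_pow_right₀ (by norm_num) (by omega)
    _ = _ := by rw [pow_mul]; norm_num

set_option maxHeartbeats 1000000 in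
theorem norm_phase_sum_le {i k P n : ℕ} {t q : ℝ} (hi : 2 ≤ i) (hk : k = 3 * i + 12)
    (hq : 2 * (k : ℝ) ^ 3 ≤ q ^ 2) (hq0 : 0 ≤ q) (hP1 : (P : ℝ) ≤ q ^ 4) (hP2 : q ^ 4 / 2 ≤ P)
    (hn1 : q ^ 10 ≤ n) (hn2 : (n : ℝ) ≤ 2 * q ^ 10) (ht1 : q ^ (5 * (i - 1)) ≤ |t|)
    (ht2 : |t| ≤ q ^ (5 * i)) :
    ‖∑ x ∈ Icc (1 : ℤ) P, ∑ y ∈ Icc (1 : ℤ) P,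
      phaseChar (fun j => taylorCoeff k t n j * powerVec k x j) (powerVec k y)‖ ≤
      8 * (P : ℝ) ^ 2 * q ^ (-(9 / (200 * k ^ 6)) : ℝ) := by
  have hk18 : 18 ≤ k := by omega
  have hk' : (18 : ℝ) ≤ k := by exact_mod_cast hk18
  have hk3 : (5832 : ℝ) ≤ (k : ℝ) ^ 3 := by
    calc (5832 : ℝ) = 18 ^ 3 := by norm_num
      _ ≤ _ := by gcongr
  have hq1 : 1 ≤ q := by nlinarith
  have hqpos : 0 < q := by linarith
  have hP1' : 1 ≤ P := by
    have : 0 < (P : ℝ) := lt_of_lt_of_le (by positivity) hP2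
    exact_mod_cast this
  have hP0 : (0 : ℝ) < P := by exact_mod_cast hP1'
  have hn0 : (0 : ℝ) < n := lt_of_lt_of_le (by positivity) hn1
  have ht0 : 0 < |t| := lt_of_lt_of_le (by positivity) ht1
  set j : Fin k := ⟨i - 1, by omega⟩ with hj
  have hj1 : j.1 + 1 = i := by rw [hj]; simp only; omega
  have hβ : |taylorCoeff k t n j| = |t| / (i * (n : ℝ) ^ i) := by
    have e : ((j.1 : ℝ) + 1) = i := by rw [← hj1]; push_cast; rfl
    rw [taylorCoeff, hj1, e, abs_mul, abs_neg, abs_div, abs_pow, abs_neg, abs_one, one_pow,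
      abs_of_nonneg (by positivity : (0 : ℝ) ≤ i * (n : ℝ) ^ i)]
    ring
  have hi' : (2 : ℝ) ≤ i := by exact_mod_cast hi
  have hβ0 : 0 < |taylorCoeff k t n j| := by rw [hβ]; positivity
  have hk3' : (0 : ℝ) < (k : ℝ) ^ 3 := by positivity
  have hsmall : |taylorCoeff k t n j| * (2 * k ^ 3 * P ^ (j.1 + 1)) ≤ Real.pi := by
    rw [hj1, hβ]
    have h1 : |t| * (2 * k ^ 3 * (P : ℝ) ^ i) ≤ (i * (n : ℝ) ^ i) * 1 := by
      calc |t| * (2 * k ^ 3 * (P : ℝ) ^ i) ≤ q ^ (5 * i) * (q ^ 2 * (q ^ 4) ^ i) := by gcongr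
        _ = q ^ (9 * i + 2) := by rw [← pow_mul, ← pow_add, ← pow_add]; ring_nf
        _ ≤ q ^ (10 * i) := pow_le_pow_right₀ hq1 (by omega)
        _ = (q ^ 10) ^ i := by rw [← pow_mul]
        _ ≤ (n : ℝ) ^ i := by gcongr
        _ ≤ (i * (n : ℝ) ^ i) * 1 := by
          rw [mul_one]; exact le_mul_of_one_le_left (by positivity) (by linarith)
    calc _ = |t| * (2 * k ^ 3 * (P : ℝ) ^ i) / (i * (n : ℝ) ^ i) := by ring
      _ ≤ 1 := by rw [div_le_iff₀ (by positivity)]; linarith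
      _ ≤ _ := by linarith [Real.pi_gt_three]
  have hmain := norm_bilinear_sum_pow_le_of_small (by omega) hP1' (taylorCoeff k t n) j
    (abs_pos.1 hβ0) hsmall
  rw [hj1] at hmain
  set V := ‖∑ x ∈ Icc (1 : ℤ) P, ∑ y ∈ Icc (1 : ℤ) P,
      phaseChar (fun j => taylorCoeff k t n j * powerVec k x j) (powerVec k y)‖ with hV
  have hV0 : 0 ≤ V := norm_nonneg _
  -- estimate of the logarithm
  have hlog : 1 + Real.log (2 * k ^ 3 * P ^ i) ≤ (4 * i + 2) * (5 * q ^ (1 / 5 : ℝ)) := by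
    have h1 : Real.log (2 * k ^ 3 * P ^ i) ≤ (4 * i + 2) * Real.log q := by
      calc _ ≤ Real.log (q ^ (4 * i + 2)) := by
            apply Real.log_le_log (by positivity)
            calc 2 * (k : ℝ) ^ 3 * P ^ i ≤ q ^ 2 * (q ^ 4) ^ i := by gcongr
              _ = _ := by rw [← pow_mul, ← pow_add, add_comm]
        _ = _ := by rw [Real.log_pow]; push_cast; ring
    have h2 : Real.log q ≤ 5 * q ^ (1 / 5 : ℝ) - 5 := by
      have := Real.log_le_sub_one_of_pos (x := q ^ (1 / 5 : ℝ)) (by positivity)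
      rw [Real.log_rpow hqpos] at this
      linarith
    have h3 : 0 ≤ q ^ (1 / 5 : ℝ) := by positivity
    nlinarith
  have hA : 6 * (k : ℝ) ^ 3 * P ^ i / (P : ℝ) ^ (2 * i) ≤ 6 * k ^ 3 * 2 ^ i * q ^ (-(4 / 5) : ℝ) := by
    have e1 : 6 * (k : ℝ) ^ 3 * P ^ i / (P : ℝ) ^ (2 * i) = 6 * k ^ 3 * ((P : ℝ) ^ i)⁻¹ := by
      rw [two_mul, pow_add]; field_simp
    have e2 : ((P : ℝ) ^ i)⁻¹ ≤ 2 ^ i * q ^ (-(4 / 5) : ℝ) := by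
      calc ((P : ℝ) ^ i)⁻¹ ≤ ((q ^ 4 / 2) ^ i)⁻¹ := by gcongr
        _ = 2 ^ i * q ^ (-(4 * i : ℝ)) := by
            rw [Real.rpow_neg hq0, show (4 * i : ℝ) = ((4 * i : ℕ) : ℝ) by push_cast; rfl,
              Real.rpow_natCast, div_pow, ← pow_mul, inv_div, div_eq_mul_inv]
        _ ≤ _ := by
            gcongr 2 ^ i * ?_
            apply Real.rpow_le_rpow_of_exponent_le hq1
            linarith
    rw [e1]
    calc 6 * (k : ℝ) ^ 3 * ((P : ℝ) ^ i)⁻¹ ≤ 6 * k ^ 3 * (2 ^ i * q ^ (-(4 / 5) : ℝ)) := by gcongr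
      _ = _ := by ring
  have hl0 : 0 ≤ 1 + Real.log (2 * k ^ 3 * P ^ i) := by
    have : (1 : ℝ) ≤ 2 * k ^ 3 * P ^ i :=
      one_le_mul_of_one_le_of_one_le (by linarith) (one_le_pow₀ (by exact_mod_cast hP1'))
    have := Real.log_nonneg this
    linarith
  have hB : 2 * Real.pi / |taylorCoeff k t n j| * (1 + Real.log (2 * k ^ 3 * P ^ i)) /
      (P : ℝ) ^ (2 * i) ≤ 8 * (i * 2 ^ i * ((4 * i + 2) * 5) * 4 ^ i) * q ^ (-(4 / 5) : ℝ) := by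
    have e1 : |taylorCoeff k t n j|⁻¹ ≤ i * 2 ^ i * q ^ (5 * i + 5 : ℝ) := by
      rw [hβ, inv_div]
      rw [div_le_iff₀ ht0]
      have e2 : q ^ (10 * i) ≤ q ^ (5 * i + 5 : ℝ) * |t| := by
        calc q ^ (10 * i) = q ^ (5 * i + 5) * q ^ (5 * (i - 1)) := by
              rw [← pow_add]; congr 1; omega
          _ ≤ q ^ (5 * i + 5) * |t| := by gcongr
          _ = _ := by
            rw [← Real.rpow_natCast]; push_cast; rfl
      calc (i : ℝ) * (n : ℝ) ^ i ≤ i * (2 * q ^ 10) ^ i := by gcongr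
        _ = i * 2 ^ i * q ^ (10 * i) := by rw [mul_pow, ← pow_mul]; ring
        _ ≤ i * 2 ^ i * (q ^ (5 * i + 5 : ℝ) * |t|) := by gcongr
        _ = _ := by ring
    have e3 : ((P : ℝ) ^ (2 * i))⁻¹ ≤ 4 ^ i * q ^ (-(8 * i) : ℝ) := by
      calc ((P : ℝ) ^ (2 * i))⁻¹ ≤ ((q ^ 4 / 2) ^ (2 * i))⁻¹ := by gcongr
        _ = 4 ^ i * q ^ (-(8 * i) : ℝ) := by
            rw [Real.rpow_neg hq0, show (8 * i : ℝ) = ((8 * i : ℕ) : ℝ) by push_cast; rfl,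
              Real.rpow_natCast, div_pow, ← pow_mul, inv_div, div_eq_mul_inv, pow_mul 2 2 i]
            norm_num
            ring_nf
    have hpi : 2 * Real.pi ≤ 8 := by linarith [Real.pi_lt_four]
    calc _ = 2 * Real.pi * |taylorCoeff k t n j|⁻¹ * (1 + Real.log (2 * k ^ 3 * P ^ i)) *
          ((P : ℝ) ^ (2 * i))⁻¹ := by ring
      _ ≤ 8 * (i * 2 ^ i * q ^ (5 * i + 5 : ℝ)) * ((4 * i + 2) * (5 * q ^ (1 / 5 : ℝ))) *
          (4 ^ i * q ^ (-(8 * i) : ℝ)) := by gcongr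
      _ = 8 * (i * 2 ^ i * ((4 * i + 2) * 5) * 4 ^ i) *
          (q ^ (5 * i + 5 : ℝ) * q ^ (1 / 5 : ℝ) * q ^ (-(8 * i) : ℝ)) := by ring
      _ ≤ _ := by
          rw [← Real.rpow_add hqpos, ← Real.rpow_add hqpos]
          gcongr 8 * (i * 2 ^ i * ((4 * i + 2) * 5) * 4 ^ i) * ?_
          apply Real.rpow_le_rpow_of_exponent_le hq1
          linarith
  have hPq : (P : ℝ) ^ (1 / 50 : ℝ) ≤ q ^ (2 / 25 : ℝ) := by
    calc (P : ℝ) ^ (1 / 50 : ℝ) ≤ (q ^ 4) ^ (1 / 50 : ℝ) := by gcongr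
      _ = _ := by rw [← Real.rpow_natCast, ← Real.rpow_mul hq0]; norm_num
  have hcomb := combine_bound_le (i := i) hk
  have hpow : V ^ (16 * k ^ 6) ≤
      (8 * (P : ℝ) ^ 2 * q ^ (-(9 / (200 * k ^ 6)) : ℝ)) ^ (16 * k ^ 6) := by
    have hk6 : (0 : ℝ) < (k : ℝ) ^ 6 := by positivity
    have hexp : (q ^ (-(9 / (200 * k ^ 6)) : ℝ)) ^ (16 * k ^ 6) = q ^ (-(18 / 25) : ℝ) := by
      rw [← Real.rpow_natCast, ← Real.rpow_mul hq0]
      congr 1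
      push_cast
      field_simp
      norm_num
    have h8 := two_mul_pow_le_eight_pow (k := k) (by omega)
    calc V ^ (16 * k ^ 6) ≤ _ := hmain
      _ ≤ (2 * k : ℝ) ^ (36 * k ^ 5) * (P : ℝ) ^ (32 * k ^ 6) * q ^ (2 / 25 : ℝ) *
          ((2 * k : ℝ) ^ (k ^ 5) * q ^ (-(4 / 5) : ℝ)) := by
          rw [add_div]
          have hAB := add_le_add hA hB
          rw [← add_mul] at hAB
          have hAB' := hAB.trans (mul_le_mul_of_nonneg_right hcomb
            (by positivity : 0 ≤ q ^ (-(4 / 5) : ℝ)))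
          refine mul_le_mul (mul_le_mul_of_nonneg_left hPq (by positivity)) hAB' ?_ (by positivity)
          have := hβ0.le
          have := Real.pi_pos.le
          positivity
      _ = (2 * k : ℝ) ^ (37 * k ^ 5) * (P : ℝ) ^ (32 * k ^ 6) *
          (q ^ (2 / 25 : ℝ) * q ^ (-(4 / 5) : ℝ)) := by
          rw [show 37 * k ^ 5 = 36 * k ^ 5 + k ^ 5 by ring, pow_add]; ring
      _ ≤ 8 ^ (16 * k ^ 6) * (P : ℝ) ^ (32 * k ^ 6) * q ^ (-(18 / 25) : ℝ) := by
          rw [← Real.rpow_add hqpos]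
          norm_num at h8 ⊢
          gcongr
      _ = _ := by
          rw [mul_pow, mul_pow, hexp, ← pow_mul]
          ring_nf
  exact le_of_pow_le_pow_left₀ (by positivity) (by positivity) hpow

theorem norm_zeta_sum_le_aux {i k P N N' : ℕ} {t q : ℝ} (hi : 2 ≤ i) (hk : k = 3 * i + 12)
    (hq : 2 * (k : ℝ) ^ 3 ≤ q ^ 2) (hq0 : 0 ≤ q) (hP1 : (P : ℝ) ≤ q ^ 4) (hP2 : q ^ 4 / 2 ≤ P)
    (hN : (N : ℝ) = q ^ 10) (hN1 : N ≤ N') (hN2 : N' ≤ 2 * N)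
    (ht1 : q ^ (5 * (i - 1)) ≤ |t|) (ht2 : |t| ≤ q ^ (5 * i)) :
    ‖∑ n ∈ Ioc N N', Complex.exp (((-t * Real.log (n : ℝ) : ℝ) : ℂ) * Complex.I)‖ ≤
      12 * (N * q ^ (-(9 / (200 * k ^ 6)) : ℝ)) := by
  have hk18 : 18 ≤ k := by omega
  have hk' : (18 : ℝ) ≤ k := by exact_mod_cast hk18
  have hk3 : (5832 : ℝ) ≤ (k : ℝ) ^ 3 := by
    calc (5832 : ℝ) = 18 ^ 3 := by norm_num
      _ ≤ _ := by gcongr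
  have hq1 : 1 ≤ q := by nlinarith
  have hqpos : 0 < q := by linarith
  have hP1' : 1 ≤ P := by
    have : 0 < (P : ℝ) := lt_of_lt_of_le (by positivity) hP2
    exact_mod_cast this
  have hP0 : (0 : ℝ) < P := by exact_mod_cast hP1'
  have hN0 : (0 : ℝ) < N := by rw [hN]; positivity
  have hk6 : (1 : ℝ) ≤ (k : ℝ) ^ 6 := one_le_pow₀ (by linarith)
  set Q := q ^ (-(9 / (200 * k ^ 6)) : ℝ) with hQ
  have hQ0 : 0 < Q := by positivity
  have hqQ : q⁻¹ ≤ Q := by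
    rw [hQ, ← Real.rpow_neg_one]
    apply Real.rpow_le_rpow_of_exponent_le hq1
    have : 9 / (200 * (k : ℝ) ^ 6) ≤ 1 := by
      rw [div_le_one (by positivity)]; linarith
    linarith
  have hPsq : (P : ℝ) ^ 2 ≤ N * q⁻¹ ^ 2 := by
    calc (P : ℝ) ^ 2 ≤ (q ^ 4) ^ 2 := by gcongr
      _ = _ := by rw [hN]; field_simp
  have hq2 : q⁻¹ ^ 2 ≤ q⁻¹ := by
    have : q⁻¹ ≤ 1 := inv_le_one_of_one_le₀ hq1
    have h0 : 0 ≤ q⁻¹ := by positivity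
    nlinarith
  set f : ℕ → ℂ := fun n => Complex.exp (((-t * Real.log (n : ℝ) : ℝ) : ℂ) * Complex.I) with hf
  have hf1 : ∀ n, ‖f n‖ ≤ 1 := fun n => (Complex.norm_exp_ofReal_mul_I _).le
  have hinner : ∀ n ∈ Ioc N N', ‖∑ x ∈ Icc 1 P, ∑ y ∈ Icc 1 P, f (n + x * y)‖ ≤
      10 * P ^ 2 * Q := by
    intro n hn
    rw [mem_Ioc] at hn
    have hn1 : (N : ℝ) ≤ n := by exact_mod_cast hn.1.le
    have hn2 : (n : ℝ) ≤ 2 * N := by exact_mod_cast hn.2.trans hN2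
    have hnP : 2 * P ^ 2 ≤ n := by
      have : 2 * (P : ℝ) ^ 2 ≤ (n : ℝ) := by
        calc 2 * (P : ℝ) ^ 2 ≤ q ^ 2 * (q ^ 4) ^ 2 := by gcongr; linarith
          _ = (N : ℝ) := by rw [hN]; ring
          _ ≤ n := hn1
      exact_mod_cast this
    have h1 := norm_sum_exp_log_add_mul_le k P n t hnP hP1'
    have h2 := norm_phase_sum_le (t := t) hi hk hq hq0 hP1 hP2 (hN ▸ hn1) (hN ▸ hn2) ht1 ht2
    have h3 : |t| * ((P : ℝ) ^ 2 / n) ^ (k + 1) ≤ Q := by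
      have e1 : (P : ℝ) ^ 2 / n ≤ q⁻¹ ^ 2 := by
        rw [div_le_iff₀ (by linarith)]
        calc (P : ℝ) ^ 2 ≤ N * q⁻¹ ^ 2 := hPsq
          _ ≤ n * q⁻¹ ^ 2 := by gcongr
          _ = _ := by ring
      calc |t| * ((P : ℝ) ^ 2 / n) ^ (k + 1) ≤ q ^ (5 * i) * (q⁻¹ ^ 2) ^ (k + 1) := by gcongr
        _ = q ^ (5 * i) * (q ^ (2 * (k + 1)))⁻¹ := by rw [← pow_mul, inv_pow]
        _ ≤ q ^ (5 * i) * (q ^ (5 * i + 1))⁻¹ := by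
            gcongr ?_ * (?_)⁻¹
            exact pow_le_pow_right₀ hq1 (by omega)
        _ = q⁻¹ := by rw [pow_succ]; field_simp
        _ ≤ Q := hqQ
    refine h1.trans ?_
    calc _ ≤ 8 * (P : ℝ) ^ 2 * Q + P ^ 2 * (2 * Q) := by
          apply add_le_add h2
          gcongr ?_ * ?_
          rw [mul_assoc]
          gcongr
      _ = _ := by ring
  have hshift : ‖∑ x ∈ Icc 1 P, ∑ y ∈ Icc 1 P, (∑ n ∈ Ioc N N', f n -
      ∑ n ∈ Ioc N N', f (n + x * y))‖ ≤ P ^ 2 * (2 * P ^ 2) := by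
    calc _ ≤ ∑ x ∈ Icc 1 P, ∑ y ∈ Icc 1 P, (2 * (P : ℝ) ^ 2) := by
          refine norm_sum_le_of_le _ fun x hx => norm_sum_le_of_le _ fun y hy => ?_
          refine (norm_sum_Ioc_sub_shift_le f hf1 hN1 (x * y)).trans ?_
          rw [mem_Icc] at hx hy
          have : x * y ≤ P * P := Nat.mul_le_mul hx.2 hy.2
          have : ((x * y : ℕ) : ℝ) ≤ P * P := by exact_mod_cast this
          nlinarith
      _ = _ := by simp [sum_const]; ring
  have hmain : (P : ℂ) ^ 2 * ∑ n ∈ Ioc N N', f n = (∑ x ∈ Icc 1 P, ∑ y ∈ Icc 1 P,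
      (∑ n ∈ Ioc N N', f n - ∑ n ∈ Ioc N N', f (n + x * y))) +
      ∑ n ∈ Ioc N N', ∑ x ∈ Icc 1 P, ∑ y ∈ Icc 1 P, f (n + x * y) := by
    have : ∑ n ∈ Ioc N N', ∑ x ∈ Icc 1 P, ∑ y ∈ Icc 1 P, f (n + x * y) =
        ∑ x ∈ Icc 1 P, ∑ y ∈ Icc 1 P, ∑ n ∈ Ioc N N', f (n + x * y) := by
      rw [sum_comm]
      exact sum_congr rfl fun x _ => sum_comm
    rw [this]
    simp_rw [sum_sub_distrib]
    rw [sub_add_cancel]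
    simp [sum_const]
    ring
  have hfin : (P : ℝ) ^ 2 * ‖∑ n ∈ Ioc N N', f n‖ ≤ P ^ 2 * (12 * (N * Q)) := by
    have e : (P : ℝ) ^ 2 * ‖∑ n ∈ Ioc N N', f n‖ = ‖(P : ℂ) ^ 2 * ∑ n ∈ Ioc N N', f n‖ := by
      simp
    rw [e, hmain]
    refine (norm_add_le _ _).trans ?_
    have h2 : ‖∑ n ∈ Ioc N N', ∑ x ∈ Icc 1 P, ∑ y ∈ Icc 1 P, f (n + x * y)‖ ≤
        N * (10 * P ^ 2 * Q) := by
      refine (norm_sum_le_of_le _ hinner).trans ?_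
      rw [sum_const, Nat.card_Ioc, nsmul_eq_mul]
      gcongr
      omega
    have h3 : (P : ℝ) ^ 2 ≤ N * Q := hPsq.trans (by gcongr; exact hq2.trans hqQ)
    have h4 : (P : ℝ) ^ 2 * (2 * P ^ 2) ≤ P ^ 2 * (2 * (N * Q)) := by gcongr
    linarith
  exact le_of_mul_le_mul_left hfin (by positivity)

theorem norm_zeta_sum_le {i N N' : ℕ} {t : ℝ} (hi : 2 ≤ i)
    (hN : (2 * (3 * i + 12 : ℝ) ^ 3) ^ 5 ≤ N) (h1 : (N : ℝ) ^ (i - 1) ≤ t ^ 2)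
    (h2 : t ^ 2 ≤ (N : ℝ) ^ i) (hN1 : N ≤ N') (hN2 : N' ≤ 2 * N) :
    ‖∑ n ∈ Ioc N N', Complex.exp (((-t * Real.log (n : ℝ) : ℝ) : ℂ) * Complex.I)‖ ≤
      12 * (N : ℝ) ^ (1 - 1 / (240 * (3 * i + 12) ^ 6) : ℝ) := by
  have hN0 : (0 : ℝ) < N := lt_of_lt_of_le (by positivity) hN
  have hN1' : (1 : ℝ) ≤ N := by exact_mod_cast hN0
  set q := (N : ℝ) ^ (1 / 10 : ℝ) with hq
  have hq0 : 0 < q := by positivity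
  have hq1 : 1 ≤ q := Real.one_le_rpow hN1' (by norm_num)
  have hq10 : (N : ℝ) = q ^ 10 := by
    rw [hq, ← Real.rpow_natCast, ← Real.rpow_mul hN0.le]; norm_num
  have hfl := Nat.floor_le (by positivity : 0 ≤ q ^ 4)
  have hfl2 := Nat.lt_floor_add_one (q ^ 4)
  have hfl1 : (1 : ℝ) ≤ ⌊q ^ 4⌋₊ := by
    exact_mod_cast Nat.le_floor (by simpa using one_le_pow₀ hq1)
  have h := norm_zeta_sum_le_aux (q := q) (t := t) hi rfl ?_ hq0.le hfl (by linarith) hq10 hN1 hN2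
    ?_ ?_
  · refine h.trans ?_
    have hk6 : (0 : ℝ) < (3 * i + 12 : ℝ) ^ 6 := by positivity
    rw [hq, ← Real.rpow_mul hN0.le]
    nth_rw 1 [← Real.rpow_one (N : ℝ)]
    rw [← Real.rpow_add hN0]
    gcongr 12 * ?_
    apply Real.rpow_le_rpow_of_exponent_le hN1'
    push_cast
    rw [← sub_nonneg]
    have : (1 - 1 / (240 * (3 * i + 12 : ℝ) ^ 6)) -
      (1 + 1 / 10 * -(9 / (200 * (3 * i + 12 : ℝ) ^ 6))) =
        (1 / 3000) / (3 * i + 12 : ℝ) ^ 6 := by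
      field_simp; ring
    rw [this]
    positivity
  · push_cast
    rw [hq10] at hN
    have : (2 * (3 * i + 12 : ℝ) ^ 3) ^ 5 ≤ (q ^ 2) ^ 5 := by rw [← pow_mul]; exact hN
    exact le_of_pow_le_pow_left₀ (by norm_num) (by positivity) this
  · apply le_of_pow_le_pow_left₀ two_ne_zero (abs_nonneg _)
    rw [sq_abs, ← pow_mul]
    rw [hq10, ← pow_mul] at h1
    rwa [show 5 * (i - 1) * 2 = 10 * (i - 1) by ring]
  · apply le_of_pow_le_pow_left₀ two_ne_zero (by positivity)
    rw [sq_abs, ← pow_mul]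
    rw [hq10, ← pow_mul] at h2
    rwa [show 5 * i * 2 = 10 * i by ring]

noncomputable def zetaRem (n : ℕ) (s : ℂ) : ℂ :=
  (s - 1) * ((n : ℂ) + 1) ^ (-s) - (n : ℂ) ^ (1 - s) + ((n : ℂ) + 1) ^ (1 - s)

theorem norm_zetaRem_le {n : ℕ} (hn : 1 ≤ n) {s : ℂ} (hs : 0 < s.re) :
    ‖zetaRem n s‖ ≤ ‖s - 1‖ * ‖s‖ * (n : ℝ) ^ (-s.re - 1) := by
  have hn' : (1 : ℝ) ≤ n := by exact_mod_cast hn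
  have hn0 : (0 : ℝ) < n := by linarith
  have hder : ∀ (c : ℂ) (x : ℝ), 0 < x →
      HasDerivAt (fun y : ℝ => (y : ℂ) ^ c) (c * (x : ℂ) ^ (c - 1)) x := by
    intro c x hx
    have h := (hasDerivAt_id (x : ℂ)).cpow_const (c := c) (Or.inl (by simpa using hx))
    simpa using h.comp_ofReal
  have hbd : ∀ x ∈ Set.Icc (n : ℝ) (n + 1), ∀ y ∈ Set.Icc (n : ℝ) (n + 1),
      ‖((y : ℂ)) ^ (-s) - (x : ℂ) ^ (-s)‖ ≤ ‖s‖ * (n : ℝ) ^ (-s.re - 1) * ‖y - x‖ := by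
    intro x hx y hy
    refine (convex_Icc (n : ℝ) (n + 1)).norm_image_sub_le_of_norm_hasDerivWithin_le
      (f := fun y : ℝ => (y : ℂ) ^ (-s))
      (f' := fun x : ℝ => -s * (x : ℂ) ^ (-s - 1))
      (fun z hz => (hder _ z (by linarith [hz.1])).hasDerivWithinAt) ?_ hx hy
    intro z hz
    have hz0 : 0 < z := by linarith [hz.1]
    rw [norm_mul, norm_neg, Complex.norm_cpow_eq_rpow_re_of_pos hz0]
    gcongr
    simp only [Complex.sub_re, Complex.neg_re, Complex.one_re]
    exact Real.rpow_le_rpow_of_nonpos hn0 hz.1 (by linarith)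
  have hg : ‖(fun y : ℝ => (s - 1) * (y * ((n : ℂ) + 1) ^ (-s)) + (y : ℂ) ^ (1 - s)) (n + 1) -
      (fun y : ℝ => (s - 1) * (y * ((n : ℂ) + 1) ^ (-s)) + (y : ℂ) ^ (1 - s)) n‖ ≤
      ‖s - 1‖ * ‖s‖ * (n : ℝ) ^ (-s.re - 1) * ‖((n : ℝ) + 1) - n‖ := by
    refine (convex_Icc (n : ℝ) (n + 1)).norm_image_sub_le_of_norm_hasDerivWithin_le
      (f' := fun x : ℝ => (s - 1) * (1 * ((n : ℂ) + 1) ^ (-s)) + (1 - s) * (x : ℂ) ^ (1 - s - 1))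
      (f := fun y : ℝ => (s - 1) * (y * ((n : ℂ) + 1) ^ (-s)) + (y : ℂ) ^ (1 - s))
      (x := (n : ℝ)) (y := (n : ℝ) + 1) (C := ‖s - 1‖ * ‖s‖ * (n : ℝ) ^ (-s.re - 1))
      (fun z hz => ?_) ?_ (by simp) (by simp)
    · refine HasDerivAt.hasDerivWithinAt (HasDerivAt.add ?_ (hder _ z (by linarith [hz.1])))
      exact (((hasDerivAt_id (z : ℂ)).comp_ofReal).mul_const _).const_mul _
    · intro z hz
      have h := hbd z hz (n + 1) (by simp)
      have e : (s - 1) * (1 * ((n : ℂ) + 1) ^ (-s)) + (1 - s) * (z : ℂ) ^ (1 - s - 1) =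
          (s - 1) * ((((n : ℝ) + 1 : ℝ) : ℂ) ^ (-s) - (z : ℂ) ^ (-s)) := by
        rw [show 1 - s - 1 = -s by ring]; push_cast; ring
      rw [e, norm_mul, mul_assoc]
      gcongr
      refine h.trans (mul_le_of_le_one_right (by positivity) ?_)
      rw [Real.norm_eq_abs, abs_of_nonneg (by linarith [hz.2])]
      linarith [hz.1]
  rw [add_sub_cancel_left, norm_one, mul_one] at hg
  refine le_trans (le_of_eq ?_) hg
  congr 1
  simp only [zetaRem]
  push_cast
  ring

theorem sum_zetaRem (M J : ℕ) (s : ℂ) :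
    ∑ j ∈ range J, zetaRem (M + j) s =
      (s - 1) * (∑ n ∈ range (M + J), ((n : ℂ) + 1) ^ (-s) - ∑ n ∈ range M, ((n : ℂ) + 1) ^ (-s)) -
        (M : ℂ) ^ (1 - s) + ((M + J : ℕ) : ℂ) ^ (1 - s) := by
  induction J with
  | zero => simp
  | succ J ih =>
    rw [sum_range_succ, ih, ← add_assoc, sum_range_succ, zetaRem]
    push_cast
    ring

theorem tendsto_natCast_cpow_neg {s : ℂ} (hs : 1 < s.re) :
    Filter.Tendsto (fun n : ℕ => (n : ℂ) ^ (1 - s)) Filter.atTop (nhds 0) := by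
  rw [tendsto_zero_iff_norm_tendsto_zero]
  have h : Filter.Tendsto (fun n : ℕ => (n : ℝ) ^ (-(s.re - 1))) Filter.atTop (nhds 0) :=
    (tendsto_rpow_neg_atTop (by linarith)).comp tendsto_natCast_atTop_atTop
  refine h.congr' ?_
  filter_upwards [Filter.eventually_ge_atTop 1] with n hn
  rw [Complex.norm_natCast_cpow_of_pos (by omega)]
  congr 1
  simp

theorem summable_zetaRem_bound (M : ℕ) {a : ℝ} (ha : 1 < a) :
    Summable (fun j : ℕ => ((M + j : ℕ) : ℝ) ^ (-a)) := by
  have := (summable_nat_add_iff M).2 (Real.summable_nat_rpow.2 (by linarith : -a < -1))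
  simpa only [add_comm M] using this

theorem riemannZeta₁_eq_of_one_lt {M : ℕ} (hM : 1 ≤ M) {s : ℂ} (hs : 1 < s.re) :
    riemannZeta₁ s = (s - 1) * ∑ n ∈ range M, ((n : ℂ) + 1) ^ (-s) + (M : ℂ) ^ (1 - s) +
      ∑' j : ℕ, zetaRem (M + j) s := by
  have hs1 : s ≠ 1 := by rintro rfl; simp at hs
  have hsum : Summable (fun j : ℕ => zetaRem (M + j) s) := by
    refine Summable.of_norm_bounded
      ((summable_zetaRem_bound M (a := s.re + 1) (by linarith)).mul_left (‖s - 1‖ * ‖s‖)) fun j => ?_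
    have := norm_zetaRem_le (n := M + j) (by omega) (s := s) (by linarith)
    rwa [show -s.re - 1 = -(s.re + 1) by ring] at this
  have h1 := hsum.hasSum.tendsto_sum_nat
  simp_rw [sum_zetaRem] at h1
  have hz : Summable (fun n : ℕ => ((n : ℂ) + 1) ^ (-s)) := by
    have := (summable_nat_add_iff 1).2 (Complex.summable_one_div_nat_cpow.2 hs)
    refine this.congr fun n => ?_
    push_cast
    rw [Complex.cpow_neg, one_div]
  have h2 := hz.hasSum.tendsto_sum_nat
  have h3 : ∑' n : ℕ, ((n : ℂ) + 1) ^ (-s) = riemannZeta s := by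
    rw [zeta_eq_tsum_one_div_nat_add_one_cpow hs]
    exact tsum_congr fun n => by rw [Complex.cpow_neg, one_div]
  rw [h3] at h2
  have h2' := h2.comp (Filter.tendsto_add_atTop_nat M)
  have h4 := (tendsto_natCast_cpow_neg hs).comp (Filter.tendsto_add_atTop_nat M)
  have h5 := (((h2'.sub_const (∑ n ∈ range M, ((n : ℂ) + 1) ^ (-s))).const_mul (s - 1)).sub_const
    ((M : ℂ) ^ (1 - s))).add h4
  have h6 := tendsto_nhds_unique h1 (h5.congr fun n => by
    simp only [Function.comp, add_comm n M])
  rw [h6, riemannZeta_eq_inv_sub_mul hs1]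
  have : s - 1 ≠ 0 := sub_ne_zero.2 hs1
  field_simp
  ring

theorem differentiable_zetaRem {n : ℕ} (hn : 1 ≤ n) : Differentiable ℂ (zetaRem n) := by
  have h1 : (n : ℂ) ≠ 0 := by exact_mod_cast (by omega : n ≠ 0)
  have h2 : (n : ℂ) + 1 ≠ 0 := by exact_mod_cast (by omega : n + 1 ≠ 0)
  intro s
  unfold zetaRem
  have e1 : DifferentiableAt ℂ (fun s : ℂ => ((n : ℂ) + 1) ^ (-s)) s :=
    DifferentiableAt.const_cpow (by fun_prop) (Or.inl h2)
  have e2 : DifferentiableAt ℂ (fun s : ℂ => ((n : ℂ)) ^ (1 - s)) s :=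
    DifferentiableAt.const_cpow (by fun_prop) (Or.inl h1)
  have e3 : DifferentiableAt ℂ (fun s : ℂ => ((n : ℂ) + 1) ^ (1 - s)) s :=
    DifferentiableAt.const_cpow (by fun_prop) (Or.inl h2)
  fun_prop

theorem riemannZeta₁_eq {M : ℕ} (hM : 1 ≤ M) {s : ℂ} (hs : 1 / 4 < s.re) :
    riemannZeta₁ s = (s - 1) * ∑ n ∈ range M, ((n : ℂ) + 1) ^ (-s) + (M : ℂ) ^ (1 - s) +
      ∑' j : ℕ, zetaRem (M + j) s := by
  set R := ‖s‖ + 3 with hR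
  set U : Set ℂ := {z | 1 / 4 < z.re} ∩ Metric.ball 0 R with hU
  have hUo : IsOpen U := (isOpen_lt continuous_const Complex.continuous_re).inter Metric.isOpen_ball
  have hUc : IsPreconnected U :=
    ((convex_halfSpace_re_gt _).inter (convex_ball _ _)).isPreconnected
  have hd : DifferentiableOn ℂ (fun s => ∑' j : ℕ, zetaRem (M + j) s) U := by
    refine Complex.differentiableOn_tsum_of_summable_norm
      ((summable_zetaRem_bound M (a := 5 / 4) (by norm_num)).mul_left ((R + 1) * R))
      (fun j => (differentiable_zetaRem (by omega)).differentiableOn) hUo ?_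
    rintro j w ⟨hw1, hw2⟩
    rw [Set.mem_ofPred_eq] at hw1
    rw [mem_ball_zero_iff] at hw2
    refine (norm_zetaRem_le (by omega) (by linarith)).trans ?_
    have h1 : ‖w - 1‖ ≤ R + 1 := (norm_sub_le _ _).trans (by rw [norm_one]; linarith)
    have h2 : (1 : ℝ) ≤ ((M + j : ℕ) : ℝ) := by exact_mod_cast (by omega : 1 ≤ M + j)
    have h3 : ((M + j : ℕ) : ℝ) ^ (-w.re - 1) ≤ ((M + j : ℕ) : ℝ) ^ (-(5 / 4) : ℝ) :=
      Real.rpow_le_rpow_of_exponent_le h2 (by linarith)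
    have : 0 ≤ R := by positivity
    gcongr
  have hd2 : DifferentiableOn ℂ (fun s => (s - 1) * ∑ n ∈ range M, ((n : ℂ) + 1) ^ (-s) +
      (M : ℂ) ^ (1 - s) + ∑' j : ℕ, zetaRem (M + j) s) U := by
    refine DifferentiableOn.add (Differentiable.differentiableOn fun z => ?_) hd
    have e1 : ∀ n : ℕ, DifferentiableAt ℂ (fun s : ℂ => ((n : ℂ) + 1) ^ (-s)) z := fun n =>
      DifferentiableAt.const_cpow (by fun_prop) (Or.inl (by exact_mod_cast (by omega : n + 1 ≠ 0)))
    have e2 : DifferentiableAt ℂ (fun s : ℂ => ((M : ℂ)) ^ (1 - s)) z :=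
      DifferentiableAt.const_cpow (by fun_prop) (Or.inl (by exact_mod_cast (by omega : M ≠ 0)))
    have e3 : DifferentiableAt ℂ (fun s : ℂ => ∑ n ∈ range M, ((n : ℂ) + 1) ^ (-s)) z :=
      DifferentiableAt.fun_sum fun n _ => e1 n
    fun_prop
  have hmem : (2 : ℂ) ∈ U := by
    refine ⟨by norm_num, ?_⟩
    rw [mem_ball_zero_iff, hR]
    norm_num
    linarith [norm_nonneg s]
  have h := (differentiable_riemannZeta₁.differentiableOn.analyticOnNhd hUo).eqOn_of_preconnected_of_eventuallyEq
    (hd2.analyticOnNhd hUo) hUc hmem ?_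
  · exact h ⟨hs, by rw [mem_ball_zero_iff, hR]; linarith⟩
  · have : {z : ℂ | 1 < z.re} ∈ nhds (2 : ℂ) :=
      (isOpen_lt continuous_const Complex.continuous_re).mem_nhds (by norm_num)
    filter_upwards [this] with z hz
    exact riemannZeta₁_eq_of_one_lt hM hz

theorem rpow_neg_three_halves_le {n : ℕ} (hn : 1 ≤ n) :
    (n : ℝ) ^ (-(3 / 2) : ℝ) ≤ 4 * ((√n)⁻¹ - (√(n + 1))⁻¹) := by
  have hn0 : (1 : ℝ) ≤ n := by exact_mod_cast hn
  set a := √(n : ℝ) with ha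
  set b := √((n : ℝ) + 1) with hb
  have ha2 : a ^ 2 = n := Real.sq_sqrt (by linarith)
  have hb2 : b ^ 2 = n + 1 := Real.sq_sqrt (by linarith)
  have ha0 : 0 < a := Real.sqrt_pos.2 (by linarith)
  have hb0 : 0 < b := Real.sqrt_pos.2 (by linarith)
  have hba : b ≤ 3 / 2 * a := by
    apply le_of_pow_le_pow_left₀ two_ne_zero (by positivity)
    rw [mul_pow, ha2, hb2]; linarith
  have e : (n : ℝ) ^ (-(3 / 2) : ℝ) = (a ^ 3)⁻¹ := by
    rw [ha, Real.sqrt_eq_rpow, ← Real.rpow_natCast, ← Real.rpow_mul (by linarith),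
      Real.rpow_neg (by linarith)]
    norm_num
  rw [e]
  have e2 : a⁻¹ - b⁻¹ = 1 / (a * b * (a + b)) := by
    field_simp
    nlinarith
  rw [e2, ← one_div, mul_one_div, div_le_div_iff₀ (by positivity) (by positivity)]
  calc 1 * (a * b * (a + b)) ≤ 1 * (a * (3 / 2 * a) * (a + 3 / 2 * a)) := by gcongr
    _ = 15 / 4 * a ^ 3 := by ring
    _ ≤ 4 * a ^ 3 := by nlinarith [pow_pos ha0 3]

theorem norm_tsum_zetaRem_le {M : ℕ} (hM : 1 ≤ M) {s : ℂ} (hs : 1 / 2 ≤ s.re) :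
    ‖∑' j : ℕ, zetaRem (M + j) s‖ ≤ ‖s - 1‖ * ‖s‖ * (4 * (√M)⁻¹) := by
  have hterm : ∀ j : ℕ, ‖zetaRem (M + j) s‖ ≤
      ‖s - 1‖ * ‖s‖ * (4 * ((√((M + j : ℕ) : ℝ))⁻¹ - (√((M + j + 1 : ℕ) : ℝ))⁻¹)) := by
    intro j
    refine (norm_zetaRem_le (by omega) (by linarith)).trans ?_
    gcongr
    have h1 : (1 : ℝ) ≤ ((M + j : ℕ) : ℝ) := by exact_mod_cast (by omega : 1 ≤ M + j)
    refine (Real.rpow_le_rpow_of_exponent_le h1 (by linarith : -s.re - 1 ≤ -(3 / 2))).trans ?_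
    have := rpow_neg_three_halves_le (n := M + j) (by omega)
    push_cast at this ⊢
    exact this
  have hpart : ∀ J : ℕ, ∑ j ∈ range J, ‖zetaRem (M + j) s‖ ≤ ‖s - 1‖ * ‖s‖ * (4 * (√M)⁻¹) := by
    intro J
    refine (sum_le_sum fun j _ => hterm j).trans ?_
    rw [← mul_sum, ← mul_sum]
    gcongr
    have := sum_range_sub' (fun j : ℕ => (√((M + j : ℕ) : ℝ))⁻¹) J
    simp only [← add_assoc] at this
    rw [this]
    simp only [add_zero, sub_le_self_iff]
    positivity
  have hsum := summable_of_sum_range_le (fun j => norm_nonneg _) hpart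
  exact (norm_tsum_le_tsum_norm hsum).trans (hsum.tsum_le_of_sum_range_le hpart)

/-- Abel's inequality: summation by parts against a nonnegative antitone weight. -/
theorem norm_sum_Ioc_mul_le {f : ℕ → ℂ} {g : ℕ → ℝ} {a b : ℕ} {B : ℝ} (hab : a ≤ b)
    (hg : ∀ n, a ≤ n → g (n + 1) ≤ g n) (hg0 : 0 ≤ g b)
    (hB : ∀ m, a ≤ m → m ≤ b → ‖∑ n ∈ Ioc a m, f n‖ ≤ B) :
    ‖∑ n ∈ Ioc a b, (g n : ℂ) * f n‖ ≤ g a * B := by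
  have key : ∀ m, a ≤ m → m ≤ b →
      ‖∑ n ∈ Ioc a m, (g n : ℂ) * f n - g m * ∑ n ∈ Ioc a m, f n‖ ≤ (g a - g m) * B := by
    intro m hm
    induction m, hm using Nat.le_induction with
    | base => simp
    | succ m hm ih =>
      intro hmb
      rw [sum_Ioc_succ_top hm, sum_Ioc_succ_top hm]
      have e : ∑ n ∈ Ioc a m, (g n : ℂ) * f n + g (m + 1) * f (m + 1) -
          g (m + 1) * (∑ n ∈ Ioc a m, f n + f (m + 1)) =
          (∑ n ∈ Ioc a m, (g n : ℂ) * f n - g m * ∑ n ∈ Ioc a m, f n) +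
          ((g m - g (m + 1) : ℝ) : ℂ) * ∑ n ∈ Ioc a m, f n := by
        push_cast; ring
      rw [e]
      refine (norm_add_le _ _).trans ?_
      rw [norm_mul, Complex.norm_real, Real.norm_eq_abs,
        abs_of_nonneg (sub_nonneg.2 (hg m hm))]
      have h1 := ih (by omega)
      have h2 := mul_le_mul_of_nonneg_left (hB m hm (by omega)) (sub_nonneg.2 (hg m hm))
      linarith
  have h1 := key b hab le_rfl
  have h2 := hB b hab le_rfl
  have h3 : ‖(g b : ℂ) * ∑ n ∈ Ioc a b, f n‖ ≤ g b * B := by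
    rw [norm_mul, Complex.norm_real, Real.norm_eq_abs, abs_of_nonneg hg0]
    gcongr
  have h4 := norm_add_le (∑ n ∈ Ioc a b, (g n : ℂ) * f n - g b * ∑ n ∈ Ioc a b, f n)
    ((g b : ℂ) * ∑ n ∈ Ioc a b, f n)
  rw [sub_add_cancel] at h4
  linarith

theorem natCast_cpow_neg_eq {n : ℕ} (hn : 1 ≤ n) (s : ℂ) :
    (n : ℂ) ^ (-s) = (((n : ℝ) ^ (-s.re) : ℝ) : ℂ) *
      Complex.exp (((-s.im * Real.log (n : ℝ) : ℝ) : ℂ) * Complex.I) := by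
  have hn0 : (0 : ℝ) < n := by exact_mod_cast hn
  rw [Complex.cpow_def_of_ne_zero (by exact_mod_cast hn0.ne'), Real.rpow_def_of_pos hn0,
    Complex.ofReal_exp, ← Complex.exp_add, ← Complex.natCast_log]
  congr 1
  apply Complex.ext <;> simp <;> ring

theorem norm_sum_dyadic_le {s : ℂ} {l : ℝ} {N : ℕ} (hl : 3 * 10 ^ 7 ≤ l)
    (hs : l ^ 8 = Real.log |s.im|) (hσ : 1 - 1 / l ^ 7 ≤ s.re) (hN : 1 ≤ N)
    (hNt : (N : ℝ) < s.im ^ 2) :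
    ‖∑ n ∈ Ioc N (2 * N), (n : ℂ) ^ (-s)‖ ≤ 12 := by
  have hl0 : 0 < l := by linarith [hl]
  have hN0 : (1 : ℝ) ≤ N := by exact_mod_cast hN
  have hNpos : (0 : ℝ) < N := by linarith
  have hσ0 : 0 < s.re := by
    have : 1 / l ^ 7 < 1 := by
      rw [div_lt_one (by positivity)]
      exact one_lt_pow₀ (by linarith) (by norm_num)
    linarith
  by_cases hA : Real.log N ≤ l ^ 7
  · have h1 : ‖∑ n ∈ Ioc N (2 * N), (n : ℂ) ^ (-s)‖ ≤ N * (N : ℝ) ^ (-s.re) := by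
      refine (norm_sum_le_of_le (f := fun n : ℕ => (n : ℂ) ^ (-s))
        (n := fun _ => (N : ℝ) ^ (-s.re)) _ fun n hn => ?_).trans ?_
      · rw [mem_Ioc] at hn
        rw [Complex.norm_natCast_cpow_of_pos (by omega), Complex.neg_re]
        exact Real.rpow_le_rpow_of_nonpos hNpos (by exact_mod_cast hn.1.le) (by linarith)
      · rw [sum_const, Nat.card_Ioc, nsmul_eq_mul, two_mul, Nat.add_sub_cancel]
    refine h1.trans ?_
    nth_rw 1 [← Real.rpow_one (N : ℝ)]
    rw [← Real.rpow_add hNpos, Real.rpow_def_of_pos hNpos]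
    have h2 : Real.log N * (1 + -s.re) ≤ 1 := by
      have h3 : 0 ≤ Real.log N := Real.log_nonneg hN0
      calc Real.log N * (1 + -s.re) ≤ Real.log N * (1 / l ^ 7) := by gcongr; linarith
        _ ≤ l ^ 7 * (1 / l ^ 7) := by gcongr
        _ = 1 := by field_simp
    refine (Real.exp_le_exp.2 h2).trans ?_
    linarith [Real.exp_one_lt_d9]
  push Not at hA
  set t := s.im with ht
  have hlogt : Real.log (t ^ 2) = 2 * l ^ 8 := by
    rw [← sq_abs, Real.log_pow, ← hs]; push_cast; ring
  have ht2 : 0 < t ^ 2 := by linarith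
  have hN1 : (1 : ℝ) < N := by
    by_contra h
    have : (N : ℝ) = 1 := le_antisymm (not_lt.1 h) hN0
    rw [this, Real.log_one] at hA
    exact absurd hA (not_lt.2 (by positivity))
  have hex : ∃ i : ℕ, t ^ 2 ≤ (N : ℝ) ^ i := by
    obtain ⟨i, hi⟩ := pow_unbounded_of_one_lt (t ^ 2) hN1
    exact ⟨i, hi.le⟩
  classical
  set i := Nat.find hex with hi
  have hi1 : t ^ 2 ≤ (N : ℝ) ^ i := Nat.find_spec hex
  have hi2 : 2 ≤ i := by
    by_contra h
    have : i = 0 ∨ i = 1 := by omega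
    rcases this with h | h
    · rw [h, pow_zero] at hi1; linarith
    · rw [h, pow_one] at hi1; linarith
  have hi3 : (N : ℝ) ^ (i - 1) < t ^ 2 := not_le.1 (Nat.find_min hex (by omega : i - 1 < i))
  have hi4 : (i : ℝ) ≤ 2 * l + 1 := by
    have h1 := Real.log_lt_log (by positivity) hi3
    rw [Real.log_pow, hlogt, Nat.cast_sub (by omega)] at h1
    have h2 : ((i : ℝ) - 1) * l ^ 7 ≤ 2 * l ^ 8 := by
      have : (0 : ℝ) ≤ i - 1 := by
        have : (2 : ℝ) ≤ i := by exact_mod_cast hi2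
        linarith
      push_cast at h1
      nlinarith
    have h3 : ((i : ℝ) - 1) * l ^ 7 ≤ (2 * l) * l ^ 7 := by linarith [pow_succ l 7]
    have := le_of_mul_le_mul_right h3 (by positivity)
    linarith
  have hK : 3 * (i : ℝ) + 12 ≤ 7 * l := by linarith
  have hNl : (2 * (3 * i + 12 : ℝ) ^ 3) ^ 5 ≤ N := by
    calc (2 * (3 * i + 12 : ℝ) ^ 3) ^ 5 ≤ (2 * (7 * l) ^ 3) ^ 5 := by gcongr
      _ = (686 * l ^ 3) ^ 5 := by ring
      _ ≤ (l * l ^ 3) ^ 5 := by gcongr; linarith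
      _ = l ^ 20 := by ring
      _ ≤ (Real.exp l) ^ 20 := by gcongr; linarith [Real.add_one_le_exp l]
      _ = Real.exp (20 * l) := by rw [← Real.exp_nat_mul]; norm_num
      _ ≤ Real.exp (l ^ 7) := by
          apply Real.exp_le_exp.2
          rw [pow_succ]
          gcongr
          calc (20 : ℝ) ≤ l ^ 1 := by linarith
            _ ≤ l ^ 6 := pow_le_pow_right₀ (by linarith) (by norm_num)
      _ ≤ Real.exp (Real.log N) := Real.exp_le_exp.2 hA.le
      _ = N := Real.exp_log hNpos
  have hδ : 1 / l ^ 7 ≤ 1 / (240 * (3 * i + 12 : ℝ) ^ 6) := by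
    apply one_div_le_one_div_of_le (by positivity)
    calc 240 * (3 * i + 12 : ℝ) ^ 6 ≤ 240 * (7 * l) ^ 6 := by gcongr
      _ = 28235760 * l ^ 6 := by ring
      _ ≤ l * l ^ 6 := by gcongr; linarith
      _ = l ^ 7 := by ring
  have hsum : ∑ n ∈ Ioc N (2 * N), (n : ℂ) ^ (-s) = ∑ n ∈ Ioc N (2 * N),
      (((n : ℝ) ^ (-s.re) : ℝ) : ℂ) * Complex.exp (((-t * Real.log (n : ℝ) : ℝ) : ℂ) * Complex.I) := by
    refine sum_congr rfl fun n hn => ?_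
    rw [mem_Ioc] at hn
    exact natCast_cpow_neg_eq (by omega) s
  rw [hsum]
  have h := norm_sum_Ioc_mul_le (g := fun n : ℕ => (n : ℝ) ^ (-s.re))
    (f := fun n : ℕ => Complex.exp (((-t * Real.log (n : ℝ) : ℝ) : ℂ) * Complex.I))
    (by omega : N ≤ 2 * N) (fun n hn => ?_) (by positivity)
    (fun m hm1 hm2 => norm_zeta_sum_le hi2 hNl hi3.le hi1 hm1 hm2)
  · refine h.trans ?_
    have e : (N : ℝ) ^ (-s.re) * (12 * (N : ℝ) ^ (1 - 1 / (240 * (3 * i + 12) ^ 6) : ℝ)) =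
        12 * (N : ℝ) ^ (-s.re + (1 - 1 / (240 * (3 * i + 12) ^ 6)) : ℝ) := by
      rw [Real.rpow_add hNpos]; ring
    rw [e]
    have := Real.rpow_le_one_of_one_le_of_nonpos hN0
      (by linarith : (-s.re + (1 - 1 / (240 * (3 * i + 12) ^ 6)) : ℝ) ≤ 0)
    linarith
  · have : (0 : ℝ) < n := by exact_mod_cast (by omega : 0 < n)
    exact Real.rpow_le_rpow_of_nonpos this (by push_cast; linarith) (by linarith)

theorem norm_riemannZeta_le {s : ℂ} {l : ℝ} (hl : 3 * 10 ^ 7 ≤ l)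
    (hs : l ^ 8 = Real.log |s.im|) (hσ : 1 - 1 / l ^ 7 ≤ s.re) (hσ2 : s.re ≤ 2) :
    ‖riemannZeta s‖ ≤ 54 * l ^ 8 := by
  have hl0 : 0 < l := by linarith
  have hl8 : l ≤ l ^ 8 := le_self_pow₀ (by linarith) (by norm_num)
  set t := s.im with ht
  have hlt : 0 < |t| := by
    by_contra h
    have : |t| = 0 := le_antisymm (not_lt.1 h) (abs_nonneg _)
    rw [this, Real.log_zero] at hs
    exact absurd hs (by positivity)
  have hlt2 : 10 ^ 7 ≤ |t| := by
    calc (10 ^ 7 : ℝ) ≤ l ^ 8 + 1 := by linarith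
      _ ≤ Real.exp (l ^ 8) := Real.add_one_le_exp _
      _ = |t| := by rw [hs, Real.exp_log hlt]
  have hσ3 : 1 / 2 ≤ s.re := by
    have : 1 / l ^ 7 ≤ 1 / 2 := by
      apply one_div_le_one_div_of_le (by norm_num)
      calc (2 : ℝ) ≤ l ^ 1 := by linarith
        _ ≤ l ^ 7 := pow_le_pow_right₀ (by linarith) (by norm_num)
    linarith
  have ht1 : (1 : ℝ) ≤ t ^ 2 := by rw [← sq_abs]; nlinarith
  obtain ⟨J, hJ1, hJ2⟩ := exists_nat_pow_near ht1 (by norm_num : (1 : ℝ) < 2)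
  set M : ℕ := 2 ^ J with hM
  have hM1 : 1 ≤ M := Nat.one_le_two_pow
  have hMr : (M : ℝ) = 2 ^ J := by rw [hM]; push_cast; rfl
  have hM0 : (1 : ℝ) ≤ M := by exact_mod_cast hM1
  have hs1 : s ≠ 1 := by
    intro h
    rw [h] at ht
    simp only [Complex.one_im] at ht
    rw [ht] at hlt
    simp at hlt
  have hJL : (J : ℝ) ≤ 3 * l ^ 8 := by
    have h1 := Real.log_le_log (by positivity) hJ1
    rw [Real.log_pow, ← sq_abs, Real.log_pow, ← hs] at h1
    push_cast at h1
    nlinarith [Real.log_two_gt_d9, (Nat.cast_nonneg J : (0 : ℝ) ≤ J)]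
  have hsum : ∀ j : ℕ, j ≤ J → ‖∑ n ∈ range (2 ^ j), ((n : ℂ) + 1) ^ (-s)‖ ≤ 1 + 12 * j := by
    intro j
    induction j with
    | zero => simp
    | succ j ih =>
      intro hj
      have h1 := ih (by omega)
      have h2 : ∑ n ∈ range (2 ^ (j + 1)), ((n : ℂ) + 1) ^ (-s) =
          ∑ n ∈ range (2 ^ j), ((n : ℂ) + 1) ^ (-s) +
          ∑ n ∈ Ioc (2 ^ j : ℕ) (2 * 2 ^ j), (n : ℂ) ^ (-s) := by
        rw [← Finset.sum_range_add_sum_Ico _ (by rw [pow_succ]; omega : 2 ^ j ≤ 2 ^ (j + 1))]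
        congr 1
        rw [show Ioc (2 ^ j : ℕ) (2 * 2 ^ j) = Ico (2 ^ j + 1) (2 ^ (j + 1) + 1) by
          ext x; rw [mem_Ioc, mem_Ico, pow_succ]; omega]
        rw [← sum_Ico_add' (fun n : ℕ => (n : ℂ) ^ (-s))]
        push_cast
        rfl
      rw [h2]
      have h3 := norm_sum_dyadic_le (s := s) (N := 2 ^ j) hl hs hσ Nat.one_le_two_pow (by
        refine lt_of_lt_of_le ?_ hJ1
        push_cast
        exact pow_lt_pow_right₀ (by norm_num) (by omega))
      refine (norm_add_le _ _).trans ?_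
      push_cast
      linarith
  have hS := hsum J le_rfl
  have heq := riemannZeta₁_eq hM1 (s := s) (by linarith)
  have hz : riemannZeta s = ∑ n ∈ range M, ((n : ℂ) + 1) ^ (-s) +
      (s - 1)⁻¹ * (M : ℂ) ^ (1 - s) + (s - 1)⁻¹ * ∑' j : ℕ, zetaRem (M + j) s := by
    have h0 : s - 1 ≠ 0 := sub_ne_zero.2 hs1
    rw [riemannZeta_eq_inv_sub_mul hs1, heq]
    field_simp
  have hs1t : |t| ≤ ‖s - 1‖ := by
    have := Complex.abs_im_le_norm (s - 1)
    simpa using this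
  have hst : ‖s‖ ≤ 2 * |t| := by
    have := Complex.norm_le_abs_re_add_abs_im s
    rw [abs_of_nonneg (by linarith : 0 ≤ s.re)] at this
    linarith
  have hMt : √(M : ℝ) ≤ |t| := by
    rw [← Real.sqrt_sq_eq_abs]
    exact Real.sqrt_le_sqrt (hMr ▸ hJ1)
  have hMt2 : |t| ≤ 2 * √(M : ℝ) := by
    rw [← Real.sqrt_sq_eq_abs, show (2 : ℝ) = √4 by
      rw [show (4 : ℝ) = 2 ^ 2 by norm_num]; exact (Real.sqrt_sq (by norm_num)).symm,
      ← Real.sqrt_mul (by norm_num)]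
    apply Real.sqrt_le_sqrt
    rw [pow_succ 2 J, ← hMr] at hJ2
    linarith
  have hsM : 0 < √(M : ℝ) := Real.sqrt_pos.2 (by linarith)
  have h2 : ‖(s - 1)⁻¹ * (M : ℂ) ^ (1 - s)‖ ≤ 1 := by
    rw [norm_mul, norm_inv, Complex.norm_natCast_cpow_of_pos hM1]
    rw [inv_mul_le_iff₀ (by linarith), mul_one]
    refine le_trans ?_ (hMt.trans hs1t)
    rw [Real.sqrt_eq_rpow]
    apply Real.rpow_le_rpow_of_exponent_le hM0
    simp only [Complex.sub_re, Complex.one_re]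
    linarith
  have h3 : ‖(s - 1)⁻¹ * ∑' j : ℕ, zetaRem (M + j) s‖ ≤ 16 := by
    rw [norm_mul, norm_inv]
    rw [inv_mul_le_iff₀ (by linarith)]
    refine (norm_tsum_zetaRem_le hM1 hσ3).trans ?_
    rw [mul_assoc]
    gcongr
    calc ‖s‖ * (4 * (√(M : ℝ))⁻¹) ≤ (2 * (2 * √(M : ℝ))) * (4 * (√(M : ℝ))⁻¹) := by
          gcongr; linarith
      _ = 16 := by field_simp; norm_num
  rw [hz]
  have h4 := norm_add₃_le (a := ∑ n ∈ range M, ((n : ℂ) + 1) ^ (-s))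
    (b := (s - 1)⁻¹ * (M : ℂ) ^ (1 - s)) (c := (s - 1)⁻¹ * ∑' j : ℕ, zetaRem (M + j) s)
  linarith

/-! ### Local analysis of entire functions -/

/-- Every nonvanishing holomorphic function on a ball has a holomorphic logarithm. -/
lemma exists_log_on_ball {f : ℂ → ℂ} {R : ℝ} (hR : 0 < R) (hf : Differentiable ℂ f)
    (h0 : ∀ z ∈ Metric.ball (0 : ℂ) R, f z ≠ 0) :
    ∃ L : ℂ → ℂ, (∀ z ∈ Metric.ball (0 : ℂ) R, HasDerivAt L (logDeriv f z) z) ∧ L 0 = 0 ∧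
      ∀ z ∈ Metric.ball (0 : ℂ) R, f z = f 0 * Complex.exp (L z) := by
  have hd : DifferentiableOn ℂ (logDeriv f) (Metric.ball 0 R) := by
    intro z hz
    have h1 : DifferentiableAt ℂ (deriv f) z :=
      (hf.contDiff (n := 2)).differentiable_deriv_two z
    exact (h1.div (hf z) (h0 z hz)).differentiableWithinAt
  obtain ⟨L, hL⟩ := hd.isExactOn_ball
  have hz0 : (0 : ℂ) ∈ Metric.ball (0 : ℂ) R := Metric.mem_ball_self hR
  have key : ∀ z ∈ Metric.ball (0 : ℂ) R, HasDerivAt (fun z => L z - L 0) (logDeriv f z) z :=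
    fun z hz => (hL z hz).sub_const _
  refine ⟨fun z => L z - L 0, key, by simp, fun z hz => ?_⟩
  have hder : ∀ w ∈ Metric.ball (0 : ℂ) R,
      HasDerivAt (fun w => f w * Complex.exp (-(L w - L 0))) 0 w := by
    intro w hw
    have h1 := (hf w).hasDerivAt.mul ((key w hw).neg.cexp)
    refine h1.congr_deriv ?_
    rw [logDeriv_apply]
    field_simp [h0 w hw]
    simp only [Pi.neg_apply]
    ring
  have hconst := (convex_ball (0 : ℂ) R).is_const_of_fderivWithin_eq_zero (𝕜 := ℂ)
    (f := fun w => f w * Complex.exp (-(L w - L 0)))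
    (fun w hw => (hder w hw).differentiableAt.differentiableWithinAt)
    (fun w hw => by
      have := (hder w hw).hasDerivWithinAt (s := Metric.ball (0 : ℂ) R)
      rw [this.hasFDerivWithinAt.fderivWithin (Metric.isOpen_ball.uniqueDiffWithinAt hw)]
      ext; simp) hz hz0
  simp only [sub_self, neg_zero, Complex.exp_zero, mul_one] at hconst
  rw [← hconst, mul_assoc, ← Complex.exp_add]
  simp

/-- Borel–Carathéodory bound for the logarithm of a nonvanishing function. -/
lemma norm_log_le_of_ne_zero {f : ℂ → ℂ} {R M : ℝ} (hR : 0 < R) (hM : 0 < M)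
    (hf : Differentiable ℂ f)
    (h0 : ∀ z ∈ Metric.ball (0 : ℂ) R, f z ≠ 0)
    (hb : ∀ z ∈ Metric.ball (0 : ℂ) R, ‖f z‖ ≤ Real.exp M * ‖f 0‖) :
    ∃ L : ℂ → ℂ, (∀ z ∈ Metric.ball (0 : ℂ) R, HasDerivAt L (logDeriv f z) z) ∧ L 0 = 0 ∧
      (∀ z ∈ Metric.ball (0 : ℂ) R, f z = f 0 * Complex.exp (L z)) ∧
      ∀ z ∈ Metric.ball (0 : ℂ) R, ‖L z‖ ≤ 2 * M * ‖z‖ / (R - ‖z‖) := by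
  obtain ⟨L, h1, h2, h3⟩ := exists_log_on_ball hR hf h0
  refine ⟨L, h1, h2, h3, fun z hz => ?_⟩
  refine Complex.borelCaratheodory_zero hM
    (fun w hw => (h1 w hw).differentiableAt.differentiableWithinAt) (fun w hw => ?_) hR hz h2
  have h4 := hb w hw
  have h5 : 0 < ‖f 0‖ := norm_pos_iff.mpr (h0 0 (Metric.mem_ball_self hR))
  rw [h3 w hw, norm_mul, mul_comm, Complex.norm_exp] at h4
  exact Real.exp_le_exp.mp (le_of_mul_le_mul_right h4 h5)

lemma norm_logDeriv_zero_le {f : ℂ → ℂ} {R M : ℝ} (hR : 0 < R) (hM : 0 < M)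
    (hf : Differentiable ℂ f)
    (h0 : ∀ z ∈ Metric.ball (0 : ℂ) R, f z ≠ 0)
    (hb : ∀ z ∈ Metric.ball (0 : ℂ) R, ‖f z‖ ≤ Real.exp M * ‖f 0‖) :
    ‖logDeriv f 0‖ ≤ 2 * M / R := by
  obtain ⟨L, h1, h2, h3, h4⟩ := norm_log_le_of_ne_zero hR hM hf h0 hb
  have hder := h1 0 (Metric.mem_ball_self hR)
  have hle : ∀ r ∈ Set.Ioo 0 R, ‖logDeriv f 0‖ ≤ 2 * M / (R - r) := by
    intro r hr
    have : ‖logDeriv f 0‖ ≤ 2 * M / (R - r) := by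
      refine hder.le_of_lip' (by have := hr.2; exact div_nonneg (by positivity) (by linarith)) ?_
      filter_upwards [Metric.ball_mem_nhds (0 : ℂ) hr.1] with z hz
      rw [mem_ball_zero_iff] at hz
      have h5 := h4 z (by rw [mem_ball_zero_iff]; linarith [hr.2])
      rw [h2, sub_zero, sub_zero]
      refine h5.trans ?_
      rw [div_mul_eq_mul_div]
      have := hr.2
      gcongr
    exact this
  have hcont : Filter.Tendsto (fun r : ℝ => 2 * M / (R - r)) (nhdsWithin 0 (Set.Ioi 0))
      (nhds (2 * M / (R - 0))) := by
    refine Filter.Tendsto.mono_left ?_ nhdsWithin_le_nhds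
    exact (continuousAt_const.div (continuousAt_const.sub continuousAt_id) (by simpa using hR.ne')).tendsto
  rw [sub_zero] at hcont
  refine ge_of_tendsto hcont ?_
  filter_upwards [Ioo_mem_nhdsGT hR] with r hr using hle r hr

lemma norm_blaschke_eq {R : ℝ} (hR : 0 < R) (ρ z : ℂ) (hz : ‖z‖ = R) :
    ‖((R : ℂ) ^ 2 - (starRingEnd ℂ) ρ * z) / R‖ = ‖z - ρ‖ := by
  have h1 : (R : ℂ) ^ 2 = z * (starRingEnd ℂ) z := by
    rw [Complex.mul_conj, Complex.normSq_eq_norm_sq, hz]; push_cast; rfl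
  have h2 : (R : ℂ) ^ 2 - (starRingEnd ℂ) ρ * z = z * (starRingEnd ℂ) (z - ρ) := by
    rw [h1, map_sub]; ring
  rw [h2, norm_div, norm_mul, RCLike.norm_conj, hz, Complex.norm_real, Real.norm_of_nonneg hR.le]
  field_simp

lemma norm_blaschke_prod_le {f g : ℂ → ℂ} {R B : ℝ} (hR : 0 < R) {n : ℕ} (ρ : Fin n → ℂ)
    (hg : Differentiable ℂ g) (hfg : ∀ z, f z = (∏ i, (z - ρ i)) * g z)
    (hb : ∀ z, ‖z‖ = R → ‖f z‖ ≤ B) {z : ℂ} (hz : ‖z‖ ≤ R) :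
    ‖(∏ i, (((R : ℂ) ^ 2 - (starRingEnd ℂ) (ρ i) * z) / R)) * g z‖ ≤ B := by
  have hd : Differentiable ℂ fun z : ℂ =>
      (∏ i, (((R : ℂ) ^ 2 - (starRingEnd ℂ) (ρ i) * z) / R)) * g z := by
    refine Differentiable.mul ?_ hg
    exact Differentiable.fun_finsetProd fun i _ => by fun_prop
  refine Complex.norm_le_of_forall_mem_frontier_norm_le (U := Metric.ball 0 R)
    (f := fun z : ℂ => (∏ i, (((R : ℂ) ^ 2 - (starRingEnd ℂ) (ρ i) * z) / R)) * g z)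
    Metric.isBounded_ball hd.diffContOnCl ?_ ?_
  · intro w hw
    rw [frontier_ball _ hR.ne', mem_sphere_zero_iff_norm] at hw
    have h1 := hb w hw
    rw [hfg w, norm_mul, norm_prod] at h1
    rw [norm_mul, norm_prod]
    simpa only [norm_blaschke_eq hR _ _ hw] using h1
  · rw [closure_ball _ hR.ne']; simpa using hz

/-- An entire function not vanishing at the origin is, on a disc, a finite product of linear
factors times a nonvanishing function. -/
lemma exists_factorization {f : ℂ → ℂ} {R : ℝ} (hR : 0 < R) (hf : Differentiable ℂ f)
    (h0 : f 0 ≠ 0) :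
    ∃ (n : ℕ) (ρ : Fin n → ℂ) (g : ℂ → ℂ), Differentiable ℂ g ∧ (∀ i, ‖ρ i‖ ≤ R) ∧
      (∀ z, f z = (∏ i, (z - ρ i)) * g z) ∧ ∀ z, ‖z‖ ≤ R → g z ≠ 0 := by
  obtain ⟨B, hB⟩ := (isCompact_closedBall (0 : ℂ) (2 * R)).exists_bound_of_continuousOn
    hf.continuous.continuousOn
  let P : ℕ → Prop := fun n => ∃ (ρ : Fin n → ℂ) (g : ℂ → ℂ), Differentiable ℂ g ∧
    (∀ i, ‖ρ i‖ ≤ R) ∧ (∀ z, f z = (∏ i, (z - ρ i)) * g z)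
  have hP0 : P 0 := ⟨Fin.elim0, f, hf, fun i => i.elim0, fun z => by simp⟩
  have hbd : ∀ n, P n → (2 : ℝ) ^ n * ‖f 0‖ ≤ B := by
    rintro n ⟨ρ, g, hg, hρ, hfg⟩
    have h1 := norm_blaschke_prod_le (R := 2 * R) (B := B) (by positivity) ρ hg hfg
      (fun z hz => hB z (by simp [hz])) (z := 0) (by simpa using hR.le)
    refine le_trans ?_ h1
    rw [hfg 0, norm_mul, norm_mul, norm_prod, norm_prod, ← mul_assoc]
    refine mul_le_mul_of_nonneg_right ?_ (norm_nonneg _)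
    calc (2 : ℝ) ^ n * ∏ i, ‖0 - ρ i‖ = ∏ i : Fin n, (2 * ‖0 - ρ i‖) := by
          rw [Finset.prod_mul_distrib]; simp
      _ ≤ _ := by
          refine Finset.prod_le_prod (fun i _ => by positivity) fun i _ => ?_
          have : (((2 * R : ℝ) : ℂ) ^ 2 - (starRingEnd ℂ) (ρ i) * 0) / ((2 * R : ℝ) : ℂ)
              = ((2 * R : ℝ) : ℂ) := by
            have : ((2 * R : ℝ) : ℂ) ≠ 0 := by exact_mod_cast (by positivity : 2 * R ≠ 0)
            field_simp; ring
          rw [this, zero_sub, norm_neg, Complex.norm_real, Real.norm_of_nonneg (by positivity)]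
          linarith [hρ i]
  obtain ⟨N, hN⟩ := pow_unbounded_of_one_lt (B / ‖f 0‖) (by norm_num : (1 : ℝ) < 2)
  have hPN : ∀ n, P n → n ≤ N := by
    intro n hn
    by_contra! h
    have h1 := hbd n hn
    rw [← le_div_iff₀ (norm_pos_iff.mpr h0)] at h1
    have h2 : (2 : ℝ) ^ N ≤ 2 ^ n := pow_le_pow_right₀ (by norm_num) h.le
    linarith
  classical
  set n := Nat.findGreatest P N with hn
  have hPn : P n := Nat.findGreatest_spec (Nat.zero_le N) hP0
  obtain ⟨ρ, g, hg, hρ, hfg⟩ := hPn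
  refine ⟨n, ρ, g, hg, hρ, hfg, fun w hw hgw => ?_⟩
  have hsucc : P (n + 1) := by
    refine ⟨Fin.cons w ρ, dslope g w, ?_, ?_, ?_⟩
    · rw [← differentiableOn_univ]
      exact (Complex.differentiableOn_dslope Filter.univ_mem).mpr hg.differentiableOn
    · intro i; refine Fin.cases ?_ (fun j => ?_) i
      · simpa using hw
      · simpa using hρ j
    · intro z
      have h1 : g z = (z - w) * dslope g w z := by
        have := sub_smul_dslope g w z
        rw [hgw, sub_zero, smul_eq_mul] at this
        exact this.symm
      rw [hfg z, Fin.prod_univ_succ, h1]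
      simp only [Fin.cons_zero, Fin.cons_succ]
      ring
  have h2 := Nat.le_findGreatest (hPN _ hsucc) hsucc
  omega

/-- Lower bound for the real part of the logarithmic derivative when all zeros lie to the left,
gaining the contribution of a set of at most one designated zero. -/
lemma re_logDeriv_ge {f : ℂ → ℂ} {R M : ℝ} (hR : 0 < R) (hM : 0 < M)
    (hf : Differentiable ℂ f) (h0 : f 0 ≠ 0)
    (hb : ∀ z, ‖z‖ ≤ R → ‖f z‖ ≤ Real.exp M * ‖f 0‖)
    (hz : ∀ z, ‖z‖ ≤ R → f z = 0 → z.re ≤ 0) :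
    -(2 * M / R) ≤ (logDeriv f 0).re ∧
    ∀ d : ℝ, 0 < d → d ≤ R → f (-(d : ℂ)) = 0 →
      1 / d - d / R ^ 2 - 2 * M / R ≤ (logDeriv f 0).re := by
  obtain ⟨n, ρ, g, hg, hρ, hfg, hgne⟩ := exists_factorization hR hf h0
  have hρf : ∀ i, f (ρ i) = 0 := fun i => by
    rw [hfg, Finset.prod_eq_zero (Finset.mem_univ i) (sub_self _), zero_mul]
  have hρ0 : ∀ i, ρ i ≠ 0 := fun i h => h0 (h ▸ hρf i)
  have hRC : (R : ℂ) ≠ 0 := by exact_mod_cast hR.ne'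
  set h : ℂ → ℂ := fun z => (∏ i, (((R : ℂ) ^ 2 - (starRingEnd ℂ) (ρ i) * z) / R)) * g z with hh
  have hhd : Differentiable ℂ h :=
    (Differentiable.fun_finsetProd fun i _ => by fun_prop).mul hg
  have hh0 : ‖f 0‖ ≤ ‖h 0‖ := by
    simp only [hh]
    rw [hfg 0, norm_mul, norm_mul, norm_prod, norm_prod]
    refine mul_le_mul_of_nonneg_right ?_ (norm_nonneg _)
    refine Finset.prod_le_prod (fun i _ => norm_nonneg _) fun i _ => ?_
    have : ((R : ℂ) ^ 2 - (starRingEnd ℂ) (ρ i) * 0) / R = R := by field_simp; ring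
    rw [this, zero_sub, norm_neg, Complex.norm_real, Real.norm_of_nonneg hR.le]
    exact hρ i
  have hfac : ∀ z, ‖z‖ < R → ∀ i, ((R : ℂ) ^ 2 - (starRingEnd ℂ) (ρ i) * z) / R ≠ 0 := by
    intro z hz i
    refine div_ne_zero (fun h => ?_) hRC
    rw [sub_eq_zero] at h
    have h1 := congrArg norm h
    rw [norm_pow, norm_mul, RCLike.norm_conj, Complex.norm_real, Real.norm_of_nonneg hR.le] at h1
    have h2 : ‖ρ i‖ * ‖z‖ ≤ R * ‖z‖ := mul_le_mul_of_nonneg_right (hρ i) (norm_nonneg _)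
    nlinarith
  have hhne : ∀ z ∈ Metric.ball (0 : ℂ) R, h z ≠ 0 := by
    intro z hz
    rw [mem_ball_zero_iff] at hz
    exact mul_ne_zero (Finset.prod_ne_zero_iff.mpr fun i _ => hfac z hz i) (hgne z hz.le)
  have hhb : ∀ z ∈ Metric.ball (0 : ℂ) R, ‖h z‖ ≤ Real.exp M * ‖h 0‖ := by
    intro z hz
    rw [mem_ball_zero_iff] at hz
    have := norm_blaschke_prod_le hR ρ hg hfg (fun z hz => hb z hz.le) hz.le
    refine this.trans (mul_le_mul_of_nonneg_left hh0 (Real.exp_pos _).le)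
  have hlog := norm_logDeriv_zero_le hR hM hhd hhne hhb
  have hg0 : g 0 ≠ 0 := hgne 0 (by simpa using hR.le)
  have e1 : logDeriv f 0 = ∑ i, (-(1 / ρ i)) + logDeriv g 0 := by
    have : f = fun z => (∏ i, (z - ρ i)) * g z := funext hfg
    rw [this, logDeriv_mul (f := fun z => ∏ i, (z - ρ i)) (g := g) 0
      (Finset.prod_ne_zero_iff.mpr fun i _ => by simpa using hρ0 i) hg0
      (Differentiable.fun_finsetProd fun i _ => by fun_prop).differentiableAt hg.differentiableAt]
    congr 1
    rw [logDeriv_prod (f := fun i z => z - ρ i) (fun i _ => by simpa using hρ0 i)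
      (fun i _ => by fun_prop)]
    refine Finset.sum_congr rfl fun i _ => ?_
    rw [logDeriv_apply]
    simp
  have e2 : logDeriv h 0 = ∑ i, (-((starRingEnd ℂ) (ρ i) / R ^ 2)) + logDeriv g 0 := by
    rw [hh, logDeriv_mul (f := fun z => ∏ i, (((R : ℂ) ^ 2 - (starRingEnd ℂ) (ρ i) * z) / R))
      (g := g) 0
      (Finset.prod_ne_zero_iff.mpr fun i _ => hfac 0 (by simpa using hR) i) hg0
      (Differentiable.fun_finsetProd fun i _ => by fun_prop).differentiableAt hg.differentiableAt]
    congr 1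
    rw [logDeriv_prod (f := fun i z => (((R : ℂ) ^ 2 - (starRingEnd ℂ) (ρ i) * z) / R))
      (fun i _ => hfac 0 (by simpa using hR) i)
      (fun i _ => by fun_prop)]
    refine Finset.sum_congr rfl fun i _ => ?_
    rw [logDeriv_apply]
    have : deriv (fun z => ((R : ℂ) ^ 2 - (starRingEnd ℂ) (ρ i) * z) / R) 0
        = -(starRingEnd ℂ) (ρ i) / R := by
      have h1 : HasDerivAt (fun z => ((R : ℂ) ^ 2 - (starRingEnd ℂ) (ρ i) * z) / R)
          ((-((starRingEnd ℂ) (ρ i) * 1)) / R) 0 :=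
        (((hasDerivAt_id (0 : ℂ)).const_mul ((starRingEnd ℂ) (ρ i))).const_sub _).div_const _
      rw [h1.deriv, mul_one]
    rw [this]
    field_simp
    simp
  have e3 : (logDeriv f 0).re = (logDeriv h 0).re
      + ∑ i, ((starRingEnd ℂ) (ρ i) / R ^ 2 - 1 / ρ i).re := by
    rw [e1, e2, ← Complex.re_sum, ← Complex.add_re]
    congr 1
    rw [Finset.sum_sub_distrib, Finset.sum_neg_distrib, Finset.sum_neg_distrib]
    ring
  have hterm : ∀ i, 0 ≤ ((starRingEnd ℂ) (ρ i) / R ^ 2 - 1 / ρ i).re := by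
    intro i
    have h1 := hz (ρ i) (hρ i) (hρf i)
    have h2 : ((starRingEnd ℂ) (ρ i) / R ^ 2 - 1 / ρ i).re
        = (-(ρ i).re) * (1 / ‖ρ i‖ ^ 2 - 1 / R ^ 2) := by
      rw [Complex.sub_re, one_div, Complex.inv_re, Complex.normSq_eq_norm_sq]
      have : ((R : ℂ) ^ 2) = ((R ^ 2 : ℝ) : ℂ) := by push_cast; rfl
      rw [this, Complex.div_ofReal_re, Complex.conj_re]
      ring
    rw [h2]
    refine mul_nonneg (by linarith) (sub_nonneg.mpr ?_)
    exact one_div_le_one_div_of_le (pow_pos (norm_pos_iff.mpr (hρ0 i)) 2)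
      (pow_le_pow_left₀ (norm_nonneg _) (hρ i) 2)
  have hre : -(2 * M / R) ≤ (logDeriv h 0).re :=
    (neg_le_neg hlog).trans (neg_le_of_abs_le (Complex.abs_re_le_norm _))
  refine ⟨?_, fun d hd hdR hfd => ?_⟩
  · rw [e3]
    linarith [Finset.sum_nonneg fun i (_ : i ∈ Finset.univ) => hterm i]
  · have h1 : ∃ i, ρ i = -(d : ℂ) := by
      rw [hfg, mul_eq_zero, Finset.prod_eq_zero_iff] at hfd
      rcases hfd with ⟨i, _, hi⟩ | hfd
      · exact ⟨i, (sub_eq_zero.mp hi).symm⟩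
      · exact absurd hfd (hgne _ (by simpa [abs_of_pos hd] using hdR))
    obtain ⟨i, hi⟩ := h1
    have h2 : ((starRingEnd ℂ) (ρ i) / R ^ 2 - 1 / ρ i).re = 1 / d - d / R ^ 2 := by
      have : ((starRingEnd ℂ) (ρ i) / R ^ 2 - 1 / ρ i) = ((1 / d - d / R ^ 2 : ℝ) : ℂ) := by
        rw [hi, map_neg, Complex.conj_ofReal]
        push_cast
        rw [one_div, inv_neg]; ring
      rw [this, Complex.ofReal_re]
    have h3 := Finset.single_le_sum (fun i _ => hterm i) (Finset.mem_univ i)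
    rw [e3]
    linarith

section
/-! ### The zero-free region -/

open scoped ArithmeticFunction.vonMangoldt ArithmeticFunction.Moebius ArithmeticFunction.zeta

lemma riemannZeta₁_eq_mul {s : ℂ} (hs : s ≠ 1) : riemannZeta₁ s = (s - 1) * riemannZeta s := by
  rw [riemannZeta_eq_inv_sub_mul hs, mul_inv_cancel_left₀ (sub_ne_zero.mpr hs)]

lemma riemannZeta₁_ne_zero_of_one_le_re {s : ℂ} (hs : 1 ≤ s.re) : riemannZeta₁ s ≠ 0 := by
  by_cases h : s = 1
  · simp [h]
  · rw [riemannZeta₁_eq_mul h]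
    exact mul_ne_zero (sub_ne_zero.mpr h) (riemannZeta_ne_zero_of_one_le_re hs)

lemma logDeriv_riemannZeta₁_eq {s : ℂ} (hs : 1 < s.re) :
    logDeriv riemannZeta₁ s = 1 / (s - 1) - LSeries (fun n : ℕ => (Λ n : ℂ)) s := by
  have h1 : s ≠ 1 := by rintro rfl; simp at hs
  have h2 : riemannZeta₁ =ᶠ[nhds s] fun s => (s - 1) * riemannZeta s := by
    filter_upwards [isOpen_ne.mem_nhds h1] with z hz using riemannZeta₁_eq_mul hz
  have h3 : HasDerivAt riemannZeta₁ (1 * riemannZeta s + (s - 1) * deriv riemannZeta s) s :=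
    (((hasDerivAt_id s).sub_const 1).mul (differentiableAt_riemannZeta h1).hasDerivAt)
      |>.congr_of_eventuallyEq h2
  rw [ArithmeticFunction.LSeries_vonMangoldt_eq_deriv_riemannZeta_div hs, logDeriv_apply, h3.deriv,
    riemannZeta₁_eq_mul h1]
  have h4 := riemannZeta_ne_zero_of_one_le_re hs.le
  have h5 := sub_ne_zero.mpr h1
  field_simp
  ring

lemma one_le_norm_riemannZeta_mul {s : ℂ} (hs : 1 < s.re) :
    1 ≤ ‖riemannZeta (s.re : ℂ)‖ * ‖riemannZeta s‖ := by
  have hs' : 1 < ((s.re : ℝ) : ℂ).re := by simpa using hs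
  have h1 : ‖LSeries (fun n : ℕ => (ζ n : ℂ)) s * LSeries (fun n : ℕ => (μ n : ℂ)) s‖ = 1 := by
    rw [ArithmeticFunction.LSeries_zeta_mul_Lseries_moebius hs, norm_one]
  rw [ArithmeticFunction.LSeries_zeta_eq_riemannZeta hs, norm_mul] at h1
  rw [← h1, mul_comm]
  refine mul_le_mul_of_nonneg_right ?_ (norm_nonneg _)
  rw [← ArithmeticFunction.LSeries_zeta_eq_riemannZeta hs']
  have hsum : Summable fun n => ‖LSeries.term (fun n : ℕ => (ζ n : ℂ)) (s.re : ℂ) n‖ :=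
    (ArithmeticFunction.LSeriesSummable_zeta_iff.mpr hs').norm
  have hle : ∀ n, ‖LSeries.term (fun n : ℕ => (μ n : ℂ)) s n‖ ≤ ‖LSeries.term (fun n : ℕ => (ζ n : ℂ)) (s.re : ℂ) n‖ := by
    intro n
    rw [LSeries.norm_term_eq, LSeries.norm_term_eq]
    split_ifs with h
    · rfl
    · rw [Complex.ofReal_re]
      gcongr
      rw [ArithmeticFunction.zeta_apply_ne h]
      simp only [Nat.cast_one, norm_one]
      have := ArithmeticFunction.abs_moebius_le_one (n := n)
      rw [Complex.norm_intCast]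
      exact_mod_cast this
  have h2 : ‖LSeries (fun n : ℕ => (μ n : ℂ)) s‖ ≤ ∑' n, ‖LSeries.term (fun n : ℕ => (ζ n : ℂ)) (s.re : ℂ) n‖ :=
    tsum_of_norm_bounded hsum.hasSum hle
  refine h2.trans ?_
  have h3 : LSeries (fun n : ℕ => (ζ n : ℂ)) (s.re : ℂ) = ((∑' n, ‖LSeries.term (fun n : ℕ => (ζ n : ℂ)) (s.re : ℂ) n‖ : ℝ) : ℂ) := by
    rw [LSeries, Complex.ofReal_tsum]
    refine tsum_congr fun n => ?_
    rw [LSeries.norm_term_eq]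
    split_ifs with h
    · simp [h]
    · rw [LSeries.term_of_ne_zero h, ArithmeticFunction.zeta_apply_ne h, Complex.ofReal_re]
      push_cast
      rw [Complex.ofReal_cpow (Nat.cast_nonneg n)]
      simp
  rw [h3, Complex.norm_real]
  exact le_abs_self _

lemma exists_zeta_bound_real : ∃ C : ℝ, 1 ≤ C ∧ ∀ σ : ℝ, 1 < σ → σ ≤ 2 →
    ‖riemannZeta (σ : ℂ)‖ ≤ C / (σ - 1) ∧ ‖logDeriv riemannZeta₁ (σ : ℂ)‖ ≤ C := by
  obtain ⟨C1, h1⟩ := (isCompact_Icc (a := (1 : ℝ)) (b := 2)).exists_bound_of_continuousOn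
    (f := fun σ : ℝ => riemannZeta₁ (σ : ℂ))
    (differentiable_riemannZeta₁.continuous.comp Complex.continuous_ofReal).continuousOn
  have hd : Continuous (deriv riemannZeta₁) :=
    (differentiable_riemannZeta₁.contDiff (n := 1)).continuous_deriv_one
  obtain ⟨C2, h2⟩ := (isCompact_Icc (a := (1 : ℝ)) (b := 2)).exists_bound_of_continuousOn
    (f := fun σ : ℝ => logDeriv riemannZeta₁ (σ : ℂ)) (by
      intro σ hσ
      refine ContinuousAt.continuousWithinAt ?_
      refine ContinuousAt.div ?_ ?_ ?_
      · exact (hd.comp Complex.continuous_ofReal).continuousAt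
      · exact (differentiable_riemannZeta₁.continuous.comp Complex.continuous_ofReal).continuousAt
      · exact riemannZeta₁_ne_zero_of_one_le_re (by simpa using hσ.1))
  refine ⟨max 1 (max C1 C2), le_max_left _ _, fun σ hσ hσ2 => ⟨?_, ?_⟩⟩
  · have hne : (σ : ℂ) ≠ 1 := by exact_mod_cast hσ.ne'
    rw [riemannZeta_eq_inv_sub_mul hne, norm_mul, norm_inv, ← Complex.ofReal_one,
      ← Complex.ofReal_sub, Complex.norm_real, Real.norm_of_nonneg (by linarith), inv_mul_eq_div]
    refine div_le_div_of_nonneg_right ?_ (by linarith)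
    exact (h1 σ ⟨hσ.le, hσ2⟩).trans ((le_max_left _ _).trans (le_max_right _ _))
  · exact (h2 σ ⟨hσ.le, hσ2⟩).trans ((le_max_right _ _).trans (le_max_right _ _))

lemma re_LSeries_vonMangoldt_nonneg {σ : ℝ} (hσ : 1 < σ) (t : ℝ) :
    0 ≤ 3 * (LSeries (fun n : ℕ => (Λ n : ℂ)) (σ : ℂ)).re + 4 * (LSeries (fun n : ℕ => (Λ n : ℂ)) (σ + t * Complex.I)).re
      + (LSeries (fun n : ℕ => (Λ n : ℂ)) (σ + (2 * t : ℝ) * Complex.I)).re := by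
  have hterm : ∀ (n : ℕ) (u : ℝ), (LSeries.term (fun n : ℕ => (Λ n : ℂ)) (σ + u * Complex.I) n).re =
      (Λ n / (n : ℝ) ^ σ) * Real.cos (u * Real.log n) := by
    intro n u
    rcases Nat.eq_zero_or_pos n with rfl | hn
    · simp
    · have h := natCast_cpow_neg_eq hn (σ + u * Complex.I)
      rw [LSeries.term_of_ne_zero hn.ne', div_eq_mul_inv, ← Complex.cpow_neg, h]
      rw [Complex.re_ofReal_mul, Complex.re_ofReal_mul, Complex.exp_ofReal_mul_I_re]
      have e1 : ((σ : ℂ) + u * Complex.I).re = σ := by simp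
      have e2 : ((σ : ℂ) + u * Complex.I).im = u := by simp
      rw [e1, e2, neg_mul, Real.cos_neg, Real.rpow_neg (Nat.cast_nonneg n)]
      ring
  have hsum : ∀ u : ℝ, HasSum (fun n => (LSeries.term (fun n : ℕ => (Λ n : ℂ)) (σ + u * Complex.I) n).re)
      (LSeries (fun n : ℕ => (Λ n : ℂ)) (σ + u * Complex.I)).re := fun u => by
    have := ArithmeticFunction.LSeriesSummable_vonMangoldt (s := σ + u * Complex.I) (by simpa using hσ)
    exact Complex.hasSum_re this.hasSum
  have h0 := hsum 0
  simp only [Complex.ofReal_zero, zero_mul, add_zero] at h0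
  have htot := ((h0.mul_left 3).add ((hsum t).mul_left 4)).add (hsum (2 * t))
  refine htot.nonneg fun n => ?_
  have h00 := hterm n 0
  simp only [Complex.ofReal_zero, zero_mul, add_zero, Real.cos_zero, mul_one] at h00
  rw [h00, hterm, hterm]
  have e3 : Real.cos (2 * t * Real.log n) = 2 * Real.cos (t * Real.log n) ^ 2 - 1 := by
    rw [mul_assoc, Real.cos_two_mul]
  rw [e3]
  have h5 : 0 ≤ Λ n / (n : ℝ) ^ σ := div_nonneg ArithmeticFunction.vonMangoldt_nonneg
    (Real.rpow_nonneg (Nat.cast_nonneg n) _)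
  nlinarith [mul_nonneg h5 (sq_nonneg (1 + Real.cos (t * Real.log n)))]

end

section
open scoped ArithmeticFunction.vonMangoldt

/-- A height beyond which the bound for zeta in the Vinogradov region applies. -/
noncomputable def zetaHeight : ℝ := Real.exp ((3 * 10 ^ 7) ^ 8) + 1

lemma two_le_zetaHeight : 2 ≤ zetaHeight := by
  have : 1 ≤ Real.exp ((3 * 10 ^ 7) ^ 8) := Real.one_le_exp (by positivity)
  unfold zetaHeight; linarith

lemma norm_riemannZeta_le_of_height {Q : ℝ} (hQ : 1 ≤ Q) {s : ℂ} (h1 : zetaHeight ≤ |s.im|)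
    (h2 : |s.im| ≤ Real.exp (Q ^ 16)) (h3 : 1 - 1 / Q ^ 14 ≤ s.re) (h4 : s.re ≤ 2) :
    ‖riemannZeta s‖ ≤ 54 * Q ^ 16 := by
  have hpos : 0 < |s.im| := by linarith [two_le_zetaHeight]
  have hlog1 : (3 * 10 ^ 7) ^ 8 ≤ Real.log |s.im| := by
    rw [Real.le_log_iff_exp_le hpos]
    refine le_trans ?_ h1
    unfold zetaHeight; linarith
  have hlog2 : Real.log |s.im| ≤ Q ^ 16 := (Real.log_le_iff_le_exp hpos).mpr h2
  obtain ⟨l, hl0, hl⟩ : ∃ l : ℝ, 0 ≤ l ∧ l ^ 8 = Real.log |s.im| := by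
    have h0 : 0 ≤ Real.log |s.im| := le_trans (by positivity) hlog1
    refine ⟨(Real.log |s.im|) ^ ((8 : ℕ) : ℝ)⁻¹, Real.rpow_nonneg h0 _, ?_⟩
    exact Real.rpow_inv_natCast_pow h0 (by norm_num)
  have hl3 : 3 * 10 ^ 7 ≤ l := by
    rw [← hl] at hlog1
    exact le_of_pow_le_pow_left₀ (by norm_num) hl0 hlog1
  have hlQ : l ≤ Q ^ 2 := by
    rw [← hl] at hlog2
    refine le_of_pow_le_pow_left₀ (n := 8) (by norm_num) (by positivity) ?_
    rw [← pow_mul]; exact hlog2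
  have := norm_riemannZeta_le hl3 hl (by
    have : 1 / Q ^ 14 ≤ 1 / l ^ 7 := by
      refine one_div_le_one_div_of_le (by positivity) ?_
      calc l ^ 7 ≤ (Q ^ 2) ^ 7 := pow_le_pow_left₀ hl0 hlQ 7
        _ = Q ^ 14 := by ring
    linarith) h4
  rw [hl] at this
  linarith

lemma exists_disc_bound : ∃ K : ℝ, 2 ≤ K ∧ ∀ Q ≥ K, ∀ c : ℂ, zetaHeight + 1 ≤ |c.im| →
    |c.im| + 1 ≤ Real.exp (Q ^ 16) → 1 + 1 / (20 * Q ^ 15) ≤ c.re → c.re ≤ 3 / 2 →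
    ∀ z : ℂ, ‖z‖ ≤ 1 / (2 * Q ^ 14) →
    ‖riemannZeta₁ (c + z)‖ ≤ Real.exp (32 * Real.log Q) * ‖riemannZeta₁ c‖ := by
  obtain ⟨C, hC, hCb⟩ := exists_zeta_bound_real
  refine ⟨2160 * C, by linarith, fun Q hQ c h1 h2 h3 h4 z hz => ?_⟩
  have hQ1 : 1 ≤ Q := by linarith
  have hQ0 : 0 < Q := by linarith
  have hz2 : ‖z‖ ≤ 1 / 2 := hz.trans (by
    refine one_div_le_one_div_of_le (by norm_num) ?_
    have := one_le_pow₀ hQ1 (n := 14)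
    linarith)
  have him := Complex.abs_im_le_norm z
  have hre := Complex.abs_re_le_norm z
  have hzre := abs_le.mp hre
  have e1 : |c.im| - 1 ≤ |(c + z).im| := by
    rw [Complex.add_im]
    have := abs_sub_abs_le_abs_sub c.im (-z.im)
    rw [abs_neg, sub_neg_eq_add] at this
    linarith
  have e2 : |(c + z).im| ≤ |c.im| + 1 := by
    rw [Complex.add_im]
    have := abs_add_le c.im z.im
    linarith
  have hε : 0 < 1 / (20 * Q ^ 15) := by positivity
  have hζ := norm_riemannZeta_le_of_height hQ1 (s := c + z) (by linarith) (by linarith) (by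
    rw [Complex.add_re]
    have : 1 / (2 * Q ^ 14) ≤ 1 / Q ^ 14 := by
      refine one_div_le_one_div_of_le (by positivity) ?_
      have := one_le_pow₀ hQ1 (n := 14)
      linarith
    linarith) (by rw [Complex.add_re]; linarith)
  have hcre : 1 < c.re := by linarith
  have h5 := one_le_norm_riemannZeta_mul hcre
  have h6 : ‖riemannZeta (c.re : ℂ)‖ ≤ 20 * C * Q ^ 15 := by
    refine (hCb c.re hcre (by linarith)).1.trans ?_
    rw [div_le_iff₀ (by linarith)]
    have : 1 = 20 * Q ^ 15 * (1 / (20 * Q ^ 15)) := by field_simp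
    calc C = 20 * C * Q ^ 15 * (1 / (20 * Q ^ 15)) := by field_simp
      _ ≤ 20 * C * Q ^ 15 * (c.re - 1) := by gcongr; linarith
  have hT := two_le_zetaHeight
  have him1 : ∀ s : ℂ, 1 ≤ |s.im| → s ≠ 1 := by rintro s hs rfl; simp at hs; linarith
  rw [riemannZeta₁_eq_mul (him1 _ (by linarith)), riemannZeta₁_eq_mul (him1 _ (by linarith)),
    norm_mul, norm_mul]
  have h7 : 1 ≤ ‖c - 1‖ := by
    have := Complex.abs_im_le_norm (c - 1)
    simp only [Complex.sub_im, Complex.one_im, sub_zero] at this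
    linarith
  have h8 : ‖c + z - 1‖ ≤ 2 * ‖c - 1‖ := by
    have : c + z - 1 = (c - 1) + z := by ring
    rw [this]
    have := norm_add_le (c - 1) z
    linarith
  have h9 : Real.exp (32 * Real.log Q) = Q ^ 32 := by
    rw [show (32 : ℝ) * Real.log Q = Real.log (Q ^ 32) by rw [Real.log_pow]; norm_num,
      Real.exp_log (by positivity)]
  rw [h9]
  have h10 : 1 ≤ 20 * C * Q ^ 15 * ‖riemannZeta c‖ :=
    h5.trans (mul_le_mul_of_nonneg_right h6 (norm_nonneg _))
  calc ‖c + z - 1‖ * ‖riemannZeta (c + z)‖ ≤ (2 * ‖c - 1‖) * (54 * Q ^ 16) := by gcongr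
    _ = (2 * ‖c - 1‖) * (54 * Q ^ 16) * 1 := by ring
    _ ≤ (2 * ‖c - 1‖) * (54 * Q ^ 16) * (20 * C * Q ^ 15 * ‖riemannZeta c‖) := by gcongr
    _ = (2160 * C) * (Q ^ 31 * ‖c - 1‖ * ‖riemannZeta c‖) := by ring
    _ ≤ Q * (Q ^ 31 * ‖c - 1‖ * ‖riemannZeta c‖) := by gcongr
    _ = _ := by ring

lemma logDeriv_comp_add (f : ℂ → ℂ) (c z : ℂ) :
    logDeriv (fun z => f (c + z)) z = logDeriv f (c + z) := by
  simp only [logDeriv_apply]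
  rw [deriv_comp_const_add]

lemma exists_zero_free_high : ∃ K : ℝ, 2 ≤ K ∧ ∀ Q ≥ K, ∀ s : ℂ, zetaHeight + 1 ≤ |s.im| →
    |s.im| ≤ Real.exp (Q ^ 16) / 3 → 1 - 1 / (5 * Q ^ 15) ≤ s.re → riemannZeta₁ s ≠ 0 := by
  obtain ⟨C, hC, hCb⟩ := exists_zeta_bound_real
  obtain ⟨K, hK, hdisc⟩ := exists_disc_bound
  have hlog : ∀ᶠ Q : ℝ in Filter.atTop, Real.log Q ≤ 1 / 6400 * Q := by
    have := Real.isLittleO_log_id_atTop.def (c := 1 / 6400) (by norm_num)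
    filter_upwards [this, Filter.eventually_ge_atTop 1] with Q h1 h2
    rw [id, Real.norm_of_nonneg (Real.log_nonneg h2), Real.norm_of_nonneg (by linarith)] at h1
    exact h1
  obtain ⟨K1, hK1⟩ := Filter.eventually_atTop.mp hlog
  refine ⟨max K (max K1 (200 * (3 * C + 5) + 2000)), le_max_of_le_left hK, fun Q hQ s h1 h2 h3 h0 => ?_⟩
  have hQK : K ≤ Q := (le_max_left _ _).trans hQ
  have hQ1 := hK1 Q (((le_max_left _ _).trans (le_max_right _ _)).trans hQ)
  have hQ2 : 200 * (3 * C + 5) + 2000 ≤ Q := ((le_max_right _ _).trans (le_max_right _ _)).trans hQ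
  have hQ0 : 1 ≤ Q := by linarith
  have hT := two_le_zetaHeight
  have hre1 : s.re < 1 := by
    by_contra! h
    exact riemannZeta₁_ne_zero_of_one_le_re h h0
  set ε : ℝ := 1 / Q ^ 15 with hε
  have hε0 : 0 < ε := by positivity
  set R : ℝ := 1 / (2 * Q ^ 14) with hR
  have hR0 : 0 < R := by positivity
  have hM0 : 0 < 32 * Real.log Q := by
    have := Real.log_pos (show 1 < Q by linarith); linarith
  have hQ14 : 1 ≤ Q ^ 14 := one_le_pow₀ hQ0
  have h5e : 1 / (5 * Q ^ 15) = ε / 5 := by rw [hε]; field_simp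
  have h20e : 1 / (20 * Q ^ 15) = ε / 20 := by rw [hε]; field_simp
  have hεhalf : ε ≤ 1 / 2 := by
    rw [hε]; refine one_div_le_one_div_of_le (by norm_num) ?_
    calc (2 : ℝ) ≤ Q := by linarith
      _ ≤ Q ^ 15 := le_self_pow₀ hQ0 (by norm_num)
  have hεR : 6 / 5 * ε ≤ R := by
    rw [hε, hR, mul_one_div, div_le_div_iff₀ (by positivity) (by positivity)]
    have : Q ^ 15 = Q * Q ^ 14 := by ring
    rw [this]
    nlinarith
  rw [h5e] at h3
  have main : ∀ u : ℝ, zetaHeight + 1 ≤ |u| → |u| + 1 ≤ Real.exp (Q ^ 16) →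
      -(2 * (32 * Real.log Q) / R) ≤ (logDeriv riemannZeta₁ ((1 + ε : ℝ) + u * Complex.I)).re ∧
      ∀ d : ℝ, 0 < d → d ≤ R → riemannZeta₁ ((1 + ε : ℝ) + u * Complex.I + (-(d : ℂ))) = 0 →
      1 / d - d / R ^ 2 - 2 * (32 * Real.log Q) / R
        ≤ (logDeriv riemannZeta₁ ((1 + ε : ℝ) + u * Complex.I)).re := by
    intro u hu1 hu2
    set c : ℂ := (1 + ε : ℝ) + u * Complex.I with hc
    have hcre : c.re = 1 + ε := by simp [hc]
    have hcim : c.im = u := by simp [hc]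
    have := re_logDeriv_ge (f := fun z => riemannZeta₁ (c + z)) hR0 hM0
      (differentiable_riemannZeta₁.comp (differentiable_id.const_add c))
      (by simpa using riemannZeta₁_ne_zero_of_one_le_re (s := c) (by rw [hcre]; linarith))
      (fun z hz => by
        simpa using hdisc Q hQK c (by rwa [hcim]) (by rwa [hcim]) (by rw [hcre, h20e]; linarith)
          (by rw [hcre]; linarith) z hz)
      (fun z hz hz0 => by
        by_contra! h
        exact riemannZeta₁_ne_zero_of_one_le_re (s := c + z)
          (by rw [Complex.add_re, hcre]; linarith) hz0)
    rw [logDeriv_comp_add, add_zero] at this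
    exact this
  have hexp : 3 * |s.im| ≤ Real.exp (Q ^ 16) := by linarith
  obtain ⟨-, hm1⟩ := main s.im h1 (by linarith)
  obtain ⟨hm2, -⟩ := main (2 * s.im) (by rw [abs_mul, abs_two]; linarith)
    (by rw [abs_mul, abs_two]; linarith)
  have hd0 : 0 < 1 + ε - s.re := by linarith
  have hd1 : 1 + ε - s.re ≤ 6 / 5 * ε := by linarith
  have hm1' := hm1 (1 + ε - s.re) hd0 (hd1.trans hεR) (by
    rw [show ((1 + ε : ℝ) : ℂ) + s.im * Complex.I + -((1 + ε - s.re : ℝ) : ℂ) = s by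
      rw [Complex.ofReal_sub]
      conv_rhs => rw [← Complex.re_add_im s]
      ring]
    exact h0)
  have h341 := re_LSeries_vonMangoldt_nonneg (σ := 1 + ε) (by linarith) s.im
  have hL : ∀ u : ℝ, (LSeries (fun n : ℕ => (Λ n : ℂ)) ((1 + ε : ℝ) + u * Complex.I)).re =
      (1 / (((1 + ε : ℝ) : ℂ) + u * Complex.I - 1)).re
        - (logDeriv riemannZeta₁ ((1 + ε : ℝ) + u * Complex.I)).re := by
    intro u
    rw [logDeriv_riemannZeta₁_eq (by simpa using hε0), Complex.sub_re]
    ring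
  have hpole : ∀ u : ℝ, 1 ≤ |u| → (1 / (((1 + ε : ℝ) : ℂ) + u * Complex.I - 1)).re ≤ 1 := by
    intro u hu
    refine (Complex.re_le_norm _).trans ?_
    rw [norm_div, norm_one]
    refine (div_le_one (lt_of_lt_of_le ?_ (Complex.abs_im_le_norm _))).mpr
      (le_trans ?_ (Complex.abs_im_le_norm _))
    · simp only [Complex.sub_im, Complex.add_im, Complex.ofReal_im, Complex.mul_im,
        Complex.ofReal_re, Complex.I_im, Complex.I_re, Complex.one_im]
      ring_nf; linarith
    · simp only [Complex.sub_im, Complex.add_im, Complex.ofReal_im, Complex.mul_im,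
        Complex.ofReal_re, Complex.I_im, Complex.I_re, Complex.one_im]
      ring_nf; linarith
  have hL0 : (LSeries (fun n : ℕ => (Λ n : ℂ)) ((1 + ε : ℝ) : ℂ)).re ≤ 1 / ε + C := by
    have h := hL 0
    simp only [Complex.ofReal_zero, zero_mul, add_zero] at h
    rw [h]
    have e1 : (1 / (((1 + ε : ℝ) : ℂ) - 1)) = ((1 / ε : ℝ) : ℂ) := by push_cast; ring
    have e2 := (hCb (1 + ε) (by linarith) (by linarith)).2
    have e3 := (abs_le.mp ((Complex.abs_re_le_norm _).trans e2)).1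
    rw [e1, Complex.ofReal_re]
    linarith
  rw [hL, hL] at h341
  have hp1 := hpole s.im (by linarith)
  have hp2 := hpole (2 * s.im) (by rw [abs_mul, abs_two]; linarith)
  set d := 1 + ε - s.re
  have f1 : 1 / d ≥ 5 / 6 * Q ^ 15 := by
    have : 1 / (6 / 5 * ε) ≤ 1 / d := one_div_le_one_div_of_le hd0 hd1
    refine le_trans (le_of_eq ?_) this
    rw [hε]; field_simp
  have f2 : d / R ^ 2 ≤ 5 * Q ^ 14 := by
    rw [div_le_iff₀ (by positivity)]
    refine hd1.trans ?_
    rw [hε, hR]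
    have : 5 * Q ^ 14 * (1 / (2 * Q ^ 14)) ^ 2 = 5 / 4 * (1 / Q ^ 14) := by field_simp; norm_num
    rw [this]
    have : 1 / Q ^ 15 ≤ 1 / Q ^ 14 := one_div_le_one_div_of_le (by positivity)
      (pow_le_pow_right₀ hQ0 (by norm_num))
    nlinarith [show 0 < 1 / Q ^ 15 by positivity]
  have f3 : 2 * (32 * Real.log Q) / R ≤ 1 / 50 * Q ^ 15 := by
    rw [hR]
    have : 2 * (32 * Real.log Q) / (1 / (2 * Q ^ 14)) = 128 * Q ^ 14 * Real.log Q := by field_simp; ring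
    rw [this]
    calc 128 * Q ^ 14 * Real.log Q ≤ 128 * Q ^ 14 * (1 / 6400 * Q) := by gcongr
      _ = _ := by ring
  have f4 : 1 / ε = Q ^ 15 := by rw [hε, one_div_one_div]
  have f5 : Q * Q ^ 14 = Q ^ 15 := by ring
  have f6 : (200 * (3 * C + 5) + 2000) * Q ^ 14 ≤ Q ^ 15 := by
    rw [← f5]; gcongr
  rw [f4] at hL0
  have f7 : 200 * (3 * C + 5) ≤ 200 * (3 * C + 5) * Q ^ 14 := le_mul_of_one_le_right (by positivity) hQ14
  have f8 : 0 < Q ^ 15 := by positivity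
  linarith

end

lemma riemannZeta₁_ne_zero_near_compact (T : ℝ) : ∃ η : ℝ, 0 < η ∧ η ≤ 1 / 2 ∧ ∀ s : ℂ,
    |s.im| ≤ T → 1 - η ≤ s.re → riemannZeta₁ s ≠ 0 := by
  have hcomp : IsCompact ((Set.Icc (1 / 2 : ℝ) 1 ×ℂ Set.Icc (-T) T) ∩ {s | riemannZeta₁ s = 0}) :=
    (isCompact_Icc.reProdIm isCompact_Icc).inter_right
      (isClosed_eq differentiable_riemannZeta₁.continuous continuous_const)
  rcases ((Set.Icc (1 / 2 : ℝ) 1 ×ℂ Set.Icc (-T) T) ∩ {s | riemannZeta₁ s = 0}).eq_empty_or_nonempty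
    with h | h
  · refine ⟨1 / 2, by norm_num, le_rfl, fun s h1 h2 h3 => ?_⟩
    rcases le_or_gt 1 s.re with h4 | h4
    · exact riemannZeta₁_ne_zero_of_one_le_re h4 h3
    · have : s ∈ ((Set.Icc (1 / 2 : ℝ) 1 ×ℂ Set.Icc (-T) T) ∩ {s | riemannZeta₁ s = 0}) :=
        ⟨⟨⟨by linarith, h4.le⟩, abs_le.mp h1⟩, h3⟩
      rw [h] at this; exact this
  · obtain ⟨s0, hs0, hmax⟩ := hcomp.exists_isMaxOn h Complex.continuous_re.continuousOn
    have h5 : s0.re < 1 := by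
      by_contra! h6
      exact riemannZeta₁_ne_zero_of_one_le_re h6 hs0.2
    have h6 : 1 / 2 ≤ s0.re := hs0.1.1.1
    refine ⟨(1 - s0.re) / 2, by linarith, by linarith, fun s h1 h2 h3 => ?_⟩
    rcases le_or_gt 1 s.re with h4 | h4
    · exact riemannZeta₁_ne_zero_of_one_le_re h4 h3
    · have : s ∈ ((Set.Icc (1 / 2 : ℝ) 1 ×ℂ Set.Icc (-T) T) ∩ {s | riemannZeta₁ s = 0}) :=
        ⟨⟨⟨by linarith, h4.le⟩, abs_le.mp h1⟩, h3⟩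
      have := hmax this
      simp only [Set.mem_ofPred_eq] at this
      linarith

lemma exists_zero_free : ∃ K : ℝ, 2 ≤ K ∧ ∀ Q ≥ K, ∀ s : ℂ,
    |s.im| ≤ Real.exp (Q ^ 16) / 3 → 1 - 1 / (5 * Q ^ 15) ≤ s.re → riemannZeta₁ s ≠ 0 := by
  obtain ⟨K, hK, h1⟩ := exists_zero_free_high
  obtain ⟨η, hη, -, h2⟩ := riemannZeta₁_ne_zero_near_compact (zetaHeight + 1)
  refine ⟨max K (1 / η), le_max_of_le_left hK, fun Q hQ s hs hσ => ?_⟩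
  have hQK : K ≤ Q := (le_max_left _ _).trans hQ
  have hQη : 1 / η ≤ Q := (le_max_right _ _).trans hQ
  rcases le_total (zetaHeight + 1) |s.im| with h | h
  · exact h1 Q hQK s h hs hσ
  · refine h2 s h ?_
    have h3 : 1 / (5 * Q ^ 15) ≤ 1 / Q := by
      refine one_div_le_one_div_of_le (by linarith) ?_
      have : Q ≤ Q ^ 15 := le_self_pow₀ (by linarith) (by norm_num)
      linarith
    have h4 : 1 / Q ≤ η := by
      rw [div_le_iff₀ (by linarith)]
      rw [div_le_iff₀ hη] at hQη
      linarith
    linarith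

/-- The Dirichlet series `∑ (Λ(n) - 1) n⁻ˢ`, continued. -/
noncomputable def primeF (s : ℂ) : ℂ := -logDeriv riemannZeta₁ s - riemannZeta₀ s

lemma exists_logDeriv_bound_high : ∃ K : ℝ, 2 ≤ K ∧ ∀ Q ≥ K, ∀ s : ℂ, zetaHeight + 2 ≤ |s.im| →
    |s.im| ≤ Real.exp (Q ^ 16) / 4 → 1 - 1 / (40 * Q ^ 15) ≤ s.re → s.re ≤ 5 / 4 →
    ‖logDeriv riemannZeta₁ s‖ ≤ Q ^ 17 := by
  obtain ⟨K, hK, hzf⟩ := exists_zero_free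
  obtain ⟨K2, hK2, hdisc⟩ := exists_disc_bound
  refine ⟨max (max K K2) 2560, le_max_of_le_left (le_max_of_le_left hK),
    fun Q hQ s h1 h2 h3 h4 => ?_⟩
  have hQK : K ≤ Q := ((le_max_left _ _).trans (le_max_left _ _)).trans hQ
  have hQK2 : K2 ≤ Q := ((le_max_right _ _).trans (le_max_left _ _)).trans hQ
  have hQ2 : 2560 ≤ Q := (le_max_right _ _).trans hQ
  have hQ1 : 1 ≤ Q := by linarith
  have hT := two_le_zetaHeight
  set ε : ℝ := 1 / Q ^ 15 with hε
  have hε0 : 0 < ε := by positivity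
  have e5 : 1 / (5 * Q ^ 15) = ε / 5 := by rw [hε]; field_simp
  have e20 : 1 / (20 * Q ^ 15) = ε / 20 := by rw [hε]; field_simp
  have e40 : 1 / (40 * Q ^ 15) = ε / 40 := by rw [hε]; field_simp
  have hlog : Real.log Q ≤ Q := (Real.log_le_sub_one_of_pos (by linarith)).trans (by linarith)
  have hM0 : 0 < 32 * Real.log Q := by
    have := Real.log_pos (show 1 < Q by linarith); linarith
  have hε1 : ε ≤ 1 / 2 := by
    rw [hε]; refine one_div_le_one_div_of_le (by norm_num) ?_
    calc (2 : ℝ) ≤ Q := by linarith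
      _ ≤ Q ^ 15 := le_self_pow₀ hQ1 (by norm_num)
  have hR14 : ε / 5 ≤ 1 / (2 * Q ^ 14) := by
    rw [← e5]
    refine one_div_le_one_div_of_le (by positivity) ?_
    have : Q ^ 14 ≤ Q ^ 15 := pow_le_pow_right₀ hQ1 (by norm_num)
    have h0 : 0 < Q ^ 14 := by positivity
    linarith
  obtain ⟨σ, hσ1, hσ2, hσ3, hσ4⟩ : ∃ σ : ℝ, 1 + ε / 20 ≤ σ ∧ σ ≤ 3 / 2 ∧ s.re ≤ σ ∧
      σ - s.re ≤ 3 / 40 * ε := by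
    rw [e40] at h3
    refine ⟨max s.re (1 + ε / 20), le_max_right _ _, max_le (by linarith) (by linarith),
      le_max_left _ _, ?_⟩
    rw [sub_le_iff_le_add]
    exact max_le (by linarith) (by linarith)
  set c : ℂ := ⟨σ, s.im⟩ with hc
  set z0 : ℂ := s - c with hz0
  have hz0n : ‖z0‖ ≤ 3 / 40 * ε := by
    have : z0 = ((s.re - σ : ℝ) : ℂ) := by
      apply Complex.ext <;> simp [hz0, hc]
    rw [this, Complex.norm_real, Real.norm_eq_abs, abs_sub_comm, abs_of_nonneg (by linarith)]
    exact hσ4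
  have hne : ∀ z ∈ Metric.ball (0 : ℂ) (ε / 5), riemannZeta₁ (c + z) ≠ 0 := by
    intro z hz
    rw [mem_ball_zero_iff] at hz
    have him := Complex.abs_im_le_norm z
    have hre := abs_le.mp (Complex.abs_re_le_norm z)
    refine hzf Q hQK _ ?_ ?_
    · rw [Complex.add_im]
      have : |s.im + z.im| ≤ |s.im| + |z.im| := abs_add_le _ _
      simp only [hc]
      linarith
    · rw [Complex.add_re, e5]
      simp only [hc]
      linarith
  obtain ⟨Lg, hL1, -, -, hL4⟩ := norm_log_le_of_ne_zero (f := fun z => riemannZeta₁ (c + z))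
    (R := ε / 5) (by positivity) hM0
    (differentiable_riemannZeta₁.comp (differentiable_id.const_add c)) hne (by
      intro z hz
      rw [mem_ball_zero_iff] at hz
      simpa using hdisc Q hQK2 c (by simp only [hc]; linarith) (by simp only [hc]; linarith)
        (by simp only [hc]; rw [e20]; linarith) (by simpa only [hc] using hσ2) z (by linarith))
  have hsub : ∀ z ∈ Metric.closedBall z0 (ε / 40), ‖z‖ ≤ ε / 10 := by
    intro z hz
    rw [mem_closedBall_iff_norm] at hz
    have := norm_add_le (z - z0) z0
    rw [sub_add_cancel] at this
    linarith
  have hder : ‖deriv Lg z0‖ ≤ 2 * (32 * Real.log Q) / (ε / 40) := by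
    refine Complex.norm_deriv_le_of_forall_mem_sphere_norm_le (by positivity) ?_ ?_
    · refine DifferentiableOn.diffContOnCl fun z hz => ?_
      rw [closure_ball _ (by positivity)] at hz
      exact (hL1 z (by rw [mem_ball_zero_iff]; linarith [hsub z hz])).differentiableAt
        |>.differentiableWithinAt
    · intro z hz
      have h5 := hsub z (Metric.sphere_subset_closedBall hz)
      refine (hL4 z (by rw [mem_ball_zero_iff]; linarith)).trans ?_
      rw [div_le_iff₀ (by linarith)]
      exact mul_le_mul_of_nonneg_left (by linarith) (by linarith)
  rw [(hL1 z0 (by rw [mem_ball_zero_iff]; linarith)).deriv, logDeriv_comp_add,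
    show c + z0 = s by rw [hz0]; ring] at hder
  refine hder.trans ?_
  have : 2 * (32 * Real.log Q) / (ε / 40) = 2560 * Real.log Q * Q ^ 15 := by
    rw [hε]; field_simp; ring
  rw [this]
  have hlog0 : 0 ≤ Real.log Q := by linarith
  calc 2560 * Real.log Q * Q ^ 15 ≤ Q * Q * Q ^ 15 := by gcongr
    _ = Q ^ 17 := by ring

/-- Zero-free region with a polynomial bound for the continued Dirichlet series. -/
theorem exists_primeF_bound : ∃ K : ℝ, 2 ≤ K ∧ ∀ Q ≥ K, ∀ s : ℂ,
    |s.im| ≤ Real.exp (Q ^ 16) / 4 → 1 - 1 / (40 * Q ^ 15) ≤ s.re → s.re ≤ 5 / 4 →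
    riemannZeta₁ s ≠ 0 ∧ ‖primeF s‖ ≤ Q ^ 18 := by
  obtain ⟨K, hK, hzf⟩ := exists_zero_free
  obtain ⟨K2, hK2, hhigh⟩ := exists_logDeriv_bound_high
  obtain ⟨η, hη, hη2, hηz⟩ := riemannZeta₁_ne_zero_near_compact (zetaHeight + 2)
  have hcomp : IsCompact (Set.Icc (1 - η) (5 / 4) ×ℂ Set.Icc (-(zetaHeight + 2)) (zetaHeight + 2)) :=
    isCompact_Icc.reProdIm isCompact_Icc
  obtain ⟨C, hC⟩ := hcomp.exists_bound_of_continuousOn (f := primeF) (by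
    intro s hs
    refine ContinuousAt.continuousWithinAt ?_
    have hd : Continuous (deriv riemannZeta₁) :=
      (differentiable_riemannZeta₁.contDiff (n := 1)).continuous_deriv_one
    have hne : riemannZeta₁ s ≠ 0 := hηz s (abs_le.mpr hs.2) hs.1.1
    exact ((hd.continuousAt.div differentiable_riemannZeta₁.continuous.continuousAt hne).neg).sub
      differentiable_riemannZeta₀.continuous.continuousAt)
  refine ⟨max (max K K2) (max 100 (max C (1 / η))), le_max_of_le_left (le_max_of_le_left hK),
    fun Q hQ s h1 h2 h3 => ?_⟩
  have hQK : K ≤ Q := ((le_max_left _ _).trans (le_max_left _ _)).trans hQ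
  have hQK2 : K2 ≤ Q := ((le_max_right _ _).trans (le_max_left _ _)).trans hQ
  have hQ' := (le_max_right _ _).trans hQ
  have hQ100 : 100 ≤ Q := (le_max_left _ _).trans hQ'
  have hQ'' := (le_max_right _ _).trans hQ'
  have hQC : C ≤ Q := (le_max_left _ _).trans hQ''
  have hQη : 1 / η ≤ Q := (le_max_right _ _).trans hQ''
  have hQ1 : 1 ≤ Q := by linarith
  have hT := two_le_zetaHeight
  have hsmall : 1 / (40 * Q ^ 15) ≤ 1 / (5 * Q ^ 15) :=
    one_div_le_one_div_of_le (by positivity) (by gcongr; norm_num)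
  refine ⟨hzf Q hQK s (h1.trans (by gcongr; norm_num)) (by linarith), ?_⟩
  rcases le_total (zetaHeight + 2) |s.im| with h | h
  · have h4 := hhigh Q hQK2 s h h1 h2 h3
    have hs1 : s ≠ 1 := by
      rintro rfl; simp at h; linarith
    have h5 : ‖riemannZeta₀ s‖ ≤ 54 * Q ^ 16 + 1 := by
      have e1 : riemannZeta₀ s = riemannZeta s - (s - 1)⁻¹ := by
        rw [riemannZeta_eq_inv_sub_add hs1]; ring
      have e2 : ‖(s - 1)⁻¹‖ ≤ 1 := by
        rw [norm_inv]
        refine inv_le_one_of_one_le₀ (le_trans ?_ (Complex.abs_im_le_norm _))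
        simp only [Complex.sub_im, Complex.one_im, sub_zero]; linarith
      have e3 := norm_riemannZeta_le_of_height hQ1 (s := s) (by linarith)
        (h1.trans (by linarith [Real.exp_pos (Q ^ 16)])) (by
          have : 1 / (40 * Q ^ 15) ≤ 1 / Q ^ 14 := by
            refine one_div_le_one_div_of_le (by positivity) ?_
            have : Q ^ 14 ≤ Q ^ 15 := pow_le_pow_right₀ hQ1 (by norm_num)
            have h0 : 0 < Q ^ 14 := by positivity
            linarith
          linarith) (by linarith)
      rw [e1]
      exact (norm_sub_le _ _).trans (by linarith)
    have h6 : ‖primeF s‖ ≤ ‖logDeriv riemannZeta₁ s‖ + ‖riemannZeta₀ s‖ := by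
      refine (norm_sub_le _ _).trans ?_
      rw [norm_neg]
    have h7 : 1 ≤ Q ^ 16 := one_le_pow₀ hQ1
    have h8 : Q ^ 17 = Q * Q ^ 16 := by ring
    have h9 : Q ^ 18 = Q * Q * Q ^ 16 := by ring
    nlinarith [mul_le_mul_of_nonneg_right hQ100 (show 0 ≤ Q * Q ^ 16 by positivity),
      mul_le_mul_of_nonneg_right hQ100 (show 0 ≤ Q ^ 16 by positivity)]
  · have h4 : 1 / (40 * Q ^ 15) ≤ η := by
      have h5 : 1 / (40 * Q ^ 15) ≤ 1 / Q := by
        refine one_div_le_one_div_of_le (by linarith) ?_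
        have : Q ≤ Q ^ 15 := le_self_pow₀ hQ1 (by norm_num)
        linarith
      have h6 : 1 / Q ≤ η := by
        rw [div_le_iff₀ (by linarith)]
        rw [div_le_iff₀ hη] at hQη
        linarith
      linarith
    have h5 := hC s ⟨⟨by linarith, h3⟩, abs_le.mp h⟩
    exact h5.trans (hQC.trans (le_self_pow₀ hQ1 (by norm_num)))

/-- The Mellin transform of the Riesz kernel `x ↦ max 0 (1 - x)`. -/
lemma hasMellin_riesz {s : ℂ} (hs : 0 < s.re) :
    HasMellin (fun x : ℝ => ((max 0 (1 - x) : ℝ) : ℂ)) s (1 / (s * (s + 1))) := by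
  have h1 := hasMellin_one_Ioc hs
  have h2 := hasMellin_cpow_Ioc 1 (s := s) (by simp; linarith)
  have h3 := hasMellin_sub h1.1 h2.1
  rw [h1.2, h2.2] at h3
  have hs0 : s ≠ 0 := by rintro rfl; simp at hs
  have hs1 : s + 1 ≠ 0 := by
    intro h
    have := congrArg Complex.re h
    simp at this; linarith
  have h4 : 1 / s - 1 / (s + 1) = 1 / (s * (s + 1)) := by field_simp; ring
  rw [h4] at h3
  have h5 : Set.EqOn (fun x : ℝ => ((max 0 (1 - x) : ℝ) : ℂ))
      (fun t : ℝ => (Set.Ioc 0 1).indicator (fun _ => (1 : ℂ)) t -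
      (Set.Ioc 0 1).indicator (fun t : ℝ => (t : ℂ) ^ (1 : ℂ)) t) (Set.Ioi 0) := by
    intro x hx
    have hx : 0 < x := hx
    rcases le_or_gt x 1 with h | h
    · simp [hx, h]
    · have : ¬ x ≤ 1 := by linarith
      simp [this, h.le]
  constructor
  · refine (MeasureTheory.integrableOn_congr_fun (fun t ht => ?_) measurableSet_Ioi).mpr h3.1
    exact congrArg (fun z : ℂ => (t : ℂ) ^ (s - 1) • z) (h5 ht)
  · rw [← h3.2]
    unfold mellin
    refine MeasureTheory.setIntegral_congr_fun measurableSet_Ioi (fun t ht => ?_)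
    exact congrArg (fun z : ℂ => (t : ℂ) ^ (s - 1) • z) (h5 ht)

lemma norm_perron_kernel_le {σ : ℝ} (hσ : σ ≠ 0) (h1 : σ ^ 2 ≤ (σ + 1) ^ 2) (hs : σ ^ 2 ≤ 1) (y : ℝ) :
    ‖1 / (((σ : ℂ) + y * Complex.I) * ((σ : ℂ) + y * Complex.I + 1))‖ ≤
      1 / σ ^ 2 * (1 + y ^ 2)⁻¹ := by
  have hb : ∀ a : ℝ, σ ^ 2 ≤ a ^ 2 → σ ^ 2 * (1 + y ^ 2) ≤ ‖(a : ℂ) + y * Complex.I‖ ^ 2 := by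
    intro a ha
    rw [Complex.sq_norm, Complex.normSq_add_mul_I]
    nlinarith [mul_nonneg (sub_nonneg.mpr hs) (sq_nonneg y)]
  have h2 := hb σ le_rfl
  have h3 := hb (σ + 1) h1
  have hp : 0 < σ ^ 2 := by positivity
  have h4 : ((σ : ℂ) + y * Complex.I + 1) = ((σ + 1 : ℝ) : ℂ) + y * Complex.I := by
    push_cast; ring
  rw [h4, norm_div, norm_one, norm_mul]
  have h5 : σ ^ 2 * (1 + y ^ 2) ≤ ‖(σ : ℂ) + y * Complex.I‖ * ‖((σ + 1 : ℝ) : ℂ) + y * Complex.I‖ := by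
    refine (pow_le_pow_iff_left₀ (by positivity) (by positivity) two_ne_zero).mp ?_
    rw [mul_pow (‖(σ : ℂ) + y * Complex.I‖), sq (σ ^ 2 * (1 + y ^ 2))]
    exact mul_le_mul h2 h3 (by positivity) (by positivity)
  calc _ ≤ 1 / (σ ^ 2 * (1 + y ^ 2)) := by
        apply one_div_le_one_div_of_le (by positivity) h5
    _ = _ := by field_simp

lemma continuous_perron_kernel {σ : ℝ} (hσ : σ ≠ 0) (h1 : σ + 1 ≠ 0) : Continuous fun y : ℝ =>
    1 / (((σ : ℂ) + y * Complex.I) * ((σ : ℂ) + y * Complex.I + 1)) := by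
  refine continuous_const.div (by fun_prop) (fun y => mul_ne_zero ?_ ?_)
  · intro h; exact hσ (by simpa using congrArg Complex.re h)
  · intro h; exact h1 (by simpa using congrArg Complex.re h)

lemma integrable_perron_kernel {σ : ℝ} (hσ : 0 < σ) (hs : σ ≤ 1) : MeasureTheory.Integrable fun y : ℝ =>
    1 / (((σ : ℂ) + y * Complex.I) * ((σ : ℂ) + y * Complex.I + 1)) :=
  (integrable_inv_one_add_sq.const_mul (1 / σ ^ 2)).mono'
    (continuous_perron_kernel hσ.ne' (by linarith)).aestronglyMeasurable
    (.of_forall (norm_perron_kernel_le hσ.ne' (by nlinarith) (by nlinarith)))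

/-- Perron's formula with the Riesz kernel. -/
lemma perron_riesz {σ : ℝ} (hσ : 0 < σ) (hs : σ ≤ 1) {x : ℝ} (hx : 0 < x) :
    ∫ y : ℝ, (x : ℂ) ^ ((σ : ℂ) + y * Complex.I) *
      (1 / (((σ : ℂ) + y * Complex.I) * ((σ : ℂ) + y * Complex.I + 1))) =
      2 * Real.pi * ((max 0 (1 - x⁻¹) : ℝ) : ℂ) := by
  have hre : ∀ y : ℝ, 0 < ((σ : ℂ) + y * Complex.I).re := by intro y; simpa using hσ
  have hm : ∀ y : ℝ, mellin (fun x : ℝ => ((max 0 (1 - x) : ℝ) : ℂ)) ((σ : ℂ) + y * Complex.I) =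
      1 / (((σ : ℂ) + y * Complex.I) * ((σ : ℂ) + y * Complex.I + 1)) := fun y =>
    (hasMellin_riesz (hre y)).2
  have h := mellinInv_mellin_eq σ (fun x : ℝ => ((max 0 (1 - x) : ℝ) : ℂ)) (inv_pos.mpr hx)
    (hasMellin_riesz (by simpa using hσ)).1
    ((integrable_perron_kernel hσ hs).congr (.of_forall fun y => (hm y).symm))
    (by fun_prop)
  unfold mellinInv at h
  rw [← h, Complex.real_smul, ← mul_assoc]
  have hpi : (2 * Real.pi : ℂ) * ((1 / (2 * Real.pi) : ℝ) : ℂ) = 1 := by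
    push_cast
    have : (Real.pi : ℂ) ≠ 0 := by exact_mod_cast Real.pi_ne_zero
    field_simp
  rw [hpi, one_mul]
  congr 1
  funext y
  rw [hm, smul_eq_mul, Complex.cpow_neg, Complex.ofReal_inv, Complex.inv_cpow, inv_inv]
  rw [Complex.arg_ofReal_of_nonneg hx.le]; exact Real.pi_pos.ne

section
open scoped ArithmeticFunction.vonMangoldt ArithmeticFunction.zeta

/-- The arithmetic function `Λ - 1`, vanishing at `0`. -/
noncomputable def lamOne (n : ℕ) : ℝ := if n = 0 then 0 else Λ n - 1

@[simp] lemma lamOne_zero : lamOne 0 = 0 := by simp [lamOne]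

lemma lamOne_of_pos {n : ℕ} (hn : 1 ≤ n) : lamOne n = Λ n - 1 := by
  simp [lamOne, show n ≠ 0 by omega]

lemma LSeriesHasSum_lamOne {s : ℂ} (hs : 1 < s.re) :
    LSeriesHasSum (fun n => (lamOne n : ℂ)) s (primeF s) := by
  have h1 : s ≠ 1 := by rintro rfl; simp at hs
  have h2 := (ArithmeticFunction.LSeriesSummable_vonMangoldt hs).LSeriesHasSum
  have h3 := (LSeriesSummable_one_iff.mpr hs).LSeriesHasSum
  rw [LSeries_one_eq_riemannZeta hs] at h3
  have h4 : primeF s = LSeries (fun n : ℕ => (Λ n : ℂ)) s - riemannZeta s := by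
    rw [primeF, logDeriv_riemannZeta₁_eq hs, riemannZeta_eq_inv_sub_add h1]; ring
  rw [h4]
  refine (LSeriesHasSum_congr _ _ fun {n} hn => ?_).mp (h2.sub h3)
  simp [lamOne_of_pos (Nat.one_le_iff_ne_zero.mpr hn)]

lemma exists_lamOne_sum_bound : ∃ C : ℝ, 1 ≤ C ∧ ∀ σ : ℝ, 1 < σ → σ ≤ 2 →
    Summable (fun n : ℕ => |lamOne n| * (n : ℝ) ^ (-σ)) ∧
    ∑' n : ℕ, |lamOne n| * (n : ℝ) ^ (-σ) ≤ C / (σ - 1) := by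
  obtain ⟨C, hC, h⟩ := exists_zeta_bound_real
  refine ⟨3 * C, by linarith, fun σ hσ hσ2 => ?_⟩
  obtain ⟨ha, hb⟩ := h σ hσ hσ2
  have hs : 1 < (σ : ℂ).re := by simpa using hσ
  have h2 := (ArithmeticFunction.LSeriesSummable_vonMangoldt hs).LSeriesHasSum
  have h3 := (LSeriesSummable_one_iff.mpr hs).LSeriesHasSum
  rw [LSeries_one_eq_riemannZeta hs] at h3
  have hterm : ∀ n : ℕ, LSeries.term ((fun n : ℕ => (Λ n : ℂ)) + 1) (σ : ℂ) n =
      (((if n = 0 then 0 else (Λ n + 1) * (n : ℝ) ^ (-σ)) : ℝ) : ℂ) := by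
    intro n
    rcases Nat.eq_zero_or_pos n with rfl | hn
    · simp
    · rw [LSeries.term_of_ne_zero hn.ne', if_neg hn.ne', Complex.ofReal_mul,
        Complex.ofReal_cpow (Nat.cast_nonneg n), div_eq_mul_inv, ← Complex.cpow_neg]
      simp
  have h4 : HasSum (fun n : ℕ => LSeries.term ((fun n : ℕ => (Λ n : ℂ)) + 1) (σ : ℂ) n)
      (LSeries (fun n : ℕ => (Λ n : ℂ)) (σ : ℂ) + riemannZeta σ) := h2.add h3
  simp only [hterm] at h4
  have h5 := Complex.hasSum_re h4
  simp only [Complex.ofReal_re] at h5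
  have hle : ∀ n : ℕ, |lamOne n| * (n : ℝ) ^ (-σ) ≤
      if n = 0 then 0 else (Λ n + 1) * (n : ℝ) ^ (-σ) := by
    intro n
    split_ifs with hn
    · simp [hn]
    · gcongr
      rw [lamOne, if_neg hn]
      have : 0 ≤ Λ n := ArithmeticFunction.vonMangoldt_nonneg
      rw [abs_le]; constructor <;> linarith
  have hsum := h5.summable.of_nonneg_of_le (fun n => by positivity) hle
  refine ⟨hsum, (hsum.tsum_le_tsum hle h5.summable).trans ?_⟩
  rw [h5.tsum_eq]
  refine (Complex.re_le_norm _).trans ?_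
  have h6 := logDeriv_riemannZeta₁_eq hs
  have h7 : LSeries (fun n : ℕ => (Λ n : ℂ)) (σ : ℂ) = ((1 / (σ - 1) : ℝ) : ℂ) - logDeriv riemannZeta₁ σ := by
    rw [h6]; push_cast; ring
  rw [h7]
  have h8 : 0 < σ - 1 := by linarith
  calc _ ≤ ‖((1 / (σ - 1) : ℝ) : ℂ)‖ + ‖logDeriv riemannZeta₁ σ‖ + ‖riemannZeta σ‖ :=
        (norm_add_le _ _).trans (by gcongr; exact norm_sub_le _ _)
    _ ≤ 1 / (σ - 1) + C + C / (σ - 1) := by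
        rw [Complex.norm_real, Real.norm_of_nonneg (by positivity)]
        gcongr
    _ ≤ _ := by
        rw [div_add' _ _ _ h8.ne', ← add_div]
        gcongr
        nlinarith
end

lemma norm_primeF_le_of_one_lt_re {C : ℝ} (h : ∀ σ : ℝ, 1 < σ → σ ≤ 2 →
    Summable (fun n : ℕ => |lamOne n| * (n : ℝ) ^ (-σ)) ∧
    ∑' n : ℕ, |lamOne n| * (n : ℝ) ^ (-σ) ≤ C / (σ - 1)) {s : ℂ} (hs : 1 < s.re) (hs2 : s.re ≤ 2) :
    ‖primeF s‖ ≤ C / (s.re - 1) := by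
  rw [← (LSeriesHasSum_lamOne hs).LSeries_eq, LSeries]
  refine (tsum_of_norm_bounded (h _ hs hs2).1.hasSum fun n => ?_).trans (h _ hs hs2).2
  rw [LSeries.norm_term_eq]
  split_ifs with hn
  · simp [hn]
  · rw [Complex.norm_real, Real.rpow_neg (Nat.cast_nonneg _), div_eq_mul_inv, Real.norm_eq_abs]

/-- The Riesz mean of the Dirichlet series of `Λ - 1`. -/
noncomputable def rieszSum (V : ℝ) (s : ℂ) : ℂ :=
  ∑ n ∈ range ⌈V⌉₊, ((lamOne n * max 0 (1 - n / V) : ℝ) : ℂ) * (n : ℂ) ^ (-s)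

lemma integral_primeF_perron {V c : ℝ} (hV : 1 ≤ V) (hc : 0 < c) (hc1 : c ≤ 1) {s : ℂ}
    (hs : s.re = 1) :
    ∫ y : ℝ, primeF (s + (c + y * Complex.I)) * ((V : ℂ) ^ ((c : ℂ) + y * Complex.I) *
      (1 / (((c : ℂ) + y * Complex.I) * ((c : ℂ) + y * Complex.I + 1)))) =
      2 * Real.pi * rieszSum V s := by
  obtain ⟨C, hC, hb⟩ := exists_lamOne_sum_bound
  have hV0 : 0 < V := by linarith
  set K : ℝ → ℂ := fun y => 1 / (((c : ℂ) + y * Complex.I) * ((c : ℂ) + y * Complex.I + 1)) with hK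
  have hKi : MeasureTheory.Integrable K := integrable_perron_kernel hc hc1
  set G : ℕ → ℝ → ℂ := fun n y => ((lamOne n : ℂ) * (n : ℂ) ^ (-s)) *
    (((V / n : ℝ) : ℂ) ^ ((c : ℂ) + y * Complex.I) * K y) with hG
  have hnV : ∀ n : ℕ, 1 ≤ n → 0 < V / n := fun n hn => by
    have : (0 : ℝ) < n := by exact_mod_cast hn
    positivity
  have hGnorm : ∀ n : ℕ, 1 ≤ n → ∀ y, ‖G n y‖ =
      (|lamOne n| * (n : ℝ) ^ (-(1 + c))) * V ^ c * ‖K y‖ := by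
    intro n hn y
    have hn0 : (0 : ℝ) < n := by exact_mod_cast hn
    simp only [hG, norm_mul]
    rw [Complex.norm_real, Complex.norm_natCast_cpow_of_pos hn,
      Complex.norm_cpow_eq_rpow_re_of_pos (hnV n hn)]
    simp only [Complex.neg_re, hs, Complex.add_re, Complex.ofReal_re, Complex.mul_re,
      Complex.I_re, mul_zero, Complex.ofReal_im, Complex.I_im, sub_zero, add_zero,
      mul_one, Real.norm_eq_abs]
    rw [Real.div_rpow hV0.le hn0.le, neg_add, Real.rpow_add hn0, Real.rpow_neg hn0.le c]
    ring
  have hG0 : ∀ y, G 0 y = 0 := by intro y; simp [hG]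
  have hGint : ∀ n, MeasureTheory.Integrable (G n) := by
    intro n
    rcases Nat.eq_zero_or_pos n with rfl | hn
    · rw [show G 0 = fun _ => 0 from funext hG0]; exact MeasureTheory.integrable_zero _ _ _
    · refine (hKi.norm.const_mul ((|lamOne n| * (n : ℝ) ^ (-(1 + c))) * V ^ c)).mono' ?_
        (.of_forall fun y => (hGnorm n hn y).le)
      refine Continuous.aestronglyMeasurable ?_
      have h1 : Continuous fun y : ℝ => ((V / n : ℝ) : ℂ) ^ ((c : ℂ) + y * Complex.I) := by
        refine Continuous.const_cpow (by fun_prop) (Or.inl ?_)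
        exact_mod_cast (hnV n hn).ne'
      exact continuous_const.mul (h1.mul (continuous_perron_kernel hc.ne' (by linarith)))
  have hsumm : Summable fun n => ∫ y, ‖G n y‖ := by
    have h1 := ((hb (1 + c) (by linarith) (by linarith)).1.mul_right (V ^ c)).mul_right (∫ y, ‖K y‖)
    refine h1.congr fun n => ?_
    rcases Nat.eq_zero_or_pos n with rfl | hn
    · simp [hG0]
    · simp only [hGnorm n hn]
      rw [MeasureTheory.integral_const_mul]
  have hmain := MeasureTheory.hasSum_integral_of_summable_integral_norm hGint hsumm
  have hlhs : ∀ y : ℝ, ∑' n, G n y = primeF (s + (c + y * Complex.I)) *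
      ((V : ℂ) ^ ((c : ℂ) + y * Complex.I) * K y) := by
    intro y
    have h1 : 1 < (s + (c + y * Complex.I)).re := by simp [hs, hc]
    have h2 := (LSeriesHasSum_lamOne h1).mul_right ((V : ℂ) ^ ((c : ℂ) + y * Complex.I) * K y)
    rw [← h2.tsum_eq]
    refine tsum_congr fun n => ?_
    rcases Nat.eq_zero_or_pos n with rfl | hn
    · simp [hG0]
    · have hn0 : (n : ℂ) ≠ 0 := by exact_mod_cast hn.ne'
      have h3 : ((V / n : ℝ) : ℂ) ^ ((c : ℂ) + y * Complex.I) =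
          (V : ℂ) ^ ((c : ℂ) + y * Complex.I) * (n : ℂ) ^ (-((c : ℂ) + y * Complex.I)) := by
        rw [div_eq_mul_inv, Complex.ofReal_mul, Complex.mul_cpow_ofReal_nonneg hV0.le (by positivity),
          Complex.ofReal_inv, Complex.ofReal_natCast, Complex.inv_cpow, Complex.cpow_neg]
        rw [Complex.natCast_arg]; exact Real.pi_pos.ne
      simp only [hG]
      rw [LSeries.term_of_ne_zero hn.ne', h3, div_eq_mul_inv, ← Complex.cpow_neg, neg_add s,
        Complex.cpow_add (-s) _ hn0]
      ring
  have hval : ∀ n : ℕ, ∫ y, G n y = 2 * Real.pi *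
      (((lamOne n * max 0 (1 - n / V) : ℝ) : ℂ) * (n : ℂ) ^ (-s)) := by
    intro n
    rcases Nat.eq_zero_or_pos n with rfl | hn
    · simp [hG0]
    · simp only [hG]
      rw [MeasureTheory.integral_const_mul, perron_riesz hc hc1 (hnV n hn), inv_div]
      push_cast
      ring
  simp only [hlhs, hval] at hmain
  have h2 := hasSum_sum_of_ne_finset_zero (L := .unconditional ℕ) (f := fun n : ℕ => (2 * Real.pi : ℂ) *
      (((lamOne n * max 0 (1 - n / V) : ℝ) : ℂ) * (n : ℂ) ^ (-s))) (s := range ⌈V⌉₊) (by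
    intro n hn
    have h3 : V ≤ n := Nat.ceil_le.mp (by simpa using hn)
    have : 1 - n / V ≤ 0 := by
      rw [sub_nonpos, le_div_iff₀ hV0]; linarith
    simp [max_eq_left this])
  rw [rieszSum, mul_sum]
  exact hmain.unique h2

lemma norm_add_mul_I_sq_ge (x y : ℝ) : |y| ≤ ‖(x : ℂ) + y * Complex.I‖ := by
  simpa using Complex.abs_im_le_norm ((x : ℂ) + y * Complex.I)

lemma arctan_le_self_of_nonneg {x : ℝ} (hx : 0 ≤ x) : Real.arctan x ≤ x := by
  have := Real.le_tan (Real.arctan_nonneg.mpr hx) (Real.arctan_lt_pi_div_two x)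
  rwa [Real.tan_arctan] at this

lemma isOpen_riemannZeta₁_ne_zero : IsOpen {z : ℂ | riemannZeta₁ z ≠ 0} :=
  isOpen_ne_fun differentiable_riemannZeta₁.continuous continuous_const

lemma differentiableOn_primeF : DifferentiableOn ℂ primeF {z : ℂ | riemannZeta₁ z ≠ 0} := by
  intro z hz
  have h1 : DifferentiableAt ℂ (deriv riemannZeta₁) z :=
    (differentiable_riemannZeta₁.deriv) z
  exact (((h1.div (differentiable_riemannZeta₁ z) hz).neg).sub
    (differentiable_riemannZeta₀ z)).differentiableWithinAt

lemma norm_perron_mul_le {V σ y D : ℝ} (hV : 0 < V) (z : ℂ) (hz : ‖z‖ ≤ D) (hσ : σ ≠ 0)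
    (h1 : σ ^ 2 ≤ (σ + 1) ^ 2) (hs : σ ^ 2 ≤ 1) :
    ‖z * ((V : ℂ) ^ ((σ : ℂ) + y * Complex.I) *
      (1 / (((σ : ℂ) + y * Complex.I) * ((σ : ℂ) + y * Complex.I + 1))))‖ ≤
      D * (V ^ σ * (1 / σ ^ 2)) * (1 + y ^ 2)⁻¹ := by
  rw [norm_mul, norm_mul, Complex.norm_cpow_eq_rpow_re_of_pos hV]
  have h := norm_perron_kernel_le hσ h1 hs y
  have h2 : ((σ : ℂ) + y * Complex.I).re = σ := by simp
  rw [h2]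
  have h3 : 0 ≤ D := (norm_nonneg _).trans hz
  calc _ ≤ D * (V ^ σ * (1 / σ ^ 2 * (1 + y ^ 2)⁻¹)) := by gcongr
    _ = _ := by ring

/-- Moving the contour in Perron's formula for a difference `F (s + w) - F s`. -/
lemma norm_integral_perron_shift_le {F : ℂ → ℂ} {U : Set ℂ} (hU : IsOpen U)
    (hF : DifferentiableOn ℂ F U) {V c δ Y M B E : ℝ} (hV : 1 ≤ V) (hδ : 0 < δ) (hδ1 : δ ≤ 1 / 2)
    (hc : 0 < c) (hc1 : c ≤ 1 / 2) (hY : 1 ≤ Y) {s : ℂ}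
    (hM : ∀ w : ℂ, -δ ≤ w.re → w.re ≤ c → |w.im| ≤ Y → s + w ∈ U ∧ ‖F (s + w)‖ ≤ M)
    (hB : ∀ y : ℝ, ‖F (s + (c + y * Complex.I))‖ ≤ B) (hE : V ^ c ≤ E)
    (hInt : MeasureTheory.Integrable fun y : ℝ => (F (s + (c + y * Complex.I)) - F s) *
      ((V : ℂ) ^ ((c : ℂ) + y * Complex.I) *
      (1 / (((c : ℂ) + y * Complex.I) * ((c : ℂ) + y * Complex.I + 1))))) :
    ‖∫ y : ℝ, (F (s + (c + y * Complex.I)) - F s) * ((V : ℂ) ^ ((c : ℂ) + y * Complex.I) *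
      (1 / (((c : ℂ) + y * Complex.I) * ((c : ℂ) + y * Complex.I + 1))))‖ ≤
      2 * M * (V ^ (-δ) * (1 / δ ^ 2)) * Real.pi + 4 * M * E / Y ^ 2 +
      (B + M) * (E * (1 / c ^ 2)) * (2 / Y) := by
  have hV0 : 0 < V := by linarith
  have hY0 : 0 < Y := by linarith
  have hs0 := hM 0 (by simp [hδ.le]) (by simp [hc.le]) (by simp [hY0.le])
  rw [add_zero] at hs0
  have hM0 : 0 ≤ M := (norm_nonneg _).trans hs0.2
  have hB0 : 0 ≤ B := (norm_nonneg _).trans (hB 0)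
  have hE0 : 0 ≤ E := (Real.rpow_pos_of_pos hV0 c).le.trans hE
  set k : ℂ → ℂ := fun w => (F (s + w) - F s) * ((V : ℂ) ^ w * (1 / (w * (w + 1)))) with hk
  set g : ℂ → ℂ := fun w => dslope F s (s + w) * (V : ℂ) ^ w * (1 / (w + 1)) with hg
  have hgk : ∀ w : ℂ, w ≠ 0 → g w = k w := by
    intro w hw
    have h1 : s + w ≠ s := by simpa using hw
    simp only [hg, hk]
    rw [dslope_of_ne _ h1, slope_def_field, add_sub_cancel_left]
    rw [one_div, one_div, mul_inv, div_eq_mul_inv]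
    ring
  have hdiff : ∀ w : ℂ, s + w ∈ U → w + 1 ≠ 0 → DifferentiableAt ℂ g w := by
    intro w hw hw1
    have h1 : DifferentiableAt ℂ (dslope F s) (s + w) :=
      ((Complex.differentiableOn_dslope (hU.mem_nhds hs0.1)).mpr hF).differentiableAt
        (hU.mem_nhds hw)
    have h2 : DifferentiableAt ℂ (fun w => dslope F s (s + w)) w :=
      h1.comp w (differentiableAt_id.const_add s)
    have hV' : (V : ℂ) ≠ 0 := by exact_mod_cast hV0.ne'
    have h3 : DifferentiableAt ℂ (fun w : ℂ => (V : ℂ) ^ w) w :=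
      differentiableAt_id.const_cpow (Or.inl hV')
    exact (h2.mul h3).mul ((differentiableAt_const _).div (differentiableAt_id.add_const _) hw1)
  have hw1 : ∀ w : ℂ, -δ ≤ w.re → w + 1 ≠ 0 := by
    intro w hw h
    have := congrArg Complex.re h
    simp at this; linarith
  have hrect := Complex.integral_boundary_rect_eq_zero_of_differentiableOn g
    ((-δ : ℝ) + (-Y : ℝ) * Complex.I) ((c : ℝ) + (Y : ℝ) * Complex.I) (by
      intro w hw
      rw [Complex.mem_reProdIm] at hw
      simp only [Complex.add_re, Complex.ofReal_re, Complex.mul_re, Complex.I_re, mul_zero,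
        Complex.ofReal_im, Complex.I_im, mul_one, Complex.add_im, Complex.mul_im, zero_add,
        sub_zero, add_zero] at hw
      rw [Set.uIcc_of_le (by linarith), Set.uIcc_of_le (by linarith)] at hw
      exact (hdiff w (hM w hw.1.1 hw.1.2 (abs_le.mpr hw.2)).1
        (hw1 w hw.1.1)).differentiableWithinAt)
  simp only [Complex.add_re, Complex.ofReal_re, Complex.mul_re, Complex.I_re, mul_zero,
    Complex.ofReal_im, Complex.I_im, mul_one, Complex.add_im, Complex.mul_im, zero_add,
    sub_zero, add_zero] at hrect
  have hdiffle : ∀ w : ℂ, -δ ≤ w.re → w.re ≤ c → |w.im| ≤ Y → ‖F (s + w) - F s‖ ≤ 2 * M :=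
    fun w h1 h2 h3 => (norm_sub_le _ _).trans (by linarith [(hM w h1 h2 h3).2, hs0.2])
  -- horizontal sides
  have hhor : ∀ y : ℝ, |y| = Y → ‖∫ x in (-δ)..c, g (x + y * Complex.I)‖ ≤ 2 * M * E / Y ^ 2 := by
    intro y hy
    have hyne : y ≠ 0 := by rintro rfl; simp at hy; linarith
    refine (intervalIntegral.norm_integral_le_of_norm_le_const (C := 2 * M * E / Y ^ 2)
      (fun x hx => ?_)).trans ?_
    · rw [Set.uIoc_of_le (by linarith)] at hx
      rw [hgk _ (fun h => hyne (by simpa using congrArg Complex.im h))]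
      simp only [hk]
      have h1 := hdiffle (x + y * Complex.I) (by simpa using hx.1.le) (by simpa using hx.2)
        (by simp [hy])
      rw [norm_mul, norm_mul, Complex.norm_cpow_eq_rpow_re_of_pos hV0, norm_div, norm_one, norm_mul]
      have h2 : V ^ ((x : ℂ) + y * Complex.I).re ≤ E := by
        refine (Real.rpow_le_rpow_of_exponent_le hV ?_).trans hE
        simpa using hx.2
      have h3 := norm_add_mul_I_sq_ge x y
      have h4 := norm_add_mul_I_sq_ge (x + 1) y
      rw [hy] at h3 h4
      have h5 : ((x + 1 : ℝ) : ℂ) + y * Complex.I = (x : ℂ) + y * Complex.I + 1 := by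
        push_cast; ring
      rw [h5] at h4
      have h6 : 1 / (‖(x : ℂ) + y * Complex.I‖ * ‖(x : ℂ) + y * Complex.I + 1‖) ≤ 1 / Y ^ 2 := by
        refine one_div_le_one_div_of_le (by positivity) ?_
        rw [sq]; exact mul_le_mul h3 h4 hY0.le (norm_nonneg _)
      calc _ ≤ 2 * M * (E * (1 / Y ^ 2)) := by gcongr
        _ = _ := by ring
    · have : |c - -δ| ≤ 1 := by rw [abs_of_nonneg (by linarith)]; linarith
      exact mul_le_of_le_one_right (by positivity) this
  -- left side
  have hleft : ‖∫ y in (-Y)..Y, g ((-δ : ℝ) + y * Complex.I)‖ ≤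
      2 * M * (V ^ (-δ) * (1 / δ ^ 2)) * Real.pi := by
    have h1 : ∀ y : ℝ, y ∈ Set.Ioc (-Y) Y → ‖g ((-δ : ℝ) + y * Complex.I)‖ ≤
        2 * M * (V ^ (-δ) * (1 / δ ^ 2)) * (1 + y ^ 2)⁻¹ := by
      intro y hy
      rw [hgk _ (fun h => by have := congrArg Complex.re h; simp at this; linarith)]
      have := norm_perron_mul_le (y := y) (σ := -δ) hV0 _ (hdiffle ((-δ : ℝ) + y * Complex.I)
        (by simp) (by simp; linarith) (by simp [abs_le]; exact ⟨by linarith [hy.1], hy.2⟩))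
        (by linarith) (by nlinarith) (by nlinarith)
      rwa [neg_sq] at this
    refine (intervalIntegral.norm_integral_le_of_norm_le (by linarith)
      (MeasureTheory.ae_of_all _ h1)
      ((integrable_inv_one_add_sq.const_mul _).intervalIntegrable)).trans ?_
    rw [intervalIntegral.integral_const_mul, integral_inv_one_add_sq]
    refine mul_le_mul_of_nonneg_left ?_ (by positivity)
    linarith [Real.arctan_lt_pi_div_two Y, Real.neg_pi_div_two_lt_arctan (-Y)]
  -- right side on a bounded interval
  have hright : ‖∫ y in (-Y)..Y, g (c + y * Complex.I)‖ ≤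
      2 * M * (V ^ (-δ) * (1 / δ ^ 2)) * Real.pi + 4 * M * E / Y ^ 2 := by
    set a1 := ∫ x in (-δ)..c, g (x + (-Y : ℝ) * Complex.I)
    set a2 := ∫ x in (-δ)..c, g (x + (Y : ℝ) * Complex.I)
    set a3 := ∫ y in (-Y)..Y, g (c + y * Complex.I)
    set a4 := ∫ y in (-Y)..Y, g ((-δ : ℝ) + y * Complex.I)
    have h1 : ‖a1‖ ≤ 2 * M * E / Y ^ 2 := hhor (-Y) (by rw [abs_neg, abs_of_pos hY0])
    have h2 : ‖a2‖ ≤ 2 * M * E / Y ^ 2 := hhor Y (abs_of_pos hY0)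
    have h3 : Complex.I • a3 = Complex.I • a4 + a2 - a1 := by linear_combination hrect
    have h4 : ‖a3‖ = ‖Complex.I • a4 + a2 - a1‖ := by
      rw [← h3, norm_smul, Complex.norm_I, one_mul]
    rw [h4]
    refine (norm_sub_le _ _).trans ?_
    have h5 := norm_add_le (Complex.I • a4) a2
    rw [norm_smul, Complex.norm_I, one_mul] at h5
    have h6 : 4 * M * E / Y ^ 2 = 2 * M * E / Y ^ 2 + 2 * M * E / Y ^ 2 := by ring
    linarith
  -- tails
  set f : ℝ → ℂ := fun y => k (c + y * Complex.I) with hf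
  have hcne : ∀ y : ℝ, (c : ℂ) + y * Complex.I ≠ 0 := fun y h => by
    have := congrArg Complex.re h; simp at this; linarith
  have hfle : ∀ y, ‖f y‖ ≤ (B + M) * (E * (1 / c ^ 2)) * (1 + y ^ 2)⁻¹ := by
    intro y
    refine (norm_perron_mul_le hV0 _ ((norm_sub_le _ _).trans (add_le_add (hB y) hs0.2)) hc.ne'
      (by nlinarith) (by nlinarith)).trans ?_
    gcongr
  have hib := integrable_inv_one_add_sq.const_mul ((B + M) * (E * (1 / c ^ 2)))
  have hat : Real.pi / 2 - Real.arctan Y ≤ 1 / Y := by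
    rw [← Real.arctan_inv_of_pos hY0, one_div]
    exact arctan_le_self_of_nonneg (by positivity)
  have hP : 0 ≤ (B + M) * (E * (1 / c ^ 2)) := by positivity
  have ht1 : ‖∫ y in Set.Ioi Y, f y‖ ≤ (B + M) * (E * (1 / c ^ 2)) * (1 / Y) := by
    refine (MeasureTheory.norm_integral_le_of_norm_le hib.integrableOn (.of_forall hfle)).trans ?_
    rw [MeasureTheory.integral_const_mul, integral_Ioi_inv_one_add_sq]
    gcongr
  have ht2 : ‖∫ y in Set.Iic (-Y), f y‖ ≤ (B + M) * (E * (1 / c ^ 2)) * (1 / Y) := by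
    refine (MeasureTheory.norm_integral_le_of_norm_le hib.integrableOn (.of_forall hfle)).trans ?_
    rw [MeasureTheory.integral_const_mul, integral_Iic_inv_one_add_sq, Real.arctan_neg]
    gcongr
    linarith
  have hfi : MeasureTheory.Integrable f := hInt
  have hsplit : ∫ y, f y = (∫ y in Set.Iic (-Y), f y) + (∫ y in (-Y)..Y, f y) +
      ∫ y in Set.Ioi Y, f y := by
    rw [add_assoc, intervalIntegral.integral_interval_add_Ioi hfi.integrableOn hfi.integrableOn,
      intervalIntegral.integral_Iic_add_Ioi hfi.integrableOn hfi.integrableOn]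
  have hmid : ∫ y in (-Y)..Y, f y = ∫ y in (-Y)..Y, g (c + y * Complex.I) := by
    simp only [hf, hgk _ (hcne _)]
  change ‖∫ y, f y‖ ≤ _
  rw [hsplit, hmid]
  refine (norm_add₃_le).trans ?_
  have : (B + M) * (E * (1 / c ^ 2)) * (2 / Y) = (B + M) * (E * (1 / c ^ 2)) * (1 / Y) +
    (B + M) * (E * (1 / c ^ 2)) * (1 / Y) := by ring
  linarith

lemma continuous_primeF_line {s : ℂ} (hs : s.re = 1) {c : ℝ} (hc : 0 ≤ c) :
    Continuous fun y : ℝ => primeF (s + (c + y * Complex.I)) := by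
  refine differentiableOn_primeF.continuousOn.comp_continuous (by fun_prop) fun y => ?_
  exact riemannZeta₁_ne_zero_of_one_le_re (by simp [hs, hc])

lemma norm_rieszSum_sub_le {C : ℝ} (hC : ∀ σ : ℝ, 1 < σ → σ ≤ 2 →
    Summable (fun n : ℕ => |lamOne n| * (n : ℝ) ^ (-σ)) ∧
    ∑' n : ℕ, |lamOne n| * (n : ℝ) ^ (-σ) ≤ C / (σ - 1))
    {V c δ Y M E : ℝ} (hV : 1 ≤ V) (hδ : 0 < δ) (hδ1 : δ ≤ 1 / 2)
    (hc : 0 < c) (hc1 : c ≤ 1 / 2) (hY : 1 ≤ Y) {s : ℂ} (hs : s.re = 1)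
    (hM : ∀ w : ℂ, -δ ≤ w.re → w.re ≤ c → |w.im| ≤ Y →
      riemannZeta₁ (s + w) ≠ 0 ∧ ‖primeF (s + w)‖ ≤ M) (hE : V ^ c ≤ E) :
    ‖rieszSum V s - primeF s‖ ≤
      2 * M * (V ^ (-δ) * (1 / δ ^ 2)) * Real.pi + 4 * M * E / Y ^ 2 +
      (C / c + M) * (E * (1 / c ^ 2)) * (2 / Y) + M / V := by
  have hV0 : 0 < V := by linarith
  have hB : ∀ y : ℝ, ‖primeF (s + (c + y * Complex.I))‖ ≤ C / c := by
    intro y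
    have h1 : (s + (c + y * Complex.I)).re = 1 + c := by simp [hs]
    have := norm_primeF_le_of_one_lt_re hC (s := s + (c + y * Complex.I)) (by rw [h1]; linarith)
      (by rw [h1]; linarith)
    rwa [h1, add_sub_cancel_left] at this
  have hk : Continuous fun y : ℝ => (V : ℂ) ^ ((c : ℂ) + y * Complex.I) *
      (1 / (((c : ℂ) + y * Complex.I) * ((c : ℂ) + y * Complex.I + 1))) := by
    refine Continuous.mul (Continuous.const_cpow (by fun_prop) (Or.inl ?_))
      (continuous_perron_kernel hc.ne' (by linarith))
    exact_mod_cast hV0.ne'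
  have hInt : ∀ (G : ℝ → ℂ) (D : ℝ), Continuous G → (∀ y, ‖G y‖ ≤ D) → MeasureTheory.Integrable
      fun y : ℝ => G y * ((V : ℂ) ^ ((c : ℂ) + y * Complex.I) *
      (1 / (((c : ℂ) + y * Complex.I) * ((c : ℂ) + y * Complex.I + 1)))) := by
    intro G D hG hD
    exact (integrable_inv_one_add_sq.const_mul (D * (V ^ c * (1 / c ^ 2)))).mono'
      (hG.mul hk).aestronglyMeasurable
      (.of_forall fun y => norm_perron_mul_le hV0 _ (hD y) hc.ne' (by nlinarith) (by nlinarith))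
  have hFc := continuous_primeF_line hs hc.le
  have i1 := hInt _ _ hFc hB
  have i2 := hInt (fun _ => primeF s) ‖primeF s‖ continuous_const (fun _ => le_rfl)
  have i3 := hInt (fun y : ℝ => primeF (s + (c + y * Complex.I)) - primeF s) (C / c + ‖primeF s‖)
    (hFc.sub continuous_const) (fun y => (norm_sub_le _ _).trans (by gcongr; exact hB y))
  have hmain := norm_integral_perron_shift_le isOpen_riemannZeta₁_ne_zero differentiableOn_primeF
    hV hδ hδ1 hc hc1 hY hM hB hE i3
  simp only [sub_mul] at hmain
  rw [MeasureTheory.integral_sub i1 i2, integral_primeF_perron hV hc (by linarith) hs,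
    MeasureTheory.integral_const_mul, perron_riesz hc (by linarith) hV0] at hmain
  have hmax : max 0 (1 - V⁻¹) = 1 - V⁻¹ := max_eq_right (by
    rw [sub_nonneg]; exact inv_le_one_of_one_le₀ hV)
  rw [hmax] at hmain
  have hs0 := hM 0 (by simp [hδ.le]) (by simp [hc.le]) (by simp; linarith)
  rw [add_zero] at hs0
  have h1 : (2 * Real.pi * rieszSum V s - primeF s * (2 * Real.pi * ((1 - V⁻¹ : ℝ) : ℂ))) =
      ((2 * Real.pi : ℝ) : ℂ) * (rieszSum V s - primeF s + primeF s * ((V⁻¹ : ℝ) : ℂ)) := by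
    push_cast; ring
  rw [h1, norm_mul, Complex.norm_real, Real.norm_of_nonneg (by positivity)] at hmain
  set R := 2 * M * (V ^ (-δ) * (1 / δ ^ 2)) * Real.pi + 4 * M * E / Y ^ 2 +
      (C / c + M) * (E * (1 / c ^ 2)) * (2 / Y)
  have h2 : ‖rieszSum V s - primeF s + primeF s * ((V⁻¹ : ℝ) : ℂ)‖ ≤ R := by
    refine le_trans (le_mul_of_one_le_left (norm_nonneg _) ?_) hmain
    linarith [Real.pi_gt_three]
  have h3 : ‖primeF s * ((V⁻¹ : ℝ) : ℂ)‖ ≤ M / V := by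
    rw [norm_mul, Complex.norm_real, Real.norm_of_nonneg (by positivity), div_eq_mul_inv]
    gcongr; exact hs0.2
  calc _ = ‖(rieszSum V s - primeF s + primeF s * ((V⁻¹ : ℝ) : ℂ)) -
        primeF s * ((V⁻¹ : ℝ) : ℂ)‖ := by rw [add_sub_cancel_right]
    _ ≤ _ := (norm_sub_le _ _).trans (add_le_add h2 h3)

lemma exists_pow_mul_exp_le (A : ℝ) (k : ℕ) {a b : ℝ} (hab : b < a) :
    ∃ K : ℝ, ∀ Q ≥ K, A * Q ^ k * Real.exp (-(a * Q)) ≤ Real.exp (-(b * Q)) := by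
  have h := (isLittleO_pow_exp_pos_mul_atTop k (sub_pos.mpr hab)).def
    (show 0 < 1 / (|A| + 1) by positivity)
  obtain ⟨K, hK⟩ := Filter.eventually_atTop.mp h
  refine ⟨K, fun Q hQ => ?_⟩
  have h1 := hK Q hQ
  rw [Real.norm_of_nonneg (Real.exp_pos _).le, Real.norm_eq_abs] at h1
  have h2 : A * Q ^ k ≤ Real.exp ((a - b) * Q) := by
    have h3 : A * Q ^ k ≤ |A| * |Q ^ k| := by rw [← abs_mul]; exact le_abs_self _
    have h4 : |A| * |Q ^ k| ≤ |A| * (1 / (|A| + 1) * Real.exp ((a - b) * Q)) := by gcongr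
    have h5 : |A| * (1 / (|A| + 1)) ≤ 1 := by
      rw [mul_one_div, div_le_one (by positivity)]; linarith
    have h6 := mul_le_mul_of_nonneg_right h5 (Real.exp_pos ((a - b) * Q)).le
    linarith
  calc _ ≤ Real.exp ((a - b) * Q) * Real.exp (-(a * Q)) := by gcongr
    _ = _ := by rw [← Real.exp_add]; ring_nf

/-- Pointwise approximation of `primeF` on the line `Re s = 1` by Riesz means. -/
theorem exists_rieszSum_sub_bound : ∃ K : ℝ, 2 ≤ K ∧ ∀ Q ≥ K, ∀ V t : ℝ,
    Real.exp (Q ^ 16 / 200) ≤ V → V ≤ Real.exp (Q ^ 16) → |t| ≤ Real.exp (Q ^ 16) / 8 →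
    ‖rieszSum V (1 + t * Complex.I) - primeF (1 + t * Complex.I)‖ ≤ Real.exp (-(Q / 10 ^ 5)) := by
  obtain ⟨K1, hK1, hF⟩ := exists_primeF_bound
  obtain ⟨C, hC1, hC⟩ := exists_lamOne_sum_bound
  obtain ⟨K2, hK2⟩ := exists_pow_mul_exp_le (20000 + 100 * C) 50
    (show (1 / 10 ^ 5 : ℝ) < 1 / 8000 by norm_num)
  refine ⟨max K1 K2, hK1.trans (le_max_left _ _), fun Q hQ V t hV1 hV2 ht => ?_⟩
  have hQK := (le_max_left K1 K2).trans hQ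
  have hQ2 : 2 ≤ Q := hK1.trans hQK
  have hQ1 : 1 ≤ Q := by linarith
  have hQ0 : 0 < Q := by linarith
  have hp : ∀ i j : ℕ, i ≤ j → Q ^ i ≤ Q ^ j := fun i j h => pow_le_pow_right₀ hQ1 h
  have hQ16 : (2 : ℝ) ^ 16 ≤ Q ^ 16 := by gcongr
  have hQ15 : (2 : ℝ) ^ 15 ≤ Q ^ 15 := by gcongr
  have hQle : Q ≤ Q ^ 16 := le_self_pow₀ hQ1 (by norm_num)
  have hV0 : 1 ≤ V := by
    refine le_trans ?_ hV1
    rw [← Real.exp_zero]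
    exact Real.exp_le_exp.mpr (by positivity)
  have hY8 : 8 ≤ Real.exp (Q ^ 16) := by
    linarith [Real.add_one_le_exp (Q ^ 16)]
  set Y := Real.exp (Q ^ 16) / 8 with hY
  set δ := 1 / (40 * Q ^ 15) with hδ
  set c := 1 / Q ^ 16 with hc
  have hδ0 : 0 < δ := by positivity
  have hc0 : 0 < c := by positivity
  have hc1 : c ≤ 1 / 4 := one_div_le_one_div_of_le (by norm_num) (by linarith)
  have hE : V ^ c ≤ 3 := by
    calc V ^ c ≤ (Real.exp (Q ^ 16)) ^ c := by gcongr
      _ = Real.exp 1 := by rw [← Real.exp_mul, hc, mul_one_div, div_self (by positivity)]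
      _ ≤ 3 := Real.exp_one_lt_three.le
  have hVδ : V ^ (-δ) ≤ Real.exp (-(1 / 8000 * Q)) := by
    calc V ^ (-δ) ≤ (Real.exp (Q ^ 16 / 200)) ^ (-δ) :=
          Real.rpow_le_rpow_of_nonpos (Real.exp_pos _) hV1 (by linarith)
      _ = _ := by
          rw [← Real.exp_mul, hδ]; congr 1; field_simp; ring
  have hmain := norm_rieszSum_sub_le hC (V := V) (c := c) (δ := δ) (Y := Y) (M := Q ^ 18) (E := 3)
    hV0 hδ0 (one_div_le_one_div_of_le (by norm_num) (by linarith)) hc0 (by linarith)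
    (by rw [hY]; linarith) (s := 1 + t * Complex.I) (by simp) (by
      intro w h1 h2 h3
      have h5 : (1 + t * Complex.I + w).re = 1 + w.re := by simp
      refine hF Q hQK _ ?_ (by rw [h5]; linarith) (by rw [h5]; linarith)
      have h4 : (1 + t * Complex.I + w).im = t + w.im := by simp
      rw [h4]
      refine (abs_add_le _ _).trans ?_
      rw [hY] at h3
      linarith) hE
  refine hmain.trans (le_trans ?_ (hK2 Q ((le_max_right _ _).trans hQ) |>.trans_eq (by ring_nf)))
  set e := Real.exp (-(1 / 8000 * Q)) with he
  have he0 : 0 < e := Real.exp_pos _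
  have h1 : 2 * Q ^ 18 * (V ^ (-δ) * (1 / δ ^ 2)) * Real.pi ≤ 12800 * (Q ^ 50 * e) := by
    have h2 : 1 / δ ^ 2 = 1600 * Q ^ 30 := by rw [hδ]; field_simp; ring
    rw [h2]
    calc _ ≤ 2 * Q ^ 18 * (e * (1600 * Q ^ 30)) * 4 := by
          gcongr; exact Real.pi_le_four
      _ = 12800 * (Q ^ 48 * e) := by ring
      _ ≤ _ := by gcongr 12800 * (?_ * e); exact hp _ _ (by norm_num)
  have hinv : 1 / Y ≤ 8 * e := by
    rw [hY, one_div_div, he, div_eq_mul_inv, ← Real.exp_neg]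
    gcongr; linarith
  have hY1 : 1 / Y ≤ 1 := by
    rw [div_le_one (by positivity)]; rw [hY]; linarith
  have h2 : 4 * Q ^ 18 * 3 / Y ^ 2 ≤ 96 * (Q ^ 50 * e) := by
    calc 4 * Q ^ 18 * 3 / Y ^ 2 = 12 * Q ^ 18 * ((1 / Y) * (1 / Y)) := by ring
      _ ≤ 12 * Q ^ 50 * ((8 * e) * 1) := by
          gcongr; norm_num
      _ = _ := by ring
  have h3 : (C / c + Q ^ 18) * (3 * (1 / c ^ 2)) * (2 / Y) ≤ (48 * (C + 1)) * (Q ^ 50 * e) := by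
    have h4 : 1 / c ^ 2 = Q ^ 32 := by rw [hc]; field_simp
    have h5 : C / c = C * Q ^ 16 := by rw [hc]; field_simp
    rw [h4, h5]
    calc _ ≤ (C * Q ^ 18 + Q ^ 18) * (3 * Q ^ 32) * (2 * (1 / Y)) := by
          rw [mul_one_div]
          gcongr ?_ * _ * _
          gcongr ?_ + _
          exact mul_le_mul_of_nonneg_left (hp _ _ (by norm_num)) (by linarith)
      _ ≤ (C * Q ^ 18 + Q ^ 18) * (3 * Q ^ 32) * (2 * (8 * e)) := by gcongr
      _ = _ := by ring
  have h4 : Q ^ 18 / V ≤ Q ^ 50 * e := by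
    rw [div_eq_mul_inv]
    have h5 : V⁻¹ ≤ e := by
      calc V⁻¹ ≤ (Real.exp (Q ^ 16 / 200))⁻¹ := by gcongr
        _ ≤ e := by
          rw [← Real.exp_neg, he]
          apply Real.exp_le_exp.mpr
          linarith
    exact mul_le_mul (hp _ _ (by norm_num)) h5 (by positivity) (by positivity)
  nlinarith [mul_pos (pow_pos hQ0 50) he0]

/-- The triangular bump function supported on `[-1, 1]`. -/
noncomputable def tent (u : ℝ) : ℝ := max 0 (1 - |u|)

/-- The Fourier transform of `tent` (up to scaling). -/
noncomputable def fejerKernel (a : ℝ) : ℝ := 2 * (1 - Real.cos a) / a ^ 2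

lemma tent_nonneg (u : ℝ) : 0 ≤ tent u := le_max_left _ _

lemma tent_le_one (u : ℝ) : tent u ≤ 1 :=
  max_le zero_le_one (by linarith [abs_nonneg u])

lemma tent_eq_zero {u : ℝ} (h : 1 ≤ |u|) : tent u = 0 :=
  max_eq_left (by linarith)

lemma continuous_tent : Continuous tent := by
  unfold tent; fun_prop

lemma abs_tent_sub_le (u v : ℝ) : |tent u - tent v| ≤ |u - v| := by
  unfold tent
  refine (abs_max_sub_max_le_max 0 (1 - |u|) 0 (1 - |v|)).trans (max_le (by simp) ?_)
  have : 1 - |u| - (1 - |v|) = |v| - |u| := by ring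
  rw [this, abs_sub_comm u v]
  exact abs_abs_sub_abs_le v u

lemma fejerKernel_nonneg (a : ℝ) : 0 ≤ fejerKernel a := by
  unfold fejerKernel
  have := Real.cos_le_one a
  exact div_nonneg (by linarith) (sq_nonneg a)

lemma fejerKernel_le (a : ℝ) : fejerKernel a ≤ 4 / a ^ 2 := by
  unfold fejerKernel
  have := Real.neg_one_le_cos a
  exact div_le_div_of_nonneg_right (by linarith) (sq_nonneg a)

lemma fejerKernel_le_one (a : ℝ) : fejerKernel a ≤ 1 := by
  unfold fejerKernel
  have := Real.one_sub_sq_div_two_le_cos (x := a)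
  refine div_le_one_of_le₀ (by linarith) (sq_nonneg a)

lemma fejerKernel_le_inv (a : ℝ) : fejerKernel a ≤ 5 * (1 + a ^ 2)⁻¹ := by
  rw [← div_eq_mul_inv, le_div_iff₀ (by positivity), mul_add, mul_one]
  have h1 := fejerKernel_le_one a
  have h2 : fejerKernel a * a ^ 2 ≤ 4 := by
    rcases eq_or_ne a 0 with rfl | h
    · simp
    · have := fejerKernel_le a
      rwa [le_div_iff₀ (by positivity)] at this
  linarith

lemma measurable_fejerKernel : Measurable fejerKernel := by
  unfold fejerKernel; fun_prop

lemma integrable_fejerKernel : MeasureTheory.Integrable fejerKernel := by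
  refine (integrable_inv_one_add_sq.const_mul 5).mono' measurable_fejerKernel.aestronglyMeasurable
    (Filter.Eventually.of_forall fun a => ?_)
  rw [Real.norm_of_nonneg (fejerKernel_nonneg a)]
  exact fejerKernel_le_inv a

lemma hasCompactSupport_tent : HasCompactSupport tent := by
  refine HasCompactSupport.of_support_subset_isCompact (isCompact_Icc (a := (-1 : ℝ)) (b := 1)) ?_
  intro u hu
  by_contra h
  refine hu (tent_eq_zero ?_)
  rw [Set.mem_Icc, ← abs_le] at h
  linarith

lemma integral_exp_mul_affine {c σ : ℂ} (hc : c ≠ 0) (a b : ℝ) :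
    ∫ v in a..b, Complex.exp (c * v) * (1 + σ * v) =
      ((1 + σ * b) * Complex.exp (c * b) / c - σ * Complex.exp (c * b) / c ^ 2) -
      ((1 + σ * a) * Complex.exp (c * a) / c - σ * Complex.exp (c * a) / c ^ 2) := by
  have key : ∀ v : ℝ, HasDerivAt (fun v : ℝ => (1 + σ * v) * Complex.exp (c * v) / c -
      σ * Complex.exp (c * v) / c ^ 2) (Complex.exp (c * v) * (1 + σ * v)) v := by
    intro v
    have h1 : HasDerivAt (fun z : ℂ => (1 + σ * z) * Complex.exp (c * z) / c -
      σ * Complex.exp (c * z) / c ^ 2) (Complex.exp (c * v) * (1 + σ * v)) (v : ℂ) := by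
      have e : HasDerivAt (fun z : ℂ => Complex.exp (c * z)) (Complex.exp (c * v) * (c * 1)) (v : ℂ) :=
        ((hasDerivAt_id' (v : ℂ)).const_mul c).cexp
      have l : HasDerivAt (fun z : ℂ => 1 + σ * z) (σ * 1) (v : ℂ) :=
        ((hasDerivAt_id' (v : ℂ)).const_mul σ).const_add 1
      have := ((l.mul e).div_const c).sub ((e.const_mul σ).div_const (c ^ 2))
      refine this.congr_deriv ?_
      field_simp
      ring
    exact h1.comp_ofReal
  rw [intervalIntegral.integral_eq_sub_of_hasDerivAt (fun v _ => key v)]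
  exact (Continuous.intervalIntegrable (by fun_prop) _ _)

lemma integral_exp_mul_tent {w : ℝ} (hw : w ≠ 0) :
    ∫ v : ℝ, Complex.exp (((-w : ℝ) : ℂ) * Complex.I * v) * (tent v : ℂ) = (fejerKernel w : ℂ) := by
  set c : ℂ := ((-w : ℝ) : ℂ) * Complex.I with hcdef
  have hc : c ≠ 0 := by
    simp [hcdef, hw]
  have hsupp : ∫ v : ℝ, Complex.exp (c * v) * (tent v : ℂ) =
      ∫ v in (-1 : ℝ)..1, Complex.exp (c * v) * (tent v : ℂ) := by
    rw [intervalIntegral.integral_of_le (by norm_num), MeasureTheory.setIntegral_eq_integral_of_forall_compl_eq_zero]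
    intro v hv
    have : 1 ≤ |v| := by
      by_contra h
      have := abs_lt.mp (not_le.mp h)
      exact hv ⟨this.1, this.2.le⟩
    simp [tent_eq_zero this]
  have hct := continuous_tent
  have hcont : Continuous fun v : ℝ => Complex.exp (c * v) * (tent v : ℂ) := by fun_prop
  rw [hsupp, ← intervalIntegral.integral_add_adjacent_intervals (b := 0)
    (hcont.intervalIntegrable _ _) (hcont.intervalIntegrable _ _)]
  have h1 : ∫ v in (-1 : ℝ)..0, Complex.exp (c * v) * (tent v : ℂ) =
      ∫ v in (-1 : ℝ)..0, Complex.exp (c * v) * (1 + 1 * v) := by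
    refine intervalIntegral.integral_congr fun v hv => ?_
    rw [Set.uIcc_of_le (by norm_num)] at hv
    have : tent v = 1 + v := by
      unfold tent; rw [abs_of_nonpos hv.2, max_eq_right (by linarith [hv.1])]; ring
    simp [this]
  have h2 : ∫ v in (0 : ℝ)..1, Complex.exp (c * v) * (tent v : ℂ) =
      ∫ v in (0 : ℝ)..1, Complex.exp (c * v) * (1 + (-1) * v) := by
    refine intervalIntegral.integral_congr fun v hv => ?_
    rw [Set.uIcc_of_le (by norm_num)] at hv
    have : tent v = 1 - v := by
      unfold tent; rw [abs_of_nonneg hv.1, max_eq_right (by linarith [hv.2])]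
    simp [this, sub_eq_add_neg]
  rw [h1, h2, integral_exp_mul_affine hc, integral_exp_mul_affine hc]
  have hcos : Complex.exp c + Complex.exp (-c) = 2 * Complex.cos (w : ℂ) := by
    rw [Complex.two_cos, hcdef]
    push_cast
    rw [add_comm]
    congr 2
    ring
  have hc2 : c ^ 2 = -(w : ℂ) ^ 2 := by
    rw [hcdef, mul_pow, Complex.I_sq]; push_cast; ring
  have hw' : (w : ℂ) ≠ 0 := by exact_mod_cast hw
  have : Complex.exp c = 2 * Complex.cos w - Complex.exp (-c) := by rw [← hcos]; ring
  unfold fejerKernel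
  push_cast
  simp only [mul_neg, mul_one, mul_zero, Complex.exp_zero]
  rw [this, hc2]
  field_simp
  ring

theorem integral_fejerKernel (x : ℝ) :
    ∫ a : ℝ, Complex.exp (((a * x : ℝ) : ℂ) * Complex.I) * (fejerKernel a : ℂ) =
      ((2 * Real.pi * tent x : ℝ) : ℂ) := by
  have hft : ∀ w : ℝ, w ≠ 0 → FourierTransform.fourier (fun v : ℝ => (tent v : ℂ)) w =
      (fejerKernel (2 * Real.pi * w) : ℂ) := by
    intro w hw
    rw [Real.fourier_real_eq_integral_exp_smul,
      ← integral_exp_mul_tent (w := 2 * Real.pi * w) (by positivity)]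
    refine MeasureTheory.integral_congr_ae (Filter.Eventually.of_forall fun v => ?_)
    simp only [smul_eq_mul]
    congr 2
    push_cast
    ring
  have hae : FourierTransform.fourier (fun v : ℝ => (tent v : ℂ)) =ᵐ[MeasureTheory.volume]
      fun w : ℝ => (fejerKernel (2 * Real.pi * w) : ℂ) := by
    filter_upwards [MeasureTheory.Measure.ae_ne MeasureTheory.volume (0 : ℝ)] with w hw using hft w hw
  have hct := continuous_tent
  have hcont : Continuous fun v : ℝ => (tent v : ℂ) := by fun_prop
  have hInt : MeasureTheory.Integrable (fun v : ℝ => (tent v : ℂ)) :=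
    (hct.integrable_of_hasCompactSupport hasCompactSupport_tent).ofReal
  have hInt' : MeasureTheory.Integrable
      (FourierTransform.fourier (fun v : ℝ => (tent v : ℂ))) := by
    refine MeasureTheory.Integrable.congr ?_ hae.symm
    exact (integrable_fejerKernel.comp_mul_left' (by positivity)).ofReal
  have hinv := congrFun (hcont.fourierInv_fourier_eq hInt hInt') x
  rw [Real.fourierInv_congr_ae hae, Real.fourierInv_eq'] at hinv
  have hsc := MeasureTheory.Measure.integral_comp_mul_left
    (fun a : ℝ => Complex.exp (((a * x : ℝ) : ℂ) * Complex.I) * (fejerKernel a : ℂ)) (2 * Real.pi)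
  have heq : ∫ v : ℝ, Complex.exp (((2 * Real.pi * inner ℝ v x : ℝ) : ℂ) * Complex.I) •
      (fejerKernel (2 * Real.pi * v) : ℂ) = (tent x : ℂ) := hinv
  have heq2 : (∫ v : ℝ, Complex.exp ((((2 * Real.pi * v) * x : ℝ) : ℂ) * Complex.I) *
      (fejerKernel (2 * Real.pi * v) : ℂ)) = (tent x : ℂ) := by
    rw [← heq]
    refine MeasureTheory.integral_congr_ae (Filter.Eventually.of_forall fun v => ?_)
    simp only [smul_eq_mul]
    congr 4
    simp only [Real.inner_apply]
    ring
  rw [heq2] at hsc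
  rw [abs_of_pos (by positivity), Complex.real_smul] at hsc
  have hpi : (Real.pi : ℂ) ≠ 0 := by exact_mod_cast Real.pi_ne_zero
  push_cast at hsc ⊢
  rw [hsc, mul_inv_cancel_left₀ (by simp [hpi])]

theorem integral_fejerKernel_scaled {δ : ℝ} (hδ : 0 < δ) (x : ℝ) :
    ∫ t : ℝ, ((δ * fejerKernel (δ * t) : ℝ) : ℂ) * Complex.exp (((t * x : ℝ) : ℂ) * Complex.I) =
      ((2 * Real.pi * tent (x / δ) : ℝ) : ℂ) := by
  have hsc := MeasureTheory.Measure.integral_comp_mul_left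
    (fun a : ℝ => Complex.exp (((a * (x / δ) : ℝ) : ℂ) * Complex.I) * (fejerKernel a : ℂ)) δ
  rw [integral_fejerKernel, abs_of_pos (by positivity), Complex.real_smul] at hsc
  have hd : (δ : ℂ) ≠ 0 := by exact_mod_cast hδ.ne'
  have : ∀ t : ℝ, ((δ * fejerKernel (δ * t) : ℝ) : ℂ) * Complex.exp (((t * x : ℝ) : ℂ) * Complex.I)
      = δ * (Complex.exp (((δ * t * (x / δ) : ℝ) : ℂ) * Complex.I) * (fejerKernel (δ * t) : ℂ)) := by
    intro t
    have : δ * t * (x / δ) = t * x := by field_simp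
    rw [this]; push_cast; ring
  simp_rw [this]
  rw [MeasureTheory.integral_const_mul, hsc]
  push_cast
  field_simp

lemma integrable_fejerKernel_scaled {δ : ℝ} (hδ : 0 < δ) :
    MeasureTheory.Integrable fun t : ℝ => δ * fejerKernel (δ * t) :=
  (integrable_fejerKernel.comp_mul_left' hδ.ne').const_mul δ

/-- The trigonometric sum `∑ c_i exp(i t θ_i)`. -/
noncomputable def trigSum {ι : Type*} (S : Finset ι) (c θ : ι → ℝ) (t : ℝ) : ℂ :=
  ∑ i ∈ S, (c i : ℂ) * Complex.exp (((t * θ i : ℝ) : ℂ) * Complex.I)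

lemma continuous_trigSum {ι : Type*} (S : Finset ι) (c θ : ι → ℝ) :
    Continuous (trigSum S c θ) := by
  unfold trigSum
  refine continuous_finsetSum _ fun i _ => ?_
  fun_prop

lemma norm_trigSum_le {ι : Type*} (S : Finset ι) (c θ : ι → ℝ) (t : ℝ) :
    ‖trigSum S c θ t‖ ≤ ∑ i ∈ S, |c i| := by
  refine (norm_sum_le _ _).trans (sum_le_sum fun i _ => ?_)
  rw [norm_mul, Complex.norm_exp_ofReal_mul_I, mul_one, Complex.norm_real, Real.norm_eq_abs]

lemma trigSum_mul {ι ι' : Type*} (S : Finset ι) (R : Finset ι') (c θ : ι → ℝ) (d φ : ι' → ℝ)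
    (t : ℝ) : trigSum S c θ t * trigSum R d φ t =
      trigSum (S ×ˢ R) (fun p => c p.1 * d p.2) (fun p => θ p.1 + φ p.2) t := by
  unfold trigSum
  rw [sum_mul_sum, ← sum_product']
  refine sum_congr rfl fun p _ => ?_
  rw [mul_add t, Complex.ofReal_add, add_mul, Complex.exp_add, Complex.ofReal_mul (c p.1)]
  ring

lemma conj_trigSum {ι : Type*} (S : Finset ι) (c θ : ι → ℝ) (t : ℝ) :
    (starRingEnd ℂ) (trigSum S c θ t) = trigSum S c (fun i => -θ i) t := by
  unfold trigSum
  rw [map_sum]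
  refine sum_congr rfl fun p _ => ?_
  rw [map_mul, Complex.conj_ofReal, ← Complex.exp_conj, map_mul, Complex.conj_I,
    Complex.conj_ofReal]
  push_cast
  ring_nf

lemma integrable_fejerKernel_mul_of_bounded {δ C : ℝ} (hδ : 0 < δ) {f : ℝ → ℂ} (hf : Continuous f)
    (hC : ∀ t, ‖f t‖ ≤ C) :
    MeasureTheory.Integrable fun t : ℝ => ((δ * fejerKernel (δ * t) : ℝ) : ℂ) * f t :=
  (integrable_fejerKernel_scaled hδ).ofReal.mul_bdd (c := C) hf.aestronglyMeasurable
    (Filter.Eventually.of_forall hC)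

lemma integral_fejerKernel_mul_trigSum {ι : Type*} {δ : ℝ} (hδ : 0 < δ) (S : Finset ι)
    (c θ : ι → ℝ) :
    ∫ t : ℝ, ((δ * fejerKernel (δ * t) : ℝ) : ℂ) * trigSum S c θ t =
      ((2 * Real.pi * ∑ i ∈ S, c i * tent (θ i / δ) : ℝ) : ℂ) := by
  unfold trigSum
  simp_rw [mul_sum]
  rw [MeasureTheory.integral_finsetSum]
  · rw [Complex.ofReal_sum]
    refine sum_congr rfl fun i _ => ?_
    simp_rw [mul_left_comm _ (c i : ℂ)]
    rw [MeasureTheory.integral_const_mul, integral_fejerKernel_scaled hδ]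
    push_cast
    ring
  · intro i _
    refine integrable_fejerKernel_mul_of_bounded (C := |c i|) hδ (by fun_prop) fun t => ?_
    rw [norm_mul, Complex.norm_exp_ofReal_mul_I, mul_one, Complex.norm_real, Real.norm_eq_abs]

lemma integrable_fejerKernel_mul_sq_trigSum {ι : Type*} {δ : ℝ} (hδ : 0 < δ) (S : Finset ι)
    (c θ : ι → ℝ) : MeasureTheory.Integrable fun t : ℝ =>
      δ * fejerKernel (δ * t) * ‖trigSum S c θ t‖ ^ 2 := by
  refine (integrable_fejerKernel_scaled hδ).mul_bdd (c := (∑ i ∈ S, |c i|) ^ 2)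
    ((continuous_trigSum S c θ).norm.pow 2).aestronglyMeasurable
    (Filter.Eventually.of_forall fun t => ?_)
  rw [Real.norm_of_nonneg (sq_nonneg _)]
  exact pow_le_pow_left₀ (norm_nonneg _) (norm_trigSum_le S c θ t) 2

lemma integral_fejerKernel_mul_sq_trigSum {ι : Type*} {δ : ℝ} (hδ : 0 < δ) (S : Finset ι)
    (c θ : ι → ℝ) :
    ∫ t : ℝ, δ * fejerKernel (δ * t) * ‖trigSum S c θ t‖ ^ 2 =
      2 * Real.pi * ∑ i ∈ S, ∑ j ∈ S, c i * c j * tent ((θ i - θ j) / δ) := by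
  have h := integral_fejerKernel_mul_trigSum hδ (S ×ˢ S) (fun p => c p.1 * c p.2)
    (fun p => θ p.1 + -θ p.2)
  rw [← Complex.ofReal_inj, ← integral_complex_ofReal]
  rw [sum_product] at h
  simp_rw [sub_eq_add_neg]
  rw [← h]
  refine MeasureTheory.integral_congr_ae (Filter.Eventually.of_forall fun t => ?_)
  simp only
  rw [← trigSum_mul S S c θ c (fun i => -θ i), ← conj_trigSum, Complex.mul_conj,
    Complex.normSq_eq_norm_sq]
  push_cast
  ring

lemma setIntegral_fejerKernel_le {δ T : ℝ} (hδ : 0 < δ) (hT : 0 < T) :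
    ∫ t in {t : ℝ | T < |t|}, δ * fejerKernel (δ * t) ≤ 8 / (δ * T) := by
  have hI := integrable_fejerKernel_scaled hδ
  have hset : {t : ℝ | T < |t|} = Set.Ioi T ∪ Set.Iio (-T) := by
    ext t
    rw [Set.mem_ofPred_eq, lt_abs, Set.mem_union, Set.mem_Ioi, Set.mem_Iio, lt_neg]
  have hdis : Disjoint (Set.Ioi T) (Set.Iio (-T)) := by
    rw [Set.disjoint_left]
    intro t h1 h2
    rw [Set.mem_Ioi] at h1
    rw [Set.mem_Iio] at h2
    linarith
  have hpos : ∫ t in Set.Ioi T, δ * fejerKernel (δ * t) ≤ 4 / (δ * T) := by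
    have hg : MeasureTheory.IntegrableOn (fun t : ℝ => 4 / δ * t ^ (-2 : ℝ)) (Set.Ioi T) :=
      (integrableOn_Ioi_rpow_of_lt (by norm_num) hT).const_mul _
    have h1 : ∫ t in Set.Ioi T, δ * fejerKernel (δ * t) ≤
        ∫ t in Set.Ioi T, 4 / δ * t ^ (-2 : ℝ) := by
      refine MeasureTheory.setIntegral_mono_on hI.integrableOn hg measurableSet_Ioi fun t ht => ?_
      have htp : 0 < t := hT.trans ht
      calc δ * fejerKernel (δ * t) ≤ δ * (4 / (δ * t) ^ 2) :=
            mul_le_mul_of_nonneg_left (fejerKernel_le _) hδ.le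
        _ = 4 / δ * t ^ (-2 : ℝ) := by
            rw [Real.rpow_neg htp.le, Real.rpow_two]; field_simp
    refine h1.trans (le_of_eq ?_)
    rw [MeasureTheory.integral_const_mul, integral_Ioi_rpow_of_lt (by norm_num) hT]
    rw [show (-2 : ℝ) + 1 = -1 by norm_num, Real.rpow_neg_one]
    field_simp
  have hneg : ∫ t in Set.Iio (-T), δ * fejerKernel (δ * t) =
      ∫ t in Set.Ioi T, δ * fejerKernel (δ * t) := by
    have := integral_comp_neg_Ioi T (fun t => δ * fejerKernel (δ * t))
    rw [← MeasureTheory.integral_Iic_eq_integral_Iio, ← this]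
    refine MeasureTheory.integral_congr_ae (Filter.Eventually.of_forall fun t => ?_)
    simp [fejerKernel]
  rw [hset, MeasureTheory.setIntegral_union hdis measurableSet_Iio hI.integrableOn hI.integrableOn,
    hneg]
  calc _ ≤ 4 / (δ * T) + 4 / (δ * T) := add_le_add hpos hpos
    _ = _ := by ring

/-- A large values estimate: if the bilinear sums attached to the well-spaced points `y m` are all
at most `-η`, there are few such points. -/
theorem card_le_of_bilinear_le {ι ι' ι'' : Type*} (S : Finset ι) (R : Finset ι') (E : Finset ι'')
    (c θ : ι → ℝ) (d φ : ι' → ℝ) (y : ι'' → ℝ) {δ T β η M : ℝ} (hδ : 0 < δ) (hT : 0 < T)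
    (hβ : 0 < β) (hη : 0 < η)
    (hsep : ∀ m ∈ E, ∀ n ∈ E, m ≠ n → δ ≤ |y m - y n|)
    (hB : ∀ t, |t| ≤ T → ‖trigSum R d φ t‖ ≤ β)
    (hM : ∑ i ∈ S, ∑ j ∈ S, c i * c j * tent ((θ i - θ j) / δ) ≤ M)
    (htail : (∑ i ∈ S, |c i|) * (∑ j ∈ R, |d j|) * (8 / (δ * T)) ≤ η)
    (hE : ∀ m ∈ E, ∑ i ∈ S, ∑ j ∈ R, c i * d j * tent ((θ i + φ j + y m) / δ) ≤ -η) :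
    (#E : ℝ) ≤ 2 * β ^ 2 * M / η ^ 2 := by
  classical
  set κ : ℝ → ℝ := fun t => δ * fejerKernel (δ * t) with hκ
  have hκ0 : ∀ t, 0 ≤ κ t := fun t => mul_nonneg hδ.le (fejerKernel_nonneg _)
  have hκI : MeasureTheory.Integrable κ := integrable_fejerKernel_scaled hδ
  set A := trigSum S c θ with hA
  set B := trigSum R d φ with hBdef
  set D := trigSum E (fun _ => 1) y with hD
  set CA := ∑ i ∈ S, |c i|
  set CB := ∑ i ∈ R, |d i|
  have hCA : 0 ≤ CA := sum_nonneg fun _ _ => abs_nonneg _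
  have hCB : 0 ≤ CB := sum_nonneg fun _ _ => abs_nonneg _
  have hAle : ∀ t, ‖A t‖ ≤ CA := norm_trigSum_le S c θ
  have hBle : ∀ t, ‖B t‖ ≤ CB := norm_trigSum_le R d φ
  have hDle : ∀ t, ‖D t‖ ≤ #E := fun t => (norm_trigSum_le E _ y t).trans (by simp)
  have hAc : Continuous A := continuous_trigSum S c θ
  have hBc : Continuous B := continuous_trigSum R d φ
  have hDc : Continuous D := continuous_trigSum E _ y
  -- mean squares
  have hA2 : ∫ t, κ t * ‖A t‖ ^ 2 ≤ 2 * Real.pi * M := by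
    rw [hA, hκ, integral_fejerKernel_mul_sq_trigSum hδ]
    exact mul_le_mul_of_nonneg_left hM (by positivity)
  have hD2 : ∫ t, κ t * ‖D t‖ ^ 2 = 2 * Real.pi * #E := by
    rw [hD, hκ, integral_fejerKernel_mul_sq_trigSum hδ]
    congr 1
    rw [card_eq_sum_ones, Nat.cast_sum]
    refine sum_congr rfl fun m hm => ?_
    rw [sum_eq_single_of_mem m hm]
    · simp [tent]
    · intro n hn hnm
      rw [tent_eq_zero, mul_zero]
      rw [abs_div, abs_of_pos hδ, le_div_iff₀ hδ, one_mul]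
      exact hsep m hm n hn (Ne.symm hnm)
  have hA2I : MeasureTheory.Integrable fun t => κ t * ‖A t‖ ^ 2 :=
    integrable_fejerKernel_mul_sq_trigSum hδ S c θ
  have hD2I : MeasureTheory.Integrable fun t => κ t * ‖D t‖ ^ 2 :=
    integrable_fejerKernel_mul_sq_trigSum hδ E _ y
  -- the trilinear integral
  have htri : ∫ t, (κ t : ℂ) * (A t * B t * D t) = ((2 * Real.pi * ∑ m ∈ E, ∑ i ∈ S, ∑ j ∈ R,
      c i * d j * tent ((θ i + φ j + y m) / δ) : ℝ) : ℂ) := by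
    simp only [hA, hBdef, hD, trigSum_mul, hκ]
    rw [integral_fejerKernel_mul_trigSum hδ, sum_product_right]
    simp only [mul_one, sum_product]
  set L := ∑ m ∈ E, ∑ i ∈ S, ∑ j ∈ R, c i * d j * tent ((θ i + φ j + y m) / δ) with hL
  have hLE : L ≤ -(η * #E) := by
    calc L ≤ ∑ m ∈ E, -η := sum_le_sum hE
      _ = _ := by rw [sum_const, nsmul_eq_mul]; ring
  have hlow : 2 * Real.pi * (η * #E) ≤ ‖∫ t, (κ t : ℂ) * (A t * B t * D t)‖ := by
    rw [htri, Complex.norm_real, Real.norm_eq_abs]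
    have : 2 * Real.pi * (η * #E) ≤ -(2 * Real.pi * L) := by
      rw [← mul_neg]
      exact mul_le_mul_of_nonneg_left (by linarith) (by positivity)
    exact this.trans (neg_le_abs _)
  set l : ℝ := 2 * β / η with hl
  have hlpos : 0 < l := by positivity
  set U : Set ℝ := {t : ℝ | T < |t|} with hU
  have hUm : MeasurableSet U := measurableSet_lt measurable_const continuous_abs.measurable
  have hpt : ∀ t, ‖(κ t : ℂ) * (A t * B t * D t)‖ ≤
      β / 2 * (l * (κ t * ‖A t‖ ^ 2) + l⁻¹ * (κ t * ‖D t‖ ^ 2)) +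
        CA * CB * #E * U.indicator κ t := by
    intro t
    rw [norm_mul, norm_mul, norm_mul, Complex.norm_real, Real.norm_of_nonneg (hκ0 t)]
    by_cases ht : t ∈ U
    · rw [Set.indicator_of_mem ht]
      have h1 : ‖A t‖ * ‖B t‖ * ‖D t‖ ≤ CA * CB * #E :=
        mul_le_mul (mul_le_mul (hAle t) (hBle t) (norm_nonneg _) hCA) (hDle t) (norm_nonneg _)
          (by positivity)
      have h2 : 0 ≤ β / 2 * (l * (κ t * ‖A t‖ ^ 2) + l⁻¹ * (κ t * ‖D t‖ ^ 2)) := by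
        have := hκ0 t
        positivity
      have := mul_le_mul_of_nonneg_left h1 (hκ0 t)
      linarith
    · rw [Set.indicator_of_notMem ht, mul_zero, add_zero]
      have hb := hB t (not_lt.mp ht)
      have hamgm : ‖A t‖ * ‖D t‖ ≤ 1 / 2 * (l * ‖A t‖ ^ 2 + l⁻¹ * ‖D t‖ ^ 2) := by
        have h0 : 0 ≤ l⁻¹ * (l * ‖A t‖ - ‖D t‖) ^ 2 := by positivity
        have : l⁻¹ * (l * ‖A t‖ - ‖D t‖) ^ 2 =
            l * ‖A t‖ ^ 2 + l⁻¹ * ‖D t‖ ^ 2 - 2 * (‖A t‖ * ‖D t‖) := by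
          field_simp; ring
        linarith
      calc κ t * (‖A t‖ * ‖B t‖ * ‖D t‖) = κ t * (‖B t‖ * (‖A t‖ * ‖D t‖)) := by ring
        _ ≤ κ t * (β * (1 / 2 * (l * ‖A t‖ ^ 2 + l⁻¹ * ‖D t‖ ^ 2))) :=
            mul_le_mul_of_nonneg_left (mul_le_mul hb hamgm (by positivity) hβ.le) (hκ0 t)
        _ = _ := by ring
  have hUI : MeasureTheory.Integrable (U.indicator κ) := hκI.indicator hUm
  have hup : ‖∫ t, (κ t : ℂ) * (A t * B t * D t)‖ ≤
      β / 2 * (l * (2 * Real.pi * M) + l⁻¹ * (2 * Real.pi * #E)) +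
        CA * CB * #E * (8 / (δ * T)) := by
    have hInt1 : MeasureTheory.Integrable fun t =>
        β / 2 * (l * (κ t * ‖A t‖ ^ 2) + l⁻¹ * (κ t * ‖D t‖ ^ 2)) :=
      ((hA2I.const_mul l).add (hD2I.const_mul l⁻¹)).const_mul _
    refine (MeasureTheory.norm_integral_le_of_norm_le (hInt1.add (hUI.const_mul (CA * CB * #E)))
      (Filter.Eventually.of_forall hpt)).trans ?_
    rw [MeasureTheory.integral_add' hInt1 (hUI.const_mul _), MeasureTheory.integral_const_mul,
      MeasureTheory.integral_add (hA2I.const_mul l) (hD2I.const_mul l⁻¹),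
      MeasureTheory.integral_const_mul, MeasureTheory.integral_const_mul,
      MeasureTheory.integral_const_mul, hD2, MeasureTheory.integral_indicator hUm]
    have := setIntegral_fejerKernel_le hδ hT
    gcongr
  have hmain := hlow.trans hup
  have hbl : β / 2 * l⁻¹ = η / 4 := by rw [hl]; field_simp; ring
  have hbl2 : β / 2 * l = β ^ 2 / η := by rw [hl]; field_simp
  have h3 : CA * CB * #E * (8 / (δ * T)) ≤ η * #E := by
    calc CA * CB * #E * (8 / (δ * T)) = (CA * CB * (8 / (δ * T))) * #E := by ring
      _ ≤ η * #E := mul_le_mul_of_nonneg_right htail (Nat.cast_nonneg _)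
  have h4 : 2 * Real.pi * (η * #E) ≤ 2 * Real.pi * (β ^ 2 / η * M) +
      2 * Real.pi * (η / 4 * #E) + η * #E := by
    calc _ ≤ _ := hmain
      _ = 2 * Real.pi * ((β / 2 * l) * M) + 2 * Real.pi * ((β / 2 * l⁻¹) * #E) +
          CA * CB * #E * (8 / (δ * T)) := by ring
      _ ≤ _ := by rw [hbl, hbl2]; linarith
  have hpi := Real.pi_gt_three
  have h5 : η * #E ≤ 2 * (β ^ 2 / η * M) := by
    have hn : 0 ≤ η * #E := by positivity
    have h6 : 2 * Real.pi * (3 / 4 * (η * #E)) - η * #E ≤ 2 * Real.pi * (β ^ 2 / η * M) := by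
      linarith
    have h7 : 2 * Real.pi * (1 / 2 * (η * #E)) ≤
        2 * Real.pi * (3 / 4 * (η * #E)) - η * #E := by nlinarith
    have := le_of_mul_le_mul_left (h7.trans h6) (by positivity)
    linarith
  rw [le_div_iff₀ (by positivity)]
  calc #E * η ^ 2 = η * (η * #E) := by ring
    _ ≤ η * (2 * (β ^ 2 / η * M)) := mul_le_mul_of_nonneg_left h5 hη.le
    _ = _ := by field_simp

section
open scoped ArithmeticFunction.vonMangoldt ArithmeticFunction.Moebius ArithmeticFunction.zeta

lemma arithmeticFunction_sub_apply (f g : ArithmeticFunction ℝ) (n : ℕ) :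
    (f - g) n = f n - g n := rfl

lemma sum_arithmeticFunction_mul_weight (f g : ArithmeticFunction ℝ) (W : ℕ → ℝ) {N R : ℕ}
    (hNR : N ≤ R) (hW : ∀ n, N < n → W n = 0) :
    ∑ n ∈ Ioc 0 N, (f * g) n * W n =
      ∑ d ∈ Ioc 0 R, ∑ l ∈ Ioc 0 R, f d * g l * W (d * l) := by
  simp only [ArithmeticFunction.mul_apply]
  trans ∑ n ∈ Ioc 0 N, ∑ x ∈ Ioc 0 R ×ˢ Ioc 0 R with x.1 * x.2 = n,
      f x.1 * g x.2 * W (x.1 * x.2)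
  · refine sum_congr rfl fun n hn ↦ ?_
    simp only [mem_Ioc] at hn
    rw [Nat.divisorsAntidiagonal_eq_prod_filter_of_le hn.1.ne' (hn.2.trans hNR), sum_mul]
    exact sum_congr rfl fun x hx => by rw [(mem_filter.mp hx).2]
  · simp_rw [sum_filter]
    rw [sum_comm, ← sum_product' _ _ (fun d l => f d * g l * W (d * l))]
    refine sum_congr rfl fun x hx => ?_
    rw [sum_ite_eq]
    split_ifs with h
    · rfl
    · rw [mem_product, mem_Ioc, mem_Ioc] at hx
      rw [hW, mul_zero]
      by_contra h2
      exact h (mem_Ioc.mpr ⟨Nat.mul_pos hx.1.1 hx.2.1, not_lt.mp h2⟩)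

/-- The Möbius function cut off at `u`. -/
noncomputable def truncMoebius (u : ℕ) : ArithmeticFunction ℝ :=
  ⟨fun n => if n ≤ u then (μ n : ℝ) else 0, by simp⟩

lemma truncMoebius_apply (u n : ℕ) : truncMoebius u n = if n ≤ u then (μ n : ℝ) else 0 := rfl

lemma abs_truncMoebius_le (u n : ℕ) : |truncMoebius u n| ≤ 1 := by
  rw [truncMoebius_apply]
  split_ifs
  · exact_mod_cast ArithmeticFunction.abs_moebius_le_one
  · simp

/-- `δ - 1 * μ_{≤ u}`, supported beyond `u`. -/
noncomputable def moebiusTail (u : ℕ) : ArithmeticFunction ℝ :=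
  1 - (ζ : ArithmeticFunction ℝ) * truncMoebius u

lemma zeta_mul_truncMoebius_apply (u n : ℕ) :
    ((ζ : ArithmeticFunction ℝ) * truncMoebius u) n = ∑ d ∈ n.divisors, truncMoebius u d := by
  rw [ArithmeticFunction.coe_zeta_mul_apply]

lemma moebiusTail_eq_zero {u n : ℕ} (h : n ≤ u) : moebiusTail u n = 0 := by
  have h1 : ((ζ : ArithmeticFunction ℝ) * truncMoebius u) n =
      ((ζ : ArithmeticFunction ℝ) * (μ : ArithmeticFunction ℝ)) n := by
    rw [zeta_mul_truncMoebius_apply, ArithmeticFunction.coe_zeta_mul_apply]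
    refine sum_congr rfl fun d hd => ?_
    rw [truncMoebius_apply, if_pos ((Nat.divisor_le hd).trans h)]
    rfl
  rw [moebiusTail, arithmeticFunction_sub_apply, h1, ArithmeticFunction.coe_zeta_mul_coe_moebius,
    sub_self]

lemma abs_moebiusTail_le {u : ℕ} (hu : 1 ≤ u) (n : ℕ) : |moebiusTail u n| ≤ #n.divisors := by
  rcases le_or_gt n u with h | h
  · rw [moebiusTail_eq_zero h]; simp
  · rw [moebiusTail, arithmeticFunction_sub_apply, ArithmeticFunction.one_apply_ne (by omega),
      zeta_mul_truncMoebius_apply, zero_sub, abs_neg]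
    refine (abs_sum_le_sum_abs _ _).trans ((sum_le_sum fun d _ => abs_truncMoebius_le u d).trans ?_)
    simp

/-- `lamOne` as an arithmetic function. -/
noncomputable def lamArith : ArithmeticFunction ℝ := ⟨lamOne, lamOne_zero⟩

lemma lamArith_apply (n : ℕ) : lamArith n = lamOne n := rfl

lemma lamArith_eq : lamArith = Λ - (ζ : ArithmeticFunction ℝ) := by
  ext n
  rcases Nat.eq_zero_or_pos n with rfl | h
  · simp
  · rw [lamArith_apply, lamOne_of_pos h, arithmeticFunction_sub_apply,
      ArithmeticFunction.natCoe_apply, ArithmeticFunction.zeta_apply_ne h.ne', Nat.cast_one]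

/-- `lamOne` smoothly cut off at `V`. -/
noncomputable def lamCut (V : ℝ) : ArithmeticFunction ℝ :=
  ⟨fun n => lamOne n * max 0 (1 - n / V), by simp⟩

lemma lamCut_apply (V : ℝ) (n : ℕ) : lamCut V n = lamOne n * max 0 (1 - n / V) := rfl

lemma lamCut_eq_zero {V : ℝ} (hV : 0 < V) {n : ℕ} (h : V ≤ n) : lamCut V n = 0 := by
  rw [lamCut_apply, max_eq_left, mul_zero]
  have : 1 ≤ n / V := by rwa [le_div_iff₀ hV, one_mul]
  linarith

lemma abs_lamOne_le (n : ℕ) : |lamOne n| ≤ n := by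
  rcases Nat.eq_zero_or_pos n with rfl | h
  · simp
  · rw [lamOne_of_pos h, abs_le]
    have h1 := ArithmeticFunction.vonMangoldt_nonneg (n := n)
    have h2 := ArithmeticFunction.vonMangoldt_le_log (n := n)
    have h3 : (1 : ℝ) ≤ n := by exact_mod_cast h
    have h4 := Real.log_le_sub_one_of_pos (show (0 : ℝ) < n by linarith)
    constructor <;> linarith

lemma cut_mem {V : ℝ} (hV : 0 < V) (n : ℕ) :
    0 ≤ max 0 (1 - n / V) ∧ max 0 (1 - n / V) ≤ 1 :=
  ⟨le_max_left _ _, max_le zero_le_one (by have : 0 ≤ n / V := by positivity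
                                           linarith)⟩

lemma abs_lamCut_le {V : ℝ} (hV : 0 < V) (n : ℕ) : |lamCut V n| ≤ n := by
  rw [lamCut_apply, abs_mul, abs_of_nonneg (cut_mem hV n).1]
  calc _ ≤ |lamOne n| * 1 := mul_le_mul_of_nonneg_left (cut_mem hV n).2 (abs_nonneg _)
    _ ≤ n := by rw [mul_one]; exact abs_lamOne_le n

lemma abs_lamArith_sub_lamCut_le {V : ℝ} (hV : 0 < V) (n : ℕ) :
    |(lamArith - lamCut V) n| ≤ n * (n / V) := by
  rw [arithmeticFunction_sub_apply, lamArith_apply, lamCut_apply]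
  have : lamOne n - lamOne n * max 0 (1 - n / V) = lamOne n * (1 - max 0 (1 - n / V)) := by ring
  rw [this, abs_mul, abs_of_nonneg (sub_nonneg.mpr (cut_mem hV n).2)]
  refine mul_le_mul (abs_lamOne_le n) ?_ (by linarith [(cut_mem hV n).2]) (Nat.cast_nonneg _)
  linarith [le_max_right 0 (1 - n / V)]

/-- The part of `Λ - 1` treated by summation over long ranges. -/
noncomputable def typeOne (u : ℕ) : ArithmeticFunction ℝ :=
  (ArithmeticFunction.log - (ζ : ArithmeticFunction ℝ) * (ζ : ArithmeticFunction ℝ)) *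
    truncMoebius u - (ζ : ArithmeticFunction ℝ) * (truncMoebius u * lamCut u)

/-- A Vaughan type identity. -/
theorem lamArith_decomposition (u : ℕ) (Z : ℝ) :
    lamArith = typeOne u + lamCut u + moebiusTail u * (lamCut Z - lamCut u) +
      moebiusTail u * (lamArith - lamCut Z) := by
  have h1 : (ArithmeticFunction.log : ArithmeticFunction ℝ) =
      Λ * (ζ : ArithmeticFunction ℝ) := ArithmeticFunction.vonMangoldt_mul_zeta.symm
  rw [typeOne, h1, moebiusTail]
  have h2 : Λ = lamArith + (ζ : ArithmeticFunction ℝ) := by rw [lamArith_eq]; abel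
  rw [h2]
  ring

lemma card_divisors_mul_le (m n : ℕ) : #(m * n).divisors ≤ #m.divisors * #n.divisors := by
  rw [Nat.divisors_mul]
  exact card_mul_le

lemma sum_card_divisors_sq_div_le (R : ℕ) :
    ∑ k ∈ Ioc 0 R, (#k.divisors : ℝ) ^ 2 / k ≤ (∑ k ∈ Ioc 0 R, (1 : ℝ) / k) ^ 4 := by
  have aux : ∀ g : ℕ → ℝ, (∀ n, 0 ≤ g n) → g 0 = 0 →
      (∀ m n, g (m * n) ≤ g m * g n) →
      ∑ k ∈ Ioc 0 R, (#k.divisors : ℝ) * g k / k ≤ (∑ k ∈ Ioc 0 R, g k / k) ^ 2 := by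
    intro g hg hg0 hgm
    have h := sum_arithmeticFunction_mul_weight (N := R) (R := R) (ζ : ArithmeticFunction ℝ)
      (ζ : ArithmeticFunction ℝ) (fun n => if n ≤ R then g n / n else 0) le_rfl
      (fun n hn => by rw [if_neg (not_le.mpr hn)])
    have h1 : ∑ k ∈ Ioc 0 R, (#k.divisors : ℝ) * g k / k =
        ∑ n ∈ Ioc 0 R, ((ζ : ArithmeticFunction ℝ) * (ζ : ArithmeticFunction ℝ)) n *
          (if n ≤ R then g n / n else 0) := by
      refine sum_congr rfl fun n hn => ?_
      rw [if_pos (mem_Ioc.mp hn).2, ArithmeticFunction.coe_zeta_mul_apply, mul_div_assoc]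
      congr 1
      rw [card_eq_sum_ones, Nat.cast_sum]
      refine sum_congr rfl fun d hd => ?_
      rw [ArithmeticFunction.natCoe_apply,
        ArithmeticFunction.zeta_apply_ne (Nat.pos_of_mem_divisors hd).ne']
    rw [h1, h, sq, sum_mul_sum]
    refine sum_le_sum fun d hd => sum_le_sum fun l hl => ?_
    rw [mem_Ioc] at hd hl
    rw [ArithmeticFunction.natCoe_apply, ArithmeticFunction.natCoe_apply,
      ArithmeticFunction.zeta_apply_ne hd.1.ne', ArithmeticFunction.zeta_apply_ne hl.1.ne',
      Nat.cast_one, one_mul, one_mul]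
    split_ifs
    · rw [div_mul_div_comm, Nat.cast_mul]
      exact div_le_div_of_nonneg_right (hgm d l) (by positivity)
    · exact mul_nonneg (div_nonneg (hg d) (Nat.cast_nonneg _)) (div_nonneg (hg l) (Nat.cast_nonneg _))
  have h1 := aux (fun n => #n.divisors) (fun n => Nat.cast_nonneg _) (by simp)
    (fun m n => by exact_mod_cast card_divisors_mul_le m n)
  have h2 := aux (fun n => if n = 0 then 0 else 1) (fun n => by split_ifs <;> simp) (by simp)
    (fun m n => by by_cases hm : m = 0 <;> by_cases hn : n = 0 <;> simp [hm, hn])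
  have h3 : ∀ c : ℕ → ℝ, ∑ k ∈ Ioc 0 R, c k * (if k = 0 then 0 else 1) / k =
      ∑ k ∈ Ioc 0 R, c k / k := fun c => sum_congr rfl fun k hk => by
    rw [if_neg (mem_Ioc.mp hk).1.ne', mul_one]
  have h4 : ∑ k ∈ Ioc 0 R, (if k = 0 then (0 : ℝ) else 1) / k = ∑ k ∈ Ioc 0 R, (1 : ℝ) / k :=
    sum_congr rfl fun k hk => by rw [if_neg (mem_Ioc.mp hk).1.ne']
  simp only [h3, h4] at h2
  calc _ = ∑ k ∈ Ioc 0 R, (#k.divisors : ℝ) * #k.divisors / k :=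
        sum_congr rfl fun k _ => by rw [sq]
    _ ≤ _ := h1
    _ ≤ ((∑ k ∈ Ioc 0 R, (1 : ℝ) / k) ^ 2) ^ 2 :=
        pow_le_pow_left₀ (sum_nonneg fun _ _ => by positivity) h2 2
    _ = _ := by ring

end

lemma card_le_of_forall_mem_Icc {s : Finset ℕ} {x y : ℝ} (hxy : x ≤ y + 1)
    (h : ∀ n ∈ s, x ≤ n ∧ (n : ℝ) ≤ y) : (#s : ℝ) ≤ y - x + 1 := by
  rcases s.eq_empty_or_nonempty with rfl | hs
  · simp; linarith
  · have h1 : #s ≤ #(Icc (s.min' hs) (s.max' hs)) :=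
      card_le_card fun n hn => mem_Icc.mpr ⟨s.min'_le n hn, s.le_max' n hn⟩
    rw [Nat.card_Icc] at h1
    have h2 := s.min'_le_max' hs
    have h3 : (#s : ℝ) + s.min' hs ≤ s.max' hs + 1 := by exact_mod_cast (by omega)
    linarith [(h _ (s.min'_mem hs)).1, (h _ (s.max'_mem hs)).2]

lemma exp_le_one_add_two_mul {x : ℝ} (h0 : 0 ≤ x) (h1 : x ≤ 1 / 2) :
    Real.exp x ≤ 1 + 2 * x := by
  refine (Real.exp_bound_div_one_sub_of_interval h0 (by linarith)).trans ?_
  rw [div_le_iff₀ (by linarith)]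
  nlinarith

lemma tent_log_ne_zero {δ x y : ℝ} (hδ : 0 < δ) (hx : 0 < x) (hy : 0 < y) (hδ2 : δ ≤ 1 / 2)
    (h : tent ((Real.log x - Real.log y) / δ) ≠ 0) :
    y * (1 - δ) ≤ x ∧ x ≤ y * (1 + 2 * δ) := by
  have h1 : |Real.log x - Real.log y| < δ := by
    by_contra h2
    refine h (tent_eq_zero ?_)
    rw [abs_div, abs_of_pos hδ, le_div_iff₀ hδ, one_mul]
    exact not_lt.mp h2
  rw [abs_lt] at h1
  constructor
  · have h3 : Real.log y + -δ ≤ Real.log x := by linarith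
    have h4 := Real.exp_le_exp.mpr h3
    rw [Real.exp_add, Real.exp_log hx, Real.exp_log hy] at h4
    have := Real.add_one_le_exp (-δ)
    refine le_trans (mul_le_mul_of_nonneg_left (by linarith) hy.le) h4
  · have h3 : Real.log x ≤ Real.log y + δ := by linarith
    have h4 := Real.exp_le_exp.mpr h3
    rw [Real.exp_add, Real.exp_log hx, Real.exp_log hy] at h4
    exact h4.trans (mul_le_mul_of_nonneg_left (exp_le_one_add_two_mul hδ.le hδ2) hy.le)

lemma sum_inv_mul_tent_le {δ : ℝ} (hδ : 0 < δ) (hδ2 : δ ≤ 1 / 2) (R : ℕ) {i : ℕ} (hi : 1 ≤ i) :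
    ∑ j ∈ Ioc 0 R, (1 : ℝ) / j * tent ((Real.log j - Real.log i) / δ) ≤ 6 * δ + 2 / i := by
  classical
  have hi' : (0 : ℝ) < i := by exact_mod_cast hi
  set s : Finset ℕ := {j ∈ Ioc 0 R | tent ((Real.log (j : ℕ) - Real.log i) / δ) ≠ 0} with hs
  have hmem : ∀ j ∈ s, (i : ℝ) * (1 - δ) ≤ j ∧ (j : ℝ) ≤ i * (1 + 2 * δ) := by
    intro j hj
    rw [hs, mem_filter, mem_Ioc] at hj
    exact tent_log_ne_zero hδ (by exact_mod_cast hj.1.1) hi' hδ2 hj.2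
  have hcard := card_le_of_forall_mem_Icc (by nlinarith) hmem
  calc ∑ j ∈ Ioc 0 R, (1 : ℝ) / j * tent ((Real.log j - Real.log i) / δ)
      = ∑ j ∈ s, (1 : ℝ) / j * tent ((Real.log j - Real.log i) / δ) := by
        rw [hs, sum_filter]
        refine sum_congr rfl fun j _ => ?_
        split_ifs with h
        · rfl
        · rw [not_ne_iff.mp h, mul_zero]
    _ ≤ ∑ j ∈ s, 2 / (i : ℝ) := by
        refine sum_le_sum fun j hj => ?_
        have h1 := (hmem j hj).1
        have h2 : (i : ℝ) / 2 ≤ j := by nlinarith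
        calc (1 : ℝ) / j * tent ((Real.log j - Real.log i) / δ) ≤ 1 / j * 1 :=
              mul_le_mul_of_nonneg_left (tent_le_one _) (by positivity)
          _ = 1 / j := mul_one _
          _ ≤ 1 / ((i : ℝ) / 2) := one_div_le_one_div_of_le (by positivity) h2
          _ = 2 / i := by field_simp
    _ = #s * (2 / (i : ℝ)) := by rw [sum_const, nsmul_eq_mul]
    _ ≤ (i * (1 + 2 * δ) - i * (1 - δ) + 1) * (2 / (i : ℝ)) :=
        mul_le_mul_of_nonneg_right hcard (by positivity)
    _ = _ := by field_simp; ring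

lemma tent_neg (u : ℝ) : tent (-u) = tent u := by unfold tent; rw [abs_neg]

lemma mean_square_le {δ : ℝ} (hδ : 0 < δ) (hδ2 : δ ≤ 1 / 2) (R : ℕ) {u : ℕ} (hu : 1 ≤ u)
    {α : ℕ → ℝ} (hα : ∀ n, |α n| ≤ #n.divisors) (hα0 : ∀ n ≤ u, α n = 0) :
    ∑ i ∈ Ioc 0 R, ∑ j ∈ Ioc 0 R, (α i / i) * (α j / j) *
      tent ((-Real.log i - -Real.log j) / δ) ≤
      (6 * δ + 2 / u) * ∑ k ∈ Ioc 0 R, (#k.divisors : ℝ) ^ 2 / k := by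
  have hu' : (0 : ℝ) < u := by exact_mod_cast hu
  have hsym : ∀ i j : ℕ, tent ((-Real.log i - -Real.log j) / δ) =
      tent ((Real.log j - Real.log i) / δ) := fun i j => by congr 2; ring
  have hsym' : ∀ i j : ℕ, tent ((Real.log j - Real.log i) / δ) =
      tent ((Real.log i - Real.log j) / δ) := fun i j => by
    rw [← tent_neg]; congr 1; ring
  have hterm : ∀ i j : ℕ, (α i / i) * (α j / j) * tent ((-Real.log i - -Real.log j) / δ) ≤
      1 / 2 * (α i ^ 2 / i * (1 / j * tent ((Real.log j - Real.log i) / δ))) +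
      1 / 2 * (α j ^ 2 / j * (1 / i * tent ((Real.log i - Real.log j) / δ))) := by
    intro i j
    rw [hsym, ← hsym' i j]
    have h1 := tent_nonneg ((Real.log j - Real.log i) / δ)
    have h2 : 0 ≤ (1 / (i * j : ℝ)) * tent ((Real.log j - Real.log i) / δ) := by positivity
    have h3 := mul_le_mul_of_nonneg_right (two_mul_le_add_sq (α i) (α j)) h2
    have e1 : (α i / i) * (α j / j) * tent ((Real.log j - Real.log i) / δ) =
      1 / 2 * (2 * α i * α j * ((1 / (i * j : ℝ)) * tent ((Real.log j - Real.log i) / δ))) := by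
      rw [one_div_mul_eq_div, ← one_div_mul_one_div (i : ℝ) j]; ring
    rw [e1]
    refine (mul_le_mul_of_nonneg_left h3 (by norm_num)).trans (le_of_eq ?_)
    rw [← one_div_mul_one_div (i : ℝ) j]; ring
  have hone : ∀ i ∈ Ioc 0 R, α i ^ 2 / i * ∑ j ∈ Ioc 0 R,
      (1 : ℝ) / j * tent ((Real.log j - Real.log i) / δ) ≤
      (6 * δ + 2 / u) * ((#i.divisors : ℝ) ^ 2 / i) := by
    intro i hi
    rw [mem_Ioc] at hi
    rcases le_or_gt i u with h | h
    · rw [hα0 i h]; simp; positivity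
    · have h1 := sum_inv_mul_tent_le hδ hδ2 R hi.1
      have h2 : (2 : ℝ) / i ≤ 2 / u :=
        div_le_div_of_nonneg_left (by norm_num) hu' (by exact_mod_cast h.le)
      have h3 : α i ^ 2 ≤ (#i.divisors : ℝ) ^ 2 := by
        rw [← sq_abs]; exact pow_le_pow_left₀ (abs_nonneg _) (hα i) 2
      calc _ ≤ (#i.divisors : ℝ) ^ 2 / i * (6 * δ + 2 / u) := by
            refine mul_le_mul (div_le_div_of_nonneg_right h3 (Nat.cast_nonneg _)) (by linarith)
              (sum_nonneg fun j _ => mul_nonneg (by positivity) (tent_nonneg _)) (by positivity)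
        _ = _ := mul_comm _ _
  calc _ ≤ ∑ i ∈ Ioc 0 R, ∑ j ∈ Ioc 0 R,
        (1 / 2 * (α i ^ 2 / i * (1 / j * tent ((Real.log j - Real.log i) / δ))) +
        1 / 2 * (α j ^ 2 / j * (1 / i * tent ((Real.log i - Real.log j) / δ)))) :=
        sum_le_sum fun i _ => sum_le_sum fun j _ => hterm i j
    _ = ∑ i ∈ Ioc 0 R, α i ^ 2 / i * ∑ j ∈ Ioc 0 R,
        (1 : ℝ) / j * tent ((Real.log j - Real.log i) / δ) := by
        simp_rw [sum_add_distrib]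
        rw [sum_comm (f := fun i j : ℕ => 1 / 2 * (α j ^ 2 / j *
          (1 / (i : ℝ) * tent ((Real.log i - Real.log j) / δ))))]
        rw [← sum_add_distrib]
        refine sum_congr rfl fun i _ => ?_
        rw [← mul_sum, ← mul_sum]
        ring
    _ ≤ _ := by rw [mul_sum]; exact sum_le_sum hone

/-- A weight concentrated near the middle of `[m ^ 3, (m + 1) ^ 3)`. -/
noncomputable def cubeWeight (δ : ℝ) (m k : ℕ) : ℝ :=
  tent ((Real.log k - 3 * Real.log (m + 1 / 2)) / δ) / k

lemma cubeWeight_nonneg (δ : ℝ) (m k : ℕ) : 0 ≤ cubeWeight δ m k :=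
  div_nonneg (tent_nonneg _) (Nat.cast_nonneg _)

lemma cubeWeight_le (δ : ℝ) (m k : ℕ) : cubeWeight δ m k ≤ 1 / k :=
  div_le_div_of_nonneg_right (tent_le_one _) (Nat.cast_nonneg _)

lemma three_mul_log (m : ℕ) : 3 * Real.log (m + 1 / 2) = Real.log (((m : ℝ) + 1 / 2) ^ 3) := by
  rw [Real.log_pow]; norm_num

lemma cubeWeight_ne_zero {δ : ℝ} {m k : ℕ} (hδ : 0 < δ) (hm : 1 ≤ m) (hδm : δ * (2 * m) ≤ 1)
    (h : cubeWeight δ m k ≠ 0) : m ^ 3 < k ∧ k + 1 < (m + 1) ^ 3 := by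
  have hm' : (1 : ℝ) ≤ m := by exact_mod_cast hm
  have hk : 0 < k := by
    rcases Nat.eq_zero_or_pos k with rfl | h2
    · simp [cubeWeight] at h
    · exact h2
  have ht : tent ((Real.log k - Real.log (((m : ℝ) + 1 / 2) ^ 3)) / δ) ≠ 0 := by
    intro h2
    exact h (by rw [cubeWeight, three_mul_log, h2, zero_div])
  have hδ2 : δ ≤ 1 / 2 := by nlinarith
  obtain ⟨h1, h2⟩ := tent_log_ne_zero hδ (by exact_mod_cast hk) (by positivity) hδ2 ht
  have hd1 : δ ≤ 1 / (2 * m) := by rwa [le_div_iff₀ (by positivity)]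
  constructor
  · have h3 : ((m : ℝ) + 1 / 2) ^ 3 * (1 - 1 / (2 * m)) ≤ k :=
      (mul_le_mul_of_nonneg_left (by linarith) (by positivity)).trans h1
    have h4 : (m : ℝ) ^ 3 < ((m : ℝ) + 1 / 2) ^ 3 * (1 - 1 / (2 * m)) := by
      have e : ((m : ℝ) + 1 / 2) ^ 3 * (1 - 1 / (2 * m)) =
          m ^ 3 + m ^ 2 - (1 / 4 + 1 / (16 * m)) := by
        field_simp; ring
      have : 1 / (16 * (m : ℝ)) ≤ 1 / 16 := by
        refine one_div_le_one_div_of_le (by norm_num) (by linarith)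
      rw [e]; nlinarith
    exact_mod_cast h4.trans_le h3
  · have h3 : (k : ℝ) ≤ ((m : ℝ) + 1 / 2) ^ 3 * (1 + 1 / m) := by
      refine h2.trans (mul_le_mul_of_nonneg_left ?_ (by positivity))
      have : 2 * (1 / (2 * (m : ℝ))) = 1 / m := by field_simp
      linarith
    have h4 : ((m : ℝ) + 1 / 2) ^ 3 * (1 + 1 / m) + 1 < ((m : ℝ) + 1) ^ 3 := by
      have e : ((m : ℝ) + 1 / 2) ^ 3 * (1 + 1 / m) =
          m ^ 3 + 5 / 2 * m ^ 2 + 9 / 4 * m + 7 / 8 + 1 / (8 * m) := by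
        field_simp; ring
      have : 1 / (8 * (m : ℝ)) ≤ 1 / 8 := by
        refine one_div_le_one_div_of_le (by norm_num) (by linarith)
      rw [e]; nlinarith
    have : (k : ℝ) + 1 < ((m : ℝ) + 1) ^ 3 := by linarith
    exact_mod_cast this

lemma log_separated {X m n : ℕ} (hm : m < 2 * X) (hn : n < 2 * X) (hmn : m ≠ n) :
    1 / (4 * X : ℝ) ≤ |3 * Real.log (m + 1 / 2) - 3 * Real.log (n + 1 / 2)| := by
  wlog h : n < m generalizing m n
  · rw [abs_sub_comm]
    exact this hn hm (Ne.symm hmn) (by omega)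
  refine le_trans ?_ (le_abs_self _)
  have hX : (0 : ℝ) < X := by exact_mod_cast (by omega : 0 < X)
  have hm0 : (0 : ℝ) < m + 1 / 2 := by positivity
  have hn0 : (0 : ℝ) < n + 1 / 2 := by positivity
  have h1 := Real.log_le_sub_one_of_pos (div_pos hn0 hm0)
  rw [Real.log_div hn0.ne' hm0.ne'] at h1
  have h2 : ((n : ℝ) + 1 / 2) / (m + 1 / 2) ≤ 1 - 1 / (m + 1 / 2) := by
    rw [div_le_iff₀ hm0, sub_mul, one_mul, one_div_mul_cancel hm0.ne']
    have : (n : ℝ) + 1 ≤ m := by exact_mod_cast h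
    linarith
  have h3 : 1 / (2 * X : ℝ) ≤ 1 / ((m : ℝ) + 1 / 2) := by
    refine one_div_le_one_div_of_le hm0 ?_
    have : (m : ℝ) + 1 ≤ 2 * X := by exact_mod_cast hm
    linarith
  have h4 : 1 / (4 * X : ℝ) ≤ 1 / (2 * X) := by
    refine one_div_le_one_div_of_le (by positivity) (by linarith)
  have h5 : 0 < 1 / ((m : ℝ) + 1 / 2) := by positivity
  linarith

lemma sum_Ioc_one_div_le (R : ℕ) : ∑ k ∈ Ioc 0 R, (1 : ℝ) / k ≤ 1 + Real.log R := by
  have h := harmonic_le_one_add_log R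
  rw [harmonic_eq_sum_Icc] at h
  push_cast at h
  refine le_trans (le_of_eq ?_) h
  exact sum_congr rfl fun k _ => one_div _

lemma rieszSum_eq_sum {N R : ℕ} (hN : 0 < N) (hNR : N ≤ R) (t : ℝ) :
    rieszSum N (1 + t * Complex.I) = trigSum (Ioc 0 R) (fun n => lamCut N n / n)
      (fun n => -Real.log n) t := by
  have hterm : ∀ n : ℕ, 1 ≤ n → (n : ℂ) ^ (-(1 + t * Complex.I)) =
      (((n : ℝ)⁻¹ : ℝ) : ℂ) * Complex.exp (((t * -Real.log n : ℝ) : ℂ) * Complex.I) := by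
    intro n hn
    rw [natCast_cpow_neg_eq hn]
    simp [Real.rpow_neg_one]
  have hpos : ∀ n : ℕ, N ≤ n → lamCut N n = 0 := by
    intro n hn
    exact lamCut_eq_zero (by exact_mod_cast hN) (by exact_mod_cast hn)
  rw [rieszSum, Nat.ceil_natCast, trigSum]
  have h1 : ∑ n ∈ range N, ((lamOne n * max 0 (1 - n / (N : ℝ)) : ℝ) : ℂ) *
      (n : ℂ) ^ (-(1 + t * Complex.I)) = ∑ n ∈ range (R + 1),
      ((lamCut N n : ℝ) : ℂ) * (n : ℂ) ^ (-(1 + t * Complex.I)) := by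
    refine sum_subset_zero_on_sdiff (range_mono (by omega)) (fun n hn => ?_) (fun n _ => rfl)
    rw [mem_sdiff, mem_range, mem_range] at hn
    rw [hpos n (by omega)]; simp
  have h2 : ∑ n ∈ Ioc 0 R, ((lamCut N n : ℝ) : ℂ) * (n : ℂ) ^ (-(1 + t * Complex.I)) =
      ∑ n ∈ range (R + 1), ((lamCut N n : ℝ) : ℂ) * (n : ℂ) ^ (-(1 + t * Complex.I)) := by
    refine sum_subset_zero_on_sdiff (fun n hn => ?_) (fun n hn => ?_) (fun n _ => rfl)
    · rw [mem_Ioc] at hn; exact mem_range.mpr (by omega)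
    · rw [mem_sdiff, mem_range, mem_Ioc] at hn
      have : n = 0 := by omega
      rw [this]; simp
  rw [h1, ← h2]
  refine sum_congr rfl fun n hn => ?_
  rw [hterm n (mem_Ioc.mp hn).1, div_eq_mul_inv, Complex.ofReal_mul (lamCut N n)]
  ring

theorem exists_typeTwo_card_bound : ∃ K : ℝ, 2 ≤ K ∧ ∀ Q ≥ K, ∀ X u : ℕ,
    (X : ℝ) = Real.exp (Q ^ 16 / 100) → (X : ℝ) / (2 * Real.exp (Q / 10 ^ 5)) ≤ u → u ≤ X →
    ∀ E ⊆ Ico X (2 * X),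
    (∀ m ∈ E, ∑ d ∈ Ioc 0 (X ^ 20), ∑ l ∈ Ioc 0 (X ^ 20),
      moebiusTail u d * (lamCut ((X ^ 20 : ℕ) : ℝ) - lamCut u) l *
        cubeWeight (1 / (4 * X)) m (d * l) ≤ -(1 / (64 * X))) →
    (#E : ℝ) ≤ X * Real.exp (-(Q / (2 * 10 ^ 5))) := by
  obtain ⟨K₁, hK₁, hP⟩ := exists_rieszSum_sub_bound
  obtain ⟨K₂, hK₂⟩ := exists_pow_mul_exp_le 196608 64 (a := 1 / 10 ^ 5) (b := 1 / (2 * 10 ^ 5))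
    (by norm_num)
  refine ⟨max K₁ K₂, le_max_of_le_left hK₁, fun Q hQ X u hX hu huX E hEX hE => ?_⟩
  have hQ1 : K₁ ≤ Q := (le_max_left _ _).trans hQ
  have hQ2 : 2 ≤ Q := hK₁.trans hQ1
  have hQ0 : 0 < Q := by linarith
  set q : ℝ := Q / 10 ^ 5 with hq
  have hq0 : 0 < q := by positivity
  have hQ16 : 2 ^ 15 * Q ≤ Q ^ 16 := by
    calc (2 : ℝ) ^ 15 * Q ≤ Q ^ 15 * Q :=
          mul_le_mul_of_nonneg_right (pow_le_pow_left₀ (by norm_num) hQ2 15) hQ0.le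
      _ = Q ^ 16 := by ring
  have hX2 : (2 : ℝ) ≤ X := by
    rw [hX]
    have := Real.add_one_le_exp (Q ^ 16 / 100)
    linarith
  have hX0 : (0 : ℝ) < X := by linarith
  have hX2' : 2 ≤ X := by exact_mod_cast hX2
  have hlogX : Real.log X = Q ^ 16 / 100 := by rw [hX, Real.log_exp]
  have hu0 : (0 : ℝ) < u := lt_of_lt_of_le (by positivity) hu
  have hu1 : 1 ≤ u := by exact_mod_cast hu0
  have hpow : ∀ k : ℕ, (X : ℝ) ^ k = Real.exp (k * (Q ^ 16 / 100)) := fun k => by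
    rw [hX, Real.exp_nat_mul]
  have hX100 : (X : ℝ) ^ 100 = Real.exp (Q ^ 16) := by rw [hpow]; congr 1; push_cast; ring
  have huR : u ≤ X ^ 20 := huX.trans (Nat.le_self_pow (by norm_num) X)
  have hulow : Real.exp (Q ^ 16 / 200) ≤ u := by
    refine le_trans ?_ hu
    rw [le_div_iff₀ (by positivity), hX]
    have h2 : (2 : ℝ) ≤ Real.exp 1 := by have := Real.add_one_le_exp (1 : ℝ); linarith
    calc Real.exp (Q ^ 16 / 200) * (2 * Real.exp q) ≤
          Real.exp (Q ^ 16 / 200) * (Real.exp 1 * Real.exp q) := by gcongr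
      _ = Real.exp (Q ^ 16 / 200 + (1 + q)) := by rw [Real.exp_add, Real.exp_add]
      _ ≤ Real.exp (Q ^ 16 / 100) := by
          refine Real.exp_le_exp.mpr ?_
          rw [hq]
          linarith
  have huhigh : (u : ℝ) ≤ Real.exp (Q ^ 16) := by
    have : (u : ℝ) ≤ X := by exact_mod_cast huX
    rw [hX] at this
    refine this.trans (Real.exp_le_exp.mpr ?_)
    have : 0 ≤ Q ^ 16 := by positivity
    linarith
  set R := X ^ 20 with hR
  have hRr : (R : ℝ) = (X : ℝ) ^ 20 := by rw [hR]; push_cast; rfl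
  have hR0 : (0 : ℝ) < R := by rw [hRr]; positivity
  have hlogR : Real.log R = Q ^ 16 / 5 := by
    rw [hRr, Real.log_pow, hlogX]; push_cast; ring
  have hRlow : Real.exp (Q ^ 16 / 200) ≤ R := by
    rw [← Real.exp_log hR0, hlogR]
    refine Real.exp_le_exp.mpr ?_
    have : 0 ≤ Q ^ 16 := by positivity
    linarith
  have hRhigh : (R : ℝ) ≤ Real.exp (Q ^ 16) := by
    rw [← Real.exp_log hR0, hlogR]
    refine Real.exp_le_exp.mpr ?_
    have : 0 ≤ Q ^ 16 := by positivity
    linarith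
  set b := lamCut (R : ℝ) - lamCut u with hb
  have hB : ∀ t : ℝ, |t| ≤ Real.exp (Q ^ 16) / 8 →
      ‖trigSum (Ioc 0 R) (fun n => b n / n) (fun n => -Real.log n) t‖ ≤ 2 * Real.exp (-q) := by
    intro t ht
    have h1 := hP Q hQ1 R t hRlow hRhigh ht
    have h2 := hP Q hQ1 u t hulow huhigh ht
    rw [← hq] at h1 h2
    have e : trigSum (Ioc 0 R) (fun n => b n / n) (fun n => -Real.log n) t =
        (rieszSum R (1 + t * Complex.I) - primeF (1 + t * Complex.I)) -
        (rieszSum u (1 + t * Complex.I) - primeF (1 + t * Complex.I)) := by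
      rw [rieszSum_eq_sum (hu1.trans huR) le_rfl, rieszSum_eq_sum hu1 huR, sub_sub_sub_cancel_right]
      unfold trigSum
      rw [← sum_sub_distrib]
      refine sum_congr rfl fun n _ => ?_
      simp only [hb, arithmeticFunction_sub_apply]
      push_cast
      ring
    rw [e]
    refine (norm_sub_le _ _).trans ?_
    linarith
  have hδ : (0 : ℝ) < 1 / (4 * X) := by positivity
  have hδ2 : 1 / (4 * X : ℝ) ≤ 1 / 2 := one_div_le_one_div_of_le (by norm_num) (by linarith)
  have hM := mean_square_le hδ hδ2 R hu1 (abs_moebiusTail_le hu1)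
    (fun n hn => moebiusTail_eq_zero hn)
  have hH : ∑ k ∈ Ioc 0 R, (#k.divisors : ℝ) ^ 2 / k ≤ Q ^ 64 := by
    refine (sum_card_divisors_sq_div_le R).trans ?_
    have h1 := sum_Ioc_one_div_le R
    rw [hlogR] at h1
    have h2 : ∑ k ∈ Ioc 0 R, (1 : ℝ) / k ≤ Q ^ 16 := by linarith
    calc _ ≤ (Q ^ 16) ^ 4 := pow_le_pow_left₀ (sum_nonneg fun _ _ => by positivity) h2 4
      _ = Q ^ 64 := by ring
  have hL1 : 1 ≤ Real.exp q := Real.one_le_exp hq0.le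
  have hM2 : ∑ i ∈ Ioc 0 R, ∑ j ∈ Ioc 0 R, (moebiusTail u i / i) * (moebiusTail u j / j) *
      tent ((-Real.log i - -Real.log j) / (1 / (4 * X))) ≤ 6 * Real.exp q / X * Q ^ 64 := by
    refine hM.trans (mul_le_mul ?_ hH (sum_nonneg fun _ _ => by positivity) (by positivity))
    have h1 : 2 / (u : ℝ) ≤ 4 * Real.exp q / X := by
      rw [div_le_div_iff₀ hu0 hX0]
      rw [div_le_iff₀ (by positivity)] at hu
      linarith
    have h2 : 6 * (1 / (4 * X : ℝ)) ≤ 2 * Real.exp q / X := by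
      rw [mul_one_div, div_le_div_iff₀ (by positivity) hX0]
      nlinarith
    calc _ ≤ 2 * Real.exp q / X + 4 * Real.exp q / X := add_le_add h2 h1
      _ = _ := by ring
  have hCA : ∑ i ∈ Ioc 0 R, |moebiusTail u i / i| ≤ R := by
    calc _ ≤ ∑ i ∈ Ioc 0 R, (1 : ℝ) := by
          refine sum_le_sum fun i hi => ?_
          have hi0 : (0 : ℝ) < i := by exact_mod_cast (mem_Ioc.mp hi).1
          rw [abs_div, abs_of_pos hi0, div_le_one hi0]
          refine (abs_moebiusTail_le hu1 i).trans ?_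
          exact_mod_cast Nat.card_divisors_le_self i
      _ = R := by simp
  have hCB : ∑ i ∈ Ioc 0 R, |b i / i| ≤ 2 * R := by
    calc _ ≤ ∑ i ∈ Ioc 0 R, (2 : ℝ) := by
          refine sum_le_sum fun i hi => ?_
          have hi0 : (0 : ℝ) < i := by exact_mod_cast (mem_Ioc.mp hi).1
          rw [abs_div, abs_of_pos hi0, div_le_iff₀ hi0, hb, arithmeticFunction_sub_apply]
          have h1 := abs_lamCut_le hR0 i
          have h2 := abs_lamCut_le hu0 i
          exact (abs_sub _ _).trans (by linarith)
      _ = 2 * R := by simp [mul_comm]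
  have hE' : ∀ m ∈ E, ∑ i ∈ Ioc 0 R, ∑ j ∈ Ioc 0 R, moebiusTail u i / i * (b j / j) *
      tent ((-Real.log i + -Real.log j + 3 * Real.log (m + 1 / 2)) / (1 / (4 * X))) ≤
        -(1 / (64 * X)) := by
    intro m hm
    refine le_trans (le_of_eq ?_) (hE m hm)
    refine sum_congr rfl fun i hi => sum_congr rfl fun j hj => ?_
    have hi0 : (0 : ℝ) < i := by exact_mod_cast (mem_Ioc.mp hi).1
    have hj0 : (0 : ℝ) < j := by exact_mod_cast (mem_Ioc.mp hj).1
    rw [cubeWeight, Nat.cast_mul, Real.log_mul hi0.ne' hj0.ne', ← tent_neg]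
    have : -((-Real.log i + -Real.log j + 3 * Real.log (m + 1 / 2)) / (1 / (4 * (X : ℝ)))) =
      (Real.log i + Real.log j - 3 * Real.log (m + 1 / 2)) / (1 / (4 * X)) := by ring
    rw [this, div_mul_div_comm, div_mul_eq_mul_div, mul_div_assoc]
  have hsep : ∀ m ∈ E, ∀ n ∈ E, m ≠ n →
      1 / (4 * X : ℝ) ≤ |3 * Real.log (m + 1 / 2) - 3 * Real.log (n + 1 / 2)| := by
    intro m hm n hn hmn
    exact log_separated (mem_Ico.mp (hEX hm)).2 (mem_Ico.mp (hEX hn)).2 hmn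
  have htail : (∑ i ∈ Ioc 0 R, |moebiusTail u i / i|) * (∑ i ∈ Ioc 0 R, |b i / i|) *
      (8 / (1 / (4 * X) * (Real.exp (Q ^ 16) / 8))) ≤ 1 / (64 * X) := by
    have h1 : (∑ i ∈ Ioc 0 R, |moebiusTail u i / i|) * (∑ i ∈ Ioc 0 R, |b i / i|) ≤
        R * (2 * R) := mul_le_mul hCA hCB (sum_nonneg fun _ _ => abs_nonneg _) hR0.le
    refine (mul_le_mul_of_nonneg_right h1 (by positivity)).trans ?_
    rw [← hX100, hRr]
    have e : (X : ℝ) ^ 20 * (2 * (X : ℝ) ^ 20) * (8 / (1 / (4 * X) * ((X : ℝ) ^ 100 / 8))) =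
        512 / X ^ 59 := by
      field_simp
      norm_num
    rw [e, div_le_div_iff₀ (by positivity) (by positivity)]
    have h58 : (2 : ℝ) ^ 58 ≤ X ^ 58 := pow_le_pow_left₀ (by norm_num) hX2 58
    have h5 : (512 : ℝ) * 64 ≤ X ^ 58 := le_trans (by norm_num) h58
    calc 512 * (64 * (X : ℝ)) = 512 * 64 * X := by ring
      _ ≤ X ^ 58 * X := mul_le_mul_of_nonneg_right h5 hX0.le
      _ = 1 * X ^ 59 := by ring
  have hfin := card_le_of_bilinear_le (Ioc 0 R) (Ioc 0 R) E _ _ _ _ _ hδ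
    (by positivity : 0 < Real.exp (Q ^ 16) / 8) (by positivity : 0 < 2 * Real.exp (-q))
    (by positivity : 0 < 1 / (64 * (X : ℝ))) hsep hB hM2 htail hE'
  refine hfin.trans ?_
  have hlast := hK₂ Q ((le_max_right _ _).trans hQ)
  rw [show 1 / (10 : ℝ) ^ 5 * Q = q by rw [hq]; ring,
    show 1 / (2 * (10 : ℝ) ^ 5) * Q = Q / (2 * 10 ^ 5) by ring] at hlast
  have hee : Real.exp (-q) * Real.exp q = 1 := by rw [← Real.exp_add]; simp
  calc 2 * (2 * Real.exp (-q)) ^ 2 * (6 * Real.exp q / X * Q ^ 64) / (1 / (64 * (X : ℝ))) ^ 2 =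
        X * (196608 * Q ^ 64 * Real.exp (-q)) * (Real.exp (-q) * Real.exp q) := by
        field_simp
        ring
    _ = X * (196608 * Q ^ 64 * Real.exp (-q)) := by rw [hee, mul_one]
    _ ≤ _ := mul_le_mul_of_nonneg_left hlast hX0.le

section
open scoped ArithmeticFunction.vonMangoldt ArithmeticFunction.Moebius ArithmeticFunction.zeta

lemma card_filter_mul_le {s N : ℕ} (hs : s ≤ N) :
    #{x ∈ Ioc 0 N ×ˢ Ioc 0 N | x.1 * x.2 ≤ N ∧ x.1 ≤ s} = ∑ a ∈ Ioc 0 s, N / a := by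
  have h : ({x ∈ Ioc 0 N ×ˢ Ioc 0 N | x.1 * x.2 ≤ N ∧ x.1 ≤ s} : Finset (ℕ × ℕ)) =
      (Ioc 0 s).biUnion fun a => ({a} : Finset ℕ) ×ˢ Ioc 0 (N / a) := by
    ext ⟨a, b⟩
    simp only [mem_filter, mem_product, mem_Ioc, mem_biUnion, mem_singleton]
    constructor
    · rintro ⟨⟨⟨ha, _⟩, hb, _⟩, hab, has⟩
      exact ⟨a, ⟨ha, has⟩, rfl, hb, (Nat.le_div_iff_mul_le ha).mpr (by rwa [mul_comm])⟩
    · rintro ⟨a', ⟨ha, has⟩, rfl, hb, hab⟩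
      rw [Nat.le_div_iff_mul_le ha] at hab
      exact ⟨⟨⟨ha, has.trans hs⟩, hb, by nlinarith⟩, by linarith, has⟩
  rw [h, card_biUnion]
  · simp
  · intro a _ a' _ hne
    rw [Function.onFun, disjoint_left]
    rintro ⟨x, y⟩ h1 h2
    simp only [mem_product, mem_singleton] at h1 h2
    exact hne (h1.1.symm.trans h2.1)

/-- Dirichlet's hyperbola identity for the divisor function. -/
lemma sum_zeta_mul_zeta (N : ℕ) :
    ∑ n ∈ Ioc 0 N, ((ζ : ArithmeticFunction ℝ) * (ζ : ArithmeticFunction ℝ)) n +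
      (Nat.sqrt N : ℝ) ^ 2 = 2 * ∑ a ∈ Ioc 0 (Nat.sqrt N), ((N / a : ℕ) : ℝ) := by
  set s := Nat.sqrt N with hs
  have hsN : s ≤ N := Nat.sqrt_le_self N
  have h1 : ∑ n ∈ Ioc 0 N, ((ζ : ArithmeticFunction ℝ) * (ζ : ArithmeticFunction ℝ)) n =
      (#{x ∈ Ioc 0 N ×ˢ Ioc 0 N | x.1 * x.2 ≤ N} : ℝ) := by
    rw [ArithmeticFunction.sum_Ioc_mul_eq_sum_prod_filter, card_eq_sum_ones, Nat.cast_sum]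
    refine sum_congr rfl fun x hx => ?_
    simp only [mem_filter, mem_product, mem_Ioc] at hx
    rw [ArithmeticFunction.natCoe_apply, ArithmeticFunction.natCoe_apply,
      ArithmeticFunction.zeta_apply_ne hx.1.1.1.ne', ArithmeticFunction.zeta_apply_ne hx.1.2.1.ne']
    simp
  have h2 : ({x ∈ Ioc 0 N ×ˢ Ioc 0 N | x.1 * x.2 ≤ N} : Finset (ℕ × ℕ)) =
      {x ∈ Ioc 0 N ×ˢ Ioc 0 N | x.1 * x.2 ≤ N ∧ x.1 ≤ s} ∪
      {x ∈ Ioc 0 N ×ˢ Ioc 0 N | x.1 * x.2 ≤ N ∧ x.2 ≤ s} := by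
    ext ⟨a, b⟩
    simp only [mem_filter, mem_union]
    constructor
    · rintro ⟨h, hab⟩
      by_cases ha : a ≤ s
      · exact Or.inl ⟨h, hab, ha⟩
      · refine Or.inr ⟨h, hab, ?_⟩
        by_contra hb
        have := Nat.sqrt_lt.mp (show Nat.sqrt N < s + 1 by omega)
        push Not at ha hb
        nlinarith
    · tauto
  have h3 : ({x ∈ Ioc 0 N ×ˢ Ioc 0 N | x.1 * x.2 ≤ N ∧ x.1 ≤ s} : Finset (ℕ × ℕ)) ∩
      {x ∈ Ioc 0 N ×ˢ Ioc 0 N | x.1 * x.2 ≤ N ∧ x.2 ≤ s} = Ioc 0 s ×ˢ Ioc 0 s := by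
    ext ⟨a, b⟩
    simp only [mem_filter, mem_inter, mem_product, mem_Ioc]
    constructor
    · tauto
    · rintro ⟨⟨ha, has⟩, hb, hbs⟩
      have h5 : a * b ≤ N := (Nat.mul_le_mul has hbs).trans (Nat.sqrt_le N)
      exact ⟨⟨⟨⟨ha, has.trans hsN⟩, hb, hbs.trans hsN⟩, h5, has⟩,
        ⟨⟨ha, has.trans hsN⟩, hb, hbs.trans hsN⟩, h5, hbs⟩
  have h4 : #{x ∈ Ioc 0 N ×ˢ Ioc 0 N | x.1 * x.2 ≤ N ∧ x.2 ≤ s} = ∑ a ∈ Ioc 0 s, N / a := by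
    rw [← card_filter_mul_le hsN]
    refine card_bij (fun x _ => (x.2, x.1)) ?_ ?_ ?_
    · rintro ⟨a, b⟩ h
      simp only [mem_filter, mem_product] at h ⊢
      exact ⟨⟨h.1.2, h.1.1⟩, by rw [mul_comm]; exact h.2.1, h.2.2⟩
    · rintro ⟨a, b⟩ _ ⟨c, d⟩ _ h
      simp only [Prod.mk.injEq] at h ⊢
      exact ⟨h.2, h.1⟩
    · rintro ⟨a, b⟩ h
      simp only [mem_filter, mem_product] at h
      exact ⟨(b, a), by
        simp only [mem_filter, mem_product]
        exact ⟨⟨h.1.2, h.1.1⟩, by rw [mul_comm]; exact h.2.1, h.2.2⟩, rfl⟩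
  have h5 := card_union_add_card_inter
    ({x ∈ Ioc 0 N ×ˢ Ioc 0 N | x.1 * x.2 ≤ N ∧ x.1 ≤ s} : Finset (ℕ × ℕ))
    {x ∈ Ioc 0 N ×ˢ Ioc 0 N | x.1 * x.2 ≤ N ∧ x.2 ≤ s}
  rw [← h2, h3, h4, card_filter_mul_le hsN, card_product, Nat.card_Ioc, Nat.sub_zero] at h5
  rw [h1]
  have h6 : ((#{x ∈ Ioc 0 N ×ˢ Ioc 0 N | x.1 * x.2 ≤ N} + s * s : ℕ) : ℝ) =
    ((∑ a ∈ Ioc 0 s, N / a + ∑ a ∈ Ioc 0 s, N / a : ℕ) : ℝ) := by rw [h5]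
  push_cast at h6 ⊢
  linarith

end

lemma sum_Ioc_log_bounds {n : ℕ} (hn : 1 ≤ n) :
    n * Real.log n - n + 1 ≤ ∑ j ∈ Ioc 0 n, Real.log j ∧
      ∑ j ∈ Ioc 0 n, Real.log j ≤ n * Real.log n - n + 1 + Real.log n := by
  induction n, hn using Nat.le_induction with
  | base => simp
  | succ n hn ih =>
    rw [sum_Ioc_succ_top (Nat.zero_le n)]
    have hn0 : (0 : ℝ) < n := by exact_mod_cast hn
    have h1 := Real.log_le_sub_one_of_pos (show (0 : ℝ) < ((n + 1 : ℕ) : ℝ) / n by positivity)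
    have h2 := Real.log_le_sub_one_of_pos (show (0 : ℝ) < (n : ℝ) / ((n + 1 : ℕ) : ℝ) by positivity)
    rw [Real.log_div (by positivity) (by positivity)] at h1 h2
    push_cast at h1 h2 ⊢
    have h3 : n * ((n + 1 : ℝ) / n - 1) = 1 := by field_simp; ring
    have h4 : (n + 1) * ((n : ℝ) / (n + 1) - 1) = -1 := by field_simp; ring
    have h5 := mul_le_mul_of_nonneg_left h1 hn0.le
    have h6 := mul_le_mul_of_nonneg_left h2 (show (0 : ℝ) ≤ n + 1 by linarith)
    constructor <;> nlinarith [ih.1, ih.2]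

lemma log_le_two_mul_sqrt {x : ℝ} (hx : 0 < x) : Real.log x ≤ 2 * √x := by
  have h := Real.log_le_sub_one_of_pos (Real.sqrt_pos.mpr hx)
  rw [Real.log_sqrt hx.le] at h
  linarith

lemma sum_one_div_bounds {s : ℕ} (hs : 1 ≤ s) :
    Real.log s + Real.eulerMascheroniConstant ≤ ∑ a ∈ Ioc 0 s, (1 : ℝ) / a ∧
      ∑ a ∈ Ioc 0 s, (1 : ℝ) / a ≤ Real.log s + Real.eulerMascheroniConstant + 1 / s := by
  have hs0 : (0 : ℝ) < s := by exact_mod_cast hs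
  have h0 : ∑ a ∈ Ioc 0 s, (1 : ℝ) / a = (harmonic s : ℝ) := by
    rw [harmonic_eq_sum_Icc]
    push_cast
    refine sum_congr (by ext; simp [Nat.one_le_iff_ne_zero, Nat.pos_iff_ne_zero]) fun a _ => ?_
    rw [one_div]
  have h1 := Real.eulerMascheroniSeq_lt_eulerMascheroniConstant s
  have h2 := Real.eulerMascheroniConstant_lt_eulerMascheroniSeq' s
  rw [Real.eulerMascheroniSeq] at h1
  rw [Real.eulerMascheroniSeq', if_neg (by omega)] at h2
  have h3 := Real.log_le_sub_one_of_pos (show (0 : ℝ) < (s + 1 : ℝ) / s by positivity)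
  rw [Real.log_div (by positivity) (by positivity)] at h3
  have h4 : (s + 1 : ℝ) / s - 1 = 1 / s := by field_simp; ring
  rw [h0]
  constructor <;> linarith

section
open scoped ArithmeticFunction.vonMangoldt ArithmeticFunction.Moebius ArithmeticFunction.zeta

/-- The summatory function of `log - τ`. -/
theorem abs_sum_log_sub_divisors_le (n : ℕ) :
    |∑ j ∈ Ioc 0 n, (ArithmeticFunction.log -
      (ζ : ArithmeticFunction ℝ) * (ζ : ArithmeticFunction ℝ)) j +
        2 * Real.eulerMascheroniConstant * n| ≤ 6 * √n + 5 := by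
  rcases Nat.eq_zero_or_pos n with rfl | hn
  · simp
  set s := Nat.sqrt n with hs
  have hs1 : 1 ≤ s := Nat.le_sqrt.mpr (by omega)
  have hs0 : (0 : ℝ) < s := by exact_mod_cast hs1
  have hn0 : (0 : ℝ) < n := by exact_mod_cast hn
  have hsn : (s : ℝ) ^ 2 ≤ n := by exact_mod_cast (Nat.sqrt_le' n)
  have hns : (n : ℝ) ≤ (s : ℝ) ^ 2 + 2 * s := by
    have h : n < (s + 1) ^ 2 := Nat.lt_succ_sqrt' n
    have : n ≤ s ^ 2 + 2 * s := by nlinarith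
    exact_mod_cast this
  have hsq : (s : ℝ) ≤ √n := Real.le_sqrt_of_sq_le hsn
  have hl := sum_Ioc_log_bounds hn
  have hH := sum_one_div_bounds hs1
  have hlog := log_le_two_mul_sqrt hn0
  have hid := sum_zeta_mul_zeta n
  rw [← hs] at hid
  set T := ∑ n ∈ Ioc 0 n, ((ζ : ArithmeticFunction ℝ) * (ζ : ArithmeticFunction ℝ)) n
  have hG : ∑ j ∈ Ioc 0 n, (ArithmeticFunction.log -
      (ζ : ArithmeticFunction ℝ) * (ζ : ArithmeticFunction ℝ)) j =
      ∑ j ∈ Ioc 0 n, Real.log j - T := by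
    rw [← sum_sub_distrib]
    exact sum_congr rfl fun j _ => by rw [arithmeticFunction_sub_apply,
      ArithmeticFunction.log_apply]
  set H := ∑ a ∈ Ioc 0 s, (1 : ℝ) / a
  have hF1 : ∑ a ∈ Ioc 0 s, ((n / a : ℕ) : ℝ) ≤ n * H := by
    rw [mul_sum]
    refine sum_le_sum fun a _ => ?_
    rw [mul_one_div]
    exact Nat.cast_div_le
  have hF2 : n * H - s ≤ ∑ a ∈ Ioc 0 s, ((n / a : ℕ) : ℝ) := by
    have h : ∑ a ∈ Ioc 0 s, ((n : ℝ) * (1 / a) - 1) ≤ ∑ a ∈ Ioc 0 s, ((n / a : ℕ) : ℝ) := by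
      refine sum_le_sum fun a ha => ?_
      rw [mul_one_div, ← Nat.floor_div_eq_div (K := ℝ)]
      exact (Nat.sub_one_lt_floor _).le
    rw [sum_sub_distrib, ← mul_sum, sum_const, Nat.card_Ioc, Nat.sub_zero, nsmul_eq_mul,
      mul_one] at h
    exact h
  have h1 : Real.log n - 2 * Real.log s ≤ n / s ^ 2 - 1 := by
    have := Real.log_le_sub_one_of_pos (show (0 : ℝ) < n / s ^ 2 by positivity)
    rwa [Real.log_div (by positivity) (by positivity), Real.log_pow, Nat.cast_ofNat] at this
  have h2 : 0 ≤ Real.log n - 2 * Real.log s := by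
    have := Real.log_le_log (by positivity) hsn
    rw [Real.log_pow, Nat.cast_ofNat] at this
    linarith
  have h3 : n * (Real.log n - 2 * Real.log s) ≤ 2 * s + 4 := by
    calc _ ≤ (n : ℝ) * (n / s ^ 2 - 1) := mul_le_mul_of_nonneg_left h1 hn0.le
      _ = (n : ℝ) * (n - s ^ 2) / s ^ 2 := by field_simp
      _ ≤ ((s : ℝ) ^ 2 + 2 * s) * (2 * s) / s ^ 2 := by
          refine div_le_div_of_nonneg_right ?_ (by positivity)
          exact mul_le_mul hns (by linarith) (by linarith) (by positivity)
      _ = 2 * s + 4 := by field_simp; ring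
  have h4 := mul_nonneg hn0.le h2
  have h5 : n * (1 / (s : ℝ)) ≤ s + 2 := by
    rw [mul_one_div, div_le_iff₀ hs0]; nlinarith
  have h6 := mul_le_mul_of_nonneg_left hH.1 hn0.le
  have h7 := mul_le_mul_of_nonneg_left hH.2 hn0.le
  rw [hG, abs_le]
  constructor
  · nlinarith [hl.1]
  · nlinarith [hl.2]

end

lemma sum_Ioc_eq_of_support {h : ℕ → ℝ} {u z : ℕ} (huz : u ≤ z) (h0 : ∀ n, u < n → h n = 0) :
    ∑ n ∈ Ioc 0 z, h n = ∑ n ∈ Ioc 0 u, h n := by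
  refine (sum_subset (Ioc_subset_Ioc_right huz) fun n hn hnu => h0 n ?_).symm
  simp only [mem_Ioc] at hn hnu
  omega

lemma sum_one_div_sqrt_le (n : ℕ) : ∑ d ∈ Ioc 0 n, 1 / √(d : ℝ) ≤ 2 * √n := by
  induction n with
  | zero => simp
  | succ n ih =>
    rw [sum_Ioc_succ_top (Nat.zero_le n)]
    push_cast at ih ⊢
    have h1 : 0 < √(n + 1 : ℝ) := Real.sqrt_pos.mpr (by positivity)
    have h2 : 0 ≤ √(n : ℝ) := Real.sqrt_nonneg _
    have h3 : √(n + 1 : ℝ) ^ 2 = n + 1 := Real.sq_sqrt (by positivity)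
    have h4 : √(n : ℝ) ^ 2 = n := Real.sq_sqrt (by positivity)
    have h5 : 1 / √(n + 1 : ℝ) ≤ 2 * (√(n + 1) - √n) := by
      rw [div_le_iff₀ h1]
      nlinarith [sq_nonneg (√(n + 1 : ℝ) - √n)]
    linarith

/-- The mean value of `typeOne u`. -/
noncomputable def typeOneMean (u : ℕ) : ℝ :=
  -(∑ d ∈ Ioc 0 u, truncMoebius u d / d) *
    (2 * Real.eulerMascheroniConstant + ∑ l ∈ Ioc 0 u, lamCut u l / l)

section
open scoped ArithmeticFunction.vonMangoldt ArithmeticFunction.Moebius ArithmeticFunction.zeta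

lemma abs_natCast_div_sub_le (z d : ℕ) : |((z / d : ℕ) : ℝ) - z / d| ≤ 1 := by
  have h1 : ((z / d : ℕ) : ℝ) ≤ z / d := Nat.cast_div_le
  have h2 : (z : ℝ) / d - 1 < ((z / d : ℕ) : ℝ) := by
    rw [← Nat.floor_div_eq_div (K := ℝ)]
    exact Nat.sub_one_lt_floor _
  rw [abs_le]
  constructor <;> linarith

lemma abs_lamCut_le_log {u : ℕ} (hu : 1 ≤ u) {l : ℕ} (hl : 1 ≤ l) (hlu : l ≤ u) :
    |lamCut u l| ≤ 1 + Real.log u := by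
  have hu0 : (0 : ℝ) < u := by exact_mod_cast hu
  have hl0 : (0 : ℝ) < l := by exact_mod_cast hl
  have h1 : |lamOne l| ≤ 1 + Real.log u := by
    rw [lamOne_of_pos hl, abs_le]
    have h1 := ArithmeticFunction.vonMangoldt_nonneg (n := l)
    have h2 := ArithmeticFunction.vonMangoldt_le_log (n := l)
    have h3 : Real.log l ≤ Real.log u := Real.log_le_log hl0 (by exact_mod_cast hlu)
    have h4 : 0 ≤ Real.log u := Real.log_natCast_nonneg u
    constructor <;> linarith
  rw [lamCut_apply, abs_mul, abs_of_nonneg (cut_mem hu0 l).1]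
  calc _ ≤ |lamOne l| * 1 := mul_le_mul_of_nonneg_left (cut_mem hu0 l).2 (abs_nonneg _)
    _ ≤ _ := by rw [mul_one]; exact h1

theorem abs_sum_typeOne_sub_le {u z : ℕ} (hu : 1 ≤ u) (huz : u ≤ z) :
    |∑ n ∈ Ioc 0 z, typeOne u n - typeOneMean u * z| ≤
      12 * √(z * u) + 7 * u + u ^ 2 * (1 + Real.log u) := by
  have hu0 : (0 : ℝ) < u := by exact_mod_cast hu
  set γ := Real.eulerMascheroniConstant
  set g := ArithmeticFunction.log - (ζ : ArithmeticFunction ℝ) * (ζ : ArithmeticFunction ℝ) with hg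
  have hγ0 : 0 < γ := lt_trans (by norm_num) Real.one_half_lt_eulerMascheroniConstant
  have hγ1 : γ < 2 / 3 := Real.eulerMascheroniConstant_lt_two_thirds
  have hμ0 : ∀ n, u < n → truncMoebius u n = 0 := fun n hn => by
    rw [truncMoebius_apply, if_neg (by omega)]
  have hf0 : ∀ n, u < n → lamCut u n = 0 := fun n hn =>
    lamCut_eq_zero hu0 (by exact_mod_cast hn.le)
  have e1 : ∑ n ∈ Ioc 0 z, (g * truncMoebius u) n =
      ∑ d ∈ Ioc 0 u, truncMoebius u d * ∑ j ∈ Ioc 0 (z / d), g j := by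
    rw [mul_comm, ArithmeticFunction.sum_Ioc_mul_eq_sum_sum]
    exact sum_Ioc_eq_of_support huz fun n hn => by rw [hμ0 n hn, zero_mul]
  have e2 : ∑ n ∈ Ioc 0 z, ((ζ : ArithmeticFunction ℝ) * (truncMoebius u * lamCut u)) n =
      ∑ d ∈ Ioc 0 u, ∑ l ∈ Ioc 0 u, truncMoebius u d * lamCut u l * ((z / (d * l) : ℕ) : ℝ) := by
    rw [mul_comm (ζ : ArithmeticFunction ℝ), ArithmeticFunction.sum_Ioc_mul_zeta_eq_sum,
      sum_arithmeticFunction_mul_weight _ _ (fun n => ((z / n : ℕ) : ℝ)) le_rfl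
        (fun n hn => by rw [Nat.div_eq_of_lt hn, Nat.cast_zero]),
      sum_Ioc_eq_of_support huz fun n hn => by simp [hμ0 n hn]]
    exact sum_congr rfl fun d _ =>
      sum_Ioc_eq_of_support huz fun n hn => by simp [hf0 n hn]
  have b1 : |∑ d ∈ Ioc 0 u, truncMoebius u d * ∑ j ∈ Ioc 0 (z / d), g j +
      2 * γ * (∑ d ∈ Ioc 0 u, truncMoebius u d / d) * z| ≤ 12 * √(z * u) + 7 * u := by
    rw [mul_sum, sum_mul, ← sum_add_distrib]
    calc _ ≤ ∑ d ∈ Ioc 0 u, (6 * √z * (1 / √d) + 7) := by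
          refine (abs_sum_le_sum_abs _ _).trans (sum_le_sum fun d hd => ?_)
          have hd0 : (0 : ℝ) < d := by exact_mod_cast (mem_Ioc.mp hd).1
          have h1 := abs_sum_log_sub_divisors_le (z / d)
          rw [← hg] at h1
          have h2 := abs_natCast_div_sub_le z d
          have h3 : √((z / d : ℕ) : ℝ) ≤ √z * (1 / √d) := by
            rw [mul_one_div, ← Real.sqrt_div (Nat.cast_nonneg z)]
            exact Real.sqrt_le_sqrt Nat.cast_div_le
          have h4 : truncMoebius u d * ∑ j ∈ Ioc 0 (z / d), g j +
              2 * γ * (truncMoebius u d / d) * z = truncMoebius u d *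
              ((∑ j ∈ Ioc 0 (z / d), g j + 2 * γ * ((z / d : ℕ) : ℝ)) -
                2 * γ * (((z / d : ℕ) : ℝ) - z / d)) := by ring
          rw [h4, abs_mul]
          refine (mul_le_of_le_one_left (abs_nonneg _) (abs_truncMoebius_le u d)).trans ?_
          refine (abs_sub _ _).trans ?_
          rw [abs_mul, abs_of_pos (by positivity : 0 < 2 * γ)]
          nlinarith
      _ = 6 * √z * ∑ d ∈ Ioc 0 u, 1 / √d + 7 * u := by
          rw [sum_add_distrib, ← mul_sum]; simp [mul_comm]
      _ ≤ 6 * √z * (2 * √u) + 7 * u := by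
          have := mul_le_mul_of_nonneg_left (sum_one_div_sqrt_le u)
            (by positivity : 0 ≤ 6 * √(z : ℝ))
          linarith
      _ = _ := by rw [Real.sqrt_mul (Nat.cast_nonneg z)]; ring
  have b2 : |∑ d ∈ Ioc 0 u, ∑ l ∈ Ioc 0 u, truncMoebius u d * lamCut u l *
      ((z / (d * l) : ℕ) : ℝ) - (∑ d ∈ Ioc 0 u, truncMoebius u d / d) *
        (∑ l ∈ Ioc 0 u, lamCut u l / l) * z| ≤ u ^ 2 * (1 + Real.log u) := by
    rw [sum_mul_sum, sum_mul, ← sum_sub_distrib]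
    calc _ ≤ ∑ d ∈ Ioc 0 u, ∑ l ∈ Ioc 0 u, (1 + Real.log u) := by
          refine (abs_sum_le_sum_abs _ _).trans (sum_le_sum fun d hd => ?_)
          rw [sum_mul, ← sum_sub_distrib]
          refine (abs_sum_le_sum_abs _ _).trans (sum_le_sum fun l hl => ?_)
          have h2 := abs_natCast_div_sub_le z (d * l)
          have h3 := abs_lamCut_le_log hu (mem_Ioc.mp hl).1 (mem_Ioc.mp hl).2
          have h4 : truncMoebius u d * lamCut u l * ((z / (d * l) : ℕ) : ℝ) -
              truncMoebius u d / d * (lamCut u l / l) * z = truncMoebius u d *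
              (lamCut u l * (((z / (d * l) : ℕ) : ℝ) - z / ((d * l : ℕ) : ℝ))) := by
            push_cast
            rw [div_mul_div_comm]
            ring
          rw [h4, abs_mul, abs_mul]
          refine (mul_le_of_le_one_left (by positivity) (abs_truncMoebius_le u d)).trans ?_
          exact (mul_le_of_le_one_right (abs_nonneg _) h2).trans h3
      _ = _ := by simp; ring
  have e3 : ∑ n ∈ Ioc 0 z, typeOne u n = ∑ n ∈ Ioc 0 z, (g * truncMoebius u) n -
      ∑ n ∈ Ioc 0 z, ((ζ : ArithmeticFunction ℝ) * (truncMoebius u * lamCut u)) n := by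
    rw [← sum_sub_distrib]
    exact sum_congr rfl fun n _ => arithmeticFunction_sub_apply _ _ _
  rw [e3, e1, e2, typeOneMean]
  refine le_trans (le_of_eq ?_) ((abs_sub _ _).trans (add_le_add b1 b2))
  congr 1
  ring

lemma abs_typeOneMean_le {u : ℕ} (hu : 2 ≤ u) :
    |typeOneMean u| ≤ (1 + Real.log u) * ‖rieszSum u (1 + (0 : ℝ) * Complex.I) -
      primeF (1 + (0 : ℝ) * Complex.I)‖ := by
  have h1 : primeF (1 + (0 : ℝ) * Complex.I) =
      ((-(2 * Real.eulerMascheroniConstant) : ℝ) : ℂ) := by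
    rw [Complex.ofReal_zero, zero_mul, add_zero, primeF, logDeriv_apply, deriv_riemannZeta₁_one,
      riemannZeta₁_one, riemannZeta₀_one]
    push_cast
    ring
  have h2 : rieszSum u (1 + (0 : ℝ) * Complex.I) =
      ((∑ l ∈ Ioc 0 u, lamCut u l / l : ℝ) : ℂ) := by
    rw [rieszSum_eq_sum (by omega) le_rfl, trigSum]
    simp
  rw [h1, h2, ← Complex.ofReal_sub, Complex.norm_real, typeOneMean, abs_mul, abs_neg,
    sub_neg_eq_add, add_comm (∑ l ∈ Ioc 0 u, lamCut u l / l), Real.norm_eq_abs]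
  refine mul_le_mul_of_nonneg_right ?_ (abs_nonneg _)
  refine (abs_sum_le_sum_abs _ _).trans (le_trans (sum_le_sum fun d hd => ?_)
    (sum_Ioc_one_div_le u))
  have hd0 : (0 : ℝ) < d := by exact_mod_cast (mem_Ioc.mp hd).1
  rw [abs_div, abs_of_pos hd0]
  exact div_le_div_of_nonneg_right (abs_truncMoebius_le u d) hd0.le

end

lemma sum_mul_by_parts (c W : ℕ → ℝ) (n : ℕ) :
    ∑ k ∈ Ioc 0 n, c k * W k = (∑ k ∈ Ioc 0 n, c k) * W n -
      ∑ k ∈ range n, (∑ j ∈ Ioc 0 k, c j) * (W (k + 1) - W k) := by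
  induction n with
  | zero => simp
  | succ n ih =>
    rw [sum_Ioc_succ_top (Nat.zero_le n), sum_Ioc_succ_top (Nat.zero_le n), sum_range_succ, ih]
    ring

lemma abs_sum_mul_weight_le {c W : ℕ → ℝ} {a b N : ℕ} {κ B τ : ℝ} (hbN : b ≤ N)
    (hW0 : ∀ k, 0 ≤ W k) (hWa : ∀ k, k ≤ a → W k = 0) (hWb : ∀ k, b ≤ k → W k = 0)
    (hc : ∀ z, a ≤ z → z < b → |∑ k ∈ Ioc 0 z, c k - κ * z| ≤ B)
    (hτ : ∀ k, a ≤ k → k < b → |W (k + 1) - W k| ≤ τ) :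
    |∑ k ∈ Ioc 0 N, c k * W k| ≤ |κ| * ∑ k ∈ Ioc 0 b, W k + (b - a : ℕ) * (B * τ) := by
  rw [sum_Ioc_eq_of_support hbN fun n hn => by rw [hWb n hn.le, mul_zero]]
  have h1 : ∑ k ∈ Ioc 0 b, c k * W k =
      κ * ∑ k ∈ Ioc 0 b, W k + ∑ k ∈ Ioc 0 b, (c k - κ) * W k := by
    rw [mul_sum, ← sum_add_distrib]
    exact sum_congr rfl fun k _ => by ring
  have h2 : ∑ k ∈ Ioc 0 b, (c k - κ) * W k =
      -∑ k ∈ Ico a b, (∑ j ∈ Ioc 0 k, c j - κ * k) * (W (k + 1) - W k) := by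
    rw [sum_mul_by_parts, hWb b le_rfl, mul_zero, zero_sub, neg_inj]
    have h3 : Ico a b ⊆ range b := fun k hk => mem_range.mpr (mem_Ico.mp hk).2
    rw [← sum_subset h3]
    · refine sum_congr rfl fun k _ => ?_
      rw [sum_sub_distrib]
      simp [mul_comm]
    · intro k hk hk2
      have : k < a := by
        simp only [mem_range, mem_Ico] at hk hk2
        omega
      rw [hWa k this.le, hWa (k + 1) this, sub_self, mul_zero]
  rw [h1, h2]
  refine (abs_add_le _ _).trans (add_le_add ?_ ?_)
  · rw [abs_mul, abs_of_nonneg (sum_nonneg fun k _ => hW0 k)]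
  · rw [abs_neg]
    calc _ ≤ ∑ k ∈ Ico a b, B * τ := by
          refine (abs_sum_le_sum_abs _ _).trans (sum_le_sum fun k hk => ?_)
          rw [mem_Ico] at hk
          rw [abs_mul]
          have := hc k hk.1 hk.2
          exact mul_le_mul this (hτ k hk.1 hk.2) (abs_nonneg _) ((abs_nonneg _).trans this)
      _ = _ := by simp

lemma abs_cubeWeight_succ_sub_le {δ : ℝ} (hδ : 0 < δ) (m : ℕ) {k : ℕ} (hk : 1 ≤ k) :
    |cubeWeight δ m (k + 1) - cubeWeight δ m k| ≤ (1 / δ + 1) / k ^ 2 := by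
  have hk0 : (0 : ℝ) < k := by exact_mod_cast hk
  have hl : |Real.log ((k + 1 : ℕ) : ℝ) - Real.log k| ≤ 1 / k := by
    have h1 := Real.log_le_sub_one_of_pos (show (0 : ℝ) < ((k + 1 : ℕ) : ℝ) / k by positivity)
    rw [Real.log_div (by positivity) (by positivity)] at h1
    have h2 : Real.log k ≤ Real.log ((k + 1 : ℕ) : ℝ) :=
      Real.log_le_log hk0 (by push_cast; linarith)
    have h3 : ((k + 1 : ℕ) : ℝ) / k - 1 = 1 / k := by push_cast; field_simp; ring
    rw [abs_of_nonneg (by linarith)]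
    linarith
  rw [cubeWeight, cubeWeight]
  set y := 3 * Real.log ((m : ℝ) + 1 / 2)
  set t1 := tent ((Real.log ((k + 1 : ℕ) : ℝ) - y) / δ)
  set t0 := tent ((Real.log (k : ℝ) - y) / δ)
  have ht : |t1 - t0| ≤ 1 / k / δ := by
    refine (abs_tent_sub_le _ _).trans ?_
    rw [← sub_div, sub_sub_sub_cancel_right, abs_div, abs_of_pos hδ]
    exact div_le_div_of_nonneg_right hl hδ.le
  have h4 : t1 / ((k + 1 : ℕ) : ℝ) - t0 / k = (t1 - t0) / k - t1 * (1 / (k * (k + 1))) := by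
    push_cast; field_simp; ring
  rw [h4]
  refine (abs_sub _ _).trans ?_
  have h5 : |(t1 - t0) / k| ≤ 1 / δ / k ^ 2 := by
    rw [abs_div, abs_of_pos hk0]
    calc _ ≤ 1 / k / δ / k := div_le_div_of_nonneg_right ht hk0.le
      _ = _ := by field_simp
  have h6 : |t1 * (1 / (k * (k + 1)))| ≤ 1 / (k : ℝ) ^ 2 := by
    rw [abs_mul, abs_of_nonneg (tent_nonneg _), abs_of_pos (by positivity)]
    refine (mul_le_of_le_one_left (by positivity) (tent_le_one _)).trans ?_
    exact one_div_le_one_div_of_le (by positivity) (by nlinarith)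
  rw [add_div]
  exact add_le_add h5 h6

lemma sum_cubeWeight_le {X m : ℕ} (hX : 1 ≤ X) (hm : m ∈ Ico X (2 * X)) :
    ∑ k ∈ Ioc 0 ((m + 1) ^ 3), cubeWeight (1 / (4 * X)) m k ≤ 7 / X := by
  rw [mem_Ico] at hm
  have hX0 : (0 : ℝ) < X := by exact_mod_cast hX
  have hm0 : (X : ℝ) ≤ m := by exact_mod_cast hm.1
  have hm1 : (1 : ℝ) ≤ m := by exact_mod_cast hX.trans hm.1
  have hm2 : (m : ℝ) + 1 ≤ 2 * X := by exact_mod_cast hm.2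
  have hδ : (0 : ℝ) < 1 / (4 * X) := by positivity
  have hδm : 1 / (4 * X) * (2 * (m : ℝ)) ≤ 1 := by
    rw [one_div_mul_eq_div, div_le_one (by positivity)]; linarith
  have hsub : Ioc (m ^ 3) ((m + 1) ^ 3) ⊆ Ioc 0 ((m + 1) ^ 3) :=
    Ioc_subset_Ioc_left (Nat.zero_le _)
  rw [← sum_subset hsub]
  · calc _ ≤ ∑ k ∈ Ioc (m ^ 3) ((m + 1) ^ 3), 1 / (m : ℝ) ^ 3 := by
          refine sum_le_sum fun k hk => (cubeWeight_le _ _ _).trans ?_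
          refine one_div_le_one_div_of_le (by positivity) ?_
          exact_mod_cast (mem_Ioc.mp hk).1.le
      _ = (3 * m ^ 2 + 3 * m + 1) / (m : ℝ) ^ 3 := by
          rw [sum_const, Nat.card_Ioc, nsmul_eq_mul,
            Nat.cast_sub (Nat.pow_le_pow_left (Nat.le_succ m) 3)]
          push_cast
          ring
      _ ≤ 7 * m ^ 2 / (m : ℝ) ^ 3 := by
          refine div_le_div_of_nonneg_right ?_ (by positivity)
          nlinarith
      _ = 7 / m := by field_simp
      _ ≤ 7 / X := div_le_div_of_nonneg_left (by norm_num) hX0 hm0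
  · intro k _ hk2
    by_contra h
    have := cubeWeight_ne_zero hδ (hX.trans hm.1) hδm h
    exact hk2 (mem_Ioc.mpr ⟨this.1, by omega⟩)

theorem exists_typeOne_bound : ∃ K : ℝ, 2 ≤ K ∧ ∀ Q ≥ K, ∀ X u : ℕ,
    (X : ℝ) = Real.exp (Q ^ 16 / 100) → (X : ℝ) / (2 * Real.exp (Q / 10 ^ 5)) ≤ u →
    (u : ℝ) ≤ X / Real.exp (Q / 10 ^ 5) → ∀ m ∈ Ico X (2 * X),
    |∑ n ∈ Ioc 0 (X ^ 20), typeOne u n * cubeWeight (1 / (4 * X)) m n| ≤ 1 / (256 * X) := by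
  obtain ⟨K₁, hK₁, hP⟩ := exists_rieszSum_sub_bound
  obtain ⟨K₂, hK₂⟩ := exists_pow_mul_exp_le (256 * 1600) 16 (a := 1 / (2 * 10 ^ 5)) (b := 0)
    (by norm_num)
  refine ⟨max K₁ K₂, le_max_of_le_left hK₁, fun Q hQ X u hX hu huX m hm => ?_⟩
  have hQ1 : K₁ ≤ Q := (le_max_left _ _).trans hQ
  have hQ2 : 2 ≤ Q := hK₁.trans hQ1
  have hQ0 : 0 < Q := by linarith
  have hlast := hK₂ Q ((le_max_right _ _).trans hQ)
  set e : ℝ := Real.exp (-(1 / (2 * 10 ^ 5) * Q)) with he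
  have he0 : 0 < e := Real.exp_pos _
  have he1 : e ≤ 1 := Real.exp_le_one_iff.mpr (by simp only [Left.neg_nonpos_iff]; positivity)
  have hee : Real.exp (-(Q / 10 ^ 5)) = e ^ 2 := by
    rw [he, ← Real.exp_nat_mul]; congr 1; push_cast; ring
  have hQ15 : 2 ^ 15 * Q ≤ Q ^ 16 := by
    calc (2 : ℝ) ^ 15 * Q ≤ Q ^ 15 * Q :=
          mul_le_mul_of_nonneg_right (pow_le_pow_left₀ (by norm_num) hQ2 15) hQ0.le
      _ = Q ^ 16 := by ring
  have hQ16 : 65536 ≤ Q ^ 16 := by linarith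
  have hX2 : (2 : ℝ) ≤ X := by
    rw [hX]
    have := Real.add_one_le_exp (Q ^ 16 / 100)
    linarith
  have hX0 : (0 : ℝ) < X := by linarith
  have hX2' : 2 ≤ X := by exact_mod_cast hX2
  have hlogX : Real.log X = Q ^ 16 / 100 := by rw [hX, Real.log_exp]
  have hulow : Real.exp (Q ^ 16 / 200) ≤ u := by
    refine le_trans ?_ hu
    rw [le_div_iff₀ (by positivity), hX]
    have h2 : (2 : ℝ) ≤ Real.exp 1 := by have := Real.add_one_le_exp (1 : ℝ); linarith
    calc Real.exp (Q ^ 16 / 200) * (2 * Real.exp (Q / 10 ^ 5)) ≤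
          Real.exp (Q ^ 16 / 200) * (Real.exp 1 * Real.exp (Q / 10 ^ 5)) := by gcongr
      _ = Real.exp (Q ^ 16 / 200 + (1 + Q / 10 ^ 5)) := by rw [Real.exp_add, Real.exp_add]
      _ ≤ Real.exp (Q ^ 16 / 100) := by
          refine Real.exp_le_exp.mpr ?_
          linarith
  have hu2 : 2 ≤ u := by
    have h : (2 : ℝ) ≤ u := by
      have := Real.add_one_le_exp (Q ^ 16 / 200)
      linarith
    exact_mod_cast h
  have hu0 : (0 : ℝ) < u := by positivity
  have huX' : (u : ℝ) ≤ X * e ^ 2 := by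
    rw [← hee, Real.exp_neg, ← div_eq_mul_inv]; exact huX
  have huX1 : (u : ℝ) ≤ X := huX'.trans (mul_le_of_le_one_right hX0.le (pow_le_one₀ he0.le he1))
  have huhigh : (u : ℝ) ≤ Real.exp (Q ^ 16) := by
    rw [hX] at huX1
    exact huX1.trans (Real.exp_le_exp.mpr (by linarith))
  have hlogu : Real.log u ≤ Q ^ 16 / 100 := hlogX ▸ Real.log_le_log hu0 huX1
  have hκ : |typeOneMean u| ≤ Q ^ 16 * e ^ 2 := by
    refine (abs_typeOneMean_le hu2).trans ?_
    rw [← hee]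
    refine mul_le_mul (by linarith) ?_ (norm_nonneg _) (by positivity)
    exact hP Q hQ1 u 0 hulow huhigh (by rw [abs_zero]; positivity)
  have hm' := mem_Ico.mp hm
  have hXm : (X : ℝ) ≤ m := by exact_mod_cast hm'.1
  have hm1 : (1 : ℝ) ≤ m := by linarith
  have hm2 : (m : ℝ) + 1 ≤ 2 * X := by exact_mod_cast hm'.2
  have hδ : (0 : ℝ) < 1 / (4 * X) := by positivity
  have hδm : 1 / (4 * X) * (2 * (m : ℝ)) ≤ 1 := by
    rw [one_div_mul_eq_div, div_le_one (by positivity)]; linarith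
  have hcube : (m + 1) ^ 3 ≤ 8 * X ^ 3 := by
    calc (m + 1) ^ 3 ≤ (2 * X) ^ 3 := Nat.pow_le_pow_left hm'.2 3
      _ = _ := by ring
  have hb20 : (m + 1) ^ 3 ≤ X ^ 20 := by
    refine hcube.trans ?_
    calc 8 * X ^ 3 ≤ X ^ 17 * X ^ 3 := by
          refine Nat.mul_le_mul_right _ (le_trans (by norm_num) (Nat.pow_le_pow_left hX2' 17))
      _ = X ^ 20 := by ring
  have hne : ∀ k, cubeWeight (1 / (4 * X)) m k ≠ 0 → m ^ 3 < k ∧ k + 1 < (m + 1) ^ 3 :=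
    fun k => cubeWeight_ne_zero hδ (by omega) hδm
  have hB : ∀ z, m ^ 3 ≤ z → z < (m + 1) ^ 3 →
      |∑ k ∈ Ioc 0 z, typeOne u k - typeOneMean u * z| ≤ 44 * Q ^ 16 * X ^ 2 * e := by
    intro z hz1 hz2
    have huz : u ≤ z := by
      have h1 : u ≤ X := by exact_mod_cast huX1
      exact ((h1.trans hm'.1).trans (Nat.le_self_pow (by norm_num) m)).trans hz1
    refine (abs_sum_typeOne_sub_le (by omega) huz).trans ?_
    have hzr : (z : ℝ) ≤ 8 * X ^ 3 := by exact_mod_cast hz2.le.trans hcube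
    have h1 : √(z * u) ≤ 3 * X ^ 2 * e := by
      rw [show 3 * X ^ 2 * e = √((3 * X ^ 2 * e) ^ 2) by rw [Real.sqrt_sq (by positivity)]]
      refine Real.sqrt_le_sqrt ?_
      calc (z : ℝ) * u ≤ 8 * X ^ 3 * (X * e ^ 2) := mul_le_mul hzr huX' hu0.le (by positivity)
        _ = 8 * (X ^ 4 * e ^ 2) := by ring
        _ ≤ 9 * (X ^ 4 * e ^ 2) := by
          refine mul_le_mul_of_nonneg_right (by norm_num) (by positivity)
        _ = _ := by ring
    have h2 : (u : ℝ) ≤ X ^ 2 * e := by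
      refine huX'.trans ?_
      calc X * e ^ 2 = (X * e) * e := by ring
        _ ≤ (X * X) * e := by
          refine mul_le_mul_of_nonneg_right ?_ he0.le
          exact mul_le_mul_of_nonneg_left (by linarith) hX0.le
        _ = _ := by ring
    have h3 : (u : ℝ) ^ 2 ≤ X ^ 2 * e := by
      calc (u : ℝ) ^ 2 = u * u := by ring
        _ ≤ X * (X * e ^ 2) := mul_le_mul huX1 huX' hu0.le hX0.le
        _ = X ^ 2 * e * e := by ring
        _ ≤ X ^ 2 * e * 1 := mul_le_mul_of_nonneg_left he1 (by positivity)
        _ = _ := by ring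
    have h4 : (u : ℝ) ^ 2 * (1 + Real.log u) ≤ X ^ 2 * e * Q ^ 16 := by
      refine mul_le_mul h3 (by linarith) ?_ (by positivity)
      have := Real.log_natCast_nonneg u
      linarith
    have h5 : X ^ 2 * e * 43 ≤ X ^ 2 * e * (43 * Q ^ 16) :=
      mul_le_mul_of_nonneg_left (by linarith) (by positivity)
    linarith
  have hτ : ∀ k, m ^ 3 ≤ k → k < (m + 1) ^ 3 →
      |cubeWeight (1 / (4 * X)) m (k + 1) - cubeWeight (1 / (4 * X)) m k| ≤
        5 * X / (m : ℝ) ^ 6 := by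
    intro k hk1 _
    have h1 : 1 ≤ m ^ 3 := Nat.one_le_pow _ _ (by omega)
    refine (abs_cubeWeight_succ_sub_le hδ m (h1.trans hk1)).trans ?_
    have hk : (m : ℝ) ^ 3 ≤ k := by exact_mod_cast hk1
    rw [one_div_one_div]
    refine div_le_div₀ (by positivity) (by linarith) (by positivity) ?_
    calc (m : ℝ) ^ 6 = (m ^ 3) ^ 2 := by ring
      _ ≤ _ := pow_le_pow_left₀ (by positivity) hk 2
  refine (abs_sum_mul_weight_le hb20 (cubeWeight_nonneg _ m)
    (fun k hk => by_contra fun h => hk.not_gt (hne k h).1)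
    (fun k hk => by_contra fun h => by have := (hne k h).2; omega) hB hτ).trans ?_
  have hcnt : (((m + 1) ^ 3 - m ^ 3 : ℕ) : ℝ) ≤ 7 * m ^ 2 := by
    rw [Nat.cast_sub (Nat.pow_le_pow_left (Nat.le_succ m) 3)]
    push_cast
    nlinarith
  have hA : |typeOneMean u| * ∑ k ∈ Ioc 0 ((m + 1) ^ 3), cubeWeight (1 / (4 * X)) m k ≤
      Q ^ 16 * e * (7 / X) := by
    refine mul_le_mul (hκ.trans ?_) (sum_cubeWeight_le (by omega) hm)
      (sum_nonneg fun k _ => cubeWeight_nonneg _ _ _) (by positivity)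
    refine mul_le_mul_of_nonneg_left ?_ (by positivity)
    nlinarith
  have hC : (((m + 1) ^ 3 - m ^ 3 : ℕ) : ℝ) * (44 * Q ^ 16 * X ^ 2 * e * (5 * X / (m : ℝ) ^ 6)) ≤
      1540 * Q ^ 16 * e / X := by
    calc _ ≤ 7 * m ^ 2 * (44 * Q ^ 16 * X ^ 2 * e * (5 * X / (m : ℝ) ^ 6)) :=
          mul_le_mul_of_nonneg_right hcnt (by positivity)
      _ = 1540 * Q ^ 16 * e * X ^ 3 / m ^ 4 := by field_simp; ring
      _ ≤ 1540 * Q ^ 16 * e * X ^ 3 / X ^ 4 := by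
          refine div_le_div_of_nonneg_left (by positivity) (by positivity) ?_
          exact pow_le_pow_left₀ hX0.le hXm 4
      _ = _ := by field_simp
  have hfin : 256 * (1600 * Q ^ 16 * e) ≤ 1 := by
    rw [zero_mul, neg_zero, Real.exp_zero] at hlast
    linarith
  calc _ ≤ Q ^ 16 * e * (7 / X) + 1540 * Q ^ 16 * e / X := add_le_add hA hC
    _ = 1547 * Q ^ 16 * e / X := by ring
    _ ≤ 1 / 256 / X := by
        refine div_le_div_of_nonneg_right ?_ hX0.le
        have : 0 ≤ Q ^ 16 * e := by positivity
        linarith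
    _ = _ := by rw [div_div]

/-- The primes `p` with `m ^ 3 < p` and `p + 1 < (m + 1) ^ 3`. -/
def cubePrimes (m : ℕ) : Finset ℕ :=
  {p ∈ Ioc 0 ((m + 1) ^ 3) | p.Prime ∧ m ^ 3 < p ∧ p + 1 < (m + 1) ^ 3}

lemma mem_cubePrimes {m p : ℕ} :
    p ∈ cubePrimes m ↔ p.Prime ∧ m ^ 3 < p ∧ p + 1 < (m + 1) ^ 3 := by
  rw [cubePrimes, mem_filter, mem_Ioc]
  exact ⟨fun h => h.2, fun h => ⟨⟨h.1.pos, by omega⟩, h⟩⟩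

lemma le_sum_cubeWeight {X m : ℕ} (hX : 8 ≤ X) (hm : m ∈ Ico X (2 * X)) :
    1 / (32 * X : ℝ) ≤ ∑ k ∈ Ioc 0 ((m + 1) ^ 3), cubeWeight (1 / (4 * X)) m k := by
  rw [mem_Ico] at hm
  have hX0 : (8 : ℝ) ≤ X := by exact_mod_cast hX
  have hm0 : (X : ℝ) ≤ m := by exact_mod_cast hm.1
  have hm2 : (m : ℝ) + 1 ≤ 2 * X := by exact_mod_cast hm.2
  set δ : ℝ := 1 / (4 * X) with hδ'
  have hδ : 0 < δ := by positivity
  have hδX : δ * X = 1 / 4 := by rw [hδ']; field_simp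
  set Y : ℝ := ((m : ℝ) + 1 / 2) ^ 3 with hY
  have hY0 : 0 < Y := by positivity
  have hYX : (X : ℝ) ^ 3 ≤ Y := pow_le_pow_left₀ (by linarith) (by linarith) 3
  have hYδ : 8 ≤ Y * δ := by
    have h1 : (X : ℝ) ^ 3 * δ ≤ Y * δ := mul_le_mul_of_nonneg_right hYX hδ.le
    have h2 : (X : ℝ) ^ 3 * δ = X ^ 2 * (δ * X) := by ring
    rw [h2, hδX] at h1
    nlinarith
  set J := ⌊Y * δ / 2⌋₊ with hJ
  have hJ1 : Y * δ / 2 - 1 < J := Nat.sub_one_lt_floor _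
  have hJ2 : (J : ℝ) ≤ Y * δ / 2 := Nat.floor_le (by positivity)
  have hceil : (⌈Y⌉₊ : ℝ) < Y + 1 := Nat.ceil_lt_add_one hY0.le
  have hkey : ∀ k ∈ Ico ⌈Y⌉₊ (⌈Y⌉₊ + J), Y ≤ k ∧ (k : ℝ) ≤ Y * (1 + δ / 2) := by
    intro k hk
    rw [mem_Ico] at hk
    refine ⟨Nat.ceil_le.mp hk.1, ?_⟩
    have : (k : ℝ) + 1 ≤ ⌈Y⌉₊ + J := by exact_mod_cast hk.2
    nlinarith
  have hδ1 : δ ≤ 1 / 16 := one_div_le_one_div_of_le (by norm_num) (by linarith)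
  have hsub : Ico ⌈Y⌉₊ (⌈Y⌉₊ + J) ⊆ Ioc 0 ((m + 1) ^ 3) := by
    intro k hk
    obtain ⟨h1, h2⟩ := hkey k hk
    rw [mem_Ioc]
    have hk0 : (0 : ℝ) < k := by linarith
    refine ⟨by exact_mod_cast hk0, ?_⟩
    have h3 : (k : ℝ) ≤ ((m : ℝ) + 1) ^ 3 := by
      refine h2.trans ?_
      have h4 : Y * (1 + δ / 2) = Y + Y * δ / 2 := by ring
      have h5 : Y * δ ≤ (m + 1 / 2) ^ 2 := by
        have h6 : (m + 1 / 2) * δ ≤ 1 := by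
          have : (m + 1 / 2) * δ ≤ (2 * X) * δ := mul_le_mul_of_nonneg_right (by linarith) hδ.le
          linarith
        calc Y * δ = (m + 1 / 2 : ℝ) ^ 2 * ((m + 1 / 2) * δ) := by rw [hY]; ring
          _ ≤ (m + 1 / 2 : ℝ) ^ 2 * 1 := mul_le_mul_of_nonneg_left h6 (by positivity)
          _ = _ := mul_one _
      rw [h4, hY]
      nlinarith
    exact_mod_cast h3
  have hterm : ∀ k ∈ Ico ⌈Y⌉₊ (⌈Y⌉₊ + J), 1 / (3 * Y) ≤ cubeWeight δ m k := by
    intro k hk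
    obtain ⟨h1, h2⟩ := hkey k hk
    have hk0 : (0 : ℝ) < k := by linarith
    have hl1 : 0 ≤ Real.log k - Real.log Y := by
      have := Real.log_le_log hY0 h1; linarith
    have hl2 : Real.log k - Real.log Y ≤ δ / 2 := by
      rw [← Real.log_div hk0.ne' hY0.ne']
      refine (Real.log_le_sub_one_of_pos (by positivity)).trans ?_
      rw [tsub_le_iff_right, div_le_iff₀ hY0]
      linarith
    have ht : 1 / 2 ≤ tent ((Real.log k - Real.log Y) / δ) := by
      refine le_trans ?_ (le_max_right _ _)
      rw [abs_of_nonneg (by positivity)]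
      have : (Real.log k - Real.log Y) / δ ≤ 1 / 2 := by
        rw [div_le_iff₀ hδ]; linarith
      linarith
    rw [cubeWeight, three_mul_log, ← hY]
    calc 1 / (3 * Y) = (1 / 2) / (3 / 2 * Y) := by field_simp
      _ ≤ _ := div_le_div₀ (by linarith) ht hk0 (by nlinarith)
  calc 1 / (32 * X : ℝ) = δ / 8 := by rw [hδ', div_div]; ring
    _ ≤ J * (1 / (3 * Y)) := by
        rw [mul_one_div, le_div_iff₀ (by positivity)]
        nlinarith
    _ = ∑ k ∈ Ico ⌈Y⌉₊ (⌈Y⌉₊ + J), 1 / (3 * Y) := by simp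
    _ ≤ ∑ k ∈ Ico ⌈Y⌉₊ (⌈Y⌉₊ + J), cubeWeight δ m k := sum_le_sum hterm
    _ ≤ _ := sum_le_sum_of_subset_of_nonneg hsub fun k _ _ => cubeWeight_nonneg _ _ _

lemma abs_sum_remainder_le {u N : ℕ} {Z δ : ℝ} (hu : 1 ≤ u) (hZ : 0 < Z) (m : ℕ)
    (hW : ∀ k, N < k → cubeWeight δ m k = 0) :
    |∑ n ∈ Ioc 0 N, (moebiusTail u * (lamArith - lamCut Z)) n * cubeWeight δ m n| ≤
      N ^ 3 / Z := by
  rw [sum_arithmeticFunction_mul_weight _ _ _ le_rfl hW]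
  calc _ ≤ ∑ d ∈ Ioc 0 N, ∑ l ∈ Ioc 0 N, (N / Z : ℝ) := by
        refine (abs_sum_le_sum_abs _ _).trans (sum_le_sum fun d hd => ?_)
        refine (abs_sum_le_sum_abs _ _).trans (sum_le_sum fun l hl => ?_)
        rw [mem_Ioc] at hd hl
        have hd0 : (0 : ℝ) < d := by exact_mod_cast hd.1
        have hl0 : (0 : ℝ) < l := by exact_mod_cast hl.1
        have hlN : (l : ℝ) ≤ N := by exact_mod_cast hl.2
        have h1 : |moebiusTail u d| ≤ d := by
          refine (abs_moebiusTail_le hu d).trans ?_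
          exact_mod_cast Nat.card_divisors_le_self d
        have h2 := abs_lamArith_sub_lamCut_le hZ l
        have h3 := cubeWeight_le δ m (d * l)
        rw [abs_mul, abs_mul, abs_of_nonneg (cubeWeight_nonneg _ _ _)]
        calc _ ≤ d * (l * (l / Z)) * (1 / ((d * l : ℕ) : ℝ)) := by
              refine mul_le_mul (mul_le_mul h1 h2 (abs_nonneg _) hd0.le) h3
                (cubeWeight_nonneg _ _ _) (by positivity)
          _ = l / Z := by push_cast; field_simp
          _ ≤ N / Z := div_le_div_of_nonneg_right hlN hZ.le
    _ = _ := by simp; ring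

section
open scoped ArithmeticFunction.vonMangoldt

lemma sum_vonMangoldt_cubeWeight_le {X m : ℕ} (hX : 8 ≤ X) (hm : m ∈ Ico X (2 * X)) :
    ∑ k ∈ Ioc 0 ((m + 1) ^ 3), Λ k * cubeWeight (1 / (4 * X)) m k ≤
      4 * Real.log X * ∑ p ∈ cubePrimes m, (1 : ℝ) / p +
        24 * √((X : ℝ) ^ 3) * Real.log X / X ^ 3 := by
  rw [mem_Ico] at hm
  have hX0 : (8 : ℝ) ≤ X := by exact_mod_cast hX
  have hXpos : (0 : ℝ) < X := by linarith
  have hm0 : (X : ℝ) ≤ m := by exact_mod_cast hm.1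
  have hm2 : (m : ℝ) + 1 ≤ 2 * X := by exact_mod_cast hm.2
  have hδ : (0 : ℝ) < 1 / (4 * X) := by positivity
  have hδm : 1 / (4 * X) * (2 * (m : ℝ)) ≤ 1 := by
    rw [one_div_mul_eq_div, div_le_one (by positivity)]; linarith
  have hne : ∀ k, cubeWeight (1 / (4 * X)) m k ≠ 0 → m ^ 3 < k ∧ k + 1 < (m + 1) ^ 3 :=
    fun k => cubeWeight_ne_zero hδ (by omega) hδm
  have hcube : (((m + 1) ^ 3 : ℕ) : ℝ) ≤ 8 * X ^ 3 := by
    push_cast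
    calc ((m : ℝ) + 1) ^ 3 ≤ (2 * X) ^ 3 := pow_le_pow_left₀ (by positivity) hm2 3
      _ = _ := by ring
  have hlogX : 0 ≤ Real.log X := Real.log_natCast_nonneg X
  have hlog : Real.log (((m + 1) ^ 3 : ℕ) : ℝ) ≤ 4 * Real.log X := by
    have h1 : (((m + 1) ^ 3 : ℕ) : ℝ) ≤ (X : ℝ) ^ 4 := by
      refine hcube.trans ?_
      calc 8 * (X : ℝ) ^ 3 ≤ X * X ^ 3 := mul_le_mul_of_nonneg_right hX0 (by positivity)
        _ = _ := by ring
    have h2 := Real.log_le_log (by positivity) h1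
    rwa [Real.log_pow, Nat.cast_ofNat] at h2
  rw [← sum_filter_add_sum_filter_not (Ioc 0 ((m + 1) ^ 3)) Nat.Prime]
  refine add_le_add ?_ ?_
  · rw [mul_sum]
    have h1 : ∀ k ∈ (Ioc 0 ((m + 1) ^ 3)).filter Nat.Prime, k ∉ cubePrimes m →
        Λ k * cubeWeight (1 / (4 * X)) m k = 0 := by
      intro k hk hk2
      have : cubeWeight (1 / (4 * X)) m k = 0 := by
        by_contra h
        exact hk2 (mem_cubePrimes.mpr ⟨(mem_filter.mp hk).2, hne k h⟩)
      rw [this, mul_zero]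
    have hsub : cubePrimes m ⊆ (Ioc 0 ((m + 1) ^ 3)).filter Nat.Prime := by
      intro p hp
      rw [cubePrimes, mem_filter] at hp
      exact mem_filter.mpr ⟨hp.1, hp.2.1⟩
    rw [← sum_subset hsub h1]
    refine sum_le_sum fun p hp => ?_
    rw [mem_cubePrimes] at hp
    have hp0 : (0 : ℝ) < p := by exact_mod_cast hp.1.pos
    refine mul_le_mul ?_ (cubeWeight_le _ _ _) (cubeWeight_nonneg _ _ _) (by positivity)
    refine ArithmeticFunction.vonMangoldt_le_log.trans (le_trans ?_ hlog)
    refine Real.log_le_log hp0 ?_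
    have : p ≤ (m + 1) ^ 3 := by omega
    exact_mod_cast this
  · have hN1 : (1 : ℝ) ≤ (((m + 1) ^ 3 : ℕ) : ℝ) := by
      exact_mod_cast Nat.one_le_pow _ _ (Nat.succ_pos m)
    have h1 := Chebyshev.psi_sub_theta_eq_sum_not_prime (((m + 1) ^ 3 : ℕ) : ℝ)
    have h2 := Chebyshev.psi_sub_theta_le hN1
    rw [Nat.floor_natCast] at h1
    calc _ ≤ ∑ k ∈ Ioc 0 ((m + 1) ^ 3) with ¬k.Prime, Λ k * (1 / (X : ℝ) ^ 3) := by
          refine sum_le_sum fun k _ => mul_le_mul_of_nonneg_left ?_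
            ArithmeticFunction.vonMangoldt_nonneg
          by_cases h : cubeWeight (1 / (4 * X)) m k = 0
          · rw [h]; positivity
          · refine (cubeWeight_le _ _ _).trans (one_div_le_one_div_of_le (by positivity) ?_)
            have h3 : (m : ℝ) ^ 3 ≤ k := by exact_mod_cast (hne k h).1.le
            exact (pow_le_pow_left₀ hXpos.le hm0 3).trans h3
      _ ≤ (2 * √(((m + 1) ^ 3 : ℕ) : ℝ) * Real.log (((m + 1) ^ 3 : ℕ) : ℝ)) * (1 / (X : ℝ) ^ 3) := by
          rw [← sum_mul, ← h1]
          exact mul_le_mul_of_nonneg_right h2 (by positivity)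
      _ ≤ (2 * (3 * √((X : ℝ) ^ 3)) * (4 * Real.log X)) * (1 / (X : ℝ) ^ 3) := by
          refine mul_le_mul_of_nonneg_right ?_ (by positivity)
          refine mul_le_mul (mul_le_mul_of_nonneg_left ?_ (by norm_num)) hlog
            (Real.log_natCast_nonneg _) (by positivity)
          rw [show 3 * √((X : ℝ) ^ 3) = √(9 * X ^ 3) by
            rw [Real.sqrt_mul (by norm_num), show (9 : ℝ) = 3 ^ 2 by norm_num,
              Real.sqrt_sq (by norm_num)]]
          refine Real.sqrt_le_sqrt (hcube.trans ?_)
          exact mul_le_mul_of_nonneg_right (by norm_num) (by positivity)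
      _ = _ := by ring

end

section
open scoped ArithmeticFunction.vonMangoldt ArithmeticFunction.zeta

/-- All but a few of the intervals between consecutive cubes contain many primes. -/
theorem exists_cubePrimes_card_bound : ∃ K : ℝ, 2 ≤ K ∧ ∀ Q ≥ K, ∀ X : ℕ,
    (X : ℝ) = Real.exp (Q ^ 16 / 100) →
    (#{m ∈ Ico X (2 * X) | ∑ p ∈ cubePrimes m, (1 : ℝ) / p < 1 / (1024 * X * Real.log X)} : ℝ) ≤
      X * Real.exp (-(Q / (2 * 10 ^ 5))) := by
  obtain ⟨K₁, hK₁, h₁⟩ := exists_typeOne_bound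
  obtain ⟨K₂, hK₂, h₂⟩ := exists_typeTwo_card_bound
  refine ⟨max K₁ K₂, le_max_of_le_left hK₁, fun Q hQ X hX => ?_⟩
  have hQ1 : K₁ ≤ Q := (le_max_left _ _).trans hQ
  have hQ2 : 2 ≤ Q := hK₁.trans hQ1
  have hQ0 : 0 < Q := by linarith
  set L : ℝ := Real.exp (Q / 10 ^ 5) with hL
  have hL0 : 0 < L := Real.exp_pos _
  have hQ15 : 2 ^ 15 * Q ≤ Q ^ 16 := by
    calc (2 : ℝ) ^ 15 * Q ≤ Q ^ 15 * Q :=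
          mul_le_mul_of_nonneg_right (pow_le_pow_left₀ (by norm_num) hQ2 15) hQ0.le
      _ = Q ^ 16 := by ring
  have hQ16 : 65536 ≤ Q ^ 16 := by linarith
  have hX8 : (8 : ℝ) ≤ X := by
    rw [hX]
    have := Real.add_one_le_exp (Q ^ 16 / 100)
    linarith
  have hX0 : (0 : ℝ) < X := by linarith
  have hX8' : 8 ≤ X := by exact_mod_cast hX8
  have hlogX : Real.log X = Q ^ 16 / 100 := by rw [hX, Real.log_exp]
  have hXL : 2 ≤ X / L := by
    rw [hX, hL, ← Real.exp_sub]
    have := Real.add_one_le_exp (Q ^ 16 / 100 - Q / 10 ^ 5)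
    linarith
  set u := ⌊X / L⌋₊ with hu
  have hu1 : (u : ℝ) ≤ X / L := Nat.floor_le (by positivity)
  have hu2 : X / (2 * L) ≤ u := by
    have h3 : X / L - 1 < u := Nat.sub_one_lt_floor _
    have h4 : X / (2 * L) = X / L / 2 := by rw [div_div, mul_comm]
    linarith
  have hu0 : 1 ≤ u := by
    have : (0 : ℝ) < u := lt_of_lt_of_le (by positivity) hu2
    exact_mod_cast this
  have huX : u ≤ X := by
    have h3 : (u : ℝ) ≤ X := by
      refine hu1.trans (div_le_self hX0.le ?_)
      exact Real.one_le_exp (by positivity)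
    exact_mod_cast h3
  refine h₂ Q ((le_max_right _ _).trans hQ) X u hX hu2 huX _ (filter_subset _ _) ?_
  intro m hm
  obtain ⟨hmI, hbad⟩ := mem_filter.mp hm
  have hm' := mem_Ico.mp hmI
  have hm2 : (m : ℝ) + 1 ≤ 2 * X := by exact_mod_cast hm'.2
  set W := cubeWeight (1 / (4 * X)) m with hW
  have hδ : (0 : ℝ) < 1 / (4 * X) := by positivity
  have hδm : 1 / (4 * X) * (2 * (m : ℝ)) ≤ 1 := by
    rw [one_div_mul_eq_div, div_le_one (by positivity)]; linarith
  have hne : ∀ k, W k ≠ 0 → m ^ 3 < k ∧ k + 1 < (m + 1) ^ 3 :=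
    fun k => cubeWeight_ne_zero hδ (by omega) hδm
  have hWb : ∀ k, (m + 1) ^ 3 < k → W k = 0 := fun k hk => by_contra fun h => by
    have := (hne k h).2; omega
  have hcube : (m + 1) ^ 3 ≤ 8 * X ^ 3 := by
    calc (m + 1) ^ 3 ≤ (2 * X) ^ 3 := Nat.pow_le_pow_left hm'.2 3
      _ = _ := by ring
  have hb20 : (m + 1) ^ 3 ≤ X ^ 20 := by
    refine hcube.trans ?_
    calc 8 * X ^ 3 ≤ X ^ 17 * X ^ 3 := by
          refine Nat.mul_le_mul_right _ (le_trans (by norm_num) (Nat.pow_le_pow_left hX8' 17))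
      _ = X ^ 20 := by ring
  set Z : ℕ := X ^ 20 with hZ
  have hred : ∀ c : ℕ → ℝ, ∑ n ∈ Ioc 0 Z, c n * W n = ∑ n ∈ Ioc 0 ((m + 1) ^ 3), c n * W n :=
    fun c => sum_Ioc_eq_of_support hb20 fun n hn => by rw [hWb n hn, mul_zero]
  rw [← sum_arithmeticFunction_mul_weight (N := Z) _ _ W le_rfl
    (fun n hn => hWb n (lt_of_le_of_lt hb20 hn))]
  have hT1 := h₁ Q hQ1 X u hX hu2 hu1 m hmI
  rw [← hW, ← hZ] at hT1
  have hdec : ∑ n ∈ Ioc 0 Z, lamArith n * W n = ∑ n ∈ Ioc 0 Z, typeOne u n * W n +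
      ∑ n ∈ Ioc 0 Z, (moebiusTail u * (lamCut (Z : ℝ) - lamCut u)) n * W n +
      ∑ n ∈ Ioc 0 Z, (moebiusTail u * (lamArith - lamCut (Z : ℝ))) n * W n := by
    rw [← sum_add_distrib, ← sum_add_distrib]
    refine sum_congr rfl fun n _ => ?_
    have h0 : lamCut u n * W n = 0 := by
      by_cases h : W n = 0
      · rw [h, mul_zero]
      · rw [lamCut_eq_zero (by exact_mod_cast hu0), zero_mul]
        have h3 := (hne n h).1
        have h4 : m ≤ m ^ 3 := Nat.le_self_pow (by norm_num) m
        exact_mod_cast (by omega : u ≤ n)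
    nth_rewrite 1 [lamArith_decomposition u (Z : ℝ)]
    simp only [ArithmeticFunction.add_apply]
    linear_combination h0
  have hrem : |∑ n ∈ Ioc 0 Z, (moebiusTail u * (lamArith - lamCut (Z : ℝ))) n * W n| ≤
      1 / (256 * X) := by
    have hZr : (Z : ℝ) = (X : ℝ) ^ 20 := by rw [hZ]; push_cast; rfl
    rw [hred]
    refine (abs_sum_remainder_le hu0 (by rw [hZr]; positivity) m hWb).trans ?_
    have h3 : (((m + 1) ^ 3 : ℕ) : ℝ) ≤ 8 * X ^ 3 := by exact_mod_cast hcube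
    rw [hZr, div_le_div_iff₀ (by positivity) (by positivity)]
    calc (((m + 1) ^ 3 : ℕ) : ℝ) ^ 3 * (256 * X) ≤ (8 * X ^ 3) ^ 3 * (256 * X) :=
          mul_le_mul_of_nonneg_right (pow_le_pow_left₀ (by positivity) h3 3) (by positivity)
      _ = 131072 * X ^ 10 := by ring
      _ ≤ X ^ 10 * X ^ 10 := by
          refine mul_le_mul_of_nonneg_right ?_ (by positivity)
          exact le_trans (by norm_num) (pow_le_pow_left₀ (by norm_num) hX8 10)
      _ = 1 * X ^ 20 := by ring
  have hlam : ∑ n ∈ Ioc 0 Z, lamArith n * W n =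
      ∑ n ∈ Ioc 0 ((m + 1) ^ 3), Λ n * W n - ∑ n ∈ Ioc 0 ((m + 1) ^ 3), W n := by
    rw [hred, ← sum_sub_distrib]
    refine sum_congr rfl fun n hn => ?_
    rw [lamArith_apply, lamOne_of_pos (mem_Ioc.mp hn).1]
    ring
  have hlow := le_sum_cubeWeight hX8' hmI
  have hprimes := sum_vonMangoldt_cubeWeight_le hX8' hmI
  rw [← hW] at hlow hprimes
  have hlog0 : 0 < Real.log X := by rw [hlogX]; positivity
  have hP1 : 4 * Real.log X * ∑ p ∈ cubePrimes m, (1 : ℝ) / p ≤ 1 / (256 * X) := by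
    refine (mul_le_mul_of_nonneg_left hbad.le (by positivity)).trans (le_of_eq ?_)
    field_simp
    norm_num
  have hP2 : 24 * √((X : ℝ) ^ 3) * Real.log X / X ^ 3 ≤ 1 / (256 * X) := by
    set h := Q ^ 16 / 200 with hh
    have hh327 : 327 ≤ h := by rw [hh]; linarith
    have hX2h : (X : ℝ) = Real.exp h ^ 2 := by
      rw [hX, ← Real.exp_nat_mul]; congr 1; rw [hh]; push_cast; ring
    have hsq : √((X : ℝ) ^ 3) = Real.exp h ^ 3 := by
      rw [hX2h, show (Real.exp h ^ 2) ^ 3 = (Real.exp h ^ 3) ^ 2 by ring,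
        Real.sqrt_sq (by positivity)]
    have hlogh : Real.log X = 2 * h := by rw [hlogX, hh]; ring
    have hexp := Real.pow_div_factorial_le_exp h (by linarith) 4
    have h24 : ((Nat.factorial 4 : ℕ) : ℝ) = 24 := by norm_num [Nat.factorial]
    rw [h24] at hexp
    have hbig : 12288 * h ≤ Real.exp h := by
      refine le_trans ?_ hexp
      rw [le_div_iff₀ (by norm_num)]
      have h3 : (327 : ℝ) ^ 3 ≤ h ^ 3 := pow_le_pow_left₀ (by norm_num) hh327 3
      nlinarith
    rw [hsq, hlogh, div_le_div_iff₀ (by positivity) (by positivity), hX2h]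
    calc 24 * Real.exp h ^ 3 * (2 * h) * (256 * Real.exp h ^ 2) =
          (12288 * h) * Real.exp h ^ 5 := by ring
      _ ≤ Real.exp h * Real.exp h ^ 5 := mul_le_mul_of_nonneg_right hbig (by positivity)
      _ = _ := by ring
  have e1 : 1 / (32 * X : ℝ) = 8 * (1 / (256 * X)) := by field_simp; norm_num
  have e2 : 1 / (64 * X : ℝ) = 4 * (1 / (256 * X)) := by field_simp; norm_num
  rw [e1] at hlow
  rw [e2]
  have a1 := (abs_le.mp hT1).1
  have a2 := (abs_le.mp hrem).1
  linarith

end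

lemma exists_cubePrimes_sum_bound : ∃ K : ℝ, 2 ≤ K ∧ ∀ Q ≥ K, ∀ X : ℕ,
    (X : ℝ) = Real.exp (Q ^ 16 / 100) → ∀ B : ℕ,
    ∑ m ∈ Ico X (2 ^ B * X) with ∑ p ∈ cubePrimes m, (1 : ℝ) / p < 1 / (1024 * m * Real.log m),
      (1 : ℝ) / m ≤ B * Real.exp (-(Q / (2 * 10 ^ 5))) := by
  obtain ⟨K, hK2, hK⟩ := exists_cubePrimes_card_bound
  refine ⟨K, hK2, fun Q hQ X hX B => ?_⟩
  have hQ0 : 0 < Q := by linarith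
  have hX1 : (1 : ℝ) < X := by rw [hX]; exact Real.one_lt_exp_iff.mpr (by positivity)
  have hlogX : Real.log X = Q ^ 16 / 100 := by rw [hX, Real.log_exp]
  have hX0 : 0 < X := by
    have : (0 : ℝ) < X := by linarith
    exact_mod_cast this
  induction B with
  | zero => simp
  | succ B ih =>
    have hle : X ≤ 2 ^ B * X := Nat.le_mul_of_pos_left X (by positivity)
    have e2 : 2 ^ (B + 1) * X = 2 * (2 ^ B * X) := by ring
    have hle2 : 2 ^ B * X ≤ 2 ^ (B + 1) * X := by omega
    rw [← Ico_union_Ico_eq_Ico hle hle2, filter_union, sum_union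
      (disjoint_filter_filter (Ico_disjoint_Ico_consecutive _ _ _))]
    push_cast
    rw [add_one_mul]
    refine add_le_add ih ?_
    rw [e2]
    set Y := 2 ^ B * X with hY
    have hXY : (X : ℝ) ≤ Y := by exact_mod_cast hle
    have hY0 : (0 : ℝ) < Y := by linarith
    have hlogY : Q ^ 16 / 100 ≤ Real.log Y := hlogX ▸ Real.log_le_log (by linarith) hXY
    have hlogYpos : 0 < Real.log Y := lt_of_lt_of_le (by positivity) hlogY
    set q : ℝ := (100 * Real.log Y) ^ ((16 : ℕ) : ℝ)⁻¹ with hq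
    have hq16 : q ^ 16 = 100 * Real.log Y := Real.rpow_inv_natCast_pow (by positivity) (by norm_num)
    have hq0 : 0 ≤ q := by positivity
    have hQq : Q ≤ q := le_of_pow_le_pow_left₀ (by norm_num : 16 ≠ 0) hq0 (by linarith)
    have hYe : (Y : ℝ) = Real.exp (q ^ 16 / 100) := by
      rw [hq16, mul_div_cancel_left₀ _ (by norm_num), Real.exp_log hY0]
    have hcard := hK q (hQ.trans hQq) Y hYe
    calc _ ≤ ∑ m ∈ Ico Y (2 * Y) with ∑ p ∈ cubePrimes m, (1 : ℝ) / p <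
          1 / (1024 * Y * Real.log Y), (1 : ℝ) / m := by
          refine sum_le_sum_of_subset_of_nonneg (fun m hm => ?_) fun _ _ _ => by positivity
          rw [mem_filter] at hm ⊢
          refine ⟨hm.1, hm.2.trans_le ?_⟩
          have hYm : (Y : ℝ) ≤ m := by exact_mod_cast (mem_Ico.mp hm.1).1
          refine one_div_le_one_div_of_le (by positivity) ?_
          exact mul_le_mul (by linarith) (Real.log_le_log hY0 hYm) hlogYpos.le (by positivity)
      _ ≤ ∑ m ∈ Ico Y (2 * Y) with ∑ p ∈ cubePrimes m, (1 : ℝ) / p <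
          1 / (1024 * Y * Real.log Y), (1 : ℝ) / Y := by
          refine sum_le_sum fun m hm => ?_
          have hYm : (Y : ℝ) ≤ m := by exact_mod_cast (mem_Ico.mp (mem_filter.mp hm).1).1
          exact one_div_le_one_div_of_le hY0 hYm
      _ ≤ Real.exp (-(q / (2 * 10 ^ 5))) := by
          rw [sum_const, nsmul_eq_mul, mul_one_div, div_le_iff₀ hY0]
          exact hcard.trans_eq (mul_comm _ _)
      _ ≤ _ := by
          refine Real.exp_le_exp.mpr (neg_le_neg ?_)
          exact div_le_div_of_nonneg_right hQq (by norm_num)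

lemma disjoint_cubePrimes {m n : ℕ} (h : m ≠ n) : Disjoint (cubePrimes m) (cubePrimes n) := by
  wlog hmn : m < n generalizing m n
  · exact (this h.symm (by omega)).symm
  rw [disjoint_left]
  intro p hp hp2
  rw [mem_cubePrimes] at hp hp2
  have := Nat.pow_le_pow_left (show m + 1 ≤ n from hmn) 3
  omega

/-- Passing from a set of integers to the primes just above their cubes does not lose too much
logarithmic mass. -/
theorem exists_cubePrimes_biUnion_bound : ∃ K : ℝ, 2 ≤ K ∧ ∀ Q ≥ K, ∀ X B : ℕ,
    (X : ℝ) = Real.exp (Q ^ 16 / 100) → (B : ℝ) ≤ Q ^ 16 → ∀ S ⊆ Ico X (2 ^ B * X),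
    Real.exp (-(Q / (4 * 10 ^ 5))) ≤ ∑ q ∈ S, (1 : ℝ) / q → ∀ R ≥ Q, R ^ 16 = 3 * Q ^ 16 →
    S.biUnion cubePrimes ⊆ Ico (X ^ 3) (2 ^ (3 * B) * X ^ 3) ∧
    Real.exp (-(R / (4 * 10 ^ 5))) ≤ ∑ p ∈ S.biUnion cubePrimes, (1 : ℝ) / p := by
  obtain ⟨K₁, hK₁, h₁⟩ := exists_cubePrimes_sum_bound
  obtain ⟨K₂, hK₂⟩ := exists_pow_mul_exp_le 2 16 (a := 1 / (2 * 10 ^ 5)) (b := 1 / (4 * 10 ^ 5))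
    (by norm_num)
  obtain ⟨K₃, hK₃⟩ := exists_pow_mul_exp_le 2048 16 (a := 1 / (64 * 10 ^ 5)) (b := 0)
    (by norm_num)
  refine ⟨max K₁ (max K₂ K₃), le_max_of_le_left hK₁, fun Q hQ X B hX hB S hS hW R hR hRQ => ?_⟩
  have hQ1 : K₁ ≤ Q := (le_max_left _ _).trans hQ
  have hQ2 := hK₂ Q (((le_max_left _ _).trans (le_max_right _ _)).trans hQ)
  have hQ3 := hK₃ Q (((le_max_right _ _).trans (le_max_right _ _)).trans hQ)
  have hQge2 : 2 ≤ Q := hK₁.trans hQ1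
  have hQ0 : 0 < Q := by linarith
  have hX1 : (1 : ℝ) < X := by rw [hX]; exact Real.one_lt_exp_iff.mpr (by positivity)
  have hlogX : Real.log X = Q ^ 16 / 100 := by rw [hX, Real.log_exp]
  constructor
  · intro p hp
    obtain ⟨q, hq, hpq⟩ := mem_biUnion.mp hp
    rw [mem_cubePrimes] at hpq
    have hqI := mem_Ico.mp (hS hq)
    rw [mem_Ico]
    have a1 := Nat.pow_le_pow_left hqI.1 3
    have a2 := Nat.pow_le_pow_left (show q + 1 ≤ 2 ^ B * X from hqI.2) 3
    have a3 : (2 ^ B * X) ^ 3 = 2 ^ (3 * B) * X ^ 3 := by rw [mul_pow, ← pow_mul, mul_comm B]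
    omega
  · have hbad := h₁ Q hQ1 X hX B
    set P : ℕ → Prop := fun m => ∑ p ∈ cubePrimes m, (1 : ℝ) / p < 1 / (1024 * m * Real.log m)
      with hP
    classical
    have hbadS : ∑ q ∈ S with P q, (1 : ℝ) / q ≤ Real.exp (-(Q / (4 * 10 ^ 5))) / 2 := by
      have e1 : Q / (2 * 10 ^ 5) = 1 / (2 * 10 ^ 5) * Q := by ring
      have e2 : Q / (4 * 10 ^ 5) = 1 / (4 * 10 ^ 5) * Q := by ring
      calc _ ≤ ∑ m ∈ Ico X (2 ^ B * X) with P m, (1 : ℝ) / m :=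
            sum_le_sum_of_subset_of_nonneg (filter_subset_filter _ hS) fun _ _ _ => by positivity
        _ ≤ B * Real.exp (-(Q / (2 * 10 ^ 5))) := by convert hbad
        _ ≤ Q ^ 16 * Real.exp (-(Q / (2 * 10 ^ 5))) :=
            mul_le_mul_of_nonneg_right hB (Real.exp_pos _).le
        _ ≤ _ := by rw [e1, e2]; linarith
    have hgood : Real.exp (-(Q / (4 * 10 ^ 5))) / 2 ≤ ∑ q ∈ S with ¬P q, (1 : ℝ) / q := by
      have := sum_filter_add_sum_filter_not S P (fun q => (1 : ℝ) / q)
      linarith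
    rw [sum_biUnion fun m _ n _ h => disjoint_cubePrimes h]
    have hstep : ∑ q ∈ S with ¬P q, (1 : ℝ) / q * (1 / (1024 * Q ^ 16)) ≤
        ∑ q ∈ S, ∑ p ∈ cubePrimes q, (1 : ℝ) / p := by
      refine le_trans (sum_le_sum fun q hq => ?_) (sum_le_sum_of_subset_of_nonneg
        (filter_subset _ S) fun _ _ _ => sum_nonneg fun _ _ => by positivity)
      rw [mem_filter] at hq
      have hqI := mem_Ico.mp (hS hq.1)
      have hXq : (X : ℝ) ≤ q := by exact_mod_cast hqI.1
      have hq1 : (1 : ℝ) < q := by linarith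
      have hqB : (q : ℝ) ≤ 2 ^ B * X := by exact_mod_cast hqI.2.le
      have hlogq : Real.log q ≤ Q ^ 16 := by
        refine (Real.log_le_log (by linarith) hqB).trans ?_
        rw [Real.log_mul (by positivity) (by linarith), Real.log_pow, hlogX]
        have h2 := Real.log_two_lt_d9
        have h3 : B * Real.log 2 ≤ B * 0.7 := mul_le_mul_of_nonneg_left (by linarith)
          (Nat.cast_nonneg B)
        have h4 : 0 < Q ^ 16 := by positivity
        linarith
      refine le_trans ?_ (not_lt.mp hq.2)
      rw [one_div_mul_one_div]
      have hlq := Real.log_pos hq1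
      refine one_div_le_one_div_of_le (by positivity) ?_
      have := mul_le_mul_of_nonneg_left hlogq (show (0 : ℝ) ≤ 1024 * q by positivity)
      linarith
    refine le_trans ?_ hstep
    rw [← sum_mul]
    have hR2 : Q * (1 + 1 / 16) ≤ R := by
      refine le_of_pow_le_pow_left₀ (by norm_num : 16 ≠ 0) (by linarith) ?_
      rw [hRQ, mul_pow, mul_comm (3 : ℝ)]
      exact mul_le_mul_of_nonneg_left (by norm_num) (by positivity)
    have hexp : Real.exp (-(R / (4 * 10 ^ 5))) ≤
        Real.exp (-(Q / (4 * 10 ^ 5))) * Real.exp (-(1 / (64 * 10 ^ 5) * Q)) := by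
      rw [← Real.exp_add]
      refine Real.exp_le_exp.mpr ?_
      linarith
    have hQ16 : 0 < Q ^ 16 := by positivity
    rw [zero_mul, neg_zero, Real.exp_zero] at hQ3
    refine hexp.trans (le_trans ?_ (mul_le_mul_of_nonneg_right hgood (by positivity)))
    rw [div_mul_div_comm, mul_one, le_div_iff₀ (by positivity)]
    have := mul_le_mul_of_nonneg_left hQ3 (Real.exp_pos (-(Q / (4 * 10 ^ 5)))).le
    linarith

/-- The primes just above the cubes of the elements of `T`. -/
def cubeStep (T : Finset ℕ) : Finset ℕ := T.biUnion cubePrimes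

lemma cubeStep_iterate_eq_biUnion (n : ℕ) (T : Finset ℕ) :
    cubeStep^[n] T = T.biUnion fun q => cubeStep^[n] {q} := by
  induction n with
  | zero => simp
  | succ n ih =>
    simp only [Function.iterate_succ_apply']
    rw [ih, cubeStep, biUnion_biUnion]
    rfl

lemma cubeStep_iterate_eq_empty {m n : ℕ} (h : m ≤ n) {T : Finset ℕ}
    (hT : cubeStep^[m] T = ∅) : cubeStep^[n] T = ∅ := by
  induction n, h using Nat.le_induction with
  | base => exact hT
  | succ n _ ih => rw [Function.iterate_succ_apply', ih]; rfl

lemma exists_mem_cubeStep_iterate_nonempty {T : Finset ℕ}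
    (h : ∀ n, (cubeStep^[n] T).Nonempty) : ∃ q ∈ T, ∀ n, (cubeStep^[n] {q}).Nonempty := by
  by_contra! hcon
  choose! N hN using hcon
  refine (h (T.sup N)).ne_empty ?_
  rw [cubeStep_iterate_eq_biUnion, eq_empty_iff_forall_notMem]
  intro p hp
  obtain ⟨q, hq, hpq⟩ := mem_biUnion.mp hp
  rw [cubeStep_iterate_eq_empty (le_sup hq) (hN q hq)] at hpq
  exact notMem_empty p hpq

lemma exists_mem_cubePrimes_nonempty {q : ℕ} (h : ∀ n, (cubeStep^[n] {q}).Nonempty) :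
    ∃ p ∈ cubePrimes q, ∀ n, (cubeStep^[n] {p}).Nonempty := by
  refine exists_mem_cubeStep_iterate_nonempty fun n => ?_
  have := h (n + 1)
  rwa [Function.iterate_succ_apply, cubeStep, singleton_biUnion] at this

lemma exists_cubePrimes_chain {T : Finset ℕ} (h : ∀ n, (cubeStep^[n] T).Nonempty) :
    ∃ p : ℕ → ℕ, p 0 ∈ T ∧ ∀ n, p (n + 1) ∈ cubePrimes (p n) := by
  obtain ⟨q, hqT, hq⟩ := exists_mem_cubeStep_iterate_nonempty h
  choose f hf using fun x : {q : ℕ // ∀ n, (cubeStep^[n] {q}).Nonempty} =>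
    exists_mem_cubePrimes_nonempty x.2
  let g : {q : ℕ // ∀ n, (cubeStep^[n] {q}).Nonempty} →
    {q : ℕ // ∀ n, (cubeStep^[n] {q}).Nonempty} := fun x => ⟨f x, (hf x).2⟩
  refine ⟨fun n => (g^[n] ⟨q, hq⟩ : _), hqT, fun n => ?_⟩
  simp only [Function.iterate_succ_apply']
  exact (hf _).1

/-- Nested cubes determine a real number whose powers have prescribed floors. -/
lemma exists_floor_pow_eq {p : ℕ → ℕ} (h0 : 2 ≤ p 0) (hlow : ∀ n, p n ^ 3 ≤ p (n + 1))
    (hup : ∀ n, p (n + 1) + 1 < (p n + 1) ^ 3) :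
    ∃ A : ℝ, 1 < A ∧ ∀ n, ⌊A ^ (3 ^ n : ℕ)⌋ = (p n : ℤ) := by
  have hne : ∀ n : ℕ, 3 ^ n ≠ 0 := fun n => by positivity
  set a : ℕ → ℝ := fun n => (p n : ℝ) ^ ((3 ^ n : ℕ) : ℝ)⁻¹ with ha
  set b : ℕ → ℝ := fun n => ((p n : ℝ) + 1) ^ ((3 ^ n : ℕ) : ℝ)⁻¹ with hb
  have ha0 : ∀ n, 0 ≤ a n := fun n => by positivity
  have hb0 : ∀ n, 0 ≤ b n := fun n => by positivity
  have hap : ∀ n, a n ^ 3 ^ n = p n := fun n =>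
    Real.rpow_inv_natCast_pow (by positivity) (hne n)
  have hbp : ∀ n, b n ^ 3 ^ n = p n + 1 := fun n =>
    Real.rpow_inv_natCast_pow (by positivity) (hne n)
  have hmono : Monotone a := monotone_nat_of_le_succ fun n => by
    refine le_of_pow_le_pow_left₀ (hne (n + 1)) (ha0 _) ?_
    rw [hap, pow_succ, pow_mul, hap]
    exact_mod_cast hlow n
  have hanti : StrictAnti b := strictAnti_nat_of_succ_lt fun n => by
    refine lt_of_pow_lt_pow_left₀ (3 ^ (n + 1)) (hb0 _) ?_
    rw [hbp, pow_succ, pow_mul, hbp]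
    exact_mod_cast hup n
  have hab : ∀ m n, a m ≤ b n := hmono.forall_le_of_antitone hanti.antitone fun n =>
    Real.rpow_le_rpow (by positivity) (by linarith) (by positivity)
  have hbdd : BddAbove (Set.range a) := ⟨b 0, by rintro _ ⟨m, rfl⟩; exact hab m 0⟩
  have hle : ∀ n, a n ≤ ⨆ n, a n := le_ciSup hbdd
  have hlt : ∀ n, ⨆ n, a n < b n := fun n =>
    (ciSup_le fun m => hab m (n + 1)).trans_lt (hanti n.lt_succ_self)
  refine ⟨⨆ n, a n, ?_, fun n => ?_⟩
  · have h1 := hap 0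
    rw [pow_zero, pow_one] at h1
    have h2 : (2 : ℝ) ≤ p 0 := by exact_mod_cast h0
    have h3 := hle 0
    linarith
  · rw [Int.floor_eq_iff]
    push_cast
    refine ⟨hap n ▸ pow_le_pow_left₀ (ha0 n) (hle n) _, ?_⟩
    rw [← hbp]
    exact pow_lt_pow_left₀ (hlt n) ((ha0 n).trans (hle n)) (hne n)

lemma exists_cubeStep_iterate_nonempty :
    ∃ X : ℕ, 2 ≤ X ∧ ∀ n, (cubeStep^[n] (Ico X (2 * X))).Nonempty := by
  obtain ⟨K, hK2, hK⟩ := exists_cubePrimes_biUnion_bound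
  obtain ⟨X, hX⟩ := exists_nat_ge (Real.exp ((max K (4 * 10 ^ 5)) ^ 16))
  set K' := max K (4 * 10 ^ 5) with hK'
  have hK'1 : (4 * 10 ^ 5 : ℝ) ≤ K' := le_max_right _ _
  have hK'16 : K' ≤ K' ^ 16 := le_self_pow₀ (by linarith) (by norm_num)
  have hX0 : (0 : ℝ) < X := (Real.exp_pos _).trans_le hX
  have hlog : K' ^ 16 ≤ Real.log X := (Real.le_log_iff_exp_le hX0).mpr hX
  have hlog0 : 0 < Real.log X := by linarith
  have hX2 : 2 ≤ X := by
    have := Real.add_one_le_exp (K' ^ 16)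
    have : (2 : ℝ) ≤ X := by linarith
    exact_mod_cast this
  refine ⟨X, hX2, ?_⟩
  set Q : ℕ → ℝ := fun k => (100 * (3 ^ k * Real.log X)) ^ ((16 : ℕ) : ℝ)⁻¹ with hQ
  have hQ0 : ∀ k, 0 ≤ Q k := fun k => by positivity
  have hQp : ∀ k, Q k ^ 16 = 100 * (3 ^ k * Real.log X) := fun k =>
    Real.rpow_inv_natCast_pow (by positivity) (by norm_num)
  have hQK : ∀ k, K' ≤ Q k := fun k => by
    refine le_of_pow_le_pow_left₀ (by norm_num : 16 ≠ 0) (hQ0 k) ?_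
    rw [hQp]
    have : (1 : ℝ) * Real.log X ≤ 3 ^ k * Real.log X :=
      mul_le_mul_of_nonneg_right (one_le_pow₀ (by norm_num)) hlog0.le
    linarith
  have hmass : ∀ k, cubeStep^[k] (Ico X (2 * X)) ⊆ Ico (X ^ 3 ^ k) (2 ^ 3 ^ k * X ^ 3 ^ k) ∧
      Real.exp (-(Q k / (4 * 10 ^ 5))) ≤ ∑ p ∈ cubeStep^[k] (Ico X (2 * X)), (1 : ℝ) / p := by
    intro k
    induction k with
    | zero =>
      simp only [pow_zero, pow_one, Function.iterate_zero, id_eq]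
      refine ⟨subset_rfl, ?_⟩
      have h1 : ∑ p ∈ Ico X (2 * X), (1 : ℝ) / (2 * X) ≤ ∑ p ∈ Ico X (2 * X), (1 : ℝ) / p := by
        refine sum_le_sum fun p hp => ?_
        have hp' := mem_Ico.mp hp
        have hp0 : (0 : ℝ) < p := by
          have : 0 < p := by omega
          exact_mod_cast this
        refine one_div_le_one_div_of_le hp0 ?_
        exact_mod_cast hp'.2.le
      rw [sum_const, Nat.card_Ico, nsmul_eq_mul, show 2 * X - X = X by omega] at h1
      have h2 : (X : ℝ) * (1 / (2 * X)) = 1 / 2 := by field_simp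
      have h3 : Real.exp (-(Q 0 / (4 * 10 ^ 5))) ≤ Real.exp (-1) := by
        refine Real.exp_le_exp.mpr (neg_le_neg ?_)
        rw [le_div_iff₀ (by norm_num)]
        linarith [hQK 0]
      have h4 := Real.exp_neg_one_lt_half
      linarith
    | succ k ih =>
      have hc : ((X ^ 3 ^ k : ℕ) : ℝ) = Real.exp (Q k ^ 16 / 100) := by
        rw [hQp, mul_div_cancel_left₀ _ (by norm_num)]
        have := Real.exp_nat_mul (Real.log X) (3 ^ k)
        push_cast at this ⊢
        rw [this, Real.exp_log hX0]
      have hB : ((3 ^ k : ℕ) : ℝ) ≤ Q k ^ 16 := by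
        rw [hQp]
        push_cast
        have : (3 : ℝ) ^ k * 1 ≤ 3 ^ k * Real.log X :=
          mul_le_mul_of_nonneg_left (by linarith) (by positivity)
        have : 0 ≤ (3 : ℝ) ^ k * Real.log X := by positivity
        linarith
      have hR16 : Q (k + 1) ^ 16 = 3 * Q k ^ 16 := by rw [hQp, hQp]; ring
      have hR : Q k ≤ Q (k + 1) := by
        refine le_of_pow_le_pow_left₀ (by norm_num : 16 ≠ 0) (hQ0 _) ?_
        rw [hR16]
        have := pow_nonneg (hQ0 k) 16
        linarith
      have := hK (Q k) ((le_max_left _ _).trans (hQK k)) _ _ hc hB _ ih.1 ih.2 _ hR hR16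
      rw [Function.iterate_succ_apply', pow_succ, pow_mul X, mul_comm (3 ^ k) 3]
      exact this
  intro n
  by_contra hne
  rw [not_nonempty_iff_eq_empty] at hne
  have := (hmass n).2
  rw [hne, sum_empty] at this
  exact absurd (Real.exp_pos _) (not_lt.mpr this)

end

/-- Mills' theorem (1947): there is a real constant `A > 1` such that
`⌊A ^ (3 ^ n)⌋` is prime for every `n ≥ 1`. -/
theorem mills_theorem :
    ∃ A : ℝ, 1 < A ∧ ∀ n : ℕ, 1 ≤ n → Prime ⌊A ^ (3 ^ n : ℕ)⌋ := by
  obtain ⟨X, hX, hne⟩ := exists_cubeStep_iterate_nonempty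
  obtain ⟨p, hp0, hp⟩ := exists_cubePrimes_chain hne
  simp only [mem_cubePrimes] at hp
  obtain ⟨A, hA, hfloor⟩ := exists_floor_pow_eq (hX.trans (Finset.mem_Ico.mp hp0).1)
    (fun n => (hp n).2.1.le) (fun n => (hp n).2.2)
  refine ⟨A, hA, fun n hn => ?_⟩
  obtain ⟨k, rfl⟩ := Nat.exists_eq_add_of_le' hn
  rw [hfloor]
  exact Nat.prime_iff_prime_int.mp (hp k).1
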